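/- (Linear approximation of solutions) There exist a universal exponent α ∈ (0,1) and a universal constant C > 0, depending only on n, Λ, M and C₀, such that: if η is a viscosity solution of the linearized oblique problem on K₁⁺ with |η| ≤ 1 on K₁⁺, then for every 0 < ρ ≤ 1/2 there exist ā : [−ρ,0] → ℝⁿ, whose first n−1 components are constant and whose n-th component āₙ is differentiable, and a differentiable b̄ : [−ρ,0] → ℝ, such that |ā(t)| ≤ C and |āₙ'(t)| ≤ C·ρ^{α−1}·λ⁻¹ for all t, b̄'(t) = v(t)·ā(t), and |η(x,t) − ā(t)·x − b̄(t)| ≤ C·ρ^{1+α} for all (x,t) ∈ K_ρ. -/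

import Mathlib

open Set MeasureTheory Metric
open scoped RealInnerProductSpace

noncomputable section

abbrev Eucl (n : ℕ) : Type := EuclideanSpace ℝ (Fin n)
abbrev SpaceTime (n : ℕ) : Type := Eucl n × ℝ

/-- The operator norm of an `n × n` real matrix, acting on Euclidean space. -/
noncomputable def matOpNorm {n : ℕ} (A : Matrix (Fin n) (Fin n) ℝ) : ℝ :=
  ‖(LinearMap.toContinuousLinearMap (Matrix.toEuclideanLin A))‖

/-- `F` is uniformly elliptic with ellipticity constant `Λ`. -/
def UniformlyElliptic {n : ℕ} (Λ : ℝ) (F : Matrix (Fin n) (Fin n) ℝ → ℝ) : Prop :=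
  ∀ M N : Matrix (Fin n) (Fin n) ℝ, M.IsSymm → N.IsSymm → N.PosSemidef →
    Λ⁻¹ * matOpNorm N ≤ F (M + N) - F M ∧ F (M + N) - F M ≤ Λ * matOpNorm N

/-- Pucci minimal operator `P⁻(R, a, b) = a ∑_{eᵢ>0} eᵢ + b ∑_{eᵢ<0} eᵢ`. -/
noncomputable def pucciMinus {n : ℕ} (R : Matrix (Fin n) (Fin n) ℝ) (a b : ℝ) : ℝ :=
  if h : R.IsHermitian then
    a * ∑ i, max (h.eigenvalues i) 0 + b * ∑ i, min (h.eigenvalues i) 0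
  else 0

/-- Pucci maximal operator `P⁺(R, a, b) = a ∑_{eᵢ<0} eᵢ + b ∑_{eᵢ>0} eᵢ`. -/
noncomputable def pucciPlus {n : ℕ} (R : Matrix (Fin n) (Fin n) ℝ) (a b : ℝ) : ℝ :=
  if h : R.IsHermitian then
    a * ∑ i, min (h.eigenvalues i) 0 + b * ∑ i, max (h.eigenvalues i) 0
  else 0

/-- Parabolic cylinder `E_ρ(x₀,t₀) = B_ρ(x₀) × (t₀ − ρ², t₀]`. -/
def cylE {n : ℕ} (x₀ : Eucl n) (t₀ ρ : ℝ) : Set (SpaceTime n) :=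
  (ball x₀ ρ) ×ˢ (Ioc (t₀ - ρ ^ 2) t₀)

/-- `φ` is C² in `x` and C¹ in `t` on `D`, with time derivative `φt`,
spatial gradient `gφ` and spatial Hessian `Hφ`. -/
structure ParabolicTest {n : ℕ} (φ : SpaceTime n → ℝ) (D : Set (SpaceTime n))
    (φt : SpaceTime n → ℝ) (gφ : SpaceTime n → Eucl n)
    (Hφ : SpaceTime n → Matrix (Fin n) (Fin n) ℝ) : Prop where
  contPhi : ContinuousOn φ D
  contPhit : ContinuousOn φt D
  contGrad : ContinuousOn gφ D
  contHess : ContinuousOn Hφ D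
  symmHess : ∀ p ∈ D, (Hφ p).IsSymm
  timeDeriv : ∀ p ∈ D, HasDerivWithinAt (fun s : ℝ => φ (p.1, s)) (φt p) {s : ℝ | (p.1, s) ∈ D} p.2
  spaceGrad : ∀ p ∈ D, HasGradientWithinAt (fun y => φ (y, p.2)) (gφ p) {y | (y, p.2) ∈ D} p.1
  spaceHess : ∀ p ∈ D, HasFDerivWithinAt (fun y => gφ (y, p.2))
      (LinearMap.toContinuousLinearMap (Matrix.toEuclideanLin (Hφ p))) {y | (y, p.2) ∈ D} p.1

/-- `φ` touches `u` from above at `p₀` in the set `E`. -/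
def TouchesAbove {n : ℕ} (φ u : SpaceTime n → ℝ) (E : Set (SpaceTime n)) (p₀ : SpaceTime n) :
    Prop :=
  p₀ ∈ E ∧ φ p₀ = u p₀ ∧ ∀ p ∈ E, u p ≤ φ p

/-- `φ` touches `u` from below at `p₀` in the set `E`. -/
def TouchesBelow {n : ℕ} (φ u : SpaceTime n → ℝ) (E : Set (SpaceTime n)) (p₀ : SpaceTime n) :
    Prop :=
  p₀ ∈ E ∧ φ p₀ = u p₀ ∧ ∀ p ∈ E, φ p ≤ u p

/-- `u` is a viscosity subsolution of `u_t = F(D²u)` in `D`. -/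
def ViscSub {n : ℕ} (F : Matrix (Fin n) (Fin n) ℝ → ℝ) (u : SpaceTime n → ℝ)
    (D : Set (SpaceTime n)) : Prop :=
  ∀ (φ φt : SpaceTime n → ℝ) (gφ : SpaceTime n → Eucl n)
    (Hφ : SpaceTime n → Matrix (Fin n) (Fin n) ℝ) (p₀ : SpaceTime n) (ρ : ℝ),
    0 < ρ → p₀ ∈ D → cylE p₀.1 p₀.2 ρ ⊆ D →
    ParabolicTest φ (cylE p₀.1 p₀.2 ρ) φt gφ Hφ →
    TouchesAbove φ u (cylE p₀.1 p₀.2 ρ) p₀ →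
    φt p₀ ≤ F (Hφ p₀)

/-- `u` is a viscosity supersolution of `u_t = F(D²u)` in `D`. -/
def ViscSup {n : ℕ} (F : Matrix (Fin n) (Fin n) ℝ → ℝ) (u : SpaceTime n → ℝ)
    (D : Set (SpaceTime n)) : Prop :=
  ∀ (φ φt : SpaceTime n → ℝ) (gφ : SpaceTime n → Eucl n)
    (Hφ : SpaceTime n → Matrix (Fin n) (Fin n) ℝ) (p₀ : SpaceTime n) (ρ : ℝ),
    0 < ρ → p₀ ∈ D → cylE p₀.1 p₀.2 ρ ⊆ D →
    ParabolicTest φ (cylE p₀.1 p₀.2 ρ) φt gφ Hφ →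
    TouchesBelow φ u (cylE p₀.1 p₀.2 ρ) p₀ →
    F (Hφ p₀) ≤ φt p₀

end

/-- The last ("vertical") coordinate `xₙ` of a point in `ℝⁿ = ℝ^{d+1}`. -/
def lastC {d : ℕ} (x : Eucl (d + 1)) : ℝ := x (Fin.last d)

/-- `K_r = (B_r ∩ {xₙ > 0}) × (−r, 0]`. -/
def Kc (d : ℕ) (r : ℝ) : Set (SpaceTime (d + 1)) :=
  {p | p.1 ∈ ball 0 r ∧ 0 < lastC p.1 ∧ p.2 ∈ Ioc (-r) 0}

/-- `F_r = (B_r ∩ {xₙ = 0}) × (−r, 0]`. -/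
def Fc (d : ℕ) (r : ℝ) : Set (SpaceTime (d + 1)) :=
  {p | p.1 ∈ ball 0 r ∧ lastC p.1 = 0 ∧ p.2 ∈ Ioc (-r) 0}

/-- `K_r⁺ = K_r ∪ F_r`. -/
def KcP (d : ℕ) (r : ℝ) : Set (SpaceTime (d + 1)) := Kc d r ∪ Fc d r

/-- The Dirichlet part `∂_b K₁` of the boundary of `K₁`: the part of the topological
boundary not contained in `F₁ ∪ ((B₁ ∩ {xₙ>0}) × {0})`. -/
def bdryK (d : ℕ) : Set (SpaceTime (d + 1)) :=
  frontier (Kc d 1) \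
    (Fc d 1 ∪ {p | p.1 ∈ ball 0 1 ∧ 0 < lastC p.1 ∧ p.2 = 0})

/-- Coefficient data for the linearized oblique problem: `Q` is symmetric, uniformly
elliptic, differentiable (entrywise, with derivative `Q'`) with `‖Q'‖ ≤ C₀/λ`, and the
oblique vector `v` is differentiable with `vₙ ≥ M⁻¹`, `|v| ≤ M`, `|v'| ≤ λ⁻¹`. -/
structure ObliqueData (d : ℕ) (lam Λ M C₀ : ℝ)
    (Q Q' : ℝ → Matrix (Fin (d + 1)) (Fin (d + 1)) ℝ)
    (v v' : ℝ → Eucl (d + 1)) : Prop where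
  lam_pos : 0 < lam
  lam_le_one : lam ≤ 1
  Lam_ge_one : 1 ≤ Λ
  M_ge_one : 1 ≤ M
  C0_pos : 0 < C₀
  Qsymm : ∀ t ∈ Icc (-1 : ℝ) 0, (Q t).IsSymm
  Qlower : ∀ t ∈ Icc (-1 : ℝ) 0,
    (Q t - (Λ * M ^ 2)⁻¹ • (1 : Matrix (Fin (d + 1)) (Fin (d + 1)) ℝ)).PosSemidef
  Qupper : ∀ t ∈ Icc (-1 : ℝ) 0,
    ((Λ * M ^ 2) • (1 : Matrix (Fin (d + 1)) (Fin (d + 1)) ℝ) - Q t).PosSemidef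
  Qderiv : ∀ t ∈ Icc (-1 : ℝ) 0, ∀ i j,
    HasDerivWithinAt (fun s => Q s i j) (Q' t i j) (Icc (-1 : ℝ) 0) t
  Qderiv_bound : ∀ t ∈ Icc (-1 : ℝ) 0, matOpNorm (Q' t) ≤ C₀ / lam
  vderiv : ∀ t ∈ Icc (-1 : ℝ) 0, HasDerivWithinAt v (v' t) (Icc (-1 : ℝ) 0) t
  vlast : ∀ t ∈ Icc (-1 : ℝ) 0, M⁻¹ ≤ lastC (v t)
  vbound : ∀ t ∈ Icc (-1 : ℝ) 0, ‖v t‖ ≤ M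
  vderiv_bound : ∀ t ∈ Icc (-1 : ℝ) 0, ‖v' t‖ ≤ lam⁻¹

/-- `η` is a viscosity subsolution of the linearized oblique problem
`λ η_t = tr(Q(t) D²η)` in `K₁`, `η_t = v(t)·∇η` on `F₁`. -/
def ObliqueSub (d : ℕ) (lam : ℝ) (Q : ℝ → Matrix (Fin (d + 1)) (Fin (d + 1)) ℝ)
    (v : ℝ → Eucl (d + 1)) (η : SpaceTime (d + 1) → ℝ) : Prop :=
  ContinuousOn η (KcP d 1) ∧
  ∀ (φ φt : SpaceTime (d + 1) → ℝ) (gφ : SpaceTime (d + 1) → Eucl (d + 1))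
    (Hφ : SpaceTime (d + 1) → Matrix (Fin (d + 1)) (Fin (d + 1)) ℝ)
    (p₀ : SpaceTime (d + 1)) (ρ : ℝ),
    0 < ρ →
    ParabolicTest φ (cylE p₀.1 p₀.2 ρ ∩ closure (Kc d 1)) φt gφ Hφ →
    TouchesAbove φ η (cylE p₀.1 p₀.2 ρ ∩ closure (Kc d 1)) p₀ →
    (p₀ ∈ Kc d 1 → lam * φt p₀ ≤ (Q p₀.2 * Hφ p₀).trace) ∧
    (p₀ ∈ Fc d 1 → φt p₀ ≤ ⟪v p₀.2, gφ p₀⟫)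

/-- `η` is a viscosity supersolution of the linearized oblique problem. -/
def ObliqueSup (d : ℕ) (lam : ℝ) (Q : ℝ → Matrix (Fin (d + 1)) (Fin (d + 1)) ℝ)
    (v : ℝ → Eucl (d + 1)) (η : SpaceTime (d + 1) → ℝ) : Prop :=
  ContinuousOn η (KcP d 1) ∧
  ∀ (φ φt : SpaceTime (d + 1) → ℝ) (gφ : SpaceTime (d + 1) → Eucl (d + 1))
    (Hφ : SpaceTime (d + 1) → Matrix (Fin (d + 1)) (Fin (d + 1)) ℝ)
    (p₀ : SpaceTime (d + 1)) (ρ : ℝ),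
    0 < ρ →
    ParabolicTest φ (cylE p₀.1 p₀.2 ρ ∩ closure (Kc d 1)) φt gφ Hφ →
    TouchesBelow φ η (cylE p₀.1 p₀.2 ρ ∩ closure (Kc d 1)) p₀ →
    (p₀ ∈ Kc d 1 → (Q p₀.2 * Hφ p₀).trace ≤ lam * φt p₀) ∧
    (p₀ ∈ Fc d 1 → ⟪v p₀.2, gφ p₀⟫ ≤ φt p₀)

/-- `η` is a viscosity solution of the linearized oblique problem on `K₁⁺`. -/
def ObliqueSolution (d : ℕ) (lam : ℝ) (Q : ℝ → Matrix (Fin (d + 1)) (Fin (d + 1)) ℝ)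
    (v : ℝ → Eucl (d + 1)) (η : SpaceTime (d + 1) → ℝ) : Prop :=
  ObliqueSub d lam Q v η ∧ ObliqueSup d lam Q v η

/-- The distance `|x' − y'|` between the horizontal projections. -/
noncomputable def primeDist {d : ℕ} (x y : Eucl (d + 1)) : ℝ :=
  Real.sqrt (∑ i : Fin d, (x i.castSucc - y i.castSucc) ^ 2)

/-- The boundary-adapted parabolic distance `d(·,·)`. -/
noncomputable def pdist {d : ℕ} (P₁ P₂ : SpaceTime (d + 1)) : ℝ :=
  primeDist P₁.1 P₂.1 +
    min (|lastC P₁.1| + |lastC P₂.1| + |P₁.2 - P₂.2|)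
      (|lastC P₁.1 - lastC P₂.1| + Real.sqrt |P₁.2 - P₂.2|)

/-- The rescaled distance `d_λ(P₁,P₂) = λ⁻¹ d(λP₁, λP₂)`. -/
noncomputable def pdistL {d : ℕ} (lam : ℝ) (P₁ P₂ : SpaceTime (d + 1)) : ℝ :=
  lam⁻¹ * pdist (lam • P₁.1, lam * P₁.2) (lam • P₂.1, lam * P₂.2)


lemma sdt {f f1 : ℝ → ℝ} {f2 x : ℝ} (h0 : ∀ y, HasDerivAt f (f1 y) y)
    (h1 : HasDerivAt f1 f2 x) (hm : IsLocalMax f x) : f2 ≤ 0 := by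
  by_contra hc
  push Not at hc
  have e1 : deriv f = f1 := funext fun y => (h0 y).deriv
  have z : f1 x = 0 := by rw [← e1]; exact hm.deriv_eq_zero
  have hmin : IsLocalMin f x := by
    apply isLocalMin_of_deriv_deriv_pos
    · rw [e1, h1.deriv]; exact hc
    · rw [e1]; exact z
    · exact (h0 x).continuousAt
  have hconst : f =ᶠ[nhds x] fun _ => f x := by
    filter_upwards [hm, hmin] with y hy1 hy2
    exact le_antisymm hy1 hy2
  have : f1 =ᶠ[nhds x] fun _ => 0 := by
    have := hconst.deriv
    rw [e1] at this
    simpa using this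
  have h3 := this.hasDerivAt_iff.mp h1
  have := h3.unique (hasDerivAt_const x (0:ℝ))
  linarith

structure CJ where
  f : ℝ → ℂ
  f1 : ℝ → ℂ
  f2 : ℝ → ℂ
  h0 : ∀ y, HasDerivAt f (f1 y) y
  h1 : ∀ y, HasDerivAt f1 (f2 y) y
  c2 : Continuous f2

namespace CJ
open Complex

def lin (α β : ℂ) (u w : CJ) : CJ where
  f y := α * u.f y + β * w.f y
  f1 y := α * u.f1 y + β * w.f1 y
  f2 y := α * u.f2 y + β * w.f2 y
  h0 y := ((u.h0 y).const_mul α).add ((w.h0 y).const_mul β)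
  h1 y := ((u.h1 y).const_mul α).add ((w.h1 y).const_mul β)
  c2 := (continuous_const.mul u.c2).add (continuous_const.mul w.c2)

def zero : CJ where
  f _ := 0
  f1 _ := 0
  f2 _ := 0
  h0 y := hasDerivAt_const y 0
  h1 y := hasDerivAt_const y 0
  c2 := continuous_const

lemma c0 (u : CJ) : Continuous u.f := continuous_iff_continuousAt.2 fun y => (u.h0 y).continuousAt
lemma c1 (u : CJ) : Continuous u.f1 := continuous_iff_continuousAt.2 fun y => (u.h1 y).continuousAt

def A (Q q r : ℝ) (u : CJ) (y : ℝ) : ℂ := Q * u.f2 y + 2 * I * q * u.f1 y - r * u.f y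
def B (v θ : ℝ) (u : CJ) : ℂ := v * u.f1 0 + I * θ * u.f 0

lemma mp (u : CJ) {lam h Q q r v θ B : ℝ} (hlam : 0 < lam) (hh : 0 < h) (hQ : 0 < Q)
    (hr : q ^ 2 ≤ Q * r) (hv : 0 < v) (hB : 0 ≤ B)
    (H1 : ∀ y ∈ Icc (0:ℝ) 1, ‖lam * u.f y - h * A Q q r u y‖ ≤ lam * B)
    (H0 : ‖u.f 0 - h * CJ.B v θ u‖ ≤ B) (H2 : u.f 1 = 0) :
    ∀ y ∈ Icc (0:ℝ) 1, ‖u.f y‖ ≤ B := by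
  have hre : ∀ y, HasDerivAt (fun y => (u.f y).re) (u.f1 y).re y := fun y =>
    (reCLM.hasFDerivAt.comp_hasDerivAt y (u.h0 y))
  have him : ∀ y, HasDerivAt (fun y => (u.f y).im) (u.f1 y).im y := fun y =>
    (imCLM.hasFDerivAt.comp_hasDerivAt y (u.h0 y))
  have hre1 : ∀ y, HasDerivAt (fun y => (u.f1 y).re) (u.f2 y).re y := fun y =>
    (reCLM.hasFDerivAt.comp_hasDerivAt y (u.h1 y))
  have him1 : ∀ y, HasDerivAt (fun y => (u.f1 y).im) (u.f2 y).im y := fun y =>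
    (imCLM.hasFDerivAt.comp_hasDerivAt y (u.h1 y))
  set Nf : ℝ → ℝ := fun y => (u.f y).re ^ 2 + (u.f y).im ^ 2 with hNf
  set N1 : ℝ → ℝ := fun y => 2 * ((u.f y).re * (u.f1 y).re + (u.f y).im * (u.f1 y).im) with hN1
  have hd0 : ∀ y, HasDerivAt Nf (N1 y) y := fun y => by
    have := ((hre y).pow 2).add ((him y).pow 2)
    exact this.congr_deriv (by simp only [hN1]; push_cast; ring)
  have hd1 : ∀ y, HasDerivAt N1 (2 * ((u.f1 y).re * (u.f1 y).re + (u.f y).re * (u.f2 y).re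
      + ((u.f1 y).im * (u.f1 y).im + (u.f y).im * (u.f2 y).im))) y := fun y =>
    ((((hre y).mul (hre1 y)).add ((him y).mul (him1 y))).const_mul 2)
  have hNn : ∀ y, Nf y = ‖u.f y‖ ^ 2 := fun y => by
    rw [← normSq_eq_norm_sq, normSq_apply]; simp [hNf]; ring
  obtain ⟨y0, hy0, hmax⟩ := isCompact_Icc.exists_isMaxOn (nonempty_Icc.2 zero_le_one)
    (f := Nf) (s := Icc (0:ℝ) 1)
    (continuous_iff_continuousAt.2 fun y => (hd0 y).continuousAt).continuousOn
  suffices hs : ‖u.f y0‖ ≤ B by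
    intro y hy
    have := hmax hy
    simp only [mem_ofPred_eq, hNn] at this
    exact (abs_le_of_sq_le_sq' this (norm_nonneg _)).2.trans hs
  -- key: re (conj u * z) ≤ ‖u‖ ‖z‖
  have key : ∀ z : ℂ, (u.f y0).re * z.re + (u.f y0).im * z.im ≤ ‖u.f y0‖ * ‖z‖ := fun z => by
    have := (Complex.re_le_norm ((starRingEnd ℂ) (u.f y0) * z))
    simpa using this
  have fin : ∀ {K : ℝ}, 0 < K → K * ‖u.f y0‖ ^ 2 ≤ ‖u.f y0‖ * (K * B) → ‖u.f y0‖ ≤ B := by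
    intro K hK hk
    rcases eq_or_lt_of_le (norm_nonneg (u.f y0)) with h | h
    · rw [← h]; exact hB
    · have : K * ‖u.f y0‖ * (‖u.f y0‖ - B) ≤ 0 := by nlinarith
      have h2 : 0 < K * ‖u.f y0‖ := by positivity
      nlinarith
  have hsq : ‖u.f y0‖ ^ 2 = (u.f y0).re * (u.f y0).re + (u.f y0).im * (u.f y0).im := by
    rw [← hNn]; simp [hNf]; ring
  rcases eq_or_lt_of_le hy0.1 with h0 | h0
  · subst h0
    have hd : N1 0 ≤ 0 := by
      by_contra hc
      push Not at hc
      have : ∀ᶠ y in nhdsWithin (0:ℝ) (Ioi 0), Nf 0 < Nf y := by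
        have h := (hasDerivAt_iff_tendsto_slope.1 (hd0 0)).eventually (lt_mem_nhds hc)
        have h' : ∀ᶠ y in nhdsWithin (0:ℝ) (Ioi 0), 0 < slope Nf 0 y :=
          h.filter_mono (nhdsWithin_mono _ fun y hy => ne_of_gt hy)
        filter_upwards [h', self_mem_nhdsWithin] with y hy hy'
        rw [slope_def_field] at hy
        have hp : (0:ℝ) < y - 0 := by simpa using hy'
        have := (div_pos_iff_of_pos_right hp).1 hy
        linarith
      have h2 : ∀ᶠ y in nhdsWithin (0:ℝ) (Ioi 0), y ∈ Icc (0:ℝ) 1 := by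
        filter_upwards [Ioc_mem_nhdsGT (zero_lt_one (α := ℝ))] with y hy
        exact ⟨hy.1.le, hy.2⟩
      obtain ⟨y, hy1, hy2⟩ := (this.and h2).exists
      have := hmax hy2
      simp only [mem_ofPred_eq] at this
      linarith
    apply fin one_pos
    have h2 : ‖u.f 0‖ * ‖u.f 0 - h * CJ.B v θ u‖ ≤ ‖u.f 0‖ * B :=
      mul_le_mul_of_nonneg_left H0 (norm_nonneg _)
    have h1 := (key _).trans h2
    rw [hsq]
    simp only [hN1] at hd
    simp only [CJ.B, sub_re, sub_im, mul_re, mul_im, add_re, add_im, ofReal_re, ofReal_im, I_re, I_im] at h1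
    have h3 : 0 ≤ h * v * -((u.f 0).re * (u.f1 0).re + (u.f 0).im * (u.f1 0).im) := by
      apply mul_nonneg (by positivity); linarith
    nlinarith
  rcases eq_or_lt_of_le hy0.2 with h1 | h1
  · rw [h1, H2]; simpa using hB
  have hloc : IsLocalMax Nf y0 := hmax.isLocalMax (Icc_mem_nhds h0 h1)
  have hs2 := sdt hd0 (hd1 y0) hloc
  apply fin hlam
  have k1 := key (lam * u.f y0 - h * A Q q r u y0)
  have k2 : ‖u.f y0‖ * ‖lam * u.f y0 - h * A Q q r u y0‖ ≤ ‖u.f y0‖ * (lam * B) :=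
      mul_le_mul_of_nonneg_left (H1 y0 hy0) (norm_nonneg _)
  refine le_trans ?_ (k1.trans k2)
  rw [hsq]
  simp only [A, sub_re, sub_im, mul_re, mul_im, add_re, add_im, ofReal_re, ofReal_im, I_re, I_im,
    re_ofNat, im_ofNat]
  generalize (u.f y0).re = a at *
  generalize (u.f y0).im = b at *
  generalize (u.f1 y0).re = a1 at *
  generalize (u.f1 y0).im = b1 at *
  generalize (u.f2 y0).re = a2 at *
  generalize (u.f2 y0).im = b2 at *
  have e1 : 0 ≤ Q * -(a1*a1 + a*a2 + (b1*b1+b*b2)) := mul_nonneg hQ.le (by linarith)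
  have e2 : 0 ≤ Q * (a1*a1+b1*b1) + 2*q*(a*b1 - b*a1) + r*(a*a+b*b) := by
    have : 0 ≤ Q * (Q * (a1*a1+b1*b1) + 2*q*(a*b1 - b*a1) + r*(a*a+b*b)) := by
      nlinarith [sq_nonneg (Q*a1 - q*b), sq_nonneg (Q*b1+q*a), mul_nonneg (sub_nonneg.2 hr) (add_nonneg (mul_self_nonneg a) (mul_self_nonneg b))]
    exact nonneg_of_mul_nonneg_right this hQ
  have e3 : 0 ≤ h * (Q * -(a1*a1 + a*a2 + (b1*b1+b*b2)) + (Q * (a1*a1+b1*b1) + 2*q*(a*b1 - b*a1) + r*(a*a+b*b))) :=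
    mul_nonneg hh.le (add_nonneg e1 e2)
  nlinarith

lemma ode1 (m c : ℂ) {F : ℝ → ℂ} (hF : Continuous F) :
    ∃ z : ℝ → ℂ, (∀ y, HasDerivAt z (m * z y + F y) y) ∧ z 0 = c := by
  refine ⟨fun y => exp (m * y) * (c + ∫ s in (0:ℝ)..y, exp (-m * s) * F s), fun y => ?_, by simp⟩
  have h1 : HasDerivAt (fun y : ℝ => exp (m * y)) (exp (m * y) * m) y := by
    have := ((hasDerivAt_id y).ofReal_comp.const_mul m).cexp
    simpa using this
  have h2 : HasDerivAt (fun y => ∫ s in (0:ℝ)..y, exp (-m * s) * F s) (exp (-m * y) * F y) y := by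
    have hc : Continuous fun s : ℝ => exp (-m * s) * F s := by fun_prop
    exact intervalIntegral.integral_hasDerivAt_right (hc.intervalIntegrable _ _)
      (hc.stronglyMeasurableAtFilter _ _) hc.continuousAt
  refine (h1.mul (h2.const_add c)).congr_deriv ?_
  have : exp (m * y) * exp (-m * y) = 1 := by rw [← exp_add]; simp
  linear_combination F y * this

lemma ode2 (m1 m2 c1 c2 : ℂ) {F : ℝ → ℂ} (hF : Continuous F) :
    ∃ w : CJ, (∀ y, w.f2 y = (m1 + m2) * w.f1 y - m1 * m2 * w.f y + F y) ∧
      w.f 0 = c1 ∧ w.f1 0 = m2 * c1 + c2 := by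
  obtain ⟨z, hz, hz0⟩ := ode1 m1 c2 hF
  have cz : Continuous z := continuous_iff_continuousAt.2 fun y => (hz y).continuousAt
  obtain ⟨w, hw, hw0⟩ := ode1 m2 c1 cz
  have cw : Continuous w := continuous_iff_continuousAt.2 fun y => (hw y).continuousAt
  refine ⟨⟨w, fun y => m2 * w y + z y, fun y => m2 * (m2 * w y + z y) + (m1 * z y + F y), hw,
    fun y => ((hw y).const_mul m2).add (hz y), by fun_prop⟩, fun y => ?_, hw0, ?_⟩
  · simp only; ring
  · simp [hw0, hz0]

lemma bvp {lam h Q q r v θ : ℝ} (hlam : 0 < lam) (hh : 0 < h) (hQ : 0 < Q)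
    (hr : q ^ 2 ≤ Q * r) (hv : 0 < v) {F : ℝ → ℂ} (hF : Continuous F) (G : ℂ) :
    ∃ w : CJ, (∀ y, lam * w.f y - h * A Q q r w y = lam * F y) ∧
      w.f 0 - h * CJ.B v θ w = G ∧ w.f 1 = 0 := by
  have hQ' : (Q:ℂ) ≠ 0 := by exact_mod_cast hQ.ne'
  have hh' : (h:ℂ) ≠ 0 := by exact_mod_cast hh.ne'
  set s : ℂ := -(2 * I * q / Q) with hs
  set p : ℂ := -((lam / h + r) / Q) with hp
  obtain ⟨δ, hδ⟩ := IsAlgClosed.exists_pow_nat_eq (s ^ 2 - 4 * p) (n := 2) (by norm_num)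
  have m1 : (s + δ) / 2 + (s - δ) / 2 = s := by ring
  have m2 : (s + δ) / 2 * ((s - δ) / 2) = p := by linear_combination (-1/4) * hδ
  have ex : ∀ (F : ℝ → ℂ), Continuous F → ∀ c1 c2 : ℂ, ∃ w : CJ,
      (∀ y, lam * w.f y - h * A Q q r w y = lam * F y) ∧ w.f 0 = c1 ∧
        w.f1 0 = (s - δ) / 2 * c1 + c2 := by
    intro F hF c1 c2
    obtain ⟨w, hw, hw0, hw1⟩ := ode2 ((s + δ) / 2) ((s - δ) / 2) c1 c2
      (F := fun y => -(lam / (h * Q)) * F y) (by fun_prop)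
    refine ⟨w, fun y => ?_, hw0, hw1⟩
    have := hw y
    rw [m1, m2] at this
    rw [A, this, hs, hp]
    field_simp
    ring
  obtain ⟨u1, hu1, hu10, hu11⟩ := ex (fun _ => 0) continuous_const 1 0
  obtain ⟨u2, hu2, hu20, hu21⟩ := ex (fun _ => 0) continuous_const 0 1
  obtain ⟨w, hw, hw0, hw1⟩ := ex F hF 0 0
  let L : (ℂ × ℂ) →ₗ[ℂ] (ℂ × ℂ) :=
    { toFun := fun c => (c.1 * (u1.f 0 - h * CJ.B v θ u1) + c.2 * (u2.f 0 - h * CJ.B v θ u2),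
        c.1 * u1.f 1 + c.2 * u2.f 1)
      map_add' := fun a b => by ext <;> simp <;> ring
      map_smul' := fun a b => by ext <;> simp <;> ring }
  have linA : ∀ (a b : ℂ) (u w : CJ) y, A Q q r (lin a b u w) y = a * A Q q r u y + b * A Q q r w y := by
    intro a b u w y; simp only [A, lin]; ring
  have linB : ∀ (a b : ℂ) (u w : CJ), CJ.B v θ (lin a b u w) = a * CJ.B v θ u + b * CJ.B v θ w := by
    intro a b u w; simp only [CJ.B, lin]; ring
  have linf : ∀ (a b : ℂ) (u w : CJ) y, (lin a b u w).f y = a * u.f y + b * w.f y := fun _ _ _ _ _ => rfl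
  have hinj : Function.Injective L := by
    rw [injective_iff_map_eq_zero]
    rintro ⟨a, b⟩ hab
    have h1 : a * (u1.f 0 - h * CJ.B v θ u1) + b * (u2.f 0 - h * CJ.B v θ u2) = 0 := congrArg Prod.fst hab
    have h2 : a * u1.f 1 + b * u2.f 1 = 0 := congrArg Prod.snd hab
    have hb : (lin a b u1 u2).f 0 - h * CJ.B v θ (lin a b u1 u2) = 0 := by
      rw [linB, linf, ← h1]; ring
    have := mp (lin a b u1 u2) hlam hh hQ hr hv le_rfl (θ := θ) (fun y _ => by
      rw [linA, linf]
      have e1 := hu1 y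
      have e2 := hu2 y
      have : (lam * (a * u1.f y + b * u2.f y) - h * (a * A Q q r u1 y + b * A Q q r u2 y) : ℂ) = 0 := by
        linear_combination a * e1 + b * e2
      rw [this]; simp) (by rw [hb]; simp) h2 0 (by simp)
    have ha : a = 0 := by
      have := norm_le_zero_iff.1 this
      rw [linf, hu10, hu20] at this; simpa using this
    subst ha
    have hv' : (v:ℂ) ≠ 0 := by exact_mod_cast hv.ne'
    simp only [CJ.B, lin, hu20, hu21, zero_mul, zero_add, mul_zero, add_zero, zero_sub, mul_one] at hb
    have hb0 : b = 0 := by simpa [hv', hh'] using hb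
    simp [hb0]
  obtain ⟨⟨a, b⟩, hab⟩ := (LinearMap.injective_iff_surjective.1 hinj) (G - (w.f 0 - h * CJ.B v θ w), -w.f 1)
  have h1 : a * (u1.f 0 - h * CJ.B v θ u1) + b * (u2.f 0 - h * CJ.B v θ u2) = G - (w.f 0 - h * CJ.B v θ w) :=
    congrArg Prod.fst hab
  have h2 : a * u1.f 1 + b * u2.f 1 = -w.f 1 := congrArg Prod.snd hab
  refine ⟨lin 1 1 w (lin a b u1 u2), fun y => ?_, ?_, ?_⟩
  · rw [linA, linA, linf, linf]
    linear_combination a * hu1 y + b * hu2 y + hw y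
  · rw [linB, linB, linf, linf]; linear_combination h1
  · rw [linf, linf]; linear_combination h2

/-- bound of derivatives -/
lemma db (cQ K : ℝ) (hc : 0 < cQ) (hK : 0 ≤ K) : ∃ C : ℝ, 0 ≤ C ∧ ∀ (u : CJ) (Q q r v θ B : ℝ), cQ ≤ Q → cQ ≤ v →
    |q| ≤ K → |r| ≤ K → |θ| ≤ K → 
    (∀ y ∈ Icc (0:ℝ) 1, ‖A Q q r u y‖ ≤ B) → (∀ y ∈ Icc (0:ℝ) 1, ‖u.f y‖ ≤ B) → ‖CJ.B v θ u‖ ≤ B →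
    ∀ y ∈ Icc (0:ℝ) 1, ‖u.f1 y‖ ≤ C * B ∧ ‖u.f2 y‖ ≤ C * B := by
  set C1 := (1 + K) / cQ with hC1
  set C2 := 2 * K / cQ with hC2
  have hC10 : 0 ≤ C1 := by positivity
  have hC20 : 0 ≤ C2 := by positivity
  have hg : ∀ x, 0 ≤ x → x ≤ 1 → gronwallBound C1 C2 C1 x ≤ gronwallBound C1 C2 C1 1 := fun x hx0 hx1 =>
    gronwallBound_mono hC10 hC10 hC20 hx1
  have hg0 : 0 ≤ gronwallBound C1 C2 C1 1 := by
    refine le_trans ?_ (hg 0 le_rfl zero_le_one); rw [gronwallBound_x0]; exact hC10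
  refine ⟨gronwallBound C1 C2 C1 1 + (C2 * gronwallBound C1 C2 C1 1 + C1), by positivity, ?_⟩
  intro u Q q r v θ B hQ hv hq hr hθ hA hf hBB
  have hB : 0 ≤ B := (norm_nonneg _).trans hBB
  have hQ0 : 0 < Q := hc.trans_le hQ
  have hv0 : 0 < v := hc.trans_le hv
  have n2 : ∀ y ∈ Icc (0:ℝ) 1, ‖u.f2 y‖ ≤ C2 * ‖u.f1 y‖ + C1 * B := by
    intro y hy
    have e : (Q:ℂ) * u.f2 y = A Q q r u y - 2 * I * q * u.f1 y + r * u.f y := by simp only [A]; ring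
    have := congrArg norm e
    rw [norm_mul, norm_real, Real.norm_of_nonneg hQ0.le] at this
    have h2 : ‖A Q q r u y - 2 * I * q * u.f1 y + r * u.f y‖ ≤ B + 2 * K * ‖u.f1 y‖ + K * B := by
      refine (norm_add_le _ _).trans (add_le_add ((norm_sub_le _ _).trans (add_le_add (hA y hy) ?_)) ?_)
      · simp only [norm_mul, norm_real, norm_I, RCLike.norm_ofNat, Real.norm_eq_abs, mul_one]; gcongr
      · simp only [norm_mul, norm_real, Real.norm_eq_abs]; gcongr; exact hf y hy
    rw [← this] at h2
    have h3 : cQ * ‖u.f2 y‖ ≤ B + 2 * K * ‖u.f1 y‖ + K * B := le_trans (by gcongr) h2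
    rw [hC1, hC2]
    have : 2 * K / cQ * ‖u.f1 y‖ + (1 + K) / cQ * B = (B + 2 * K * ‖u.f1 y‖ + K * B) / cQ := by ring
    rw [this, le_div_iff₀ hc]; linarith
  have n1 : ‖u.f1 0‖ ≤ C1 * B := by
    have e : (v:ℂ) * u.f1 0 = CJ.B v θ u - I * θ * u.f 0 := by simp only [CJ.B]; ring
    have := congrArg norm e
    rw [norm_mul, norm_real, Real.norm_of_nonneg hv0.le] at this
    have h2 : ‖CJ.B v θ u - I * θ * u.f 0‖ ≤ B + K * B := by
      refine (norm_sub_le _ _).trans (add_le_add hBB ?_)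
      simp only [norm_mul, norm_real, norm_I, Real.norm_eq_abs, one_mul]; gcongr; exact hf 0 (by simp)
    rw [← this] at h2
    have h3 : cQ * ‖u.f1 0‖ ≤ B + K * B := le_trans (by gcongr) h2
    have : C1 * B = (B + K * B) / cQ := by rw [hC1]; ring
    rw [this, le_div_iff₀ hc]; linarith
  have gs : ∀ x, gronwallBound (C1 * B) C2 (C1 * B) x = B * gronwallBound C1 C2 C1 x := by
    intro x; unfold gronwallBound; split_ifs <;> ring
  have n3 : ∀ y ∈ Icc (0:ℝ) 1, ‖u.f1 y‖ ≤ gronwallBound C1 C2 C1 1 * B := by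
    intro y hy
    have := norm_le_gronwallBound_of_norm_deriv_right_le (f := u.f1) (f' := u.f2) (δ := C1 * B) (K := C2) (ε := C1 * B)
      (a := 0) (b := 1) u.c1.continuousOn (fun x _ => (u.h1 x).hasDerivWithinAt) n1 (fun x hx => n2 x ⟨hx.1, hx.2.le⟩) y hy
    rw [gs, sub_zero] at this
    refine this.trans ?_
    rw [mul_comm]
    exact mul_le_mul_of_nonneg_right (hg y hy.1 hy.2) hB
  intro y hy
  have a1 := n3 y hy
  have a2 := n2 y hy
  have a3 : C2 * ‖u.f1 y‖ ≤ C2 * (gronwallBound C1 C2 C1 1 * B) := by gcongr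
  have p1 : 0 ≤ C2 * gronwallBound C1 C2 C1 1 * B := by positivity
  have p2 : 0 ≤ C1 * B := by positivity
  have p3 : 0 ≤ gronwallBound C1 C2 C1 1 * B := by positivity
  constructor <;> nlinarith

end CJ


lemma dgron {x : ℕ → ℝ} {a b b0 h : ℝ} (ha : 0 ≤ a) (hb : 0 ≤ b) (hh : 0 < h) (hb0 : 0 ≤ b0)
    (h0 : x 0 ≤ b0) {N : ℕ} (hs : ∀ k, k < N → x (k + 1) ≤ (1 + a * h) * x k + b * h) :
    ∀ k, k ≤ N → x k ≤ (b0 + b * (k * h)) * Real.exp (a * (k * h)) := by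
  intro k
  induction k with
  | zero => intro _; simpa using h0
  | succ k ih =>
    intro hk
    have e1 : 1 + a * h ≤ Real.exp (a * h) := by linarith [Real.add_one_le_exp (a * h)]
    have h1 := hs k (by omega)
    have h2 := ih (by omega)
    have h4 : 1 ≤ Real.exp (a * ((k + 1) * h)) := Real.one_le_exp (by positivity)
    have h5 : Real.exp (a * ((k + 1) * h)) = Real.exp (a * h) * Real.exp (a * (k * h)) := by
      rw [← Real.exp_add]; ring_nf
    have h3 : (1 + a * h) * x k ≤ Real.exp (a * h) * ((b0 + b * (k * h)) * Real.exp (a * (k * h))) := by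
      refine (mul_le_mul_of_nonneg_left h2 (by positivity)).trans ?_
      exact mul_le_mul_of_nonneg_right e1 (by positivity)
    push_cast
    have h6 : b * h ≤ b * h * Real.exp (a * ((k + 1) * h)) := le_mul_of_one_le_right (by positivity) h4
    calc x (k + 1) ≤ _ := h1
      _ ≤ Real.exp (a * h) * ((b0 + b * (k * h)) * Real.exp (a * (k * h))) + b * h * Real.exp (a * ((k + 1) * h)) := by linarith
      _ = _ := by rw [h5]; ring

section
variable {P D E : Type*} [NormedAddCommGroup P] [NormedSpace ℝ P] [AddCommGroup D] [Module ℝ D]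
  [NormedAddCommGroup E] [NormedSpace ℝ E]

set_option maxHeartbeats 1000000 in
lemma rothe_disc (J : D →ₗ[ℝ] E) (A : P →ₗ[ℝ] D →ₗ[ℝ] E) (S : Set P) (ℓ L K : ℝ)
    (hℓ : 0 ≤ ℓ) (hL : 0 ≤ L) (hK : 0 ≤ K)
    (hdis : ∀ p ∈ S, ∀ h : ℝ, 0 < h → ∀ x, ‖J x‖ ≤ ‖J x - h • A p x‖)
    (hsur : ∀ p ∈ S, ∀ h : ℝ, 0 < h → ∀ y, ∃ x, J x - h • A p x = y)
    (hrel : ∀ p ∈ S, ∀ q x, ‖A q x‖ ≤ ℓ * ‖q‖ * (‖A p x‖ + ‖J x‖)) :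
    ∃ C : ℝ, 0 ≤ C ∧ ∀ (N : ℕ) (h κ : ℝ) (p : ℕ → P) (g : ℕ → E), 0 < h → 0 < N → N * h ≤ 1 → h ≤ κ → κ ≤ 1 →
      (∀ k, p k ∈ S) → (∀ k, ‖p (k + 1) - p k‖ ≤ L * h) →
      (∀ k, ‖(p (k + 2) - p (k + 1)) - (p (k + 1) - p k)‖ ≤ κ * h) → g 0 = 0 →
      (∀ k < N, ‖g (k + 1) - g k‖ ≤ K * h) →
      (∀ k, k + 2 ≤ N → ‖(g (k + 2) - g (k + 1)) - (g (k + 1) - g k)‖ ≤ κ * h) →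
      ∃ w d : ℕ → D, d 0 = 0 ∧ w 0 = 0 ∧ (∀ k, w (k + 1) = w k + h • d (k + 1)) ∧
        (∀ k, J (d k) = A (p k) (w k) + g k) ∧
        (∀ k ≤ N, ‖J (w k)‖ ≤ C ∧ ‖J (d k)‖ ≤ C ∧ ‖A (p k) (w k)‖ ≤ C ∧ ‖h • A (p k) (d k)‖ ≤ C * κ) ∧
        ∀ k < N, ‖J (d (k + 1)) - J (d k)‖ ≤ C * κ := by
  set a1 := ℓ * L with ha1
  set X := (2 * ℓ * L * K + K) * Real.exp a1 with hX
  set b2 := 2 * a1 * (ℓ * L * (X + K + K) + K + X) + ℓ * (X + K + K) + 1 with hb2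
  set a2 := 2 * a1 with ha2
  set Y := (K + b2) * Real.exp a2 with hY
  have ha10 : 0 ≤ a1 := by positivity
  have hX0 : 0 ≤ X := by positivity
  have hb20 : 0 ≤ b2 := by positivity
  have hY0 : 0 ≤ Y := by positivity
  refine ⟨K + X + Y + (ℓ * L * (X + K + K) + K), by positivity, ?_⟩
  intro N h κ p g hh hN0 hN hhκ hκ1 hp hp1 hp2 hg0 hg1 hg2
  have hκ0 := hh.le.trans hhκ
  choose sol hsol using fun (k : ℕ) (y : E) => hsur (p k) (hp k) h hh y
  let w : ℕ → D := fun k => Nat.rec (0 : D) (fun k wk => sol (k + 1) (J wk + h • g (k + 1))) k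
  have w0 : w 0 = 0 := rfl
  have ws : ∀ k, J (w (k + 1)) - h • A (p (k + 1)) (w (k + 1)) = J (w k) + h • g (k + 1) := fun k =>
    hsol (k + 1) _
  let d : ℕ → D := fun k => Nat.casesOn k 0 (fun k => h⁻¹ • (w (k + 1) - w k))
  have d0 : d 0 = 0 := rfl
  have ds : ∀ k, w (k + 1) = w k + h • d (k + 1) := fun k => by
    change w (k + 1) = w k + h • (h⁻¹ • (w (k + 1) - w k))
    rw [smul_smul, mul_inv_cancel₀ hh.ne']; simp
  have Jd : ∀ k, J (d k) = A (p k) (w k) + g k := by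
    intro k
    cases k with
    | zero => simp [d0, w0, hg0]
    | succ k =>
      have h1 := ws k
      have h2 : h • J (d (k + 1)) = h • (A (p (k + 1)) (w (k + 1)) + g (k + 1)) := by
        have : J (w (k + 1)) = J (w k) + h • J (d (k + 1)) := by rw [ds k]; simp
        rw [smul_add]
        have h3 : J (w (k + 1)) = J (w k) + h • g (k + 1) + h • A (p (k + 1)) (w (k + 1)) :=
          sub_eq_iff_eq_add.1 h1
        rw [this] at h3
        have := add_left_cancel (h3.trans (add_assoc _ _ _))
        rw [this]; abel
      exact smul_right_injective E hh.ne' h2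
  have kh : ∀ k ≤ N, (k : ℝ) * h ≤ 1 := fun k hk => by
    refine le_trans ?_ hN
    have : (k : ℝ) ≤ N := by exact_mod_cast hk
    gcongr
  have gk : ∀ k ≤ N, ‖g k‖ ≤ K := by
    have : ∀ k : ℕ, k ≤ N → ‖g k‖ ≤ K * (k * h) := by
      intro k
      induction k with
      | zero => simp [hg0]
      | succ k ih =>
        intro hk
        have : g (k + 1) = g k + (g (k + 1) - g k) := by abel
        rw [this]
        refine (norm_add_le _ _).trans ((add_le_add (ih (by omega)) (hg1 k (by omega))).trans ?_)
        push_cast; apply le_of_eq; ring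
    intro k hk
    refine (this k hk).trans ?_
    exact mul_le_of_le_one_right hK (kh k hk)
  have Jw : ∀ k ≤ N, ‖J (w k)‖ ≤ K := by
    have : ∀ k : ℕ, k ≤ N → ‖J (w k)‖ ≤ K * (k * h) := by
      intro k
      induction k with
      | zero => simp [w0]
      | succ k ih =>
        intro hk
        refine (hdis _ (hp (k + 1)) h hh _).trans ?_
        rw [ws k]
        refine (norm_add_le _ _).trans ((add_le_add (ih (by omega)) (?_ : _ ≤ h * K)).trans ?_)
        · rw [norm_smul, Real.norm_of_nonneg hh.le]; gcongr; exact gk _ hk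
        · push_cast; apply le_of_eq; ring
    intro k hk
    exact (this k hk).trans (mul_le_of_le_one_right hK (kh k hk))
  have Aw : ∀ k ≤ N, ‖A (p k) (w k)‖ ≤ ‖J (d k)‖ + K := fun k hk => by
    have : A (p k) (w k) = J (d k) - g k := by rw [Jd]; abel
    rw [this]
    exact (norm_sub_le _ _).trans (add_le_add le_rfl (gk k hk))
  have Aq : ∀ k ≤ N, ∀ q, ‖A q (w k)‖ ≤ ℓ * ‖q‖ * (‖J (d k)‖ + K + K) := fun k hk q => by
    refine (hrel _ (hp k) q _).trans ?_
    gcongr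
    · exact Aw k hk
    · exact Jw k hk
  have eq1 : ∀ k, J (d (k + 1)) - h • A (p (k + 1)) (d (k + 1)) =
      J (d k) + A (p (k + 1) - p k) (w k) + (g (k + 1) - g k) := by
    intro k
    rw [Jd (k + 1), Jd k, ds k]
    simp only [map_add, map_smul, map_sub, LinearMap.sub_apply]
    abel
  have L1 : ∀ k ≤ N, ‖J (d k)‖ ≤ X := by
    have := dgron (x := fun k => ‖J (d k)‖) (a := a1) (b := 2 * ℓ * L * K + K) (b0 := 0) (N := N)
      ha10 (by positivity) hh le_rfl (by simp [d0]) (by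
        intro k hk
        refine (hdis _ (hp (k + 1)) h hh _).trans ?_
        rw [eq1]
        have h1 := Aq k hk.le (p (k + 1) - p k)
        have h2 : ℓ * ‖p (k + 1) - p k‖ * (‖J (d k)‖ + K + K) ≤ ℓ * (L * h) * (‖J (d k)‖ + K + K) := by
          gcongr; exact hp1 k
        have := (norm_add_le (J (d k) + A (p (k + 1) - p k) (w k)) (g (k + 1) - g k)).trans
          (add_le_add (norm_add_le _ _) (hg1 k hk))
        simp only [ha1]
        nlinarith)
    intro k hk
    refine (this k hk).trans ?_
    rw [zero_add, hX]
    have := kh k hk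
    gcongr
    · exact mul_le_of_le_one_right (by positivity) this
    · exact mul_le_of_le_one_right (by positivity) this
  have Aq2 : ∀ k ≤ N, ∀ q, ‖A q (w k)‖ ≤ ℓ * ‖q‖ * (X + K + K) := fun k hk q => by
    refine (Aq k hk q).trans ?_
    gcongr
    exact L1 k hk
  have hAd : ∀ k < N, ‖h • A (p (k + 1)) (d (k + 1))‖ ≤
      ‖J (d (k + 1)) - J (d k)‖ + (ℓ * L * (X + K + K) + K) * h := by
    intro k hk
    have : h • A (p (k + 1)) (d (k + 1)) = (J (d (k + 1)) - J (d k)) - (A (p (k + 1) - p k) (w k) + (g (k + 1) - g k)) := by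
      have := eq1 k
      rw [sub_eq_iff_eq_add] at this
      rw [this]; abel
    rw [this]
    have h1 := Aq2 k hk.le (p (k + 1) - p k)
    have h2 : ℓ * ‖p (k + 1) - p k‖ * (X + K + K) ≤ ℓ * (L * h) * (X + K + K) := by
      gcongr; exact hp1 k
    refine (norm_sub_le _ _).trans (add_le_add le_rfl ((norm_add_le _ _).trans ((add_le_add (h1.trans h2) (hg1 k hk)).trans ?_)))
    apply le_of_eq; ring
  have L2 : ∀ k < N, ‖J (d (k + 1)) - J (d k)‖ ≤ Y * κ := by
    have := dgron (x := fun k => ‖J (d (k + 1)) - J (d k)‖) (a := a2) (b := b2 * κ) (b0 := K * κ) (N := N - 1)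
      (by positivity) (by have := hh.le.trans hhκ; positivity) hh (by have := hh.le.trans hhκ; positivity) (by
        simp only [zero_add, d0, map_zero, sub_zero]
        refine (hdis _ (hp 1) h hh _).trans ?_
        have := eq1 0
        simp only [zero_add, d0, map_zero, w0, hg0, sub_zero] at this
        rw [this]
        have := hg1 0 hN0
        simp only [zero_add, hg0, sub_zero] at this
        exact this.trans (by gcongr)) (by
        intro k hk
        have hk1 : k + 1 ≤ N := by omega
        have hk2 : k < N := by omega
        have key : (J (d (k + 2)) - J (d (k + 1))) - h • A (p (k + 2)) (d (k + 2) - d (k + 1)) =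
          (J (d (k + 1)) - J (d k)) + h • A (p (k + 2) - p (k + 1)) (d (k + 1))
          + A ((p (k + 2) - p (k + 1)) - (p (k + 1) - p k)) (w (k + 1))
          + h • A (p (k + 1) - p k) (d (k + 1)) + ((g (k + 2) - g (k + 1)) - (g (k + 1) - g k)) := by
          have e1 := eq1 (k + 1)
          have e0 := eq1 k
          have e2 : w k = w (k + 1) - h • d (k + 1) := by rw [ds k]; abel
          rw [e2] at e0
          simp only [map_sub, map_smul, LinearMap.sub_apply, smul_sub, sub_eq_iff_eq_add] at e1 e0 ⊢
          rw [show k + 1 + 1 = k + 2 from rfl] at e1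
          rw [e1, e0]
          abel
        have hd := hdis _ (hp (k + 2)) h hh (d (k + 2) - d (k + 1))
        rw [map_sub, key] at hd
        refine hd.trans ?_
        have hD : ∀ q : P, ‖q‖ ≤ L * h → ‖h • A q (d (k + 1))‖ ≤ a1 * h * (‖J (d (k + 1)) - J (d k)‖ + (ℓ * L * (X + K + K) + K + X) * κ) := by
          intro q hq
          have h1 := hrel _ (hp (k + 1)) q (d (k + 1))
          rw [norm_smul, Real.norm_of_nonneg hh.le]
          have h2 := hAd k hk2
          rw [norm_smul, Real.norm_of_nonneg hh.le] at h2
          have h3 := L1 (k + 1) hk1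
          calc h * ‖A q (d (k + 1))‖ ≤ h * (ℓ * (L * h) * (‖A (p (k + 1)) (d (k + 1))‖ + ‖J (d (k + 1))‖)) := by
                gcongr; refine h1.trans ?_; gcongr
            _ = a1 * h * (h * ‖A (p (k + 1)) (d (k + 1))‖ + h * ‖J (d (k + 1))‖) := by rw [ha1]; ring
            _ ≤ a1 * h * ((‖J (d (k + 1)) - J (d k)‖ + (ℓ * L * (X + K + K) + K) * κ) + κ * X) := by
                gcongr
                refine h2.trans ?_
                gcongr
            _ = _ := by ring
        have t1 := hD _ (hp1 (k + 1))
        have t2 := hD _ (hp1 k)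
        have t3 := (Aq2 (k + 1) hk1 ((p (k + 2) - p (k + 1)) - (p (k + 1) - p k))).trans
          (by gcongr; exact hp2 k : _ ≤ ℓ * (κ * h) * (X + K + K))
        have t4 := hg2 k (by omega)
        refine (norm_add_le _ _).trans ((add_le_add ((norm_add_le _ _).trans (add_le_add ((norm_add_le _ _).trans (add_le_add
          ((norm_add_le _ _).trans (add_le_add le_rfl t1)) t3)) t2)) t4).trans ?_)
        apply le_of_eq
        simp only [ha2, hb2]
        ring)
    intro k hk
    refine (this k (by omega)).trans ?_
    have := kh k hk.le
    rw [hY]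
    have q1 : b2 * κ * (k * h) ≤ b2 * κ := mul_le_of_le_one_right (by positivity) this
    have q2 : a2 * (k * h) ≤ a2 := mul_le_of_le_one_right (by positivity) this
    calc _ ≤ (K * κ + b2 * κ) * Real.exp a2 := by gcongr
      _ = _ := by ring
  have hc0 : 0 ≤ ℓ * L * (X + K + K) + K := by positivity
  refine ⟨w, d, d0, w0, ds, Jd, fun k hk => ⟨?_, ?_, ?_, ?_⟩, fun k hk => ?_⟩
  · linarith [Jw k hk]
  · linarith [L1 k hk]
  · linarith [Aw k hk, L1 k hk]
  · cases k with
    | zero => simp only [d0, map_zero, smul_zero, norm_zero]; positivity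
    | succ k =>
      refine (hAd k (by omega)).trans ?_
      have h1 := L2 k (by omega)
      have h2 : (ℓ * L * (X + K + K) + K) * h ≤ (ℓ * L * (X + K + K) + K) * κ := by gcongr
      have h3 : 0 ≤ (K + X) * κ := by positivity
      have h4 : (K + X + Y + (ℓ * L * (X + K + K) + K)) * κ = Y * κ + (ℓ * L * (X + K + K) + K) * κ + (K + X) * κ := by ring
      linarith
  · have h1 := L2 k hk
    have h3 : 0 ≤ (K + X + (ℓ * L * (X + K + K) + K)) * κ := by positivity
    have h4 : (K + X + Y + (ℓ * L * (X + K + K) + K)) * κ = Y * κ + (K + X + (ℓ * L * (X + K + K) + K)) * κ := by ring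
    linarith
end


lemma posPow (n : ℕ) (s : ℝ) :
    HasDerivAt (fun s : ℝ => max s 0 ^ (n + 2)) ((n + 2) * max s 0 ^ (n + 1)) s := by
  have h1 : ∀ s ∈ Ici (0:ℝ), HasDerivWithinAt (fun s : ℝ => max s 0 ^ (n + 2)) ((n + 2) * max s 0 ^ (n + 1)) (Ici 0) s := by
    intro s hs
    have := ((hasDerivAt_pow (n + 2) s).hasDerivWithinAt (s := Ici 0)).congr_of_mem (f₁ := fun s : ℝ => max s 0 ^ (n + 2))
      (fun x hx => by rw [max_eq_left hx]) hs
    rw [max_eq_left hs]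
    simpa using this
  have h2 : ∀ s ∈ Iic (0:ℝ), HasDerivWithinAt (fun s : ℝ => max s 0 ^ (n + 2)) ((n + 2) * max s 0 ^ (n + 1)) (Iic 0) s := by
    intro s hs
    have := ((hasDerivAt_const s (0:ℝ)).hasDerivWithinAt (s := Iic 0)).congr_of_mem (f₁ := fun s : ℝ => max s 0 ^ (n + 2))
      (fun x hx => by simp [max_eq_right (show x ≤ 0 from hx)]) hs
    rw [max_eq_right hs]
    simpa using this
  rcases lt_trichotomy s 0 with h | h | h
  · exact (h2 s h.le).hasDerivAt (Iic_mem_nhds h)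
  · subst h
    have := (h2 0 (by simp)).union (h1 0 (by simp))
    rwa [Iic_union_Ici, hasDerivWithinAt_univ] at this
  · exact (h1 s h.le).hasDerivAt (Ici_mem_nhds h)

noncomputable def hatI (s : ℝ) : ℝ := (max (s + 1) 0 ^ 2 - 2 * max s 0 ^ 2 + max (s - 1) 0 ^ 2) / 2
noncomputable def hat (s : ℝ) : ℝ := max (s + 1) 0 - 2 * max s 0 + max (s - 1) 0

lemma hatI_deriv (s : ℝ) : HasDerivAt hatI (hat s) s := by
  have h (c : ℝ) : HasDerivAt (fun s : ℝ => max (s + c) 0 ^ 2) (2 * max (s + c) 0) s := by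
    have := (posPow 0 (s + c)).comp_add_const s c
    simpa using this
  have h1 := h 1
  have h2 := h 0
  have h3 := h (-1)
  simp only [add_zero] at h2
  simp only [← sub_eq_add_neg] at h3
  refine (((h1.sub (h2.const_mul 2)).add h3).div_const 2).congr_deriv ?_
  unfold hat; ring

lemma hat_cont : Continuous hat := by unfold hat; fun_prop

lemma hatI_ge {s : ℝ} (h : 1 ≤ s) : hatI s = 1 := by
  unfold hatI; rw [max_eq_left (by linarith), max_eq_left (by linarith), max_eq_left (by linarith)]; ring
lemma hatI_le {s : ℝ} (h : s ≤ -1) : hatI s = 0 := by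
  unfold hatI; rw [max_eq_right (by linarith), max_eq_right (by linarith), max_eq_right (by linarith)]; ring
lemma hatI_p {s : ℝ} (h : 0 ≤ s) (h' : s ≤ 1) : hatI s = 1 / 2 + s - s ^ 2 / 2 := by
  unfold hatI; rw [max_eq_left (by linarith), max_eq_left (by linarith), max_eq_right (by linarith)]; ring
lemma hatI_n {s : ℝ} (h : 0 ≤ s) (h' : s ≤ 1) : hatI (s - 1) = s ^ 2 / 2 := by
  unfold hatI; rw [max_eq_left (by linarith), max_eq_right (by linarith), max_eq_right (by linarith)]; ring
lemma hat_ge {s : ℝ} (h : 1 ≤ s) : hat s = 0 := by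
  unfold hat; rw [max_eq_left (by linarith), max_eq_left (by linarith), max_eq_left (by linarith)]; ring
lemma hat_le {s : ℝ} (h : s ≤ -1) : hat s = 0 := by
  unfold hat; rw [max_eq_right (by linarith), max_eq_right (by linarith), max_eq_right (by linarith)]; ring
lemma hat_p {s : ℝ} (h : 0 ≤ s) (h' : s ≤ 1) : hat s = 1 - s := by
  unfold hat; rw [max_eq_left (by linarith), max_eq_left (by linarith), max_eq_right (by linarith)]; ring
lemma hat_n {s : ℝ} (h : 0 ≤ s) (h' : s ≤ 1) : hat (s - 1) = s := by
  unfold hat; rw [max_eq_left (by linarith), max_eq_right (by linarith), max_eq_right (by linarith)]; ring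

lemma aux_s1 {s : ℝ} (h : 0 ≤ s) (h' : s ≤ 1) : ‖-1 / 2 + s - s ^ 2 / 2‖ ≤ 1 := by
  rw [Real.norm_eq_abs, abs_le]; constructor <;> nlinarith
lemma aux_s2 {s : ℝ} (h : 0 ≤ s) (h' : s ≤ 1) : ‖s ^ 2 / 2‖ ≤ 1 := by
  rw [Real.norm_eq_abs, abs_le]; constructor <;> nlinarith
lemma aux_s3 {h : ℝ} (hh : 0 < h) (j : ℕ) : (-1 - (-1 + ((j + 1 : ℕ):ℝ) * h)) / h ≤ -1 := by
  push_cast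
  rw [div_le_iff₀ hh]; nlinarith [(by positivity : 0 ≤ (j:ℝ) * h)]

/-- splitting of sums with hat coefficients -/
lemma sum_split {D : Type*} [AddCommGroup D] [Module ℝ D] (N k : ℕ) (hk : k < N) (c : ℕ → ℝ) (c0 : ℝ) (d : ℕ → D)
    (hlo : ∀ j < k, c j = c0) (hhi : ∀ j, k + 1 < j → c j = 0) :
    ∑ j ∈ Finset.range (N + 1), c j • d j =
      c0 • ∑ j ∈ Finset.range k, d j + c k • d k + c (k + 1) • d (k + 1) := by
  have h1 : ∑ j ∈ Finset.range (k + 2), c j • d j = ∑ j ∈ Finset.range (N + 1), c j • d j := by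
    apply Finset.sum_subset
    · intro j hj; simp only [Finset.mem_range] at *; omega
    · intro j _ hj; simp only [Finset.mem_range] at hj; rw [hhi j (by omega), zero_smul]
  rw [← h1, Finset.sum_range_succ, Finset.sum_range_succ, Finset.smul_sum]
  congr 2
  exact Finset.sum_congr rfl fun j hj => by rw [hlo j (Finset.mem_range.1 hj)]

lemma exists_cell {N : ℕ} (hN : 0 < N) {τ : ℝ} (h0 : 0 ≤ τ) (h1 : τ ≤ N) :
    ∃ k < N, 0 ≤ τ - k ∧ τ - k ≤ 1 := by
  rcases eq_or_lt_of_le h0 with h | h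
  · exact ⟨0, hN, by simp [← h], by simp [← h]⟩
  · have h2 : 0 < ⌈τ⌉₊ := Nat.ceil_pos.2 h
    have h3 : ⌈τ⌉₊ ≤ N := Nat.ceil_le.2 h1
    have h4 := Nat.le_ceil τ
    have h5 := Nat.ceil_lt_add_one h0
    refine ⟨⌈τ⌉₊ - 1, by omega, ?_, ?_⟩ <;> rw [Nat.cast_sub h2] <;> push_cast <;> linarith

section
variable {P D E : Type*} [NormedAddCommGroup P] [NormedSpace ℝ P] [AddCommGroup D] [Module ℝ D]
  [NormedAddCommGroup E] [NormedSpace ℝ E]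

lemma avg_seq {S : Set P} (hS : Convex ℝ S) (p : ℝ → P) (L : ℝ) (hL : 0 ≤ L) (hpS : ∀ t, p t ∈ S)
    (hp : ∀ s t, ‖p s - p t‖ ≤ L * |s - t|) (m : ℕ) (hm : 0 < m) (h : ℝ) (hh : 0 < h) :
    ∃ q : ℕ → P, (∀ k, q k ∈ S) ∧ (∀ k, ‖q (k + 1) - q k‖ ≤ L * h) ∧
      (∀ k, ‖(q (k + 2) - q (k + 1)) - (q (k + 1) - q k)‖ ≤ 2 * L / m * h) ∧
      ∀ (k : ℕ) t, |t - (-1 + k * h)| ≤ h → ‖p t - q k‖ ≤ L * ((m + 1) * h) := by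
  have hm' : (0:ℝ) < m := by exact_mod_cast hm
  have hsum1 : ∑ j ∈ Finset.range m, (m:ℝ)⁻¹ = 1 := by simp [hm.ne']
  set T : ℕ → ℕ → ℝ := fun k j => -1 + k * h - j * h with hT
  have hq : ∀ k : ℕ, (∑ j ∈ Finset.range m, (m:ℝ)⁻¹ • p (T (k + 1) j)) - ∑ j ∈ Finset.range m, (m:ℝ)⁻¹ • p (T k j)
      = (m:ℝ)⁻¹ • (p (-1 + (k + 1) * h) - p (-1 + (k + 1) * h - m * h)) := by
    intro k
    rw [← Finset.sum_sub_distrib]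
    simp_rw [← smul_sub]
    rw [← Finset.smul_sum]
    congr 1
    have := Finset.sum_range_sub' (fun j : ℕ => p (-1 + (k + 1) * h - j * h)) m
    simp only [Nat.cast_zero, zero_mul, sub_zero] at this
    rw [← this]
    refine Finset.sum_congr rfl fun j _ => ?_
    simp only [hT]
    push_cast
    congr 2
    ring
  refine ⟨fun k => ∑ j ∈ Finset.range m, (m:ℝ)⁻¹ • p (T k j), fun k => ?_, fun k => ?_, fun k => ?_, fun k t ht => ?_⟩
  · exact hS.sum_mem (fun _ _ => by positivity) hsum1 fun _ _ => hpS _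
  · simp only [hq]
    rw [norm_smul, Real.norm_of_nonneg (by positivity)]
    refine (mul_le_mul_of_nonneg_left (hp _ _) (by positivity)).trans ?_
    rw [sub_sub_cancel, abs_of_nonneg (by positivity)]
    apply le_of_eq; field_simp
  · simp only [show k + 2 = (k + 1) + 1 from rfl, hq]
    rw [← smul_sub, norm_smul, Real.norm_of_nonneg (by positivity)]
    have e : ∀ a b c d : P, a - b - (c - d) = (a - c) - (b - d) := fun a b c d => by abel
    rw [e]
    refine (mul_le_mul_of_nonneg_left ((norm_sub_le _ _).trans (add_le_add (hp _ _) (hp _ _))) (by positivity)).trans ?_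
    push_cast
    have e1 : (-1 + ((k:ℝ) + 1 + 1) * h) - (-1 + ((k:ℝ) + 1) * h) = h := by ring
    have e2 : (-1 + ((k:ℝ) + 1 + 1) * h - m * h) - (-1 + ((k:ℝ) + 1) * h - m * h) = h := by ring
    rw [e1, e2, abs_of_pos hh]
    apply le_of_eq; field_simp; ring
  · have : p t - ∑ j ∈ Finset.range m, (m:ℝ)⁻¹ • p (T k j) = ∑ j ∈ Finset.range m, (m:ℝ)⁻¹ • (p t - p (T k j)) := by
      simp_rw [smul_sub]
      rw [Finset.sum_sub_distrib, ← Finset.sum_smul, hsum1, one_smul]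
    rw [this]
    refine (norm_sum_le _ _).trans ?_
    have : ∀ j ∈ Finset.range m, ‖(m:ℝ)⁻¹ • (p t - p (T k j))‖ ≤ (m:ℝ)⁻¹ * (L * ((m + 1) * h)) := by
      intro j hj
      rw [norm_smul, Real.norm_of_nonneg (by positivity)]
      gcongr
      refine (hp _ _).trans ?_
      gcongr
      have hj' : (j:ℝ) ≤ m := by exact_mod_cast (Finset.mem_range.1 hj).le
      have : t - T k j = (t - (-1 + k * h)) + j * h := by simp only [hT]; ring
      rw [this]
      refine (abs_add_le _ _).trans ?_
      rw [abs_of_nonneg (a := (j:ℝ) * h) (by positivity)]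
      nlinarith
    refine (Finset.sum_le_sum this).trans ?_
    rw [Finset.sum_const, Finset.card_range, nsmul_eq_mul]
    apply le_of_eq; field_simp

set_option maxHeartbeats 1000000 in
lemma rothe (J : D →ₗ[ℝ] E) (A : P →ₗ[ℝ] D →ₗ[ℝ] E) {S : Set P} (hS : Convex ℝ S) (ℓ L K R : ℝ)
    (hℓ : 0 ≤ ℓ) (hL : 0 ≤ L) (hK : 0 ≤ K) (hR : 0 ≤ R)
    (hdis : ∀ p ∈ S, ∀ h : ℝ, 0 < h → ∀ x, ‖J x‖ ≤ ‖J x - h • A p x‖)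
    (hsur : ∀ p ∈ S, ∀ h : ℝ, 0 < h → ∀ y, ∃ x, J x - h • A p x = y)
    (hrel : ∀ p ∈ S, ∀ q x, ‖A q x‖ ≤ ℓ * ‖q‖ * (‖A p x‖ + ‖J x‖))
    (p : ℝ → P) (hpS : ∀ t, p t ∈ S) (hpR : ∀ t, ‖p t‖ ≤ R)
    (hp : ∀ s t, ‖p s - p t‖ ≤ L * |s - t|) (g : ℝ → E) (hg0 : g (-1) = 0)
    (hg : ∀ s ∈ Icc (-1:ℝ) 0, ∀ t ∈ Icc (-1:ℝ) 0, ‖g s - g t‖ ≤ K * |s - t|)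
    (hg2 : ∀ t h, 0 < h → -1 ≤ t → t + 2 * h ≤ 0 → ‖(g (t + 2 * h) - g (t + h)) - (g (t + h) - g t)‖ ≤ K * h * h)
    {ε : ℝ} (hε : 0 < ε) :
    ∃ (N : ℕ) (a a1 : ℕ → ℝ → ℝ) (d : ℕ → D), (∀ j t, HasDerivAt (a j) (a1 j t) t) ∧
      (∀ j, Continuous (a1 j)) ∧ (∀ j, a j (-1) = 0) ∧ (∀ j, a1 j (-1) = 0) ∧
      ∀ t ∈ Icc (-1:ℝ) 0, ‖J (∑ j ∈ Finset.range N, a1 j t • d j)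
        - A (p t) (∑ j ∈ Finset.range N, a j t • d j) - g t‖ ≤ ε := by
  obtain ⟨C, hC, hrothe⟩ := rothe_disc J A S ℓ L K hℓ hL hK hdis hsur hrel
  set C' := 1 + 2 * L + K with hC'
  set Z := C * C' + 4 * C * ℓ * R * C' + 4 * C * ℓ * L + K with hZ
  obtain ⟨m, hm⟩ := exists_nat_gt (C' + Z / ε)
  have hZ0 : 0 ≤ Z := by positivity
  have hm1 : C' < m := lt_of_le_of_lt (by simp; positivity) hm
  have hm0 : (0:ℝ) < m := lt_of_le_of_lt (by positivity) hm1
  have hm1' : (1:ℝ) ≤ m := le_trans (by simp only [hC']; linarith) hm1.le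
  have hmn : 0 < m := by exact_mod_cast hm0
  have hZm : Z / m ≤ ε := by
    rw [div_le_iff₀ hm0]
    have : Z / ε ≤ m := le_trans (by simp only [hC']; linarith) hm.le
    rw [div_le_iff₀ hε] at this; linarith
  set h : ℝ := 1 / (m:ℝ) ^ 2 with hh
  have hh0 : 0 < h := by positivity
  have hhm : h ≤ 1 / m := by
    rw [hh]; apply one_div_le_one_div_of_le hm0; nlinarith
  have hmh : m * h = 1 / m := by rw [hh]; field_simp
  set κ := C' / m with hκ
  have hκ0 : 0 ≤ κ := by positivity
  have hC'1 : 1 ≤ C' := by simp only [hC']; linarith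
  have hhκ : h ≤ κ := hhm.trans (by rw [hκ]; gcongr)
  have hκ1 : κ ≤ 1 := by rw [hκ, div_le_one hm0]; exact hm1.le
  have hNh : ((m ^ 2 : ℕ):ℝ) * h = 1 := by rw [hh]; push_cast; field_simp
  obtain ⟨q, hqS, hq1, hq2, hq3⟩ := avg_seq hS p L hL hpS hp m hmn h hh0
  have tk : ∀ k : ℕ, k ≤ m ^ 2 → (-1 + k * h) ∈ Icc (-1:ℝ) 0 := fun k hk => by
    have : (k:ℝ) * h ≤ ((m ^ 2 : ℕ):ℝ) * h := by gcongr
    have h2 : 0 ≤ (k:ℝ) * h := by positivity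
    constructor <;> linarith
  obtain ⟨w, d, d0, w0, hwd, hJd, hb, he⟩ := hrothe (m ^ 2) h κ q (fun k => g (-1 + k * h)) hh0 (by positivity) hNh.le hhκ hκ1
    hqS hq1 (fun k => (hq2 k).trans (by rw [hκ]; gcongr; simp only [hC']; linarith)) (by simpa using hg0)
    (fun k hk => by
      refine (hg _ (tk _ (by omega)) _ (tk _ (by omega))).trans (le_of_eq ?_)
      push_cast
      rw [show (-1 + ((k:ℝ) + 1) * h) - (-1 + k * h) = h by ring, abs_of_pos hh0])
    (fun k hk => by
      have t1 := tk k (by omega)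
      have t2 := tk (k + 2) hk
      have := hg2 (-1 + k * h) h hh0 t1.1 (by have := t2.2; push_cast at this; linarith)
      rw [show -1 + k * h + 2 * h = -1 + ((k + 2 : ℕ):ℝ) * h by push_cast; ring,
        show -1 + k * h + h = -1 + ((k + 1 : ℕ):ℝ) * h by push_cast; ring] at this
      refine this.trans ?_
      gcongr
      calc K * h ≤ C' * (1 / m) := by gcongr; simp only [hC']; linarith
        _ = κ := by rw [hκ]; ring)
  have hw : ∀ k, w k = h • ∑ j ∈ Finset.range (k + 1), d j := by
    intro k
    induction k with
    | zero => simp [w0, d0]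
    | succ k ih => rw [hwd, ih, Finset.sum_range_succ _ (k + 1), smul_add]
  let c : ℝ → ℕ → ℝ := fun t j => (t - (-1 + j * h)) / h
  have hc : ∀ t (j k : ℕ), c t j = c t k + (k - j) := fun t j k => by
    simp only [c]; field_simp; ring
  refine ⟨m ^ 2, fun j t => h * hatI (c t (j + 1)), fun j t => hat (c t (j + 1)), fun j => d (j + 1), fun j t => ?_,
    fun j => hat_cont.comp (by fun_prop), fun j => ?_, fun j => ?_, fun t ht => ?_⟩
  · have h1 : HasDerivAt (fun t => c t (j + 1)) (1 / h) t := by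
      simp only [c]
      exact ((hasDerivAt_id t).sub_const _).div_const h
    have := ((hatI_deriv (c t (j + 1))).comp t h1).const_mul h
    refine this.congr_deriv ?_
    field_simp
  · have : c (-1) (j + 1) ≤ -1 := aux_s3 hh0 j
    simp [hatI_le this]
  · have : c (-1) (j + 1) ≤ -1 := aux_s3 hh0 j
    simp [hat_le this]
  · have sh : ∀ b : ℕ → ℝ, ∑ j ∈ Finset.range (m ^ 2), b (j + 1) • d (j + 1) = ∑ j ∈ Finset.range (m ^ 2 + 1), b j • d j := by
      intro b; rw [Finset.sum_range_succ' _ (m ^ 2), d0]; simp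
    obtain ⟨k, hk, hs0, hs1⟩ := exists_cell (N := m ^ 2) (by positivity) (τ := (t + 1) / h)
      (by have := ht.1; apply div_nonneg <;> linarith) (by rw [div_le_iff₀ hh0, hNh]; linarith [ht.2])
    have hck : (t + 1) / h - k = c t k := by simp only [c]; field_simp; ring
    rw [hck] at hs0 hs1
    set s := c t k with hs
    have hlo : ∀ j < k, 1 ≤ c t j := fun j hj => by
      rw [hc t j k]; have : (j:ℝ) + 1 ≤ k := by exact_mod_cast hj
      linarith
    have hhi : ∀ j, k + 1 < j → c t j ≤ -1 := fun j hj => by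
      rw [hc t j k]; have : (k:ℝ) + 1 + 1 ≤ j := by exact_mod_cast hj
      linarith
    have hk1 : c t (k + 1) = s - 1 := by rw [hc t (k + 1) k]; push_cast; ring
    rw [sh (fun j => hat (c t j)), sh (fun j => h * hatI (c t j)),
      sum_split (m ^ 2) k hk (fun j => hat (c t j)) 0 d (fun j hj => hat_ge (hlo j hj)) (fun j hj => hat_le (hhi j hj)),
      sum_split (m ^ 2) k hk (fun j => h * hatI (c t j)) h d (fun j hj => by simp [hatI_ge (hlo j hj)])
        (fun j hj => by simp [hatI_le (hhi j hj)])]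
    simp only [hk1, ← hs, hat_p hs0 hs1, hat_n hs0 hs1, hatI_p hs0 hs1, hatI_n hs0 hs1, zero_smul, zero_add]
    have e1 : h • ∑ j ∈ Finset.range k, d j = w k - h • d k := by
      rw [hw, Finset.sum_range_succ, smul_add]; abel
    rw [e1]
    have htk : |t - (-1 + k * h)| ≤ h := by
      have : t - (-1 + k * h) = s * h := by rw [hs]; simp only [c]; field_simp
      rw [this, abs_of_nonneg (by positivity)]; exact mul_le_of_le_one_left hh0.le hs1
    have hAd : ∀ j, j ≤ m ^ 2 → ‖h • A (p t) (d j)‖ ≤ 2 * C * ℓ * R * κ := fun j hj => by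
      obtain ⟨_, b2, _, b4⟩ := hb j hj
      have := hrel _ (hqS j) (p t) (d j)
      rw [norm_smul, Real.norm_of_nonneg hh0.le] at b4 ⊢
      calc h * ‖A (p t) (d j)‖ ≤ h * (ℓ * R * (‖A (q j) (d j)‖ + ‖J (d j)‖)) := by
            gcongr; refine this.trans ?_; gcongr; exact hpR t
        _ = ℓ * R * (h * ‖A (q j) (d j)‖ + h * ‖J (d j)‖) := by ring
        _ ≤ ℓ * R * (C * κ + κ * C) := by gcongr
        _ = _ := by ring
    obtain ⟨b1, b2, b3, b4⟩ := hb k hk.le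
    have key : J ((1 - s) • d k + s • d (k + 1)) - A (p t) (w k - h • d k + (h * (1 / 2 + s - s ^ 2 / 2)) • d k + (h * (s ^ 2 / 2)) • d (k + 1)) - g t
      = s • (J (d (k + 1)) - J (d k)) - (A (p t - q k) (w k)) - (-1 / 2 + s - s ^ 2 / 2) • (h • A (p t) (d k)) - (s ^ 2 / 2) • (h • A (p t) (d (k + 1)))
        - (g t - g (-1 + k * h)) := by
      have := hJd k
      simp only [map_add, map_sub, map_smul, LinearMap.sub_apply]
      rw [show (A (p t)) (w k) - (A (q k)) (w k) = A (p t) (w k) - (J (d k) - g (-1 + k * h)) by rw [this]; abel]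
      module
    rw [key]
    have n1 : ‖s • (J (d (k + 1)) - J (d k))‖ ≤ C * κ := by
      rw [norm_smul, Real.norm_of_nonneg hs0]
      exact (mul_le_of_le_one_left (norm_nonneg _) hs1).trans (he k hk)
    have n2 : ‖A (p t - q k) (w k)‖ ≤ 4 * C * ℓ * L * (1 / m) := by
      refine (hrel _ (hqS k) _ _).trans ?_
      calc _ ≤ ℓ * (L * ((m + 1) * h)) * (C + C) := by gcongr; exact hq3 k t htk
        _ ≤ ℓ * (L * (2 * m * h)) * (C + C) := by gcongr; linarith
        _ = _ := by rw [mul_assoc 2, hmh]; ring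
    have n3 : ‖(-1 / 2 + s - s ^ 2 / 2) • (h • A (p t) (d k))‖ ≤ 2 * C * ℓ * R * κ := by
      rw [norm_smul]
      refine (mul_le_of_le_one_left (norm_nonneg _) (aux_s1 hs0 hs1)).trans (hAd k hk.le)
    have n4 : ‖(s ^ 2 / 2) • (h • A (p t) (d (k + 1)))‖ ≤ 2 * C * ℓ * R * κ := by
      rw [norm_smul]
      refine (mul_le_of_le_one_left (norm_nonneg _) (aux_s2 hs0 hs1)).trans (hAd (k + 1) hk)
    have n5 : ‖g t - g (-1 + k * h)‖ ≤ K * (1 / m) := by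
      refine (hg _ ht _ (tk k hk.le)).trans ?_
      gcongr; exact htk.trans hhm
    refine ((norm_sub_le _ _).trans (add_le_add ((norm_sub_le _ _).trans (add_le_add ((norm_sub_le _ _).trans (add_le_add
      ((norm_sub_le _ _).trans (add_le_add n1 n2)) n3)) n4)) n5)).trans (le_trans (le_of_eq ?_) hZm)
    rw [hZ, hκ]; ring
end


namespace CJ
open Complex

def DM : Submodule ℝ ((ℝ → ℂ) × (ℝ → ℂ) × (ℝ → ℂ)) where
  carrier := {w | (∀ y, HasDerivAt w.1 (w.2.1 y) y) ∧ (∀ y, HasDerivAt w.2.1 (w.2.2 y) y) ∧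
    Continuous w.2.2 ∧ w.1 1 = 0}
  add_mem' := fun {a b} ha hb => ⟨fun y => (ha.1 y).add (hb.1 y), fun y => (ha.2.1 y).add (hb.2.1 y),
    ha.2.2.1.add hb.2.2.1, by simp [ha.2.2.2, hb.2.2.2]⟩
  zero_mem' := ⟨fun y => hasDerivAt_const y 0, fun y => hasDerivAt_const y 0, continuous_const, rfl⟩
  smul_mem' := fun c a ha => ⟨fun y => (ha.1 y).const_smul c, fun y => (ha.2.1 y).const_smul c,
    ha.2.2.1.const_smul c, by simp [ha.2.2.2]⟩

def DM.cj (w : DM) : CJ := ⟨w.1.1, w.1.2.1, w.1.2.2, w.2.1, w.2.2.1, w.2.2.2.1⟩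

abbrev EE := C(Icc (0:ℝ) 1, ℂ) × ℂ

def JJ : DM →ₗ[ℝ] EE where
  toFun w := (⟨fun y => (DM.cj w).f y, (DM.cj w).c0.comp continuous_subtype_val⟩, (DM.cj w).f 0)
  map_add' a b := by ext <;> simp [DM.cj]
  map_smul' c a := by ext <;> simp [DM.cj]

noncomputable def AA (lam : ℝ) : (Fin 5 → ℝ) →ₗ[ℝ] DM →ₗ[ℝ] EE :=
  LinearMap.mk₂ ℝ (fun p w => (⟨fun y => (lam:ℂ)⁻¹ * A (p 0) (p 1) (p 2) (DM.cj w) y, by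
      have h0 := (DM.cj w).c0
      have h1 := (DM.cj w).c1
      have h2 := (DM.cj w).c2
      simp only [A]; fun_prop⟩, CJ.B (p 3) (p 4) (DM.cj w)))
    (fun p q w => by ext <;> simp [A, CJ.B] <;> ring)
    (fun c p w => by ext <;> simp [A, CJ.B] <;> ring)
    (fun p w w' => by ext <;> simp [A, CJ.B, DM.cj] <;> ring)
    (fun c p w => by ext <;> simp [A, CJ.B, DM.cj] <;> ring)

def SS (c K : ℝ) : Set (Fin 5 → ℝ) :=
  {p | c ≤ p 0 ∧ c ≤ p 3 ∧ (∀ i, |p i| ≤ K) ∧ ∀ ξ : ℝ, 0 ≤ p 0 * ξ ^ 2 + 2 * p 1 * ξ + p 2}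

lemma SS_convex (c K : ℝ) : Convex ℝ (SS c K) := by
  rintro p ⟨p0, p3, pK, pq⟩ q ⟨q0, q3, qK, qq⟩ a b ha hb hab
  refine ⟨?_, ?_, fun i => ?_, fun ξ => ?_⟩ <;> simp only [Pi.add_apply, Pi.smul_apply, smul_eq_mul]
  · calc c = a * c + b * c := by rw [← add_mul, hab, one_mul]
      _ ≤ _ := by gcongr
  · calc c = a * c + b * c := by rw [← add_mul, hab, one_mul]
      _ ≤ _ := by gcongr
  · refine (abs_add_le _ _).trans ?_
    rw [abs_mul, abs_mul, abs_of_nonneg ha, abs_of_nonneg hb]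
    calc _ ≤ a * K + b * K := by gcongr; exacts [pK i, qK i]
      _ = K := by rw [← add_mul, hab, one_mul]
  · have := add_nonneg (mul_nonneg ha (pq ξ)) (mul_nonneg hb (qq ξ))
    linarith

lemma SS_disc {c K : ℝ} (hc : 0 < c) {p : Fin 5 → ℝ} (hp : p ∈ SS c K) : p 1 ^ 2 ≤ p 0 * p 2 := by
  obtain ⟨p0, -, -, pq⟩ := hp
  have h0 : 0 < p 0 := hc.trans_le p0
  have := pq (-(p 1) / p 0)
  have e : p 0 * (-(p 1) / p 0) ^ 2 + 2 * p 1 * (-(p 1) / p 0) + p 2 = (p 0 * p 2 - p 1 ^ 2) / p 0 := by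
    field_simp; ring
  rw [e, le_div_iff₀ h0] at this
  linarith

lemma mode_dis {lam c K : ℝ} (hlam : 0 < lam) (hc : 0 < c) : ∀ p ∈ SS c K, ∀ h : ℝ, 0 < h → ∀ x,
    ‖JJ x‖ ≤ ‖JJ x - h • AA lam p x‖ := by
  intro p hp h hh x
  set B := ‖JJ x - h • AA lam p x‖ with hB
  have hl : (lam:ℂ) ≠ 0 := by exact_mod_cast hlam.ne'
  have h1 : ∀ y ∈ Icc (0:ℝ) 1, ‖lam * (DM.cj x).f y - h * A (p 0) (p 1) (p 2) (DM.cj x) y‖ ≤ lam * B := by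
    intro y hy
    have := (ContinuousMap.norm_coe_le_norm _ (⟨y, hy⟩ : Icc (0:ℝ) 1)).trans (norm_fst_le (JJ x - h • AA lam p x))
    have e : (lam * (DM.cj x).f y - h * A (p 0) (p 1) (p 2) (DM.cj x) y : ℂ) = lam * ((JJ x - h • AA lam p x).1 ⟨y, hy⟩) := by
      simp [JJ, AA, mul_sub]
      field_simp
    rw [e, norm_mul, norm_real, Real.norm_of_nonneg hlam.le]
    gcongr
  have h2 : ‖(DM.cj x).f 0 - h * CJ.B (p 3) (p 4) (DM.cj x)‖ ≤ B := by
    have := norm_snd_le (JJ x - h • AA lam p x)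
    have e : (JJ x - h • AA lam p x).2 = (DM.cj x).f 0 - h * CJ.B (p 3) (p 4) (DM.cj x) := by
      simp [JJ, AA]
    rw [← e]; exact this
  have := mp (DM.cj x) hlam hh (hc.trans_le hp.1) (SS_disc hc hp) (hc.trans_le hp.2.1) (norm_nonneg _) h1 h2 x.2.2.2.2
  refine norm_prod_le_iff.2 ⟨?_, this 0 (by simp)⟩
  exact (ContinuousMap.norm_le _ (norm_nonneg _)).2 fun y => this y y.2

lemma mode_sur {lam c K : ℝ} (hlam : 0 < lam) (hc : 0 < c) : ∀ p ∈ SS c K, ∀ h : ℝ, 0 < h → ∀ y,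
    ∃ x, JJ x - h • AA lam p x = y := by
  rintro p hp h hh ⟨F, G⟩
  have hl : (lam:ℂ) ≠ 0 := by exact_mod_cast hlam.ne'
  obtain ⟨w, hw, hw0, hw1⟩ := bvp hlam hh (hc.trans_le hp.1) (SS_disc hc hp) (hc.trans_le hp.2.1) (θ := p 4)
    (F := IccExtend zero_le_one F) F.continuous.Icc_extend' G
  let x : DM := ⟨(w.f, w.f1, w.f2), w.h0, w.h1, w.c2, hw1⟩
  have hx : DM.cj x = w := rfl
  refine ⟨x, ?_⟩
  ext y
  · have := hw y
    rw [IccExtend_val] at this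
    have e : (JJ x - h • AA lam p x).1 y = w.f y - h * ((lam:ℂ)⁻¹ * A (p 0) (p 1) (p 2) w y) := by
      simp [JJ, AA, hx]
    rw [e]
    apply mul_left_cancel₀ hl
    simp only
    rw [← this]
    field_simp
  · simpa [JJ, AA, hx] using hw0

lemma mode_rel {lam c K : ℝ} (hlam : 0 < lam) (hc : 0 < c) (hK : 0 ≤ K) : ∃ ℓ : ℝ, 0 ≤ ℓ ∧ ∀ p ∈ SS c K, ∀ q x,
    ‖AA lam q x‖ ≤ ℓ * ‖q‖ * (‖AA lam p x‖ + ‖JJ x‖) := by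
  obtain ⟨C, hC, hdb⟩ := db c K hc hK
  have hl : (lam:ℂ) ≠ 0 := by exact_mod_cast hlam.ne'
  refine ⟨(lam⁻¹ * (3 * C + 1) + (C + 1)) * (lam + 1), by positivity, fun p hp q x => ?_⟩
  set B := (lam + 1) * (‖AA lam p x‖ + ‖JJ x‖) with hB
  set w := DM.cj x with hw
  have n0 : ∀ y ∈ Icc (0:ℝ) 1, ‖w.f y‖ ≤ B := fun y hy => by
    have := (ContinuousMap.norm_coe_le_norm _ (⟨y, hy⟩ : Icc (0:ℝ) 1)).trans (norm_fst_le (JJ x))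
    have e : ‖w.f y‖ ≤ ‖JJ x‖ := this
    have h1 : 0 ≤ ‖AA lam p x‖ := norm_nonneg _
    have h2 : 0 ≤ ‖JJ x‖ := norm_nonneg _
    calc _ ≤ 1 * (0 + ‖JJ x‖) := by linarith
      _ ≤ B := by rw [hB]; gcongr; linarith
  have nA : ∀ y ∈ Icc (0:ℝ) 1, ‖A (p 0) (p 1) (p 2) w y‖ ≤ B := fun y hy => by
    have := (ContinuousMap.norm_coe_le_norm _ (⟨y, hy⟩ : Icc (0:ℝ) 1)).trans (norm_fst_le (AA lam p x))
    have e : A (p 0) (p 1) (p 2) w y = lam * ((AA lam p x).1 ⟨y, hy⟩) := by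
      simp [AA, ← hw]; field_simp
    rw [e, norm_mul, norm_real, Real.norm_of_nonneg hlam.le, hB]
    have h2 : 0 ≤ ‖JJ x‖ := norm_nonneg _
    gcongr
    · linarith
    · linarith
  have nB : ‖CJ.B (p 3) (p 4) w‖ ≤ B := by
    have : ‖CJ.B (p 3) (p 4) w‖ ≤ ‖AA lam p x‖ := norm_snd_le (AA lam p x)
    have h1 : 0 ≤ ‖AA lam p x‖ := norm_nonneg _
    have h2 : 0 ≤ ‖JJ x‖ := norm_nonneg _
    calc _ ≤ 1 * (‖AA lam p x‖ + 0) := by linarith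
      _ ≤ B := by rw [hB]; gcongr; linarith
  have hd := hdb w (p 0) (p 1) (p 2) (p 3) (p 4) B hp.1 hp.2.1 (hp.2.2.1 1) (hp.2.2.1 2) (hp.2.2.1 4) nA n0 nB
  have hB0 : 0 ≤ B := (norm_nonneg _).trans nB
  have hq : ∀ i, ‖(q i : ℂ)‖ ≤ ‖q‖ := fun i => by rw [norm_real]; exact norm_le_pi_norm q i
  have e : (lam⁻¹ * (3 * C + 1) + (C + 1)) * (lam + 1) * ‖q‖ * (‖AA lam p x‖ + ‖JJ x‖) =
    lam⁻¹ * (‖q‖ * (C * B) + 2 * 1 * ‖q‖ * (C * B) + ‖q‖ * B) + (‖q‖ * (C * B) + 1 * ‖q‖ * B) := by rw [hB]; ring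
  rw [e]
  have t0 : 0 ≤ ‖q‖ := norm_nonneg _
  refine norm_prod_le_iff.2 ⟨(ContinuousMap.norm_le _ (by positivity)).2 fun y => ?_, ?_⟩
  · change ‖(lam:ℂ)⁻¹ * A (q 0) (q 1) (q 2) w y‖ ≤ _
    refine le_trans ?_ (le_add_of_nonneg_right (by positivity))
    rw [norm_mul, norm_inv, norm_real, Real.norm_of_nonneg hlam.le]
    gcongr
    unfold A
    refine (norm_sub_le _ _).trans (add_le_add ((norm_add_le _ _).trans ?_) ?_)
    · simp only [norm_mul, norm_I, RCLike.norm_ofNat]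
      gcongr
      exacts [hq 0, (hd y y.2).2, hq 1, (hd y y.2).1]
    · rw [norm_mul]; gcongr; exacts [hq 2, n0 y y.2]
  · change ‖CJ.B (q 3) (q 4) w‖ ≤ _
    refine le_trans ?_ (le_add_of_nonneg_left (by positivity))
    unfold CJ.B
    refine (norm_add_le _ _).trans ?_
    simp only [norm_mul, norm_I]
    gcongr
    exacts [hq 3, (hd 0 (by simp)).1, hq 4, n0 0 (by simp)]

lemma smul_src {E : Type*} [NormedAddCommGroup E] [NormedSpace ℝ E] (y : E) (b : ℝ → ℝ) (Kb : ℝ) (hb0 : b (-1) = 0)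
    (hb1 : ∀ s ∈ Icc (-1:ℝ) 0, ∀ t ∈ Icc (-1:ℝ) 0, |b s - b t| ≤ Kb * |s - t|)
    (hb2 : ∀ t h, 0 < h → -1 ≤ t → t + 2 * h ≤ 0 → |(b (t + 2 * h) - b (t + h)) - (b (t + h) - b t)| ≤ Kb * h * h) :
    b (-1) • y = 0 ∧ (∀ s ∈ Icc (-1:ℝ) 0, ∀ t ∈ Icc (-1:ℝ) 0, ‖b s • y - b t • y‖ ≤ Kb * ‖y‖ * |s - t|) ∧
    (∀ t h, 0 < h → -1 ≤ t → t + 2 * h ≤ 0 →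
      ‖(b (t + 2 * h) • y - b (t + h) • y) - (b (t + h) • y - b t • y)‖ ≤ Kb * ‖y‖ * h * h) := by
  refine ⟨by rw [hb0, zero_smul], fun s hs t ht => ?_, fun t h hh ht ht' => ?_⟩
  · rw [← sub_smul, norm_smul]
    have := mul_le_mul_of_nonneg_right (hb1 s hs t ht) (norm_nonneg y)
    simp only [Real.norm_eq_abs]; linarith
  · simp only [← sub_smul]; rw [norm_smul]
    have := mul_le_mul_of_nonneg_right (hb2 t h hh ht ht') (norm_nonneg y)
    simp only [Real.norm_eq_abs]; linarith

lemma mode_solve {lam c K L Kb : ℝ} (hlam : 0 < lam) (hc : 0 < c) (hK : 0 ≤ K) (hL : 0 ≤ L) (hKb : 0 ≤ Kb)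
    (p : ℝ → Fin 5 → ℝ) (hpS : ∀ t, p t ∈ SS c K) (hp : ∀ s t, ‖p s - p t‖ ≤ L * |s - t|)
    (b : ℝ → ℝ) (hb0 : b (-1) = 0) (hb1 : ∀ s ∈ Icc (-1:ℝ) 0, ∀ t ∈ Icc (-1:ℝ) 0, |b s - b t| ≤ Kb * |s - t|)
    (hb2 : ∀ t h, 0 < h → -1 ≤ t → t + 2 * h ≤ 0 → |(b (t + 2 * h) - b (t + h)) - (b (t + h) - b t)| ≤ Kb * h * h)
    (ψ : C(Icc (0:ℝ) 1, ℂ)) (γ : ℂ) {ε : ℝ} (hε : 0 < ε) :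
    ∃ (N : ℕ) (a a1 : ℕ → ℝ → ℝ) (d : ℕ → CJ), (∀ j t, HasDerivAt (a j) (a1 j t) t) ∧
      (∀ j, Continuous (a1 j)) ∧ (∀ j, a j (-1) = 0) ∧ (∀ j, a1 j (-1) = 0) ∧ (∀ j, (d j).f 1 = 0) ∧
      ∀ t ∈ Icc (-1:ℝ) 0, (∀ y : Icc (0:ℝ) 1, ‖lam * ∑ j ∈ Finset.range N, a1 j t * (d j).f y
        - ∑ j ∈ Finset.range N, a j t * A (p t 0) (p t 1) (p t 2) (d j) y - b t * ψ y‖ ≤ ε) ∧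
        ‖∑ j ∈ Finset.range N, a1 j t * (d j).f 0
        - ∑ j ∈ Finset.range N, a j t * CJ.B (p t 3) (p t 4) (d j) - b t * γ‖ ≤ ε := by
  obtain ⟨ℓ, hℓ, hrel⟩ := mode_rel (lam := lam) hlam hc hK
  have hl : (lam:ℂ) ≠ 0 := by exact_mod_cast hlam.ne'
  set y0 : EE := ((lam:ℂ)⁻¹ • ψ, γ) with hy0
  have hε' : 0 < min ε (ε / lam) := lt_min hε (by positivity)
  obtain ⟨N, a, a1, d, h1, h2, h3, h3', h4⟩ := rothe JJ (AA lam) (SS_convex c K) ℓ L (Kb * ‖y0‖) K hℓ hL (by positivity) hK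
    (mode_dis hlam hc) (mode_sur hlam hc) hrel p hpS
    (fun t => (pi_norm_le_iff_of_nonneg hK).2 fun i => (hpS t).2.2.1 i) hp
    (fun t => b t • y0) (smul_src y0 b Kb hb0 hb1 hb2).1 (smul_src y0 b Kb hb0 hb1 hb2).2.1
    (smul_src y0 b Kb hb0 hb1 hb2).2.2 hε'
  refine ⟨N, a, a1, fun j => DM.cj (d j), h1, h2, h3, h3', fun j => (d j).2.2.2.2, fun t ht => ?_⟩
  have H := h4 t ht
  rw [map_sum, map_sum] at H
  simp only [map_smul] at H
  constructor
  · intro y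
    have := (ContinuousMap.norm_coe_le_norm _ y).trans ((norm_fst_le _).trans H)
    have e : (lam * ∑ j ∈ Finset.range N, a1 j t * (DM.cj (d j)).f y
        - ∑ j ∈ Finset.range N, a j t * A (p t 0) (p t 1) (p t 2) (DM.cj (d j)) y - b t * ψ y : ℂ) =
        lam * ((∑ j ∈ Finset.range N, a1 j t • JJ (d j) - ∑ j ∈ Finset.range N, a j t • AA lam (p t) (d j) - b t • y0).1 y) := by
      simp only [Prod.fst_sub, Prod.fst_sum, ContinuousMap.sub_apply, ContinuousMap.sum_apply, mul_sub, Finset.mul_sum, Prod.smul_fst,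
        ContinuousMap.smul_apply, hy0, AA, JJ, LinearMap.mk₂_apply, ContinuousMap.coe_mk, real_smul, LinearMap.coe_mk, AddHom.coe_mk, smul_eq_mul]
      have e3 : ∀ a b : ℂ, (lam:ℂ) * (a * ((lam:ℂ)⁻¹ * b)) = a * b := fun a b => by
        rw [mul_left_comm, mul_inv_cancel_left₀ hl]
      simp only [e3]
    rw [e, norm_mul, norm_real, Real.norm_of_nonneg hlam.le]
    calc _ ≤ lam * (ε / lam) := by gcongr; exact this.trans (min_le_right _ _)
      _ = ε := by field_simp
  · have := (norm_snd_le _).trans H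
    refine le_trans (le_of_eq ?_) (this.trans (min_le_left _ _))
    congr 1
    simp only [Prod.snd_sub, Prod.snd_sum, Prod.smul_snd, hy0, AA, JJ, LinearMap.mk₂_apply, real_smul, LinearMap.coe_mk, AddHom.coe_mk]

end CJ


noncomputable section
namespace OB
open Filter Topology

/-- the differential on space-time with gradient `g` and time derivative `c` -/
def dL {n : ℕ} (g : Eucl n) (c : ℝ) : SpaceTime n →L[ℝ] ℝ :=
  (innerSL ℝ g).comp (ContinuousLinearMap.fst ℝ _ _) + c • ContinuousLinearMap.snd ℝ _ _

lemma dL_apply {n : ℕ} (g : Eucl n) (c : ℝ) (p : SpaceTime n) : dL g c p = ∑ i, g i * p.1 i + c * p.2 := by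
  simp [dL, PiLp.inner_apply, mul_comm]

def mL {n : ℕ} (A : Matrix (Fin n) (Fin n) ℝ) : Eucl n →L[ℝ] Eucl n :=
  LinearMap.toContinuousLinearMap (Matrix.toEuclideanLin A)

lemma mL_apply {n : ℕ} (A : Matrix (Fin n) (Fin n) ℝ) (x : Eucl n) (i : Fin n) : mL A x i = ∑ j, A i j * x j := by
  simp [mL, Matrix.mulVec, dotProduct]

structure Reg (n : ℕ) where
  u : SpaceTime n → ℝ
  ut : SpaceTime n → ℝ
  g : SpaceTime n → Eucl n
  H : SpaceTime n → Matrix (Fin n) (Fin n) ℝ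
  hu : ∀ p, HasFDerivAt u (dL (g p) (ut p)) p
  hg : ∀ x t, HasFDerivAt (fun x => g (x, t)) (mL (H (x, t))) x
  cut : Continuous ut
  cg : Continuous g
  cH : Continuous H
  sym : ∀ p i j, H p i j = H p j i

namespace Reg
variable {n : ℕ}

lemma cu (U : Reg n) : Continuous U.u := continuous_iff_continuousAt.2 fun p => (U.hu p).continuousAt

lemma cgi (U : Reg n) (i : Fin n) : Continuous fun p => U.g p i :=
  (EuclideanSpace.proj i : Eucl n →L[ℝ] ℝ).continuous.comp U.cg
lemma cHi (U : Reg n) (i j : Fin n) : Continuous fun p => U.H p i j := U.cH.matrix_elem i j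

lemma hx (U : Reg n) (x : Eucl n) (t : ℝ) : HasFDerivAt (fun x => U.u (x, t)) (innerSL ℝ (U.g (x, t))) x := by
  have h : HasFDerivAt (fun x : Eucl n => (x, t)) ((ContinuousLinearMap.id ℝ (Eucl n)).prod 0) x :=
    (hasFDerivAt_id x).prodMk (hasFDerivAt_const t x)
  have := (U.hu (x, t)).comp x h
  refine this.congr_fderiv ?_
  ext y; simp [dL]

lemma htime (U : Reg n) (x : Eucl n) (t : ℝ) : HasDerivAt (fun t => U.u (x, t)) (U.ut (x, t)) t := by
  have := (U.hu (x, t)).comp_hasDerivAt t ((hasDerivAt_const t x).prodMk (hasDerivAt_id t))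
  simpa [dL, Function.comp_def] using this

/-- `tr(QH)` -/
def L (U : Reg n) (Q : Matrix (Fin n) (Fin n) ℝ) (p : SpaceTime n) : ℝ := ∑ i, ∑ j, Q i j * U.H p i j

lemma L_trace (U : Reg n) (Q : Matrix (Fin n) (Fin n) ℝ) (p : SpaceTime n) : (Q * U.H p).trace = U.L Q p := by
  simp only [Matrix.trace, Matrix.diag_apply, Matrix.mul_apply, L]
  exact Finset.sum_congr rfl fun i _ => Finset.sum_congr rfl fun j _ => by rw [U.sym]

lemma parabolicTest (U : Reg n) (D : Set (SpaceTime n)) : ParabolicTest U.u D U.ut U.g U.H where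
  contPhi := U.cu.continuousOn
  contPhit := U.cut.continuousOn
  contGrad := U.cg.continuousOn
  contHess := U.cH.continuousOn
  symmHess := fun p _ => by ext i j; exact U.sym p j i
  timeDeriv := fun p _ => (U.htime p.1 p.2).hasDerivWithinAt
  spaceGrad := fun p _ => by
    rw [hasGradientWithinAt_iff_hasFDerivWithinAt]; exact (U.hx p.1 p.2).hasFDerivWithinAt
  spaceHess := fun p _ => (U.hg p.1 p.2).hasFDerivWithinAt

def add (U W : Reg n) : Reg n where
  u p := U.u p + W.u p
  ut p := U.ut p + W.ut p
  g p := U.g p + W.g p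
  H p := U.H p + W.H p
  hu p := ((U.hu p).add (W.hu p)).congr_fderiv (by
    refine ContinuousLinearMap.ext fun q => ?_
    simp only [_root_.add_apply, dL_apply, PiLp.add_apply, add_mul, Finset.sum_add_distrib]; ring)
  hg x t := ((U.hg x t).add (W.hg x t)).congr_fderiv (by
    refine ContinuousLinearMap.ext fun q => ?_
    ext i
    simp only [_root_.add_apply, PiLp.add_apply, mL_apply, Matrix.add_apply, add_mul, Finset.sum_add_distrib])
  cut := U.cut.add W.cut
  cg := U.cg.add W.cg
  cH := U.cH.add W.cH
  sym p i j := by simp [U.sym p i j, W.sym p i j]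

def mul (U W : Reg n) : Reg n where
  u p := U.u p * W.u p
  ut p := U.u p * W.ut p + W.u p * U.ut p
  g p := U.u p • W.g p + W.u p • U.g p
  H p := Matrix.of fun i j => U.u p * W.H p i j + W.u p * U.H p i j + U.g p i * W.g p j + W.g p i * U.g p j
  hu p := ((U.hu p).mul (W.hu p)).congr_fderiv (by
    refine ContinuousLinearMap.ext fun q => ?_
    simp only [_root_.add_apply, _root_.smul_apply, dL_apply, PiLp.add_apply, PiLp.smul_apply, smul_eq_mul, add_mul, mul_add, Finset.sum_add_distrib, Finset.mul_sum, mul_assoc]; ring)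
  hg x t := (((U.hx x t).smul (W.hg x t)).add ((W.hx x t).smul (U.hg x t))).congr_fderiv (by
    refine ContinuousLinearMap.ext fun q => ?_
    ext i
    simp only [_root_.add_apply, _root_.smul_apply, ContinuousLinearMap.smulRight_apply, PiLp.add_apply, PiLp.smul_apply,
      mL_apply, Matrix.of_apply, add_mul, Finset.sum_add_distrib, smul_eq_mul, innerSL_apply_apply, PiLp.inner_apply, RCLike.inner_apply, conj_trivial,
      Finset.mul_sum, Finset.sum_mul, mul_assoc]
    have e1 : ∀ (a : ℝ) (f q : Eucl n), ∑ j, a * (f j * q j) = ∑ j, q j * (f j * a) := fun a f q =>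
      Finset.sum_congr rfl fun j _ => by ring
    rw [e1, e1]; ring)
  cut := by have := U.cu; have := W.cu; have := U.cut; have := W.cut; fun_prop
  cg := by have := U.cu; have := W.cu; have := U.cg; have := W.cg; fun_prop
  cH := by
    refine continuous_matrix fun i j => ?_
    simp only [Matrix.of_apply]
    exact (((U.cu.mul (W.cHi i j)).add (W.cu.mul (U.cHi i j))).add ((U.cgi i).mul (W.cgi j))).add ((W.cgi i).mul (U.cgi j))
  sym p i j := by simp only [Matrix.of_apply, U.sym p i j, W.sym p i j]; ring

def comp (U : Reg n) (σ σ1 σ2 : ℝ → ℝ) (h1 : ∀ s, HasDerivAt σ (σ1 s) s) (h2 : ∀ s, HasDerivAt σ1 (σ2 s) s) (h3 : Continuous σ2) : Reg n where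
  u p := σ (U.u p)
  ut p := σ1 (U.u p) * U.ut p
  g p := σ1 (U.u p) • U.g p
  H p := Matrix.of fun i j => σ1 (U.u p) * U.H p i j + σ2 (U.u p) * (U.g p i * U.g p j)
  hu p := ((h1 _).comp_hasFDerivAt p (U.hu p)).congr_fderiv (by
    refine ContinuousLinearMap.ext fun q => ?_
    simp only [_root_.smul_apply, dL_apply, PiLp.smul_apply, smul_eq_mul, mul_add, Finset.mul_sum, mul_assoc])
  hg x t := (((h2 _).comp_hasFDerivAt x (U.hx x t)).smul (U.hg x t)).congr_fderiv (by
    refine ContinuousLinearMap.ext fun q => ?_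
    ext i
    simp only [_root_.add_apply, _root_.smul_apply, ContinuousLinearMap.smulRight_apply, PiLp.add_apply, PiLp.smul_apply,
      mL_apply, Matrix.of_apply, add_mul, Finset.sum_add_distrib, smul_eq_mul, innerSL_apply_apply, PiLp.inner_apply, RCLike.inner_apply, conj_trivial,
      Finset.mul_sum, Finset.sum_mul, mul_assoc, Function.comp_apply]
    congr 1
    exact Finset.sum_congr rfl fun j _ => by ring)
  cut := by
    have := U.cu; have := U.cut; have : Continuous σ1 := continuous_iff_continuousAt.2 fun s => (h2 s).continuousAt
    fun_prop
  cg := by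
    have := U.cu; have := U.cg; have : Continuous σ1 := continuous_iff_continuousAt.2 fun s => (h2 s).continuousAt
    fun_prop
  cH := by
    have := U.cu; have := U.cg; have := U.cH; have : Continuous σ1 := continuous_iff_continuousAt.2 fun s => (h2 s).continuousAt
    refine continuous_matrix fun i j => ?_
    simp only [Matrix.of_apply]
    exact ((this.comp U.cu).mul (U.cHi i j)).add ((h3.comp U.cu).mul ((U.cgi i).mul (U.cgi j)))
  sym p i j := by simp only [Matrix.of_apply, U.sym p i j]; ring

def ofTime (n : ℕ) (a a1 : ℝ → ℝ) (h : ∀ t, HasDerivAt a (a1 t) t) (hc : Continuous a1) : Reg n where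
  u p := a p.2
  ut p := a1 p.2
  g _ := 0
  H _ := 0
  hu p := ((h p.2).comp_hasFDerivAt p hasFDerivAt_snd).congr_fderiv (by
    refine ContinuousLinearMap.ext fun q => ?_
    simp [dL_apply])
  hg x t := (hasFDerivAt_const _ _).congr_fderiv (by
    refine ContinuousLinearMap.ext fun q => ?_
    ext i; simp [mL_apply])
  cut := by fun_prop
  cg := continuous_const
  cH := continuous_const
  sym p i j := rfl

def quad (D l : Fin n → ℝ) : Reg n where
  u p := ∑ i, (D i * p.1 i ^ 2 + l i * p.1 i)
  ut _ := 0
  g p := WithLp.toLp 2 fun i => 2 * D i * p.1 i + l i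
  H _ := Matrix.diagonal fun i => 2 * D i
  hu p := by
    have h : ∀ i : Fin n, HasFDerivAt (fun p : SpaceTime n => p.1 i) ((EuclideanSpace.proj i : Eucl n →L[ℝ] ℝ).comp (ContinuousLinearMap.fst ℝ _ _)) p :=
      fun i => ((EuclideanSpace.proj i : Eucl n →L[ℝ] ℝ).comp (ContinuousLinearMap.fst ℝ (Eucl n) ℝ)).hasFDerivAt
    refine (HasFDerivAt.fun_sum fun i _ => (((h i).pow 2).const_mul (D i)).add ((h i).const_mul (l i))).congr_fderiv ?_
    refine ContinuousLinearMap.ext fun q => ?_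
    simp only [_root_.sum_apply, dL_apply]
    simp
    exact Finset.sum_congr rfl fun j _ => by ring
  hg x t := by
    rw [← hasFDerivWithinAt_univ, hasFDerivWithinAt_euclidean]
    intro i
    rw [hasFDerivWithinAt_univ]
    have h : HasFDerivAt (fun x : Eucl n => x i) (EuclideanSpace.proj i : Eucl n →L[ℝ] ℝ) x :=
      (EuclideanSpace.proj i : Eucl n →L[ℝ] ℝ).hasFDerivAt
    refine ((h.const_mul (2 * D i)).add_const (l i)).congr_fderiv ?_
    refine ContinuousLinearMap.ext fun q => ?_
    simp [mL_apply, Matrix.diagonal_apply]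
  cut := continuous_const
  cg := by fun_prop
  cH := continuous_const
  sym p i j := by
    simp only [Matrix.diagonal_apply]; by_cases h : i = j
    · subst h; rfl
    · rw [if_neg h, if_neg (Ne.symm h)]

def smul (c : ℝ) (U : Reg n) : Reg n where
  u p := c * U.u p
  ut p := c * U.ut p
  g p := c • U.g p
  H p := c • U.H p
  hu p := ((U.hu p).const_mul c).congr_fderiv (by
    refine ContinuousLinearMap.ext fun q => ?_
    simp only [_root_.smul_apply, dL_apply, PiLp.smul_apply, smul_eq_mul, mul_add, Finset.mul_sum, mul_assoc])
  hg x t := ((U.hg x t).const_smul c).congr_fderiv (by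
    refine ContinuousLinearMap.ext fun q => ?_
    ext i
    simp only [_root_.smul_apply, PiLp.smul_apply, mL_apply, Matrix.smul_apply, smul_eq_mul, Finset.mul_sum, mul_assoc])
  cut := U.cut.const_mul c
  cg := U.cg.const_smul c
  cH := U.cH.const_smul c
  sym p i j := by simp [U.sym p i j]

/-- bilinear form of `Q` -/
def _root_.OB.bq (Q : Matrix (Fin n) (Fin n) ℝ) (a b : Eucl n) : ℝ := ∑ i, ∑ j, Q i j * (a i * b j)

lemma L_add (U W : Reg n) (Q) (p) : (U.add W).L Q p = U.L Q p + W.L Q p := by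
  simp [L, add, mul_add, Finset.sum_add_distrib]
lemma L_smul (c : ℝ) (W : Reg n) (Q) (p) : (smul c W).L Q p = c * W.L Q p := by
  simp only [L, smul, Matrix.smul_apply, smul_eq_mul, Finset.mul_sum]
  exact Finset.sum_congr rfl fun i _ => Finset.sum_congr rfl fun j _ => by ring
lemma _root_.OB.bq_comm {Q : Matrix (Fin n) (Fin n) ℝ} (hQ : Q.IsSymm) (a b : Eucl n) : bq Q a b = bq Q b a := by
  unfold bq
  rw [Finset.sum_comm]
  exact Finset.sum_congr rfl fun i _ => Finset.sum_congr rfl fun j _ => by rw [hQ.apply i j]; ring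
lemma L_mul (U W : Reg n) {Q} (hQ : Matrix.IsSymm Q) (p) : (U.mul W).L Q p = U.u p * W.L Q p + W.u p * U.L Q p + 2 * bq Q (U.g p) (W.g p) := by
  have : (U.mul W).L Q p = U.u p * W.L Q p + W.u p * U.L Q p + bq Q (U.g p) (W.g p) + bq Q (W.g p) (U.g p) := by
    simp only [L, mul, Matrix.of_apply, bq, Finset.mul_sum, ← Finset.sum_add_distrib]
    exact Finset.sum_congr rfl fun i _ => Finset.sum_congr rfl fun j _ => by ring
  rw [this, bq_comm hQ (W.g p)]; ring
lemma L_comp (U : Reg n) (σ σ1 σ2 h1 h2 h3 Q p) : (U.comp σ σ1 σ2 h1 h2 h3).L Q p = σ1 (U.u p) * U.L Q p + σ2 (U.u p) * bq Q (U.g p) (U.g p) := by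
  simp only [L, comp, Matrix.of_apply, bq, Finset.mul_sum, ← Finset.sum_add_distrib]
  exact Finset.sum_congr rfl fun i _ => Finset.sum_congr rfl fun j _ => by ring
lemma L_ofTime (a a1 h hc Q p) : (ofTime n a a1 h hc).L Q p = 0 := by simp [L, ofTime]
lemma L_quad (D l Q p) : (quad (n := n) D l).L Q p = ∑ i, Q i i * (2 * D i) := by
  simp [L, quad, Matrix.diagonal_apply]

end Reg

/-! one-dimensional calculus at maxima -/
lemma deriv_left_max {f : ℝ → ℝ} {f' t : ℝ} (h : HasDerivWithinAt f f' (Iic t) t) (hm : ∀ᶠ s in 𝓝[≤] t, f s ≤ f t) : 0 ≤ f' := by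
  have h1 := (hasDerivWithinAt_iff_tendsto_slope' (s := Iio t) (by simp)).1 (h.mono Iio_subset_Iic_self)
  refine ge_of_tendsto h1 ?_
  filter_upwards [hm.filter_mono (nhdsWithin_mono t Iio_subset_Iic_self), self_mem_nhdsWithin] with s h2 h3
  rw [slope_def_field]
  exact div_nonneg_of_nonpos (sub_nonpos.2 h2) (sub_nonpos.2 (le_of_lt h3))

lemma deriv_right_max {f : ℝ → ℝ} {f' t : ℝ} (h : HasDerivWithinAt f f' (Ici t) t) (hm : ∀ᶠ s in 𝓝[≥] t, f s ≤ f t) : f' ≤ 0 := by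
  have h1 := (hasDerivWithinAt_iff_tendsto_slope' (s := Ioi t) (by simp)).1 (h.mono Ioi_subset_Ici_self)
  refine le_of_tendsto h1 ?_
  filter_upwards [hm.filter_mono (nhdsWithin_mono t Ioi_subset_Ici_self), self_mem_nhdsWithin] with s h2 h3
  rw [slope_def_field]
  exact div_nonpos_of_nonpos_of_nonneg (sub_nonpos.2 h2) (sub_nonneg.2 (le_of_lt h3))


lemma bq_nonneg {n : ℕ} {Q : Matrix (Fin n) (Fin n) ℝ} (hQ : Q.PosSemidef) (e : Eucl n) : 0 ≤ bq Q e e := by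
  have := hQ.dotProduct_mulVec_nonneg e.ofLp
  simp only [dotProduct, Matrix.mulVec, Pi.star_apply, star_trivial, Finset.mul_sum] at this
  refine this.trans (le_of_eq ?_)
  exact Finset.sum_congr rfl fun i _ => Finset.sum_congr rfl fun j _ => by ring

open scoped MatrixOrder in
lemma psd_fac {n : ℕ} {Q : Matrix (Fin n) (Fin n) ℝ} (hQ : Q.PosSemidef) : ∃ B : Matrix (Fin n) (Fin n) ℝ, Q = B.conjTranspose * B := by
  obtain ⟨X, hX, -, h⟩ :=
    sub_zero Q ▸ CFC.exists_sqrt_of_isSelfAdjoint_of_quasispectrumRestricts hQ.1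
      (QuasispectrumRestricts.nnreal_of_nonneg hQ.nonneg)
  rw [sub_zero] at h
  exact ⟨X, by rw [← h]; congr 1; exact hX.star_eq.symm⟩

lemma trace_nonpos {n : ℕ} {Q H : Matrix (Fin n) (Fin n) ℝ} (hQ : Q.PosSemidef) (hH : ∀ e : Eucl n, bq H e e ≤ 0) :
    ∑ i, ∑ j, Q i j * H i j ≤ 0 := by
  obtain ⟨B, rfl⟩ := psd_fac hQ
  have : ∑ i, ∑ j, (B.conjTranspose * B) i j * H i j = ∑ k, bq H (WithLp.toLp 2 (B k)) (WithLp.toLp 2 (B k)) := by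
    simp only [bq, Matrix.mul_apply, Matrix.conjTranspose_apply, star_trivial, Finset.sum_mul]
    have : ∀ f : Fin n → Fin n → Fin n → ℝ, ∑ i, ∑ j, ∑ k, f i j k = ∑ k, ∑ i, ∑ j, f i j k := fun f => by
      rw [Finset.sum_comm (γ := Fin n)]
      rw [← Finset.sum_comm (γ := Fin n)]
      rw [Finset.sum_comm]
      conv_rhs => rw [Finset.sum_comm]
      rw [Finset.sum_comm]
      refine Finset.sum_congr rfl fun i _ => Finset.sum_comm
    rw [this]
    exact Finset.sum_congr rfl fun k _ => Finset.sum_congr rfl fun i _ => Finset.sum_congr rfl fun j _ => by ring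
  rw [this]
  exact Finset.sum_nonpos fun k _ => hH _

namespace Reg
variable {n : ℕ}

lemma line1 (U : Reg n) (x e : Eucl n) (t s : ℝ) :
    HasDerivAt (fun s : ℝ => U.u (x + s • e, t)) ⟪U.g (x + s • e, t), e⟫ s := by
  have h : HasDerivAt (fun s : ℝ => x + s • e) e s := by
    simpa using ((hasDerivAt_id s).smul_const e).const_add x
  exact (U.hx (x + s • e) t).comp_hasDerivAt s h

lemma line2 (U : Reg n) (x e f : Eucl n) (t s : ℝ) :
    HasDerivAt (fun s : ℝ => ⟪U.g (x + s • e, t), f⟫) (bq (U.H (x + s • e, t)) f e) s := by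
  have h : HasDerivAt (fun s : ℝ => x + s • e) e s := by
    simpa using ((hasDerivAt_id s).smul_const e).const_add x
  have h2 := ((U.hg (x + s • e) t).comp_hasDerivAt s h).inner ℝ (hasDerivAt_const s f)
  refine h2.congr_deriv ?_
  simp only [inner_zero_right, zero_add, PiLp.inner_apply, mL_apply, bq, RCLike.inner_apply, conj_trivial, Finset.mul_sum]
  exact Finset.sum_congr rfl fun i _ => Finset.sum_congr rfl fun j _ => by ring

lemma max_pt {d : ℕ} (U : Reg (d + 1)) (x : Eucl (d + 1)) (t : ℝ) (hx : 0 ≤ lastC x)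
    (hm : ∀ᶠ p in 𝓝 (x, t), 0 ≤ lastC p.1 → p.2 ≤ t → U.u p ≤ U.u (x, t)) :
    0 ≤ U.ut (x, t) ∧ (0 < lastC x → ∀ Q : Matrix (Fin (d + 1)) (Fin (d + 1)) ℝ, Q.PosSemidef → U.L Q (x, t) ≤ 0) ∧
    (∀ v : Eucl (d + 1), 0 ≤ lastC v → ⟪v, U.g (x, t)⟫ ≤ 0) := by
  have lin : ∀ e : Eucl (d + 1), Tendsto (fun s : ℝ => (x + s • e, t)) (𝓝 0) (𝓝 (x, t)) := fun e => by
    have : Continuous fun s : ℝ => (x + s • e, t) := by fun_prop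
    simpa using this.tendsto 0
  refine ⟨?_, ?_, ?_⟩
  · refine deriv_left_max (U.htime x t).hasDerivWithinAt ?_
    have : Tendsto (fun s : ℝ => (x, s)) (𝓝[≤] t) (𝓝 (x, t)) :=
      ((Continuous.prodMk_right x).tendsto t).mono_left nhdsWithin_le_nhds
    filter_upwards [this.eventually hm, self_mem_nhdsWithin] with s h1 h2 using h1 hx h2
  · intro hx0 Q hQ
    refine trace_nonpos hQ fun e => ?_
    have h1 := U.line2 x e e t 0
    simp only [zero_smul, add_zero] at h1
    refine sdt (U.line1 x e t) h1 ?_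
    have : ∀ᶠ p : SpaceTime (d + 1) in 𝓝 (x, t), 0 < lastC p.1 := by
      have hc : Continuous fun p : SpaceTime (d + 1) => lastC p.1 :=
        (EuclideanSpace.proj (Fin.last d) : Eucl (d + 1) →L[ℝ] ℝ).continuous.comp continuous_fst
      exact hc.continuousAt.eventually (lt_mem_nhds hx0)
    filter_upwards [(lin e).eventually hm, (lin e).eventually this] with s h2 h3
    simp only [zero_smul, add_zero]
    exact h2 h3.le le_rfl
  · intro v hv
    have h1 := U.line1 x v t 0
    simp only [zero_smul, add_zero] at h1
    rw [real_inner_comm]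
    refine deriv_right_max h1.hasDerivWithinAt ?_
    filter_upwards [((lin v).mono_left nhdsWithin_le_nhds).eventually hm, self_mem_nhdsWithin] with s h2 h3
    simp only [zero_smul, add_zero]
    refine h2 ?_ le_rfl
    simp only [lastC, PiLp.add_apply, PiLp.smul_apply, smul_eq_mul] at *
    exact add_nonneg hx (mul_nonneg h3 hv)

end Reg
end OB
end


noncomputable section
namespace OB
open Filter Topology Complex

def th {d : ℕ} (k : Fin d → ℤ) : Eucl (d + 1) →L[ℝ] ℝ := ∑ j, (k j : ℝ) • (EuclideanSpace.proj j.castSucc : Eucl (d + 1) →L[ℝ] ℝ)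
def lastL (d : ℕ) : Eucl (d + 1) →L[ℝ] ℝ := EuclideanSpace.proj (Fin.last d)
lemma th_apply {d : ℕ} (k : Fin d → ℤ) (x : Eucl (d + 1)) : th k x = ∑ j, (k j : ℝ) * x j.castSucc := by
  simp [th, _root_.sum_apply]
lemma lastL_apply {d : ℕ} (x : Eucl (d + 1)) : lastL d x = lastC x := rfl

def ee {d : ℕ} (k : Fin d → ℤ) (x : Eucl (d + 1)) : ℂ := cexp (I * (th k x : ℝ))

lemma norm_ee {d : ℕ} (k : Fin d → ℤ) (x : Eucl (d + 1)) : ‖ee k x‖ = 1 := by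
  rw [ee, mul_comm, norm_exp_ofReal_mul_I]

/-- gradient of `Re (f(xₙ) e^{ik·x'})` -/
def gr {d : ℕ} (k : Fin d → ℤ) (f f' : ℝ → ℂ) (x : Eucl (d + 1)) : Eucl (d + 1) :=
  WithLp.toLp 2 (Fin.snoc (α := fun _ => ℝ) (fun i : Fin d => (I * k i * f (lastC x) * ee k x).re) ((f' (lastC x) * ee k x).re))

lemma gr_last {d : ℕ} (k : Fin d → ℤ) (f f' : ℝ → ℂ) (x : Eucl (d + 1)) : gr k f f' x (Fin.last d) = (f' (lastC x) * ee k x).re := by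
  simp [gr]
lemma gr_cast {d : ℕ} (k : Fin d → ℤ) (f f' : ℝ → ℂ) (x : Eucl (d + 1)) (i : Fin d) :
    gr k f f' x i.castSucc = (I * k i * f (lastC x) * ee k x).re := by
  simp [gr]

lemma hasF_gr {d : ℕ} (k : Fin d → ℤ) {f f' : ℝ → ℂ} (hf : ∀ y, HasDerivAt f (f' y) y) (x : Eucl (d + 1)) :
    HasFDerivAt (fun x => (f (lastC x) * ee k x).re) (innerSL ℝ (gr k f f' x)) x := by
  have h1 : HasFDerivAt (fun x => f (lastC x)) ((lastL d).smulRight (f' (lastC x))) x := by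
    have := (hf (lastC x)).hasFDerivAt.comp x (lastL d).hasFDerivAt
    refine this.congr_fderiv ?_
    ext y; simp
  have h2 : HasFDerivAt (ee k) ((th k).smulRight (I * ee k x)) x := by
    have h3 : HasDerivAt (fun s : ℝ => cexp (I * s)) (I * cexp (I * (th k x : ℝ))) (th k x) := by
      have := ((Complex.ofRealCLM.hasDerivAt (x := th k x)).const_mul I).cexp
      simpa [mul_comm] using this
    have := h3.hasFDerivAt.comp x (th k).hasFDerivAt
    refine this.congr_fderiv ?_
    ext y; simp [ee]
  have h4 := Complex.reCLM.hasFDerivAt.comp x (h1.mul h2)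
  refine h4.congr_fderiv ?_
  refine ContinuousLinearMap.ext fun q => ?_
  have e : innerSL ℝ (gr k f f' x) q = ∑ i, gr k f f' x i * q i := by
    simp [PiLp.inner_apply, mul_comm]
  rw [e, Fin.sum_univ_castSucc, gr_last]
  simp only [gr_cast]
  have e2 : ∑ i : Fin d, (I * k i * f (lastC x) * ee k x).re * q i.castSucc = (I * f (lastC x) * ee k x).re * th k q := by
    rw [th_apply, Finset.mul_sum]
    refine Finset.sum_congr rfl fun i _ => ?_
    have : (I * k i * f (lastC x) * ee k x).re = k i * (I * f (lastC x) * ee k x).re := by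
      rw [← re_ofReal_mul]; congr 1; push_cast; ring
    rw [this]; ring
  rw [e2]
  simp only [ContinuousLinearMap.comp_apply, _root_.add_apply, _root_.smul_apply, ContinuousLinearMap.smulRight_apply, reCLM_apply, add_re, smul_eq_mul, lastL_apply]
  rw [show (f (lastC x) * (th k q • (I * ee k x))).re = (I * f (lastC x) * ee k x).re * th k q by
    rw [real_smul, mul_comm _ (th k q), ← re_ofReal_mul]; congr 1; ring]
  rw [show (ee k x * (lastC q • f' (lastC x))).re = (f' (lastC x) * ee k x).re * q (Fin.last d) by
    rw [real_smul, mul_comm _ (q _), ← re_ofReal_mul]; congr 1; unfold lastC; ring]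

lemma cont_last {d : ℕ} : Continuous (lastC : Eucl (d + 1) → ℝ) := (lastL d).continuous
lemma cont_ee {d : ℕ} (k : Fin d → ℤ) : Continuous (ee k) := by
  unfold ee; have := (th k).continuous; fun_prop

lemma cont_gr {d : ℕ} (k : Fin d → ℤ) {f f' : ℝ → ℂ} (hf : Continuous f) (hf' : Continuous f') (i : Fin (d + 1)) :
    Continuous fun x => gr k f f' x i := by
  have h1 := cont_last (d := d)
  have h2 := cont_ee k
  refine Fin.lastCases ?_ (fun i => ?_) i
  · simp only [gr_last]; fun_prop
  · simp only [gr_cast]; fun_prop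

def fi {d : ℕ} (k : Fin d → ℤ) (f f' : ℝ → ℂ) (i : Fin (d + 1)) : ℝ → ℂ :=
  Fin.snoc (α := fun _ => ℝ → ℂ) (fun i : Fin d => fun y => I * k i * f y) f' i

def spaceReg {d : ℕ} (k : Fin d → ℤ) (φ : CJ) : Reg (d + 1) where
  u p := (φ.f (lastC p.1) * ee k p.1).re
  ut _ := 0
  g p := gr k φ.f φ.f1 p.1
  H p := Matrix.of fun i j => gr k (fi k φ.f φ.f1 i) (fi k φ.f1 φ.f2 i) p.1 j
  hu p := ((hasF_gr k φ.h0 p.1).comp p hasFDerivAt_fst).congr_fderiv (by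
    refine ContinuousLinearMap.ext fun q => ?_
    simp [dL])
  hg x t := by
    rw [← hasFDerivWithinAt_univ, hasFDerivWithinAt_euclidean]
    intro i
    rw [hasFDerivWithinAt_univ]
    have key : ∀ y, HasDerivAt (fi k φ.f φ.f1 i) (fi k φ.f1 φ.f2 i y) y := by
      intro y
      refine Fin.lastCases ?_ (fun i => ?_) i
      · simpa [fi] using φ.h1 y
      · simpa [fi] using (φ.h0 y).const_mul (I * k i)
    have := hasF_gr k key x
    have e : (fun x => gr k φ.f φ.f1 x i) = fun x => (fi k φ.f φ.f1 i (lastC x) * ee k x).re := by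
      funext x
      refine Fin.lastCases ?_ (fun i => ?_) i
      · simp only [gr_last]; simp [fi]
      · simp only [gr_cast]; simp [fi]
    simp only
    rw [e]
    refine this.congr_fderiv ?_
    refine ContinuousLinearMap.ext fun q => ?_
    simp [mL_apply, PiLp.inner_apply, mul_comm]
  cut := continuous_const
  cg := by
    have h : ∀ i, Continuous fun p : SpaceTime (d + 1) => gr k φ.f φ.f1 p.1 i := fun i => (cont_gr k φ.c0 φ.c1 i).comp continuous_fst
    exact (PiLp.continuous_toLp 2 _).comp (continuous_pi h)
  cH := by
    refine continuous_matrix fun i j => (cont_gr k ?_ ?_ j).comp continuous_fst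
    · refine Fin.lastCases ?_ (fun i => ?_) i
      · simpa [fi] using φ.c1
      · have := φ.c0; simp only [fi, Fin.snoc_castSucc]; fun_prop
    · refine Fin.lastCases ?_ (fun i => ?_) i
      · simpa [fi] using φ.c2
      · have := φ.c1; simp only [fi, Fin.snoc_castSucc]; fun_prop
  sym p i j := by
    simp only [Matrix.of_apply]
    refine Fin.lastCases ?_ (fun i => ?_) i <;> refine Fin.lastCases ?_ (fun j => ?_) j <;> simp only [gr_last, gr_cast, fi, Fin.snoc_last, Fin.snoc_castSucc]
    ring_nf

def mq {d : ℕ} (Q : Matrix (Fin (d + 1)) (Fin (d + 1)) ℝ) (k : Fin d → ℤ) : ℝ := ∑ i, Q i.castSucc (Fin.last d) * k i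
def mr {d : ℕ} (Q : Matrix (Fin (d + 1)) (Fin (d + 1)) ℝ) (k : Fin d → ℤ) : ℝ := ∑ i : Fin d, ∑ j : Fin d, Q i.castSucc j.castSucc * (k i * k j)
def mt {d : ℕ} (v : Eucl (d + 1)) (k : Fin d → ℤ) : ℝ := ∑ i, v i.castSucc * k i

lemma spaceReg_L {d : ℕ} (k : Fin d → ℤ) (φ : CJ) {Q : Matrix (Fin (d + 1)) (Fin (d + 1)) ℝ} (hQ : Q.IsSymm) (p : SpaceTime (d + 1)) :
    (spaceReg k φ).L Q p = (CJ.A (Q (Fin.last d) (Fin.last d)) (mq Q k) (mr Q k) φ (lastC p.1) * ee k p.1).re := by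
  unfold Reg.L
  set y := lastC p.1
  set e := ee k p.1
  have h1 : ∀ i j : Fin d, Q i.castSucc j.castSucc * (spaceReg k φ).H p i.castSucc j.castSucc =
      ((Q i.castSucc j.castSucc * (k i * k j) : ℝ) : ℂ).re * (-(φ.f y * e)).re := fun i j => by
    simp only [spaceReg, Matrix.of_apply, gr_cast, fi, Fin.snoc_castSucc, ofReal_re]
    rw [show I * k j * (I * k i * φ.f y) * e = ((k i * k j : ℝ) : ℂ) * (-(φ.f y * e)) by push_cast; linear_combination (k j * k i * φ.f y * e) * I_mul_I, re_ofReal_mul]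
    ring
  have h2 : ∀ i : Fin d, Q i.castSucc (Fin.last d) * (spaceReg k φ).H p i.castSucc (Fin.last d) =
      Q i.castSucc (Fin.last d) * k i * (I * φ.f1 y * e).re := fun i => by
    simp only [spaceReg, Matrix.of_apply, gr_last, fi, Fin.snoc_castSucc]
    rw [show I * k i * φ.f1 y * e = ((k i : ℝ) : ℂ) * (I * φ.f1 y * e) by push_cast; ring, re_ofReal_mul]
    ring
  have h3 : ∀ i : Fin d, Q (Fin.last d) i.castSucc * (spaceReg k φ).H p (Fin.last d) i.castSucc =
      Q i.castSucc (Fin.last d) * k i * (I * φ.f1 y * e).re := fun i => by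
    rw [(spaceReg k φ).sym, hQ.apply, h2]
  have h4 : (spaceReg k φ).H p (Fin.last d) (Fin.last d) = (φ.f2 y * e).re := by
    simp only [spaceReg, Matrix.of_apply, gr_last, fi, Fin.snoc_last]; rfl
  simp only [Fin.sum_univ_castSucc, h1, h2, h3, h4, Finset.sum_add_distrib, ← Finset.sum_mul, ofReal_re]
  rw [CJ.A]
  change mr Q k * _ + mq Q k * _ + (mq Q k * _ + _) = _
  rw [show ((Q (Fin.last d) (Fin.last d)) * φ.f2 y + 2 * I * (mq Q k) * φ.f1 y - (mr Q k) * φ.f y) * e =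
    ((Q (Fin.last d) (Fin.last d) : ℝ) : ℂ) * (φ.f2 y * e) + ((2 * mq Q k : ℝ) : ℂ) * (I * φ.f1 y * e) + ((mr Q k : ℝ) : ℂ) * (-(φ.f y * e)) by push_cast; ring]
  simp only [add_re, re_ofReal_mul]
  ring

lemma spaceReg_v {d : ℕ} (k : Fin d → ℤ) (φ : CJ) (v : Eucl (d + 1)) (p : SpaceTime (d + 1)) (hp : lastC p.1 = 0) :
    ⟪v, (spaceReg k φ).g p⟫ = (CJ.B (v (Fin.last d)) (mt v k) φ * ee k p.1).re := by
  set e := ee k p.1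
  rw [PiLp.inner_apply]
  simp only [RCLike.inner_apply, conj_trivial, Fin.sum_univ_castSucc, spaceReg, gr_last, gr_cast, hp]
  have h1 : ∀ i : Fin d, (I * k i * φ.f 0 * e).re * v i.castSucc = v i.castSucc * k i * (I * φ.f 0 * e).re := fun i => by
    rw [show I * k i * φ.f 0 * e = ((k i : ℝ) : ℂ) * (I * φ.f 0 * e) by push_cast; ring, re_ofReal_mul]
    ring
  simp only [e] at h1
  simp only [h1, ← Finset.sum_mul]
  rw [CJ.B]
  change mt v k * _ + _ = _
  rw [show ((v (Fin.last d)) * φ.f1 0 + I * (mt v k) * φ.f 0) * e =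
    ((v (Fin.last d) : ℝ) : ℂ) * (φ.f1 0 * e) + ((mt v k : ℝ) : ℂ) * (I * φ.f 0 * e) by push_cast; ring]
  simp only [add_re, re_ofReal_mul]
  ring


/-- torus characters -/
def ez {d : ℕ} (k : Fin d → ℤ) (z : Fin d → Circle) : ℂ := ((∏ j, z j ^ k j : Circle) : ℂ)
def zz {d : ℕ} (x : Eucl (d + 1)) : Fin d → Circle := fun j => Circle.exp (x j.castSucc)

lemma norm_ez {d : ℕ} (k : Fin d → ℤ) (z : Fin d → Circle) : ‖ez k z‖ = 1 := Circle.norm_coe _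
lemma ez_mul {d : ℕ} (k : Fin d → ℤ) (z w : Fin d → Circle) : ez k (z * w) = ez k z * ez k w := by
  simp [ez, mul_zpow, Finset.prod_mul_distrib]
lemma ez_zz {d : ℕ} (k : Fin d → ℤ) (x : Eucl (d + 1)) : ez k (zz x) = ee k x := by
  simp only [ez, zz, ← Circle.exp_zsmul]
  rw [ee, th_apply, mul_comm]
  have : ∀ (s : Finset (Fin d)) (f : Fin d → ℝ), ∏ j ∈ s, Circle.exp (f j) = Circle.exp (∑ j ∈ s, f j) := fun s f => by
    induction s using Finset.cons_induction with
    | empty => simp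
    | cons a s ha ih => rw [Finset.prod_cons, Finset.sum_cons, ih, Circle.exp_add]
  rw [this, Circle.coe_exp]
  simp
lemma cont_ez {d : ℕ} (k : Fin d → ℤ) : Continuous (ez k) := by
  unfold ez
  have h : Continuous fun z : Fin d → Circle => ∏ j, z j ^ k j :=
    continuous_finsetProd _ fun j _ => (continuous_apply j).zpow _
  have h2 : Continuous fun w : Circle => (w : ℂ) := continuous_subtype_val
  exact h2.comp h

structure Trm (d : ℕ) where
  k : Fin d → ℤ
  a : ℝ → ℝ
  a1 : ℝ → ℝ
  ha : ∀ t, HasDerivAt a (a1 t) t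
  ca : Continuous a1
  φ : CJ

namespace Trm
variable {d : ℕ}
def mul (m : ℂ) (τ : Trm d) : Trm d := { τ with φ := CJ.lin m 0 τ.φ τ.φ }
def c0 (y t : ℝ) (τ : Trm d) : ℂ := τ.a t * τ.φ.f y
def c1 (lam : ℝ) (Q : Matrix (Fin (d + 1)) (Fin (d + 1)) ℝ) (y t : ℝ) (τ : Trm d) : ℂ :=
  lam * τ.a1 t * τ.φ.f y - τ.a t * CJ.A (Q (Fin.last d) (Fin.last d)) (mq Q τ.k) (mr Q τ.k) τ.φ y
def c2 (v : Eucl (d + 1)) (t : ℝ) (τ : Trm d) : ℂ :=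
  τ.a1 t * τ.φ.f 0 - τ.a t * CJ.B (v (Fin.last d)) (mt v τ.k) τ.φ

lemma c0_mul (m : ℂ) (y t : ℝ) (τ : Trm d) : c0 y t (τ.mul m) = m * c0 y t τ := by
  simp [c0, mul, CJ.lin]; ring
lemma c1_mul (m : ℂ) (lam Q y t) (τ : Trm d) : c1 lam Q y t (τ.mul m) = m * c1 lam Q y t τ := by
  simp [c1, mul, CJ.lin, CJ.A]; ring
lemma c2_mul (m : ℂ) (v t) (τ : Trm d) : c2 v t (τ.mul m) = m * c2 v t τ := by
  simp [c2, mul, CJ.lin, CJ.B]; ring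

def reg (τ : Trm d) : Reg (d + 1) := (Reg.ofTime (d + 1) τ.a τ.a1 τ.ha τ.ca).mul (spaceReg τ.k τ.φ)

lemma reg_u (τ : Trm d) (p) : τ.reg.u p = (c0 (lastC p.1) p.2 τ * ee τ.k p.1).re := by
  simp only [reg, Reg.mul, Reg.ofTime, spaceReg, c0]; rw [mul_assoc, re_ofReal_mul]
lemma reg_g (τ : Trm d) (p) (i : Fin d) : τ.reg.g p i.castSucc = (c0 (lastC p.1) p.2 (τ.mul (I * τ.k i)) * ee τ.k p.1).re := by
  rw [c0_mul]
  simp only [reg, Reg.mul, Reg.ofTime, spaceReg, c0, PiLp.add_apply, PiLp.smul_apply, gr_cast, PiLp.zero_apply, smul_eq_mul, mul_zero, add_zero]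
  rw [← re_ofReal_mul]; congr 1; ring
lemma reg_1 (τ : Trm d) {Q} (hQ : Matrix.IsSymm Q) (lam p) : lam * τ.reg.ut p - τ.reg.L Q p = (c1 lam Q (lastC p.1) p.2 τ * ee τ.k p.1).re := by
  rw [reg, Reg.L_mul _ _ hQ, spaceReg_L _ _ hQ, Reg.L_ofTime]
  simp only [Reg.mul, Reg.ofTime, spaceReg, c1, sub_mul, sub_re, mul_assoc, re_ofReal_mul, bq, PiLp.zero_apply, zero_mul, mul_zero, Finset.sum_const_zero]
  ring
lemma reg_2 (τ : Trm d) (v) (p) (hp : lastC p.1 = 0) : τ.reg.ut p - ⟪v, τ.reg.g p⟫ = (c2 v p.2 τ * ee τ.k p.1).re := by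
  have := spaceReg_v τ.k τ.φ v p hp
  simp only [reg, Reg.mul, Reg.ofTime, smul_zero, add_zero, inner_smul_right, this, sub_mul, sub_re, mul_assoc, re_ofReal_mul, c2]
  simp [spaceReg, hp]; ring
end Trm

abbrev Pack (d : ℕ) := List (Trm d)

/-- evaluation -/
def sm {d : ℕ} (c : Trm d → ℂ) (P : Pack d) (z : Fin d → Circle) : ℂ := (P.map fun τ => c τ * ez τ.k z).sum

namespace Pack
variable {d : ℕ}
def mult (m : (Fin d → ℤ) → ℂ) (P : Pack d) : Pack d := P.map fun τ => τ.mul (m τ.k)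
def reg : Pack d → Reg (d + 1)
  | [] => Reg.ofTime (d + 1) (fun _ => 0) (fun _ => 0) (fun t => hasDerivAt_const t 0) continuous_const
  | τ :: l => τ.reg.add (reg l)

lemma reg_u (P : Pack d) (p) : (reg P).u p = (sm (Trm.c0 (lastC p.1) p.2) P (zz p.1)).re := by
  induction P with
  | nil => simp [reg, sm, Reg.ofTime]
  | cons τ l ih =>
    have e : (reg (τ :: l)).u p = τ.reg.u p + (reg l).u p := rfl
    rw [e, ih, Trm.reg_u, sm, sm, List.map_cons, List.sum_cons, add_re, ez_zz]
lemma reg_1 (P : Pack d) {Q} (hQ : Matrix.IsSymm Q) (lam p) : lam * (reg P).ut p - (reg P).L Q p = (sm (Trm.c1 lam Q (lastC p.1) p.2) P (zz p.1)).re := by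
  induction P with
  | nil => simp [reg, sm, Reg.ofTime, Reg.L]
  | cons τ l ih =>
    have e : (reg (τ :: l)).ut p = τ.reg.ut p + (reg l).ut p := rfl
    rw [e, show reg (τ :: l) = τ.reg.add (reg l) from rfl, Reg.L_add, sm, List.map_cons, List.sum_cons, add_re, ez_zz, ← Trm.reg_1 _ hQ]
    rw [sm] at ih; rw [← ih]; ring
lemma reg_2 (P : Pack d) (v) (p) (hp : lastC p.1 = 0) : (reg P).ut p - ⟪v, (reg P).g p⟫ = (sm (Trm.c2 v p.2) P (zz p.1)).re := by
  induction P with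
  | nil => simp [reg, sm, Reg.ofTime]
  | cons τ l ih =>
    have e : (reg (τ :: l)).ut p = τ.reg.ut p + (reg l).ut p := rfl
    have e2 : (reg (τ :: l)).g p = τ.reg.g p + (reg l).g p := rfl
    rw [e, e2, inner_add_right, sm, List.map_cons, List.sum_cons, add_re, ez_zz, ← Trm.reg_2 _ _ _ hp]
    rw [sm] at ih; rw [← ih]; ring

lemma sm_append (c : Trm d → ℂ) (P R : Pack d) (z) : sm c (P ++ R) z = sm c P z + sm c R z := by simp [sm]
lemma sm_mult {c : Trm d → ℂ} (hc : ∀ m τ, c (Trm.mul m τ) = m * c τ) (m) (P : Pack d) (z) :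
    sm c (mult m P) z = (P.map fun τ => m τ.k * (c τ * ez τ.k z)).sum := by
  simp only [sm, mult, List.map_map, Function.comp_def, hc, mul_assoc]; rfl

lemma reg_g (P : Pack d) (p) (i : Fin d) : (reg P).g p i.castSucc = (reg (mult (fun k => I * k i) P)).u p := by
  induction P with
  | nil => simp [reg, mult, Reg.ofTime]
  | cons τ l ih =>
    have e2 : (reg (τ :: l)).g p = τ.reg.g p + (reg l).g p := rfl
    have e : (reg (mult (fun k => I * k i) (τ :: l))).u p = (τ.mul (I * τ.k i)).reg.u p + (reg (mult (fun k => I * k i) l)).u p := rfl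
    rw [e, e2, PiLp.add_apply, ih, Trm.reg_g, Trm.reg_u]; rfl
end Pack
end OB
end


noncomputable section
namespace OB
open Filter Topology Complex

abbrev XX (d : ℕ) := (Fin d → Circle) × Icc (0:ℝ) 1 × Icc (-1:ℝ) 0

def mono {d : ℕ} (k : Fin d → ℤ) (a b : ℕ) : C(XX d, ℂ) :=
  ⟨fun p => ez k p.1 * ((p.2.1 : ℝ) : ℂ) ^ a * ((p.2.2 : ℝ) : ℂ) ^ b, by
    have := cont_ez k; fun_prop⟩

lemma ez_add {d : ℕ} (k l : Fin d → ℤ) (z : Fin d → Circle) : ez (k + l) z = ez k z * ez l z := by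
  simp [ez, zpow_add, Finset.prod_mul_distrib]
lemma ez_neg {d : ℕ} (k : Fin d → ℤ) (z : Fin d → Circle) : ez (-k) z = (starRingEnd ℂ) (ez k z) := by
  rw [ez, ez, ← Circle.coe_inv_eq_conj]; simp [zpow_neg]

lemma dense_mono {d : ℕ} (S : Submodule ℂ C(XX d, ℂ)) (hS : IsClosed (S : Set C(XX d, ℂ))) (hm : ∀ k a b, mono k a b ∈ S) (F) : F ∈ S := by
  let M : Submonoid C(XX d, ℂ) :=
    { carrier := {f | ∃ k a b, f = mono k a b}
      mul_mem' := by
        rintro _ _ ⟨k, a, b, rfl⟩ ⟨l, a', b', rfl⟩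
        refine ⟨k + l, a + a', b + b', ?_⟩
        ext p; simp only [mono, ContinuousMap.mul_apply, ContinuousMap.coe_mk, ez_add]; ring
      one_mem' := ⟨0, 0, 0, by ext p; simp [mono, ez]⟩ }
  have hstar : star (M : Set C(XX d, ℂ)) ⊆ M := by
    rintro f ⟨k, a, b, hf⟩
    refine ⟨-k, a, b, ?_⟩
    rw [← star_star f, hf]
    ext p
    simp [mono, ez_neg]
  have hA : ((StarAlgebra.adjoin ℂ (M : Set C(XX d, ℂ))) : Set C(XX d, ℂ)) ⊆ S := by
    intro f hf
    have h1 : f ∈ Algebra.adjoin ℂ ((M : Set C(XX d, ℂ)) ∪ star (M : Set C(XX d, ℂ))) := by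
      rw [← StarAlgebra.adjoin_toSubalgebra]; exact hf
    rw [Set.union_eq_self_of_subset_right hstar] at h1
    have h2 : f ∈ Submodule.span ℂ (M : Set C(XX d, ℂ)) := by
      have := Algebra.adjoin_eq_span ℂ (M : Set C(XX d, ℂ))
      rw [Submonoid.closure_eq] at this
      rw [← this]; exact h1
    refine (Submodule.span_le.2 ?_) h2
    rintro _ ⟨k, a, b, rfl⟩; exact hm k a b
  have hsep : (StarAlgebra.adjoin ℂ (M : Set C(XX d, ℂ))).SeparatesPoints := by
    have mem : ∀ k a b, mono k a b ∈ StarAlgebra.adjoin ℂ (M : Set C(XX d, ℂ)) := fun k a b =>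
      StarAlgebra.subset_adjoin ℂ _ ⟨k, a, b, rfl⟩
    rintro ⟨z, y, t⟩ ⟨z', y', t'⟩ hne
    by_cases hz : z = z'
    · by_cases hy : y = y'
      · have ht : t ≠ t' := by rintro rfl; exact hne (by rw [hz, hy])
        refine ⟨_, ⟨mono 0 0 1, mem _ _ _, rfl⟩, ?_⟩
        simpa [mono, ez, Subtype.ext_iff] using ht
      · refine ⟨_, ⟨mono 0 1 0, mem _ _ _, rfl⟩, ?_⟩
        simpa [mono, ez, Subtype.ext_iff] using hy
    · obtain ⟨j, hj⟩ := Function.ne_iff.1 hz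
      refine ⟨_, ⟨mono (Pi.single j 1) 0 0, mem _ _ _, rfl⟩, ?_⟩
      have e : ∀ z : Fin d → Circle, ez (Pi.single j 1) z = z j := fun z => by
        unfold ez
        rw [Finset.prod_eq_single j]
        · simp
        · intro b _ hb; simp [Pi.single_eq_of_ne hb]
        · simp
      simpa [mono, e] using fun h => hj (Circle.ext h)
  have htop := ContinuousMap.starSubalgebra_topologicalClosure_eq_top_of_separatesPoints _ hsep
  have : F ∈ (StarAlgebra.adjoin ℂ (M : Set C(XX d, ℂ))).topologicalClosure := by rw [htop]; trivial
  exact hS.closure_subset_iff.2 hA this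

/-- coefficient data on all of `ℝ` -/
structure Co (d : ℕ) where
  lam : ℝ
  Q : ℝ → Matrix (Fin (d + 1)) (Fin (d + 1)) ℝ
  v : ℝ → Eucl (d + 1)
  c : ℝ
  K : ℝ
  L : ℝ
  hlam : 0 < lam
  hlam1 : lam ≤ 1
  hc : 0 < c
  hK : 0 ≤ K
  hL : 0 ≤ L
  sym : ∀ t, (Q t).IsSymm
  psd : ∀ t, (Q t).PosSemidef
  Qn : ∀ t, c ≤ Q t (Fin.last d) (Fin.last d)
  vn : ∀ t, c ≤ v t (Fin.last d)
  Qb : ∀ t i j, |Q t i j| ≤ K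
  vb : ∀ t i, |v t i| ≤ K
  Ql : ∀ s t i j, |Q s i j - Q t i j| ≤ L * |s - t|
  vl : ∀ s t i, |v s i - v t i| ≤ L * |s - t|

namespace Co
variable {d : ℕ} (W : Co d)
def pm (k : Fin d → ℤ) (t : ℝ) : Fin 5 → ℝ := ![W.Q t (Fin.last d) (Fin.last d), mq (W.Q t) k, mr (W.Q t) k, W.v t (Fin.last d), mt (W.v t) k]

lemma sum_bd {ι : Type*} [Fintype ι] (f κ : ι → ℝ) (K : ℝ) (hf : ∀ i, |f i| ≤ K) : |∑ i, f i * κ i| ≤ K * ∑ i, |κ i| := by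
  refine (Finset.abs_sum_le_sum_abs _ _).trans ?_
  rw [Finset.mul_sum]
  refine Finset.sum_le_sum fun i _ => ?_
  rw [abs_mul]; exact mul_le_mul_of_nonneg_right (hf i) (abs_nonneg _)

def kb (k : Fin d → ℤ) : ℝ := 1 + ∑ i, |(k i : ℝ)| + ∑ i, ∑ j, |(k i : ℝ) * k j|
lemma kb_b (k : Fin d → ℤ) : 1 ≤ kb k ∧ ∑ i, |(k i : ℝ)| ≤ kb k ∧ ∑ i, ∑ j, |(k i : ℝ) * k j| ≤ kb k := by
  have h1 : 0 ≤ ∑ i, |(k i : ℝ)| := Finset.sum_nonneg fun i _ => abs_nonneg _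
  have h2 : 0 ≤ ∑ i, ∑ j, |(k i : ℝ) * k j| := Finset.sum_nonneg fun i _ => Finset.sum_nonneg fun j _ => abs_nonneg _
  unfold kb
  refine ⟨?_, ?_, ?_⟩ <;> linarith

lemma par_bd (k : Fin d → ℤ) (Q : Matrix (Fin (d + 1)) (Fin (d + 1)) ℝ) (v : Eucl (d + 1)) (K : ℝ) (hK : 0 ≤ K) (hQ : ∀ i j, |Q i j| ≤ K) (hv : ∀ i, |v i| ≤ K)
    (i : Fin 5) : |(![Q (Fin.last d) (Fin.last d), mq Q k, mr Q k, v (Fin.last d), mt v k] : Fin 5 → ℝ) i| ≤ K * kb k := by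
  obtain ⟨h1, h2, h3⟩ := kb_b k
  fin_cases i
  · exact (hQ _ _).trans (le_mul_of_one_le_right hK h1)
  · change |∑ i, Q i.castSucc (Fin.last d) * (k i:ℝ)| ≤ _
    exact (sum_bd _ (fun i => (k i:ℝ)) K fun i => hQ _ _).trans (by gcongr)
  · change |∑ i : Fin d, ∑ j : Fin d, Q i.castSucc j.castSucc * ((k i:ℝ) * k j)| ≤ _
    refine le_trans ?_ (mul_le_mul_of_nonneg_left h3 hK)
    refine (Finset.abs_sum_le_sum_abs _ _).trans ?_
    rw [Finset.mul_sum]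
    exact Finset.sum_le_sum fun i _ => sum_bd _ (fun j => (k i:ℝ) * k j) K fun j => hQ _ _
  · exact (hv _).trans (le_mul_of_one_le_right hK h1)
  · change |∑ i : Fin d, v i.castSucc * (k i:ℝ)| ≤ _
    exact (sum_bd _ (fun i => (k i:ℝ)) K fun i => hv _).trans (by gcongr)

lemma pm_SS (k : Fin d → ℤ) (t : ℝ) : W.pm k t ∈ CJ.SS W.c (W.K * kb k) := by
  refine ⟨W.Qn t, W.vn t, par_bd k _ _ _ W.hK (W.Qb t) (W.vb t), fun ξ => ?_⟩
  have := bq_nonneg (W.psd t) (WithLp.toLp 2 (Fin.snoc (α := fun _ => ℝ) (fun i : Fin d => (k i : ℝ)) ξ))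
  refine this.trans (le_of_eq ?_)
  simp only [bq, Fin.sum_univ_castSucc, Fin.snoc_castSucc, Fin.snoc_last, Finset.sum_add_distrib]
  have hs : ∀ i : Fin d, W.Q t (Fin.last d) i.castSucc = W.Q t i.castSucc (Fin.last d) := fun i => (W.sym t).apply _ _
  simp only [hs]
  change mr (W.Q t) k + _ + _ = W.Q t (Fin.last d) (Fin.last d) * ξ ^ 2 + 2 * mq (W.Q t) k * ξ + mr (W.Q t) k
  rw [mq, show (2 * ∑ i, W.Q t (Fin.castSucc i) (Fin.last d) * (k i : ℝ)) * ξ = ∑ i, W.Q t (Fin.castSucc i) (Fin.last d) * (k i * ξ) + ∑ i, W.Q t (Fin.castSucc i) (Fin.last d) * (ξ * k i) by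
    rw [← Finset.sum_add_distrib, mul_assoc, Finset.sum_mul, Finset.mul_sum]
    exact Finset.sum_congr rfl fun i _ => by ring]
  ring

lemma pm_lip (k : Fin d → ℤ) (s t : ℝ) : ‖W.pm k s - W.pm k t‖ ≤ W.L * kb k * |s - t| := by
  have hb := (kb_b k).1
  have hL := W.hL
  refine (pi_norm_le_iff_of_nonneg (by positivity)).2 fun i => ?_
  have := par_bd k (W.Q s - W.Q t) (W.v s - W.v t) (W.L * |s - t|) (by positivity) (fun i j => W.Ql s t i j) (fun i => W.vl s t i) i
  rw [show W.L * kb k * |s - t| = W.L * |s - t| * kb k by ring]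
  refine le_trans (le_of_eq ?_) this
  rw [Real.norm_eq_abs]
  congr 1
  rw [Pi.sub_apply, pm, pm]
  fin_cases i <;> simp [mq, mr, mt, sub_mul, Finset.sum_sub_distrib]
end Co

lemma pow_src (n : ℕ) : ∃ Kb : ℝ, 0 ≤ Kb ∧ (∀ s ∈ Icc (-1:ℝ) 0, ∀ t ∈ Icc (-1:ℝ) 0, |(s ^ n - (-1) ^ n) - (t ^ n - (-1) ^ n)| ≤ Kb * |s - t|) ∧
    (∀ t h : ℝ, 0 < h → -1 ≤ t → t + 2 * h ≤ 0 →
      |(((t + 2 * h) ^ n - (-1) ^ n) - ((t + h) ^ n - (-1) ^ n)) - (((t + h) ^ n - (-1) ^ n) - (t ^ n - (-1) ^ n))| ≤ Kb * h * h) := by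
  have lip : ∀ n : ℕ, ∀ s ∈ Icc (-1:ℝ) 0, ∀ t ∈ Icc (-1:ℝ) 0, |s ^ n - t ^ n| ≤ n * |s - t| := by
    intro n s hs t ht
    have := Convex.norm_image_sub_le_of_norm_hasDerivWithin_le (f := fun s : ℝ => s ^ n) (f' := fun s => n * s ^ (n - 1)) (s := Icc (-1:ℝ) 0) (C := n)
      (fun x _ => (hasDerivAt_pow n x).hasDerivWithinAt) (fun x hx => ?_) (convex_Icc _ _) ht hs
    · simpa using this
    · have : |x| ≤ 1 := abs_le.2 ⟨hx.1, hx.2.trans zero_le_one⟩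
      rw [norm_mul, norm_pow, Real.norm_natCast]
      exact mul_le_of_le_one_right (Nat.cast_nonneg n) (pow_le_one₀ (norm_nonneg _) this)
  refine ⟨n * n + n, by positivity, fun s hs t ht => ?_, fun t h hh ht ht' => ?_⟩
  · have := lip n s hs t ht
    rw [sub_sub_sub_cancel_right]
    refine this.trans (mul_le_mul_of_nonneg_right ?_ (abs_nonneg _))
    nlinarith [Nat.cast_nonneg (α := ℝ) n]
  · have := Convex.norm_image_sub_le_of_norm_hasDerivWithin_le (f := fun s : ℝ => (s + h) ^ n - s ^ n)
      (f' := fun s => n * (s + h) ^ (n - 1) * 1 - n * s ^ (n - 1)) (s := Icc (-1:ℝ) (-h)) (C := n * (n * h)) (x := t) (y := t + h)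
      (fun x _ => ((((hasDerivAt_id x).add_const h).pow n).sub (hasDerivAt_pow n x)).hasDerivWithinAt) (fun x hx => ?_) (convex_Icc _ _) ⟨ht, by linarith⟩ ⟨by linarith, by linarith⟩
    · simp only [Real.norm_eq_abs, add_sub_cancel_left, abs_of_pos hh] at this
      have e : t + h + h = t + 2 * h := by ring
      rw [e] at this
      rw [sub_sub_sub_cancel_right, sub_sub_sub_cancel_right]
      refine this.trans ?_
      have : 0 ≤ (n:ℝ) * h * h := by positivity
      nlinarith
    · have := lip (n - 1) (x + h) ⟨by linarith [hx.1], by linarith [hx.2]⟩ x ⟨hx.1, by linarith [hx.2]⟩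
      rw [mul_one, ← mul_sub, norm_mul, Real.norm_natCast, Real.norm_eq_abs]
      rw [add_sub_cancel_left, abs_of_pos hh] at this
      gcongr
      refine this.trans ?_
      gcongr
      exact Nat.sub_le n 1

end OB
end


noncomputable section
namespace OB
open Filter Topology Complex

def tm : Icc (-1:ℝ) 0 := ⟨-1, by norm_num⟩
def D0 {d : ℕ} (P : Pack d) : Prop := ∀ τ ∈ P, τ.a (-1) = 0 ∧ τ.a1 (-1) = 0 ∧ τ.φ.f 1 = 0
lemma D0_append {d : ℕ} {P R : Pack d} (h : D0 P) (h' : D0 R) : D0 (P ++ R) := fun τ hτ => (List.mem_append.1 hτ).elim (h τ) (h' τ)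
lemma D0_mult {d : ℕ} {P : Pack d} (h : D0 P) (m) : D0 (Pack.mult m P) := fun τ hτ => by
  obtain ⟨σ, hσ, rfl⟩ := List.mem_map.1 hτ
  obtain ⟨h1, h2, h3⟩ := h σ hσ
  exact ⟨h1, h2, by simp [Trm.mul, CJ.lin, h3]⟩
lemma sm_zero {d : ℕ} {c : Trm d → ℂ} {P : Pack d} (h : ∀ τ ∈ P, c τ = 0) (z) : sm c P z = 0 := by
  refine List.sum_eq_zero fun x hx => ?_
  obtain ⟨τ, hτ, rfl⟩ := List.mem_map.1 hx
  rw [h τ hτ, zero_mul]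
lemma sm_const {d : ℕ} {c : Trm d → ℂ} (hc : ∀ m τ, c (Trm.mul m τ) = m * c τ) (m : ℂ) (P : Pack d) (z) :
    sm c (Pack.mult (fun _ => m) P) z = m * sm c P z := by
  rw [Pack.sm_mult hc, List.sum_map_mul_left]; rfl
lemma sm_range {d : ℕ} (c : Trm d → ℂ) (k : Fin d → ℤ) (T : ℕ → Trm d) (hT : ∀ j, (T j).k = k) (N : ℕ) (z) :
    sm c ((List.range N).map T) z = (∑ j ∈ Finset.range N, c (T j)) * ez k z := by
  rw [Finset.sum_mul, Finset.sum_range, ← List.sum_ofFn, sm, List.map_map]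
  congr 1
  rw [List.ofFn_eq_map, ← List.map_coe_finRange_eq_range, List.map_map]
  simp [Function.comp_def, hT]

section
variable {d : ℕ} (W : Co d)

def Good (s1 s2 : ℂ) (ε : ℝ) (F : C(XX d, ℂ)) (P : Pack d) : Prop := D0 P ∧ ∀ (z : Fin d → Circle) (y : Icc (0:ℝ) 1) (t : Icc (-1:ℝ) 0),
  ‖sm (Trm.c1 W.lam (W.Q t) y t) P z - s1 * (F (z, y, t) - F (z, y, tm))‖ ≤ ε ∧
  ‖sm (Trm.c2 (W.v t) t) P z - s2 * (F (z, 0, t) - F (z, 0, tm))‖ ≤ ε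

lemma nm_ez (k : Fin d → ℤ) (z) {a b : ℂ} (h : a = b * ez k z) : ‖a‖ = ‖b‖ := by rw [h, norm_mul, norm_ez, mul_one]

lemma Good_mono (s1 s2 : ℂ) {ε : ℝ} (hε : 0 < ε) (k : Fin d → ℤ) (a b : ℕ) : ∃ P, Good W s1 s2 ε (mono k a b) P := by
  obtain ⟨Kb, hKb, hb1, hb2⟩ := pow_src b
  have hkb := (Co.kb_b k).1
  have hK := W.hK
  have hL := W.hL
  obtain ⟨N, a0, a1, dd, h1, h2, h3, h4, h5, h6⟩ := CJ.mode_solve W.hlam W.hc (show 0 ≤ W.K * Co.kb k by positivity) (show 0 ≤ W.L * Co.kb k by positivity) hKb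
    (W.pm k) (W.pm_SS k) (W.pm_lip k) (fun t => t ^ b - (-1) ^ b) (by simp) hb1 hb2
    ⟨fun y => s1 * ((y:ℝ):ℂ) ^ a, by fun_prop⟩ (s2 * (0:ℂ) ^ a) hε
  refine ⟨(List.range N).map fun j => ⟨k, a0 j, a1 j, h1 j, h2 j, dd j⟩, ?_, fun z y t => ?_⟩
  · intro τ hτ
    obtain ⟨j, -, rfl⟩ := List.mem_map.1 hτ
    exact ⟨h3 j, h4 j, h5 j⟩
  · rw [sm_range _ k _ (fun j => rfl), sm_range _ k _ (fun j => rfl)]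
    obtain ⟨e1, e2⟩ := h6 t t.2
    refine ⟨le_trans (le_of_eq ?_) (e1 y), le_trans (le_of_eq ?_) e2⟩
    · refine nm_ez k z ?_
      simp only [mono, tm, Trm.c1, ContinuousMap.coe_mk, Finset.mul_sum, ← Finset.sum_sub_distrib, Co.pm]
      simp only [Finset.sum_mul, sub_mul]
      push_cast
      congr 1
      · exact Finset.sum_congr rfl fun j _ => by simp [mul_assoc]
      · ring
    · refine nm_ez k z ?_
      simp only [mono, tm, Trm.c2, ContinuousMap.coe_mk, Finset.mul_sum, ← Finset.sum_sub_distrib, Co.pm]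
      simp only [Finset.sum_mul, sub_mul]
      push_cast
      congr 1
      · ring

lemma Good_all (s1 s2 : ℂ) (F : C(XX d, ℂ)) {ε : ℝ} (hε : 0 < ε) : ∃ P, Good W s1 s2 ε F P := by
  let S : Submodule ℂ C(XX d, ℂ) :=
    { carrier := {F | ∀ ε > 0, ∃ P, Good W s1 s2 ε F P}
      add_mem' := by
        intro F G hF hG ε hε
        obtain ⟨P, hP, hP'⟩ := hF (ε / 2) (by positivity)
        obtain ⟨R, hR, hR'⟩ := hG (ε / 2) (by positivity)
        refine ⟨P ++ R, D0_append hP hR, fun z y t => ?_⟩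
        rw [Pack.sm_append, Pack.sm_append]
        obtain ⟨p1, p2⟩ := hP' z y t
        obtain ⟨r1, r2⟩ := hR' z y t
        rw [← add_halves ε]
        refine ⟨le_trans (le_of_eq ?_) ((norm_add_le _ _).trans (add_le_add p1 r1)), le_trans (le_of_eq ?_) ((norm_add_le _ _).trans (add_le_add p2 r2))⟩ <;>
        · congr 1; simp only [ContinuousMap.add_apply]; ring
      zero_mem' := fun ε hε => ⟨[], by simp [D0], fun z y t => by simp [sm, hε.le]⟩
      smul_mem' := by
        intro c F hF ε hε
        obtain ⟨P, hP, hP'⟩ := hF (ε / (‖c‖ + 1)) (by positivity)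
        have hc : ‖c‖ * (ε / (‖c‖ + 1)) ≤ ε := by
          rw [mul_div_assoc', div_le_iff₀ (by positivity)]; nlinarith
        refine ⟨Pack.mult (fun _ => c) P, D0_mult hP _, fun z y t => ?_⟩
        rw [sm_const (fun m τ => Trm.c1_mul m _ _ _ _ τ), sm_const (fun m τ => Trm.c2_mul m _ _ τ)]
        obtain ⟨p1, p2⟩ := hP' z y t
        refine ⟨le_trans (le_of_eq ?_) ((mul_le_mul_of_nonneg_left p1 (norm_nonneg c)).trans hc), le_trans (le_of_eq ?_) ((mul_le_mul_of_nonneg_left p2 (norm_nonneg c)).trans hc)⟩ <;>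
        · rw [← norm_mul]; congr 1; simp only [ContinuousMap.smul_apply, smul_eq_mul]; ring }
  refine dense_mono S ?_ (fun k a b ε hε => Good_mono W s1 s2 hε k a b) F ε hε
  refine isClosed_of_closure_subset fun F hF ε hε => ?_
  have hr : 0 < ε / (4 * (‖s1‖ + ‖s2‖ + 1)) := by positivity
  obtain ⟨G, hG, hFG⟩ := Metric.mem_closure_iff.1 hF _ hr
  obtain ⟨P, hP, hP'⟩ := hG (ε / 2) (by positivity)
  have key : ∀ s : ℂ, ‖s‖ ≤ ‖s1‖ + ‖s2‖ + 1 → ∀ p q : XX d, ‖s * (G p - G q) - s * (F p - F q)‖ ≤ ε / 2 := fun s hs p q => by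
    have h1 := (ContinuousMap.norm_coe_le_norm (F - G) p).trans (dist_eq_norm F G ▸ hFG.le)
    have h2 := (ContinuousMap.norm_coe_le_norm (F - G) q).trans (dist_eq_norm F G ▸ hFG.le)
    rw [show s * (G p - G q) - s * (F p - F q) = s * ((F - G) q - (F - G) p) by simp; ring, norm_mul]
    have h3 : ‖(F - G) q - (F - G) p‖ ≤ 2 * (ε / (4 * (‖s1‖ + ‖s2‖ + 1))) := (norm_sub_le _ _).trans (by linarith)
    refine (mul_le_mul hs h3 (norm_nonneg _) (by positivity)).trans (le_of_eq ?_)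
    field_simp; ring
  refine ⟨P, hP, fun z y t => ?_⟩
  obtain ⟨p1, p2⟩ := hP' z y t
  have k1 := key s1 (by linarith [norm_nonneg s2]) (z, y, t) (z, y, tm)
  have k2 := key s2 (by linarith [norm_nonneg s1]) (z, 0, t) (z, 0, tm)
  rw [← add_halves ε]
  refine ⟨le_trans (le_of_eq ?_) ((norm_add_le _ _).trans (add_le_add p1 k1)), le_trans (le_of_eq ?_) ((norm_add_le _ _).trans (add_le_add p2 k2))⟩ <;>
  · congr 1; ring

lemma cont_sm {X : Type*} [TopologicalSpace X] (P : Pack d) (c : X → Trm d → ℂ) (ζ : X → Fin d → Circle) (hc : ∀ τ, Continuous fun x => c x τ) (hζ : Continuous ζ) :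
    Continuous fun x => sm (c x) P (ζ x) := by
  unfold sm
  exact continuous_list_sum P fun τ _ => (hc τ).mul ((cont_ez τ.k).comp hζ)

lemma lip_cont {f : ℝ → ℝ} {L : ℝ} (h : ∀ s t, |f s - f t| ≤ L * |s - t|) : Continuous f :=
  (LipschitzWith.of_dist_le' (K := L) fun s t => h s t).continuous
lemma Trm.cta (τ : Trm d) : Continuous τ.a := continuous_iff_continuousAt.2 fun t => (τ.ha t).continuousAt

def U0 (P : Pack d) : C(XX d, ℝ) := ⟨fun p => (sm (Trm.c0 p.2.1 p.2.2) P p.1).re, by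
  refine continuous_re.comp (cont_sm P _ _ (fun τ => ?_) continuous_fst)
  have h1 := τ.cta
  have h2 := τ.φ.c0
  unfold Trm.c0; fun_prop⟩
lemma cc1 {a a1 q m r : ℝ → ℝ} {f f1 f2 : ℝ → ℂ} (h1 : Continuous a) (h2 : Continuous a1) (h3 : Continuous q) (h4 : Continuous m) (h5 : Continuous r)
    (h6 : Continuous f) (h7 : Continuous f1) (h8 : Continuous f2) (l : ℂ) :
    Continuous fun x : XX d => l * a1 x.2.2 * f x.2.1 - a x.2.2 * (q x.2.2 * f2 x.2.1 + 2 * I * m x.2.2 * f1 x.2.1 - r x.2.2 * f x.2.1) :=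
  (show Continuous fun x : ℝ × ℝ => l * a1 x.1 * f x.2 - a x.1 * (q x.1 * f2 x.2 + 2 * I * m x.1 * f1 x.2 - r x.1 * f x.2) by fun_prop).comp
    (show Continuous fun x : XX d => ((x.2.2 : ℝ), (x.2.1 : ℝ)) by fun_prop)
lemma cc2 {a a1 q m : ℝ → ℝ} (h1 : Continuous a) (h2 : Continuous a1) (h3 : Continuous q) (h4 : Continuous m) (f f1 : ℂ) :
    Continuous fun x : XX d => a1 x.2.2 * f - a x.2.2 * (q x.2.2 * f1 + I * m x.2.2 * f) :=
  (show Continuous fun x : ℝ => a1 x * f - a x * (q x * f1 + I * m x * f) by fun_prop).comp (show Continuous fun x : XX d => (x.2.2 : ℝ) by fun_prop)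
lemma Co.cQ (i j) : Continuous fun t => W.Q t i j := lip_cont fun s t => W.Ql s t i j
lemma Co.cv (i) : Continuous fun t => W.v t i := lip_cont fun s t => W.vl s t i
def U1 (P : Pack d) : C(XX d, ℝ) := ⟨fun p => (sm (Trm.c1 W.lam (W.Q p.2.2) p.2.1 p.2.2) P p.1).re, by
  refine continuous_re.comp (cont_sm P _ _ (fun τ => ?_) continuous_fst)
  exact cc1 τ.cta τ.ca (W.cQ _ _) (continuous_finsetSum _ fun i _ => (W.cQ _ _).mul continuous_const)
    (continuous_finsetSum _ fun i _ => continuous_finsetSum _ fun j _ => (W.cQ _ _).mul continuous_const) τ.φ.c0 τ.φ.c1 τ.φ.c2 _⟩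
def U2 (P : Pack d) : C(XX d, ℝ) := ⟨fun p => (sm (Trm.c2 (W.v p.2.2) p.2.2) P p.1).re, by
  refine continuous_re.comp (cont_sm P _ _ (fun τ => ?_) continuous_fst)
  exact cc2 τ.cta τ.ca (W.cv _) (continuous_finsetSum _ fun i _ => (W.cv _).mul continuous_const) _ _⟩
lemma U0_app (P R : Pack d) : U0 (P ++ R) = U0 P + U0 R := by ext p; simp [U0, Pack.sm_append]
lemma U1_app (P R : Pack d) : U1 W (P ++ R) = U1 W P + U1 W R := by ext p; simp [U1, Pack.sm_append]
lemma U2_app (P R : Pack d) : U2 W (P ++ R) = U2 W P + U2 W R := by ext p; simp [U2, Pack.sm_append]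

lemma D0_tm {P : Pack d} (h : D0 P) (z y) : U0 P (z, y, tm) = 0 ∧ U1 W P (z, y, tm) = 0 ∧ U2 W P (z, y, tm) = 0 := by
  refine ⟨?_, ?_, ?_⟩
  · simp only [U0, ContinuousMap.coe_mk]; rw [sm_zero, zero_re]; intro τ hτ; simp [Trm.c0, tm, (h τ hτ).1]
  · simp only [U1, ContinuousMap.coe_mk]; rw [sm_zero, zero_re]; intro τ hτ; simp [Trm.c1, tm, (h τ hτ).1, (h τ hτ).2.1]
  · simp only [U2, ContinuousMap.coe_mk]; rw [sm_zero, zero_re]; intro τ hτ; simp [Trm.c2, tm, (h τ hτ).1, (h τ hτ).2.1]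

lemma ap1 (F1 F2 : C(XX d, ℝ)) (h1 : ∀ z y, F1 (z, y, tm) = 0) (h2 : ∀ z y, F2 (z, y, tm) = 0) {ε : ℝ} (hε : 0 < ε) :
    ∃ P, D0 P ∧ ∀ z y t, |U1 W P (z, y, t) - F1 (z, y, t)| ≤ ε ∧ |U2 W P (z, 0, t) - F2 (z, 0, t)| ≤ ε := by
  obtain ⟨P, hP, hP'⟩ := Good_all W 1 0 ⟨fun p => (F1 p : ℂ), by fun_prop⟩ (show 0 < ε / 2 by positivity)
  obtain ⟨R, hR, hR'⟩ := Good_all W 0 1 ⟨fun p => (F2 p : ℂ), by fun_prop⟩ (show 0 < ε / 2 by positivity)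
  refine ⟨P ++ R, D0_append hP hR, fun z y t => ?_⟩
  obtain ⟨p1, p2⟩ := hP' z y t
  obtain ⟨r1, r2⟩ := hR' z y t
  simp only [ContinuousMap.coe_mk, one_mul, zero_mul, sub_zero, h1, h2, ofReal_zero] at p1 p2 r1 r2
  rw [U1_app, U2_app]
  have p1 := abs_le.1 ((abs_re_le_norm _).trans p1)
  have p2 := abs_le.1 ((abs_re_le_norm _).trans p2)
  have r1 := abs_le.1 ((abs_re_le_norm _).trans r1)
  have r2 := abs_le.1 ((abs_re_le_norm _).trans r2)
  simp only [sub_re, ofReal_re] at p1 p2 r1 r2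
  simp only [ContinuousMap.add_apply, U1, U2, ContinuousMap.coe_mk]
  constructor <;> rw [abs_le] <;> constructor <;> linarith
end
end OB
end


noncomputable section
namespace OB
open Filter Topology Complex

section
variable {d : ℕ} (W : Co d)

def up (z : Fin d → Circle) (y : ℝ) : Eucl (d + 1) := WithLp.toLp 2 (Fin.snoc (α := fun _ => ℝ) (fun i => Complex.arg (z i)) y)
lemma up_last (z : Fin d → Circle) (y : ℝ) : lastC (up z y) = y := by simp [up, lastC]
lemma zz_up (z : Fin d → Circle) (y : ℝ) : zz (up z y) = z := by
  funext j; simp [zz, up, Circle.exp_arg]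

lemma wmp (P : Pack d) (hP : D0 P) {m γ s : ℝ} (hm : 0 ≤ m) (hγ : 0 < γ) (hs : 0 ≤ s)
    (H1 : ∀ z y t, s < U0 P (z, y, t) → U1 W P (z, y, t) ≤ m * Real.exp (γ * (t + 1)))
    (H2 : ∀ z t, s < U0 P (z, 0, t) → U2 W P (z, 0, t) ≤ m * Real.exp (γ * (t + 1))) (p : XX d) :
    U0 P p ≤ s + m / (W.lam * γ) * Real.exp (γ * (p.2.2 + 1)) := by
  have hl := W.hlam
  have main : ∀ κ, m / (W.lam * γ) < κ → ∀ p : XX d, U0 P p ≤ s + κ * Real.exp (γ * (p.2.2 + 1)) := by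
    intro κ hκ
    have hκ0 : 0 < κ := lt_of_le_of_lt (by positivity) hκ
    let Φ : XX d → ℝ := fun p => U0 P p - κ * Real.exp (γ * (p.2.2 + 1))
    have hΦ : Continuous Φ := by
      have : Continuous (U0 P) := (U0 P).continuous
      fun_prop
    obtain ⟨⟨z, y, t⟩, -, hmax⟩ := isCompact_univ.exists_isMaxOn ⟨((1, 0, tm) : XX d), mem_univ _⟩ hΦ.continuousOn
    replace hmax : ∀ q, Φ q ≤ Φ (z, y, t) := fun q => hmax (mem_univ q)
    by_contra hcon
    push Not at hcon
    obtain ⟨q, hq⟩ := hcon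
    have hpos : s < Φ (z, y, t) := lt_of_lt_of_le (by simp only [Φ]; linarith) (hmax q)
    have hu : s < U0 P (z, y, t) := lt_of_lt_of_le hpos (sub_le_self _ (by positivity))
    have ht : -1 < (t:ℝ) := lt_of_le_of_ne t.2.1 fun h => by
      have : t = tm := Subtype.ext h.symm
      rw [this, (D0_tm W hP z y).1] at hu; linarith
    have hy : (y:ℝ) < 1 := lt_of_le_of_ne y.2.2 fun h => by
      have : U0 P (z, y, t) = 0 := by
        simp only [U0, ContinuousMap.coe_mk]; rw [sm_zero, zero_re]; intro τ hτ; simp [Trm.c0, h, (hP τ hτ).2.2]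
      rw [this] at hu; linarith
    let E := Reg.ofTime (d + 1) (fun t => -κ * Real.exp (γ * (t + 1))) (fun t => -κ * (Real.exp (γ * (t + 1)) * γ))
      (fun t => by
        have : HasDerivAt (fun t => γ * (t + 1)) γ t := by simpa using ((hasDerivAt_id t).add_const (1:ℝ)).const_mul γ
        exact this.exp.const_mul (-κ)) (by fun_prop)
    let U := (Pack.reg P).add E
    have hval : ∀ x' (t':ℝ) (h1 : lastC x' ∈ Icc (0:ℝ) 1) (h2 : t' ∈ Icc (-1:ℝ) 0), U.u (x', t') = Φ (zz x', ⟨_, h1⟩, ⟨_, h2⟩) := fun x' t' h1 h2 => by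
      have : U.u (x', t') = (Pack.reg P).u (x', t') + -κ * Real.exp (γ * (t' + 1)) := rfl
      rw [this, Pack.reg_u]; simp only [Φ, U0, ContinuousMap.coe_mk]; ring
    have hlu : lastC (up z y) = y := up_last z y
    have hv0 : U.u (up z y, (t:ℝ)) = Φ (z, y, t) := by
      rw [hval _ _ (by rw [hlu]; exact y.2) t.2]; congr 2
      · exact zz_up z y
      · congr 1; exact Subtype.ext hlu
    have ev : ∀ᶠ p in 𝓝 (up z y, (t:ℝ)), 0 ≤ lastC p.1 → p.2 ≤ (t:ℝ) → U.u p ≤ U.u (up z y, (t:ℝ)) := by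
      have c1 : Continuous fun p : SpaceTime (d + 1) => lastC p.1 := cont_last.comp continuous_fst
      have e1 : ∀ᶠ p : SpaceTime (d + 1) in 𝓝 (up z y, (t:ℝ)), lastC p.1 < 1 := c1.continuousAt.eventually (gt_mem_nhds (by simpa only [hlu] using hy))
      have e2 : ∀ᶠ p : SpaceTime (d + 1) in 𝓝 (up z y, (t:ℝ)), -1 < p.2 := continuous_snd.continuousAt.eventually (lt_mem_nhds ht)
      filter_upwards [e1, e2] with p p1 p2 p3 p4
      rw [hv0, hval p.1 p.2 ⟨p3, p1.le⟩ ⟨p2.le, p4.trans t.2.2⟩]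
      exact hmax _
    obtain ⟨m1, m2, m3⟩ := Reg.max_pt U (up z y) t (by rw [hlu]; exact y.2.1) ev
    have ut : U.ut (up z y, (t:ℝ)) = (Pack.reg P).ut (up z y, (t:ℝ)) + -κ * (Real.exp (γ * (t + 1)) * γ) := rfl
    have ug : U.g (up z y, (t:ℝ)) = (Pack.reg P).g (up z y, (t:ℝ)) := by
      have : U.g (up z y, (t:ℝ)) = (Pack.reg P).g (up z y, (t:ℝ)) + 0 := rfl
      rw [this, add_zero]
    have he := Real.exp_pos (γ * (t + 1))
    have hk : m < κ * (W.lam * γ) := (div_lt_iff₀ (by positivity)).1 hκ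
    have hk2 := mul_lt_mul_of_pos_right hk he
    have r1 := Pack.reg_1 P (W.sym t) W.lam (up z y, (t:ℝ))
    have r2 := Pack.reg_2 P (W.v t) (up z y, (t:ℝ))
    simp only [zz_up, hlu] at r1 r2
    rcases y.2.1.eq_or_lt with h0 | h0
    · have hy0 : y = 0 := Subtype.ext h0.symm
      subst hy0
      have := H2 z t hu
      simp only [U2, ContinuousMap.coe_mk] at this
      rw [← r2 rfl] at this
      have m3 := m3 (W.v t) (W.hc.le.trans (W.vn t))
      rw [ug] at m3
      rw [ut] at m1
      have : κ * (W.lam * γ) * Real.exp (γ * (t + 1)) ≤ κ * (Real.exp (γ * (t + 1)) * γ) := by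
        rw [show κ * (W.lam * γ) * Real.exp (γ * (t + 1)) = W.lam * (κ * (Real.exp (γ * (t + 1)) * γ)) by ring]
        exact mul_le_of_le_one_left (by positivity) W.hlam1
      linarith
    · have := H1 z y t hu
      simp only [U1, ContinuousMap.coe_mk] at this
      rw [← r1] at this
      have m2 := m2 (by rw [hlu]; exact h0) _ (W.psd t)
      rw [show U = (Pack.reg P).add E from rfl, Reg.L_add, Reg.L_ofTime] at m2
      rw [ut] at m1
      have := mul_nonneg hl.le m1
      nlinarith
  refine le_of_forall_gt_imp_ge_of_dense fun a ha => ?_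
  have he := Real.exp_pos (γ * (p.2.2 + 1))
  have h1 : m / (W.lam * γ) < (a - s) / Real.exp (γ * (p.2.2 + 1)) := by
    rw [lt_div_iff₀ he]; linarith
  have := main _ h1 p
  rw [div_mul_cancel₀ _ he.ne'] at this; linarith

lemma U_neg (P : Pack d) : ∃ R : Pack d, (D0 P → D0 R) ∧ U0 R = - U0 P ∧ U1 W R = - U1 W P ∧ U2 W R = - U2 W P := by
  refine ⟨Pack.mult (fun _ => -1) P, fun h => D0_mult h _, ?_, ?_, ?_⟩ <;> ext p
  · simp [U0, sm_const (fun m τ => Trm.c0_mul m _ _ τ)]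
  · simp [U1, sm_const (fun m τ => Trm.c1_mul m _ _ _ _ τ)]
  · simp [U2, sm_const (fun m τ => Trm.c2_mul m _ _ τ)]

lemma wmp_abs (P : Pack d) (hP : D0 P) {m γ s : ℝ} (hm : 0 ≤ m) (hγ : 0 < γ) (hs : 0 ≤ s)
    (H1 : ∀ z y t, (s < U0 P (z, y, t) → U1 W P (z, y, t) ≤ m * Real.exp (γ * (t + 1))) ∧ (U0 P (z, y, t) < -s → -(m * Real.exp (γ * (t + 1))) ≤ U1 W P (z, y, t)))
    (H2 : ∀ z t, (s < U0 P (z, 0, t) → U2 W P (z, 0, t) ≤ m * Real.exp (γ * (t + 1))) ∧ (U0 P (z, 0, t) < -s → -(m * Real.exp (γ * (t + 1))) ≤ U2 W P (z, 0, t))) (p : XX d) :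
    |U0 P p| ≤ s + m / (W.lam * γ) * Real.exp (γ * (p.2.2 + 1)) := by
  obtain ⟨R, hR, e0, e1, e2⟩ := U_neg W P
  have h1 := wmp W P hP hm hγ hs (fun z y t => (H1 z y t).1) (fun z t => (H2 z t).1) p
  have h2 := wmp W R (hR hP) hm hγ hs (fun z y t => ?_) (fun z t => ?_) p
  · rw [e0, ContinuousMap.neg_apply] at h2
    exact abs_le.2 ⟨by linarith, h1⟩
  · rw [e0, e1, ContinuousMap.neg_apply, ContinuousMap.neg_apply]
    intro h; have := (H1 z y t).2 (by linarith); linarith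
  · rw [e0, e2, ContinuousMap.neg_apply, ContinuousMap.neg_apply]
    intro h; have := (H2 z t).2 (by linarith); linarith

/-- approximate solution of the penalised problem -/
lemma penal (F χ : C(XX d, ℝ)) (hF : ∀ z y, F (z, y, tm) = 0) {ε : ℝ} (hε : 0 < ε) :
    ∃ P, D0 P ∧ ∀ z y t, |U1 W P (z, y, t) + χ (z, y, t) * U0 P (z, y, t) - F (z, y, t)| ≤ ε ∧
      |U2 W P (z, 0, t) + χ (z, 0, t) * U0 P (z, 0, t) - F (z, 0, t)| ≤ ε := by
  have hl := W.hlam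
  let γ : ℝ := 4 * (‖χ‖ + 1) / W.lam
  have hγ : 0 < γ := by positivity
  have hlg : W.lam * γ = 4 * (‖χ‖ + 1) := by simp only [γ]; field_simp
  have step : ∀ k : ℕ, ∃ P, D0 P ∧ ∀ z y t, |F (z, y, t) - U1 W P (z, y, t) - χ (z, y, t) * U0 P (z, y, t)| ≤ (3 / 4) ^ k * (‖F‖ + 1) * Real.exp (γ * (t + 1)) ∧
      |F (z, 0, t) - U2 W P (z, 0, t) - χ (z, 0, t) * U0 P (z, 0, t)| ≤ (3 / 4) ^ k * (‖F‖ + 1) * Real.exp (γ * (t + 1)) := by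
    intro k
    induction k with
    | zero =>
      refine ⟨[], by simp [D0], fun z y t => ?_⟩
      have h1 : 1 ≤ Real.exp (γ * (t + 1)) := Real.one_le_exp (mul_nonneg hγ.le (by linarith [t.2.1]))
      have h2 : ∀ p, |F p| ≤ (3 / 4) ^ 0 * (‖F‖ + 1) * Real.exp (γ * (t + 1)) := fun p => by
        have := ContinuousMap.norm_coe_le_norm F p
        rw [Real.norm_eq_abs] at this
        nlinarith [norm_nonneg F]
      simpa [U1, U0, U2, sm] using And.intro (h2 _) (h2 _)
    | succ k ih =>
      obtain ⟨P, hP, hP'⟩ := ih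
      set m := (3 / 4 : ℝ) ^ k * (‖F‖ + 1) with hm
      have hm0 : 0 < m := by positivity
      obtain ⟨R, hR, hR'⟩ := ap1 W (F - U1 W P - χ * U0 P) (F - U2 W P - χ * U0 P)
        (fun z y => by simp [hF, D0_tm W hP z y]) (fun z y => by simp [hF, D0_tm W hP z y]) (show 0 < m / 4 by positivity)
      have E1 : ∀ t : Icc (-1:ℝ) 0, 1 ≤ Real.exp (γ * (t + 1)) := fun t => Real.one_le_exp (mul_nonneg hγ.le (by linarith [t.2.1]))
      have B1 : ∀ z y t, |U1 W R (z, y, t)| ≤ (5 / 4 * m) * Real.exp (γ * (t + 1)) := fun z y t => by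
        have a1 := abs_le.1 (hR' z y t).1
        have a2 := abs_le.1 (hP' z y t).1
        simp only [ContinuousMap.sub_apply, ContinuousMap.mul_apply] at a1
        have := mul_le_mul_of_nonneg_left (E1 t) (show 0 ≤ m / 4 by positivity)
        rw [abs_le]; constructor <;> linarith
      have B2 : ∀ z t, |U2 W R (z, 0, t)| ≤ (5 / 4 * m) * Real.exp (γ * (t + 1)) := fun z t => by
        have a1 := abs_le.1 (hR' z 0 t).2
        have a2 := abs_le.1 (hP' z 0 t).2
        simp only [ContinuousMap.sub_apply, ContinuousMap.mul_apply] at a1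
        have := mul_le_mul_of_nonneg_left (E1 t) (show 0 ≤ m / 4 by positivity)
        rw [abs_le]; constructor <;> linarith
      have B0 := wmp_abs W R hR (show 0 ≤ 5 / 4 * m by positivity) hγ le_rfl
        (fun z y t => ⟨fun _ => (abs_le.1 (B1 z y t)).2, fun _ => (abs_le.1 (B1 z y t)).1⟩)
        (fun z t => ⟨fun _ => (abs_le.1 (B2 z t)).2, fun _ => (abs_le.1 (B2 z t)).1⟩)
      have B3 : ∀ p : XX d, |χ p * U0 R p| ≤ m / 2 * Real.exp (γ * (p.2.2 + 1)) - m / 16 * Real.exp (γ * (p.2.2 + 1)) := fun p => by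
        have b := B0 p
        rw [hlg, zero_add] at b
        have hχ := ContinuousMap.norm_coe_le_norm χ p
        rw [Real.norm_eq_abs] at hχ
        have he := Real.exp_pos (γ * (p.2.2 + 1))
        rw [abs_mul]
        refine (mul_le_mul (hχ.trans (by linarith : ‖χ‖ ≤ ‖χ‖ + 1)) b (abs_nonneg _) (by positivity)).trans ?_
        have : (‖χ‖ + 1) * (5 / 4 * m / (4 * (‖χ‖ + 1)) * Real.exp (γ * (p.2.2 + 1))) = 5 / 16 * (m * Real.exp (γ * (p.2.2 + 1))) := by
          field_simp; ring
        rw [this]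
        have := mul_pos hm0 he
        linarith
      refine ⟨P ++ R, D0_append hP hR, fun z y t => ?_⟩
      rw [U0_app, U1_app, U2_app]
      have hmm : (3 / 4 : ℝ) ^ (k + 1) * (‖F‖ + 1) = 3 / 4 * m := by rw [hm]; ring
      rw [hmm]
      have a1 := abs_le.1 (hR' z y t).1
      have a2 := abs_le.1 (hR' z y t).2
      have b1 := abs_le.1 (B3 (z, y, t))
      have b2 := abs_le.1 (B3 (z, 0, t))
      simp only [ContinuousMap.sub_apply, ContinuousMap.mul_apply, ContinuousMap.add_apply] at a1 a2 b1 b2 ⊢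
      have h1 := mul_le_mul_of_nonneg_left (E1 t) (show 0 ≤ m / 4 by positivity)
      have h2 := mul_pos hm0 (Real.exp_pos (γ * (t + 1)))
      constructor <;> rw [abs_le] <;> constructor <;> linarith
  obtain ⟨k, hk⟩ := exists_pow_lt_of_lt_one (show 0 < ε / ((‖F‖ + 1) * Real.exp γ) by positivity) (show (3 / 4 : ℝ) < 1 by norm_num)
  obtain ⟨P, hP, hP'⟩ := step k
  have hb : ∀ t : Icc (-1:ℝ) 0, (3 / 4 : ℝ) ^ k * (‖F‖ + 1) * Real.exp (γ * (t + 1)) ≤ ε := fun t => by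
    rw [lt_div_iff₀ (by positivity)] at hk
    have : Real.exp (γ * (t + 1)) ≤ Real.exp γ := Real.exp_le_exp.2 (mul_le_of_le_one_right hγ.le (by linarith [t.2.2]))
    have := mul_le_mul_of_nonneg_left this (show 0 ≤ (3 / 4 : ℝ) ^ k * (‖F‖ + 1) by positivity)
    linarith
  refine ⟨P, hP, fun z y t => ?_⟩
  have a1 := abs_le.1 ((hP' z y t).1.trans (hb t))
  have a2 := abs_le.1 ((hP' z y t).2.trans (hb t))
  constructor <;> rw [abs_le] <;> constructor <;> linarith
end
end OB
end


noncomputable section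
namespace OB
open Filter Topology Complex

section
variable {d : ℕ} (W : Co d)

def qf (x : Eucl (d + 1)) : ℝ := max (‖x‖ ^ 2 - 1 / 4) 0
def tf (t : ℝ) : ℝ := max (-(1 / 2) - t) 0

def bt (d : ℕ) : Reg (d + 1) :=
  (((Reg.quad (fun _ => 1) (fun _ => 0)).add (Reg.ofTime _ (fun _ => -(1 / 4)) (fun _ => 0) (fun t => hasDerivAt_const t _) continuous_const)).comp
    (fun s => max s 0 ^ 3) (fun s => 3 * max s 0 ^ 2) (fun s => 3 * (2 * max s 0))
    (fun s => by have := posPow 1 s; norm_num at this; exact this) (fun s => by have := posPow 0 s; norm_num at this; exact this.const_mul 3) (by fun_prop)).add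
  (Reg.ofTime _ (fun t => tf t ^ 2) (fun t => 2 * tf t * (-1))
    (fun t => by
      have h := posPow 0 (-(1 / 2) - t)
      norm_num at h
      have := HasDerivAt.comp t h ((hasDerivAt_id t).const_sub (-(1 / 2) : ℝ))
      simpa [tf, Function.comp_def] using this) (by unfold tf; fun_prop))

lemma nsq (x : Eucl (d + 1)) : ∑ i, x i ^ 2 = ‖x‖ ^ 2 := (EuclideanSpace.real_norm_sq_eq x).symm

lemma bt_u (p) : (bt d).u p = qf p.1 ^ 3 + tf p.2 ^ 2 := by
  simp only [bt, Reg.add, Reg.comp, Reg.quad, Reg.ofTime, qf, ← nsq]; simp [sub_eq_add_neg]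
lemma bt_ut (p) : (bt d).ut p = -(2 * tf p.2) := by
  simp [bt, Reg.add, Reg.comp, Reg.quad, Reg.ofTime]
lemma bt_g (p) : (bt d).g p = (6 * qf p.1 ^ 2) • p.1 := by
  ext i; simp only [bt, Reg.add, Reg.comp, Reg.quad, Reg.ofTime, qf, ← nsq]; simp [sub_eq_add_neg]; ring
lemma bq_smul (Q : Matrix (Fin (d + 1)) (Fin (d + 1)) ℝ) (c : ℝ) (x : Eucl (d + 1)) : bq Q (c • x) (c • x) = c ^ 2 * bq Q x x := by
  simp only [bq, Finset.mul_sum, PiLp.smul_apply, smul_eq_mul]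
  exact Finset.sum_congr rfl fun i _ => Finset.sum_congr rfl fun j _ => by ring
lemma bt_L (Q p) : (bt d).L Q p = 3 * qf p.1 ^ 2 * (2 * ∑ i, Q i i) + 24 * qf p.1 * bq Q p.1 p.1 := by
  rw [bt, Reg.L_add, Reg.L_ofTime, Reg.L_comp, Reg.L_add, Reg.L_ofTime, Reg.L_quad]
  have e : ((Reg.quad (fun _ => 1) (fun _ => 0)).add (Reg.ofTime (d + 1) (fun _ => -(1 / 4)) (fun _ => 0) (fun t => hasDerivAt_const t _) continuous_const)).g p = (2:ℝ) • p.1 := by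
    ext i; simp [Reg.add, Reg.quad, Reg.ofTime]
  have e2 : ((Reg.quad (fun _ => 1) (fun _ => 0)).add (Reg.ofTime (d + 1) (fun _ => -(1 / 4)) (fun _ => 0) (fun t => hasDerivAt_const t _) continuous_const)).u p = ‖p.1‖ ^ 2 - 1 / 4 := by
    simp only [Reg.add, Reg.quad, Reg.ofTime, ← nsq]; simp [sub_eq_add_neg]
  rw [e, e2, bq_smul, ← Finset.sum_mul]; simp only [qf]; ring

lemma coord_le (x : Eucl (d + 1)) (i) : |x i| ≤ ‖x‖ := by
  simpa using PiLp.norm_apply_le x i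

lemma bq_bd {Q : Matrix (Fin (d + 1)) (Fin (d + 1)) ℝ} {K : ℝ} (hQ : ∀ i j, |Q i j| ≤ K) (x y : Eucl (d + 1)) : |bq Q x y| ≤ (d + 1) ^ 2 * K * (‖x‖ * ‖y‖) := by
  have h : ∀ i j, |Q i j * (x i * y j)| ≤ K * (‖x‖ * ‖y‖) := fun i j => by
    rw [abs_mul, abs_mul]
    exact mul_le_mul (hQ i j) (mul_le_mul (coord_le x i) (coord_le y j) (abs_nonneg _) (norm_nonneg _)) (by positivity) ((abs_nonneg _).trans (hQ i j))
  refine (Finset.abs_sum_le_sum_abs _ _).trans ((Finset.sum_le_sum fun i _ => (Finset.abs_sum_le_sum_abs _ _).trans (Finset.sum_le_sum fun j _ => h i j)).trans (le_of_eq ?_))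
  simp; ring

def CW : ℝ := 100 * (d + 1) ^ 2 * (W.K + 1)

lemma inner_bd {v : Eucl (d + 1)} {K : ℝ} (hv : ∀ i, |v i| ≤ K) (x : Eucl (d + 1)) : |⟪v, x⟫| ≤ (d + 1) * K * ‖x‖ := by
  rw [PiLp.inner_apply]
  have : ∀ i ∈ Finset.univ, |inner ℝ (v i) (x i)| ≤ K * ‖x‖ := fun i _ => by
    simp only [RCLike.inner_apply, conj_trivial, abs_mul]
    rw [mul_comm]
    exact mul_le_mul (hv i) (coord_le x i) (abs_nonneg _) ((abs_nonneg _).trans (hv i))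
  refine (Finset.abs_sum_le_sum_abs _ _).trans ((Finset.sum_le_sum this).trans (le_of_eq ?_))
  simp; ring

lemma bt_bd (x : Eucl (d + 1)) (t : ℝ) (hx : ‖x‖ ≤ 1) :
    (bt d).L (W.Q t) (x, t) - W.lam * (bt d).ut (x, t) ≤ CW W * (qf x + tf t) ∧ ⟪W.v t, (bt d).g (x, t)⟫ - (bt d).ut (x, t) ≤ CW W * (qf x + tf t) := by
  have hK := W.hK
  have q0 : 0 ≤ qf x := le_max_right _ _
  have q1 : qf x ≤ 1 := max_le (by nlinarith [norm_nonneg x]) zero_le_one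
  have t0 : 0 ≤ tf t := le_max_right _ _
  have qq : qf x ^ 2 ≤ qf x := by nlinarith
  have n2 : ‖x‖ * ‖x‖ ≤ 1 := by nlinarith [norm_nonneg x]
  have hd : (1:ℝ) ≤ d + 1 := by linarith [Nat.cast_nonneg (α := ℝ) d]
  have hD : (1:ℝ) ≤ (d + 1) ^ 2 := one_le_pow₀ hd
  have hD' : (d + 1 : ℝ) ≤ (d + 1) ^ 2 := by nlinarith
  have DK : 0 ≤ ((d:ℝ) + 1) ^ 2 * W.K := by positivity
  have hC : 2 * tf t ≤ CW W * tf t := by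
    refine mul_le_mul_of_nonneg_right ?_ t0
    unfold CW; nlinarith
  rw [bt_L, bt_ut, bt_g]
  constructor
  · have h1 : ∑ i, W.Q t i i ≤ (d + 1) ^ 2 * W.K := by
      refine (Finset.sum_le_sum fun i _ => (le_abs_self _).trans (W.Qb t i i)).trans ?_
      simp; nlinarith
    have h2 := (le_abs_self _).trans (bq_bd (W.Qb t) x x)
    have h3 : bq (W.Q t) x x ≤ (d + 1) ^ 2 * W.K := h2.trans (by nlinarith)
    have h4 : 3 * qf x ^ 2 * (2 * ∑ i, W.Q t i i) ≤ 6 * qf x * ((d + 1) ^ 2 * W.K) := by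
      calc 3 * qf x ^ 2 * (2 * ∑ i, W.Q t i i) ≤ 3 * qf x ^ 2 * (2 * ((d + 1) ^ 2 * W.K)) := by gcongr
        _ ≤ 3 * qf x * (2 * ((d + 1) ^ 2 * W.K)) := by gcongr
        _ = _ := by ring
    have h5 : 24 * qf x * bq (W.Q t) x x ≤ 24 * qf x * ((d + 1) ^ 2 * W.K) := by gcongr
    have h6 : W.lam * (2 * tf t) ≤ 2 * tf t := mul_le_of_le_one_left (by positivity) W.hlam1
    have h7 : 30 * qf x * ((d + 1) ^ 2 * W.K) ≤ CW W * qf x := by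
      unfold CW
      have : 0 ≤ qf x * (d + 1) ^ 2 := by positivity
      nlinarith
    simp only []
    nlinarith
  · have h1 := (le_abs_self _).trans (inner_bd (W.vb t) x)
    have h2 : ⟪W.v t, x⟫ ≤ (d + 1) ^ 2 * W.K := h1.trans (by
      calc ((d:ℝ) + 1) * W.K * ‖x‖ ≤ (d + 1) ^ 2 * W.K * 1 := by gcongr
        _ = _ := by ring)
    rw [inner_smul_right]
    have h4 : 6 * qf x ^ 2 * ⟪W.v t, x⟫ ≤ 6 * qf x * ((d + 1) ^ 2 * W.K) := by
      calc 6 * qf x ^ 2 * ⟪W.v t, x⟫ ≤ 6 * qf x ^ 2 * ((d + 1) ^ 2 * W.K) := by gcongr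
        _ ≤ 6 * qf x * ((d + 1) ^ 2 * W.K) := by gcongr
    have h7 : 30 * qf x * ((d + 1) ^ 2 * W.K) ≤ CW W * qf x := by
      unfold CW
      have : 0 ≤ qf x * (d + 1) ^ 2 := by positivity
      nlinarith
    have : 0 ≤ qf x * ((d + 1) ^ 2 * W.K) := by positivity
    simp only []
    nlinarith

def GS (d : ℕ) : Set (SpaceTime (d + 1)) := {p | ‖p.1‖ ≤ 3 / 4 ∧ 0 ≤ lastC p.1 ∧ -(3 / 4) ≤ p.2 ∧ p.2 ≤ 0}
lemma GS_compact : IsCompact (GS d) := by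
  have h1 : IsCompact ((closedBall (0 : Eucl (d + 1)) (3 / 4)) ×ˢ (Icc (-(3 / 4) : ℝ) 0)) := (isCompact_closedBall _ _).prod isCompact_Icc
  have h2 : IsClosed {p : SpaceTime (d + 1) | 0 ≤ lastC p.1} := isClosed_le continuous_const (cont_last.comp continuous_fst)
  convert h1.inter_right h2 using 1
  ext p; simp [GS, dist_eq_norm, and_comm, and_assoc, and_left_comm]
lemma GS_sub {p} (hp : p ∈ GS d) : p ∈ KcP d 1 := by
  obtain ⟨h1, h2, h3, h4⟩ := hp
  rcases h2.eq_or_lt with h | h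
  · exact Or.inr ⟨by simp; linarith, h.symm, by constructor <;> linarith⟩
  · exact Or.inl ⟨by simp; linarith, h, by constructor <;> linarith⟩
lemma clK {p} (hp : p ∈ closure (Kc d 1)) : 0 ≤ lastC p.1 ∧ p.2 ≤ 0 := by
  have h2 : IsClosed {p : SpaceTime (d + 1) | 0 ≤ lastC p.1 ∧ p.2 ≤ 0} :=
    (isClosed_le continuous_const (cont_last.comp continuous_fst)).inter (isClosed_le continuous_snd continuous_const)
  exact closure_minimal (show Kc d 1 ⊆ {p | 0 ≤ lastC p.1 ∧ p.2 ≤ 0} from fun q hq => ⟨hq.2.1.le, hq.2.2.2⟩) h2 hp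
lemma K_cl {p} (hp : p ∈ KcP d 1) : p ∈ closure (Kc d 1) := by
  rcases hp with hp | hp
  · exact subset_closure hp
  · obtain ⟨h1, h2, h3⟩ := hp
    have hc : Tendsto (fun s : ℝ => ((p.1 + s • EuclideanSpace.single (Fin.last d) 1, p.2) : SpaceTime (d + 1))) (𝓝[>] 0) (𝓝 p) := by
      have : Continuous (fun s : ℝ => ((p.1 + s • EuclideanSpace.single (Fin.last d) 1, p.2) : SpaceTime (d + 1))) := by fun_prop
      have := this.tendsto 0
      simp only [zero_smul, add_zero] at this
      exact this.mono_left nhdsWithin_le_nhds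
    refine mem_closure_of_tendsto hc ?_
    have e1 := hc.eventually ((isOpen_ball.preimage continuous_fst).mem_nhds h1)
    filter_upwards [e1, self_mem_nhdsWithin] with s s1 s2
    refine ⟨s1, ?_, h3⟩
    have : p.1 (Fin.last d) = 0 := h2
    show 0 < (p.1 + s • EuclideanSpace.single (Fin.last d) 1 : Eucl (d + 1)) (Fin.last d)
    simp [this]; exact s2

lemma comp_sub {η : SpaceTime (d + 1) → ℝ} (hη : ObliqueSub d W.lam W.Q W.v η) (hη1 : ∀ p ∈ KcP d 1, η p ≤ 1) (V : Reg (d + 1))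
    {N δ κ ε : ℝ} (hδ : 0 < δ) (hκ : 0 < κ) (hN : 200 * CW W ≤ N * δ) (hε : ε < W.lam * κ) (hV : ∀ p ∈ GS d, -2 ≤ V.u p)
    (H1 : ∀ p ∈ GS d, N * (qf p.1 + tf p.2) * (η p - V.u p) - ε ≤ W.lam * V.ut p - V.L (W.Q p.2) p)
    (H2 : ∀ p ∈ GS d, lastC p.1 = 0 → N * (qf p.1 + tf p.2) * (η p - V.u p) - ε ≤ V.ut p - ⟪W.v p.2, V.g p⟫)
    {p} (hp : p ∈ GS d) (hp1 : ‖p.1‖ ≤ 1 / 2) (hp2 : -(1 / 2) ≤ p.2) : η p - V.u p ≤ δ + κ := by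
  let E : ℝ → Reg (d + 1) := fun c => Reg.ofTime (d + 1) (fun t => κ * (t + 1) + c) (fun _ => κ) (fun t => by
    simpa using ((((hasDerivAt_id t).add_const (1:ℝ)).const_mul κ).add_const c)) continuous_const
  let Ψ : ℝ → Reg (d + 1) := fun c => (V.add (Reg.smul 200 (bt d))).add (E c)
  have hΨ : ∀ c q, (Ψ c).u q = V.u q + 200 * (qf q.1 ^ 3 + tf q.2 ^ 2) + (κ * (q.2 + 1) + c) := fun c q => by rw [← bt_u]; rfl
  have hcont : ContinuousOn (fun q => η q - (Ψ 0).u q) (GS d) := (hη.1.mono fun q hq => GS_sub hq).sub (Ψ 0).cu.continuousOn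
  obtain ⟨q, hq, hmax⟩ := GS_compact.exists_isMaxOn ⟨p, hp⟩ hcont
  replace hmax : ∀ r ∈ GS d, η r - (Ψ 0).u r ≤ η q - (Ψ 0).u q := fun r hr => hmax hr
  have q0 : ∀ x : Eucl (d + 1), 0 ≤ qf x := fun x => le_max_right _ _
  have t0 : ∀ t : ℝ, 0 ≤ tf t := fun x => le_max_right _ _
  suffices h : η q - (Ψ 0).u q ≤ δ by
    have h1 := hmax p hp
    rw [hΨ 0 p] at h1
    have e1 : qf p.1 = 0 := max_eq_right (by nlinarith [norm_nonneg p.1])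
    have e2 : tf p.2 = 0 := max_eq_right (by linarith)
    rw [e1, e2] at h1
    have : κ * (p.2 + 1) ≤ κ := mul_le_of_le_one_right hκ.le (by linarith [hp.2.2.2])
    linarith
  by_contra hcon
  push Not at hcon
  obtain ⟨g1, g2, g3, g4⟩ := hq
  have hq : q ∈ GS d := ⟨g1, g2, g3, g4⟩
  have hκt : 0 ≤ κ * (q.2 + 1) := mul_nonneg hκ.le (by linarith)
  have hqd : δ < η q - V.u q - 200 * (qf q.1 ^ 3 + tf q.2 ^ 2) - κ * (q.2 + 1) := by
    have := hcon; rw [hΨ] at this; linarith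
  have b1 : 0 ≤ qf q.1 ^ 3 := pow_nonneg (q0 _) 3
  have b2 : 0 ≤ tf q.2 ^ 2 := pow_nonneg (t0 _) 2
  have hb := hV q hq
  have hb' := hη1 q (GS_sub hq)
  have hx : ‖q.1‖ < 3 / 4 := lt_of_le_of_ne g1 fun h => by
    have : (5 / 16 : ℝ) ≤ qf q.1 := le_max_of_le_left (by rw [h]; norm_num)
    have := pow_le_pow_left₀ (by norm_num) this 3
    norm_num at this; linarith
  have ht : -(3 / 4) < q.2 := lt_of_le_of_ne g3 fun h => by
    have : (1 / 4 : ℝ) ≤ tf q.2 := le_max_of_le_left (by rw [← h]; norm_num)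
    have := pow_le_pow_left₀ (by norm_num) this 2
    norm_num at this; linarith
  set c := η q - (Ψ 0).u q with hc
  have hcu : ∀ r, (Ψ c).u r = (Ψ 0).u r + c := fun r => by rw [hΨ, hΨ]; ring
  let ρ : ℝ := min (min (3 / 4 - ‖q.1‖) (q.2 + 3 / 4)) 1
  have hρ : 0 < ρ := lt_min (lt_min (by linarith) (by linarith)) one_pos
  have ρ1 : ρ ≤ 3 / 4 - ‖q.1‖ := (min_le_left _ _).trans (min_le_left _ _)
  have ρ2 : ρ ≤ q.2 + 3 / 4 := (min_le_left _ _).trans (min_le_right _ _)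
  have ρ3 : ρ ^ 2 ≤ ρ := by have : ρ ≤ 1 := min_le_right _ _; nlinarith
  have touch : TouchesAbove (Ψ c).u η (cylE q.1 q.2 ρ ∩ closure (Kc d 1)) q := by
    refine ⟨⟨⟨mem_ball_self hρ, by constructor <;> nlinarith⟩, K_cl (GS_sub hq)⟩, by rw [hcu, hc]; ring, fun r hr => ?_⟩
    obtain ⟨⟨r1, r2, r3⟩, r4⟩ := hr
    obtain ⟨r5, r6⟩ := clK r4
    have : r ∈ GS d := by
      refine ⟨?_, r5, by linarith, r6⟩
      have h1 := mem_ball_iff_norm.1 r1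
      have h2 := norm_le_norm_add_norm_sub q.1 r.1
      rw [norm_sub_rev] at h2
      linarith
    have := hmax r this
    rw [hcu]; linarith
  obtain ⟨v1, v2⟩ := hη.2 _ _ _ _ q ρ hρ ((Ψ c).parabolicTest _) touch
  obtain ⟨B1, B2⟩ := bt_bd W q.1 q.2 (by linarith)
  have et : (Ψ c).ut q = V.ut q + 200 * (bt d).ut q + κ := rfl
  have eg : (Ψ c).g q = V.g q + (200:ℝ) • (bt d).g q := by
    have : (Ψ c).g q = V.g q + (200:ℝ) • (bt d).g q + 0 := rfl
    rw [this, add_zero]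
  have hχ : 0 ≤ qf q.1 + tf q.2 := add_nonneg (q0 _) (t0 _)
  have hN0 : 0 ≤ N := by
    have : 0 ≤ CW W := by have := W.hK; unfold CW; positivity
    by_contra h; push Not at h; nlinarith
  have hkey : 200 * CW W * (qf q.1 + tf q.2) ≤ N * (qf q.1 + tf q.2) * (η q - V.u q) := by
    have h1 := mul_le_mul_of_nonneg_right hN hχ
    have h2 : N * δ * (qf q.1 + tf q.2) ≤ N * (η q - V.u q) * (qf q.1 + tf q.2) := by gcongr; linarith
    linarith
  rcases g2.eq_or_lt with h0 | h0
  · have := v2 ⟨by simp; linarith, h0.symm, by constructor <;> linarith⟩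
    rw [et, eg, inner_add_right, inner_smul_right] at this
    have h2 := H2 q hq h0.symm
    have h3 : W.lam * κ ≤ κ := mul_le_of_le_one_left hκ.le W.hlam1
    linarith
  · have := v1 ⟨by simp; linarith, h0, by constructor <;> linarith⟩
    rw [Reg.L_trace, et, show Ψ c = (V.add (Reg.smul 200 (bt d))).add (E c) from rfl, Reg.L_add, Reg.L_add, Reg.L_smul, Reg.L_ofTime] at this
    have h2 := H1 q hq
    linarith
end
end OB
end


noncomputable section
namespace OB
open Filter Topology Complex

section
variable {d : ℕ}

def cl (t : ℝ) : ℝ := max (-1) (min t 0)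
lemma cl_mem (t : ℝ) : cl t ∈ Icc (-1:ℝ) 0 := ⟨le_max_left _ _, max_le (by norm_num) (min_le_right _ _)⟩
lemma cl_id {t : ℝ} (h : t ∈ Icc (-1:ℝ) 0) : cl t = t := by rw [cl, min_eq_left h.2, max_eq_right h.1]
lemma cl_lip (s t : ℝ) : |cl s - cl t| ≤ |s - t| := by
  unfold cl
  rcases le_total s 0 with h1 | h1 <;> rcases le_total t 0 with h2 | h2 <;> simp only [min_eq_left, min_eq_right, h1, h2]
  · exact (abs_max_sub_max_le_max _ _ _ _).trans (by simp)
  · refine (abs_max_sub_max_le_max _ _ _ _).trans ?_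
    simp only [sub_self, abs_zero, sub_zero]; rw [max_eq_right (abs_nonneg _), abs_of_nonpos h1, abs_of_nonpos (by linarith)]; linarith
  · refine (abs_max_sub_max_le_max _ _ _ _).trans ?_
    simp only [sub_self, abs_zero, zero_sub, abs_neg]; rw [max_eq_right (abs_nonneg _), abs_of_nonpos h2, abs_of_nonneg (by linarith)]; linarith
  · simp

lemma bq_dot (Q : Matrix (Fin (d + 1)) (Fin (d + 1)) ℝ) (x : Eucl (d + 1)) : bq Q x x = star x.ofLp ⬝ᵥ (Q.mulVec x.ofLp) := by
  simp only [bq, dotProduct, Matrix.mulVec, Finset.mul_sum, star_trivial]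
  exact Finset.sum_congr rfl fun i _ => Finset.sum_congr rfl fun j _ => by ring

lemma bq_psd {Q : Matrix (Fin (d + 1)) (Fin (d + 1)) ℝ} (h : Q.PosSemidef) (x : Eucl (d + 1)) : 0 ≤ bq Q x x := by
  rw [bq_dot]; exact h.dotProduct_mulVec_nonneg _
lemma bq_sub (Q R : Matrix (Fin (d + 1)) (Fin (d + 1)) ℝ) (x : Eucl (d + 1)) : bq (Q - R) x x = bq Q x x - bq R x x := by
  simp only [bq, Matrix.sub_apply, sub_mul, Finset.sum_sub_distrib]
lemma bq_one (c : ℝ) (x : Eucl (d + 1)) : bq (c • (1 : Matrix (Fin (d + 1)) (Fin (d + 1)) ℝ)) x x = c * ‖x‖ ^ 2 := by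
  rw [← nsq, bq, Finset.mul_sum]
  refine Finset.sum_congr rfl fun i _ => ?_
  rw [Finset.sum_eq_single i]
  · simp [sq]
  · intro j _ hj; simp [Matrix.one_apply_ne hj.symm]
  · simp
lemma bq_single (Q : Matrix (Fin (d + 1)) (Fin (d + 1)) ℝ) (i j : Fin (d + 1)) (a b : ℝ) :
    bq Q (EuclideanSpace.single i a) (EuclideanSpace.single j b) = Q i j * (a * b) := by
  simp [bq, PiLp.single_apply]
lemma bq_addl (Q : Matrix (Fin (d + 1)) (Fin (d + 1)) ℝ) (x x' y : Eucl (d + 1)) : bq Q (x + x') y = bq Q x y + bq Q x' y := by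
  simp only [bq, PiLp.add_apply, add_mul, mul_add, Finset.sum_add_distrib]
lemma bq_addr (Q : Matrix (Fin (d + 1)) (Fin (d + 1)) ℝ) (x y y' : Eucl (d + 1)) : bq Q x (y + y') = bq Q x y + bq Q x y' := by
  simp only [bq, PiLp.add_apply, mul_add, Finset.sum_add_distrib]

lemma Q_entry {Q : Matrix (Fin (d + 1)) (Fin (d + 1)) ℝ} {K : ℝ} (hs : Q.IsSymm) (h0 : ∀ x, 0 ≤ bq Q x x) (h1 : ∀ x, bq Q x x ≤ K * ‖x‖ ^ 2) (i j) : |Q i j| ≤ K := by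
  have e : ∀ a b : ℝ, bq Q (EuclideanSpace.single i a + EuclideanSpace.single j b) (EuclideanSpace.single i a + EuclideanSpace.single j b) = Q i i * a ^ 2 + 2 * Q i j * (a * b) + Q j j * b ^ 2 := fun a b => by
    rw [bq_addl, bq_addr, bq_addr, bq_single, bq_single, bq_single, bq_single, hs.apply i j]; ring
  have di : ∀ i, Q i i ≤ K := fun i => by
    have := h1 (EuclideanSpace.single i 1)
    rw [bq_single] at this; simpa using this
  have p := h0 (EuclideanSpace.single i 1 + EuclideanSpace.single j 1)
  have m := h0 (EuclideanSpace.single i 1 + EuclideanSpace.single j (-1))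
  rw [e] at p m
  have := di i
  have := di j
  rw [abs_le]; constructor <;> linarith

lemma op_entry (A : Matrix (Fin (d + 1)) (Fin (d + 1)) ℝ) (i j) : |A i j| ≤ matOpNorm A := by
  have h := (LinearMap.toContinuousLinearMap (Matrix.toEuclideanLin A)).le_opNorm (EuclideanSpace.single j 1)
  have h2 := coord_le ((LinearMap.toContinuousLinearMap (Matrix.toEuclideanLin A)) (EuclideanSpace.single j 1)) i
  have e : ((LinearMap.toContinuousLinearMap (Matrix.toEuclideanLin A)) (EuclideanSpace.single j 1)) i = A i j := by
    simp [Matrix.toLpLin_apply]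
  rw [e] at h2
  simpa [matOpNorm] using h2.trans h

lemma lipI {f f' : ℝ → ℝ} {L : ℝ} (h : ∀ t ∈ Icc (-1:ℝ) 0, HasDerivWithinAt f (f' t) (Icc (-1:ℝ) 0) t) (hb : ∀ t ∈ Icc (-1:ℝ) 0, |f' t| ≤ L) (s t : ℝ) :
    |f (cl s) - f (cl t)| ≤ L * |s - t| := by
  have h0 : 0 ≤ L := (abs_nonneg _).trans (hb 0 (by norm_num))
  have := (convex_Icc (-1:ℝ) 0).norm_image_sub_le_of_norm_hasDerivWithin_le h hb (cl_mem t) (cl_mem s)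
  simp only [Real.norm_eq_abs] at this
  exact this.trans (mul_le_mul_of_nonneg_left (cl_lip s t) h0)

/-- coefficients extended to all times -/
def mkCo {lam Λ M C₀ : ℝ} {Q Q' : ℝ → Matrix (Fin (d + 1)) (Fin (d + 1)) ℝ} {v v' : ℝ → Eucl (d + 1)} (h : ObliqueData d lam Λ M C₀ Q Q' v v') : Co d where
  lam := lam
  Q t := Q (cl t)
  v t := v (cl t)
  c := (Λ * M ^ 2)⁻¹
  K := Λ * M ^ 2
  L := (C₀ + 1) / lam
  hlam := h.lam_pos
  hlam1 := h.lam_le_one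
  hc := by have := h.Lam_ge_one; have := h.M_ge_one; positivity
  hK := by have := h.Lam_ge_one; have := h.M_ge_one; positivity
  hL := by have := h.C0_pos; have := h.lam_pos; positivity
  sym t := h.Qsymm _ (cl_mem t)
  psd t := by
    have := h.Lam_ge_one; have := h.M_ge_one
    have h1 := (h.Qlower _ (cl_mem t)).add (Matrix.PosSemidef.one.smul (show 0 ≤ (Λ * M ^ 2)⁻¹ by positivity))
    simpa using h1
  Qn t := by
    have h1 := bq_psd (h.Qlower _ (cl_mem t)) (EuclideanSpace.single (Fin.last d) 1)
    rw [bq_sub, bq_one, bq_single] at h1; simpa using h1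
  vn t := by
    refine le_trans ?_ (h.vlast _ (cl_mem t))
    have := h.Lam_ge_one; have := h.M_ge_one
    exact inv_anti₀ (by positivity) (by nlinarith)
  Qb t i j := by
    have := h.Lam_ge_one; have := h.M_ge_one
    refine Q_entry (h.Qsymm _ (cl_mem t)) (fun x => ?_) (fun x => ?_) i j
    · have h1 := bq_psd (h.Qlower _ (cl_mem t)) x
      rw [bq_sub, bq_one] at h1
      have : 0 ≤ (Λ * M ^ 2)⁻¹ * ‖x‖ ^ 2 := by positivity
      linarith
    · have h1 := bq_psd (h.Qupper _ (cl_mem t)) x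
      rw [bq_sub, bq_one] at h1
      linarith
  vb t i := by
    refine (coord_le _ i).trans ((h.vbound _ (cl_mem t)).trans ?_)
    have := h.Lam_ge_one; have := h.M_ge_one
    nlinarith
  Ql s t i j := by
    refine lipI (fun t ht => h.Qderiv t ht i j) (fun t ht => (op_entry _ i j).trans ((h.Qderiv_bound t ht).trans ?_)) s t
    have := h.lam_pos
    gcongr; linarith
  vl s t i := by
    refine lipI (f := fun s => v s i) (f' := fun s => v' s i) (fun t ht => ?_) (fun t ht => (coord_le _ i).trans ((h.vderiv_bound t ht).trans ?_)) s t
    · exact ((EuclideanSpace.proj i : Eucl (d + 1) →L[ℝ] ℝ).hasFDerivAt.comp_hasDerivWithinAt t (h.vderiv t ht))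
    · have := h.lam_pos; have := h.C0_pos
      rw [inv_eq_one_div]; gcongr; linarith

lemma mkCo_ell {lam Λ M C₀ : ℝ} {Q Q' : ℝ → Matrix (Fin (d + 1)) (Fin (d + 1)) ℝ} {v v' : ℝ → Eucl (d + 1)} (h : ObliqueData d lam Λ M C₀ Q Q' v v') (t x) :
    (mkCo h).c * ‖x‖ ^ 2 ≤ bq ((mkCo h).Q t) x x := by
  have h1 := bq_psd (h.Qlower _ (cl_mem t)) x
  rw [bq_sub, bq_one] at h1
  have : 0 ≤ bq (Q (cl t)) x x - (Λ * M ^ 2)⁻¹ * ‖x‖ ^ 2 := h1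
  show (Λ * M ^ 2)⁻¹ * ‖x‖ ^ 2 ≤ bq (Q (cl t)) x x
  linarith

lemma sub_co {lam : ℝ} {Q Q2 : ℝ → Matrix (Fin (d + 1)) (Fin (d + 1)) ℝ} {v v2 : ℝ → Eucl (d + 1)} {η} (hQ : ∀ t ∈ Icc (-1:ℝ) 0, Q2 t = Q t) (hv : ∀ t ∈ Icc (-1:ℝ) 0, v2 t = v t)
    (h : ObliqueSub d lam Q v η) : ObliqueSub d lam Q2 v2 η := by
  refine ⟨h.1, fun φ φt gφ Hφ p ρ hρ hφ ht => ?_⟩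
  obtain ⟨h1, h2⟩ := h.2 φ φt gφ Hφ p ρ hρ hφ ht
  refine ⟨fun hp => ?_, fun hp => ?_⟩
  · rw [hQ _ ⟨hp.2.2.1.le, hp.2.2.2⟩]; exact h1 hp
  · rw [hv _ ⟨hp.2.2.1.le, hp.2.2.2⟩]; exact h2 hp

lemma sup_neg {lam : ℝ} {Q : ℝ → Matrix (Fin (d + 1)) (Fin (d + 1)) ℝ} {v : ℝ → Eucl (d + 1)} {η} (h : ObliqueSup d lam Q v η) : ObliqueSub d lam Q v (fun p => - η p) := by
  refine ⟨h.1.neg, fun φ φt gφ Hφ p ρ hρ hφ ht => ?_⟩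
  obtain ⟨h1, h2⟩ := h.2 (fun p => -φ p) (fun p => -φt p) (fun p => -gφ p) (fun p => -Hφ p) p ρ hρ
    ⟨hφ.contPhi.neg, hφ.contPhit.neg, hφ.contGrad.neg, hφ.contHess.neg, fun p hp => (hφ.symmHess p hp).neg, fun p hp => (hφ.timeDeriv p hp).neg,
      fun p hp => by
        have := (hφ.spaceGrad p hp).hasFDerivWithinAt.neg
        rw [← map_neg] at this
        exact hasGradientWithinAt_iff_hasFDerivWithinAt.2 this, fun p hp => by
        have := (hφ.spaceHess p hp).neg
        rw [← map_neg, ← map_neg] at this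
        exact this⟩
    ⟨ht.1, by have := ht.2.1; simp only [] at this; linarith, fun q hq => by have := ht.2.2 q hq; linarith⟩
  refine ⟨fun hp => ?_, fun hp => ?_⟩
  · have := h1 hp; rw [Matrix.mul_neg, Matrix.trace_neg] at this; linarith
  · have := h2 hp; rw [inner_neg_right] at this; linarith
end
end OB
end


noncomputable section
namespace OB
open Filter Topology Complex

section
variable {d : ℕ} (W : Co d)

def Xm (p : XX d) : Eucl (d + 1) := WithLp.toLp 2 (Fin.snoc (α := fun _ => ℝ) (fun i => Real.arcsin (p.1 i : ℂ).im) (p.2.1 : ℝ))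
lemma Xm_cont : Continuous (Xm : XX d → _) := by
  refine (PiLp.continuous_toLp 2 _).comp (continuous_pi fun i => ?_)
  refine Fin.lastCases ?_ (fun j => ?_) i
  · simp only [Fin.snoc_last]; fun_prop
  · simp only [Fin.snoc_castSucc]
    exact Real.continuous_arcsin.comp (continuous_im.comp (continuous_subtype_val.comp ((continuous_apply j).comp continuous_fst)))
def Rm (p : XX d) : SpaceTime (d + 1) := ((3 / 4 / max (3 / 4) ‖Xm p‖) • Xm p, max (p.2.2 : ℝ) (-(3 / 4)))
lemma Rm_cont : Continuous (Rm : XX d → _) := by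
  have := Xm_cont (d := d)
  refine (Continuous.smul (continuous_const.div (continuous_const.max this.norm) fun p => ?_) this).prodMk (by fun_prop)
  exact (lt_max_of_lt_left (by norm_num)).ne'
lemma Rm_mem (p : XX d) : Rm p ∈ GS d := by
  have h0 : 0 < max (3 / 4) ‖Xm p‖ := lt_max_of_lt_left (by norm_num)
  refine ⟨?_, ?_, le_max_right _ _, max_le p.2.2.2.2 (by norm_num)⟩
  · simp only [Rm, norm_smul]
    rw [Real.norm_of_nonneg (by positivity), div_mul_eq_mul_div, div_le_iff₀ h0]
    exact mul_le_mul_of_nonneg_left (le_max_right _ _) (by norm_num)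
  · show 0 ≤ (3 / 4 / max (3 / 4) ‖Xm p‖) * Xm p (Fin.last d)
    refine mul_nonneg (by positivity) ?_
    simp only [Xm, Fin.snoc_last]; exact p.2.1.2.1

def xp (p : SpaceTime (d + 1)) (h1 : lastC p.1 ∈ Icc (0:ℝ) 1) (h2 : p.2 ∈ Icc (-1:ℝ) 0) : XX d := (zz p.1, ⟨lastC p.1, h1⟩, ⟨p.2, h2⟩)
lemma Xm_xp (p : SpaceTime (d + 1)) (h1 h2) (hx : ‖p.1‖ ≤ 1) : Xm (xp p h1 h2) = p.1 := by
  ext i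
  refine Fin.lastCases ?_ (fun j => ?_) i
  · simp [Xm, xp, lastC]
  · have h := abs_le.1 ((coord_le p.1 j.castSucc).trans hx)
    have := Real.pi_gt_three
    have e : (zz p.1 j : ℂ).im = Real.sin (p.1 j.castSucc) := by
      rw [zz, Circle.coe_exp, exp_ofReal_mul_I_im]
    simp only [Xm, xp, Fin.snoc_castSucc, e]
    exact Real.arcsin_sin (by linarith) (by linarith)
lemma Rm_xp (p : SpaceTime (d + 1)) (h1 h2) (hp : p ∈ GS d) : Rm (xp p h1 h2) = p := by
  rw [Rm, Xm_xp p h1 h2 (by linarith [hp.1]), max_eq_left hp.1, div_self (by norm_num), one_smul]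
  simp [xp, hp.2.2.1]

def IG (d : ℕ) (r s : ℝ) : Set (SpaceTime (d + 1)) := {p | ‖p.1‖ ≤ r ∧ 0 ≤ lastC p.1 ∧ -s ≤ p.2 ∧ p.2 ≤ 0}

lemma smul_neg_u (V : Reg (d + 1)) (p) : (Reg.smul (-1) V).u p = - V.u p ∧ (Reg.smul (-1) V).ut p = - V.ut p ∧ (Reg.smul (-1) V).g p = - V.g p := by
  simp [Reg.smul]

lemma approx {η : SpaceTime (d + 1) → ℝ} (h1 : ObliqueSub d W.lam W.Q W.v η) (h2 : ObliqueSub d W.lam W.Q W.v (fun p => - η p)) (hb : ∀ p ∈ KcP d 1, |η p| ≤ 1) {θ ε : ℝ} (hθ : 0 < θ) (hε : 0 < ε) :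
    ∃ P : Pack d, ∀ p ∈ IG d (1 / 2) (1 / 2), |η p - (Pack.reg P).u p| ≤ θ ∧ |W.lam * (Pack.reg P).ut p - (Pack.reg P).L (W.Q p.2) p| ≤ ε ∧
      (lastC p.1 = 0 → |(Pack.reg P).ut p - ⟪W.v p.2, (Pack.reg P).g p⟫| ≤ ε) := by
  have hl := W.hlam
  have hCW : 0 ≤ CW W := by have := W.hK; unfold CW; positivity
  let N : ℝ := 200 * CW W / (θ / 2)
  have hN0 : 0 ≤ N := by positivity
  have hN : 200 * CW W ≤ N * (θ / 2) := by simp only [N]; rw [div_mul_cancel₀ _ (by positivity)]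
  let ε' : ℝ := min ε (min (W.lam / 3) (W.lam * (θ / 2) / 2))
  have hε' : 0 < ε' := lt_min hε (lt_min (by positivity) (by positivity))
  have e1 : ε' ≤ ε := min_le_left _ _
  have e2 : ε' ≤ W.lam / 3 := (min_le_right _ _).trans (min_le_left _ _)
  have e3 : ε' < W.lam * (θ / 2) := lt_of_le_of_lt ((min_le_right _ _).trans (min_le_right _ _)) (half_lt_self (by positivity))
  have cx := Xm_cont (d := d)
  let χ : C(XX d, ℝ) := ⟨fun p => N * (qf (Xm p) + tf p.2.2), by unfold qf tf; fun_prop⟩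
  have cη : Continuous fun p : XX d => η (Rm p) :=
    continuousOn_univ.1 (h1.1.comp Rm_cont.continuousOn fun p _ => GS_sub (Rm_mem p))
  let F : C(XX d, ℝ) := ⟨fun p => χ p * (η (Rm p) * min 1 (4 * (1 + (p.2.2:ℝ)))), χ.continuous.mul (cη.mul (by fun_prop))⟩
  have hχ : ∀ p, 0 ≤ χ p := fun p => mul_nonneg hN0 (add_nonneg (le_max_right _ _) (le_max_right _ _))
  have hF : ∀ p, |F p| ≤ χ p := fun p => by
    show |χ p * (η (Rm p) * min 1 (4 * (1 + (p.2.2:ℝ))))| ≤ χ p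
    have a := hb _ (GS_sub (Rm_mem p))
    have t1 := p.2.2.2.1
    have b : |min 1 (4 * (1 + (p.2.2:ℝ)))| ≤ 1 := by
      rw [abs_of_nonneg (le_min zero_le_one (by linarith))]; exact min_le_left _ _
    rw [abs_mul, abs_mul, abs_of_nonneg (hχ p)]
    exact mul_le_of_le_one_right (hχ p) (mul_le_one₀ a (abs_nonneg _) b)
  obtain ⟨P, hP, H⟩ := penal W F χ (fun z y => by simp [F, tm]) hε'
  have key : ∀ {a b f x e : ℝ}, 0 ≤ x → |f| ≤ x → |a + x * b - f| ≤ ε' → 1 ≤ e → (1 < b → a ≤ ε' * e) ∧ (b < -1 → -(ε' * e) ≤ a) := by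
    intro a b f x e hx hf h he
    have h := abs_le.1 h
    have hf := abs_le.1 hf
    have : ε' ≤ ε' * e := le_mul_of_one_le_right hε'.le he
    exact ⟨fun hb => by nlinarith, fun hb => by nlinarith⟩
  have he : ∀ t : Icc (-1:ℝ) 0, 1 ≤ Real.exp (1 * ((t:ℝ) + 1)) := fun t => Real.one_le_exp (by linarith [t.2.1])
  have hU : ∀ p, |U0 P p| ≤ 2 := fun p => by
    have := wmp_abs W P hP (m := ε') (γ := 1) (s := 1) hε'.le one_pos zero_le_one
      (fun z y t => key (hχ _) (hF _) (H z y t).1 (he t)) (fun z t => key (hχ _) (hF _) (H z 0 t).2 (he t)) p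
    refine this.trans ?_
    have h3 : Real.exp (1 * ((p.2.2:ℝ) + 1)) ≤ 3 :=
      (Real.exp_le_exp.2 (by linarith [p.2.2.2.2])).trans Real.exp_one_lt_three.le
    have h4 : ε' / (W.lam * 1) ≤ 1 / 3 := by rw [div_le_iff₀ (by positivity)]; linarith
    have : ε' / (W.lam * 1) * Real.exp (1 * ((p.2.2:ℝ) + 1)) ≤ 1 / 3 * 3 := mul_le_mul h4 h3 (Real.exp_pos _).le (by norm_num)
    linarith
  have main : ∀ p ∈ GS d, |(Pack.reg P).u p| ≤ 2 ∧ |W.lam * (Pack.reg P).ut p - (Pack.reg P).L (W.Q p.2) p - N * (qf p.1 + tf p.2) * (η p - (Pack.reg P).u p)| ≤ ε' ∧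
      (lastC p.1 = 0 → |(Pack.reg P).ut p - ⟪W.v p.2, (Pack.reg P).g p⟫ - N * (qf p.1 + tf p.2) * (η p - (Pack.reg P).u p)| ≤ ε') := by
    intro p hp
    have i1 : lastC p.1 ∈ Icc (0:ℝ) 1 := ⟨hp.2.1, (le_abs_self _).trans ((coord_le p.1 (Fin.last d)).trans (by linarith [hp.1]))⟩
    have i2 : p.2 ∈ Icc (-1:ℝ) 0 := ⟨by linarith [hp.2.2.1], hp.2.2.2⟩
    have u0 : U0 P (xp p i1 i2) = (Pack.reg P).u p := by rw [Pack.reg_u]; rfl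
    have eF : F (xp p i1 i2) = N * (qf p.1 + tf p.2) * η p := by
      show N * (qf (Xm (xp p i1 i2)) + tf p.2) * (η (Rm (xp p i1 i2)) * min 1 (4 * (1 + p.2))) = _
      rw [Xm_xp p i1 i2 (by linarith [hp.1]), Rm_xp p i1 i2 hp, min_eq_left (by linarith [hp.2.2.1]), mul_one]
    have eχ : χ (xp p i1 i2) = N * (qf p.1 + tf p.2) := by
      show N * (qf (Xm (xp p i1 i2)) + tf p.2) = _
      rw [Xm_xp p i1 i2 (by linarith [hp.1])]
    refine ⟨u0 ▸ hU _, ?_, fun h0 => ?_⟩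
    · have := (H (zz p.1) ⟨lastC p.1, i1⟩ ⟨p.2, i2⟩).1
      change |U1 W P (xp p i1 i2) + χ (xp p i1 i2) * U0 P (xp p i1 i2) - F (xp p i1 i2)| ≤ ε' at this
      rw [u0, eF, eχ] at this
      rw [Pack.reg_1 P (W.sym _)]
      refine le_trans (le_of_eq ?_) this
      congr 1
      show _ = (sm (Trm.c1 W.lam (W.Q p.2) (lastC p.1) p.2) P (zz p.1)).re + _ - _
      ring
    · have := (H (zz p.1) ⟨lastC p.1, i1⟩ ⟨p.2, i2⟩).2
      have e0 : ((zz p.1, 0, ⟨p.2, i2⟩) : XX d) = xp p i1 i2 := by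
        unfold xp; congr; exact Subtype.ext h0.symm
      rw [e0, u0, eF, eχ] at this
      rw [Pack.reg_2 P _ _ h0]
      refine le_trans (le_of_eq ?_) this
      congr 1
      show _ = (sm (Trm.c2 (W.v p.2) p.2) P (zz p.1)).re + _ - _
      ring
  refine ⟨P, fun p hp => ?_⟩
  obtain ⟨p1, p2, p3, p4⟩ := hp
  have hp : p ∈ GS d := ⟨by linarith, p2, by linarith, p4⟩
  have q0 : qf p.1 = 0 := max_eq_right (by nlinarith [norm_nonneg p.1])
  have t0 : tf p.2 = 0 := max_eq_right (by linarith)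
  obtain ⟨m1, m2, m3⟩ := main p hp
  rw [q0, t0] at m2 m3
  simp only [add_zero, mul_zero, zero_mul, sub_zero] at m2 m3
  refine ⟨?_, m2.trans e1, fun h => (m3 h).trans e1⟩
  have A := comp_sub W h1 (fun p hp => (abs_le.1 (hb p hp)).2) (Pack.reg P) (half_pos hθ) (half_pos hθ) hN e3 (fun p hp => (abs_le.1 (main p hp).1).1)
    (fun p hp => by have := (abs_le.1 (main p hp).2.1).1; linarith) (fun p hp h0 => by have := (abs_le.1 ((main p hp).2.2 h0)).1; linarith) hp p1 p3
  have B := comp_sub W h2 (fun p hp => by linarith [(abs_le.1 (hb p hp)).1]) (Reg.smul (-1) (Pack.reg P)) (half_pos hθ) (half_pos hθ) hN e3 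
    (fun p hp => by rw [(smul_neg_u _ p).1]; linarith [(abs_le.1 (main p hp).1).2])
    (fun p hp => by
      have := (abs_le.1 (main p hp).2.1).2
      rw [(smul_neg_u _ p).1, (smul_neg_u _ p).2.1, Reg.L_smul]; linarith)
    (fun p hp h0 => by
      have := (abs_le.1 ((main p hp).2.2 h0)).2
      rw [(smul_neg_u _ p).1, (smul_neg_u _ p).2.1, (smul_neg_u _ p).2.2, inner_neg_right]; linarith) hp p1 p3
  rw [(smul_neg_u _ p).1] at B
  rw [abs_le]; constructor <;> linarith
end
end OB
end


noncomputable section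
namespace OB
open Filter Topology Complex

section
variable {d : ℕ} (W : Co d)

def mm (κ : ℤ) (s : ℝ) : ℂ := if κ = 0 then s else (cexp (I * κ * s) - 1) / (I * κ)
lemma mm_der (κ : ℤ) (s : ℝ) : HasDerivAt (mm κ) (cexp (I * κ * s)) s := by
  by_cases h : κ = 0
  · have : mm κ = fun s : ℝ => (s:ℂ) := by funext s; simp [mm, h]
    rw [this, h]; simpa using (hasDerivAt_id s).ofReal_comp
  · have e : mm κ = fun s : ℝ => (cexp (I * κ * s) - 1) / (I * κ) := by funext s; simp [mm, h]
    have hk : I * (κ:ℂ) ≠ 0 := mul_ne_zero I_ne_zero (by exact_mod_cast h)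
    have h1 : HasDerivAt (fun s : ℝ => I * (κ:ℂ) * s) (I * κ) s := by simpa using (hasDerivAt_id s).ofReal_comp.const_mul (I * (κ:ℂ))
    have := (h1.cexp.sub_const 1).div_const (I * (κ:ℂ))
    rw [e]; rwa [mul_div_assoc, div_self hk, mul_one] at this
lemma mm_k (κ : ℤ) (s : ℝ) : I * κ * mm κ s = cexp (I * κ * s) - 1 := by
  by_cases h : κ = 0
  · simp [mm, h]
  · have hk : I * (κ:ℂ) ≠ 0 := mul_ne_zero I_ne_zero (by exact_mod_cast h)
    rw [mm, if_neg h, mul_div_cancel₀ _ hk]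
lemma mm_0 (κ : ℤ) : mm κ 0 = 0 := by simp [mm]

abbrev cs (i : Fin d) (s : ℝ) : Eucl (d + 1) := EuclideanSpace.single i.castSucc s
lemma ee_cs (k : Fin d → ℤ) (x : Eucl (d + 1)) (i : Fin d) (s : ℝ) : ee k (x + cs i s) = ee k x * cexp (I * k i * s) := by
  have : th k (cs i s) = k i * s := by
    simp only [th_apply, PiLp.single_apply, cs, (Fin.castSucc_injective d).eq_iff]; simp
  rw [ee, ee, map_add, this, ← Complex.exp_add]; push_cast; ring_nf

/-- value of a functional along tangential translations -/
def va (c : Trm d → ℂ) (P : Pack d) (x : Eucl (d + 1)) : ℝ := (sm c P (zz x)).re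
def Lc (c : Trm d → ℂ) : Prop := ∀ m τ, c (Trm.mul m τ) = m * c τ
def av (i : Fin d) (δ : ℝ) (k : Fin d → ℤ) : ℂ := mm (k i) δ / δ

lemma va_cons (c : Trm d → ℂ) (τ : Trm d) (P : Pack d) (x) : va c (τ :: P) x = (c τ * ee τ.k x).re + va c P x := by
  simp [va, sm, ez_zz]
lemma va_mc {c : Trm d → ℂ} (hc : Lc c) (m : (Fin d → ℤ) → ℂ) (τ : Trm d) (P : Pack d) (x) : va c (Pack.mult m (τ :: P)) x = (m τ.k * (c τ * ee τ.k x)).re + va c (Pack.mult m P) x := by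
  rw [Pack.mult, List.map_cons, va_cons, hc, mul_assoc]; rfl
lemma va_mm {c : Trm d → ℂ} (hc : Lc c) (m m' : (Fin d → ℤ) → ℂ) (P : Pack d) (x) : va c (Pack.mult m (Pack.mult m' P)) x = va c (Pack.mult (m * m') P) x := by
  induction P with
  | nil => rfl
  | cons τ l ih =>
    have : Pack.mult m' (τ :: l) = τ.mul (m' τ.k) :: Pack.mult m' l := rfl
    rw [this, va_mc hc, ih, va_mc hc, hc]; simp [Trm.mul, mul_assoc]

lemma va_avg {c : Trm d → ℂ} (hc : Lc c) (i : Fin d) {δ : ℝ} (hδ : 0 < δ) (P : Pack d) (x) :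
    ∃ s ∈ Ioo 0 δ, va c (Pack.mult (av i δ) P) x = va c P (x + cs i s) := by
  have hd : ∀ s : ℝ, HasDerivAt (fun s => va c (Pack.mult (fun k => mm (k i) s) P) x) (va c P (x + cs i s)) s := fun s => by
    induction P with
    | nil => simpa [va, sm, Pack.mult] using hasDerivAt_const s (0:ℝ)
    | cons τ l ih =>
      simp only [va_mc hc, va_cons]
      refine HasDerivAt.add ?_ ih
      rw [ee_cs]
      have := (mm_der (τ.k i) s).mul_const (c τ * ee τ.k x)
      rw [show c τ * (ee τ.k x * cexp (I * τ.k i * s)) = cexp (I * τ.k i * s) * (c τ * ee τ.k x) by ring]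
      exact (reCLM.hasFDerivAt.comp_hasDerivAt s this)
  obtain ⟨s, hs, h⟩ := exists_hasDerivAt_eq_slope _ _ hδ (fun s _ => (hd s).continuousAt.continuousWithinAt) fun s _ => hd s
  refine ⟨s, hs, ?_⟩
  rw [h]
  clear h hd
  induction P with
  | nil => simp [va, sm, Pack.mult]
  | cons τ l ih =>
    simp only [va_mc hc, ih, av, mm_0, zero_mul, zero_re]
    rw [div_mul_eq_mul_div, div_ofReal_re]; ring

lemma va_dif {c : Trm d → ℂ} (hc : Lc c) (i : Fin d) (δ : ℝ) (P : Pack d) (x) :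
    va c (Pack.mult (fun k => I * k i * av i δ k) P) x = (va c P (x + cs i δ) - va c P x) / δ := by
  induction P with
  | nil => simp [va, sm, Pack.mult]
  | cons τ l ih =>
    rw [va_mc hc, ih, va_cons, va_cons, ee_cs, av, ← mul_div_assoc, mm_k, div_mul_eq_mul_div, div_ofReal_re,
      show (cexp (I * τ.k i * δ) - 1) * (c τ * ee τ.k x) = c τ * (ee τ.k x * cexp (I * τ.k i * δ)) - c τ * ee τ.k x by ring, sub_re]
    ring

def EE (m : (Fin d → ℤ) → ℂ) (r : ℝ) : Prop := ∀ (c : Trm d → ℂ) (_ : Lc c) (P : Pack d) (x : Eucl (d + 1)), ∃ ξ : Eucl (d + 1), lastC ξ = 0 ∧ ‖ξ‖ ≤ r ∧ va c (Pack.mult m P) x = va c P (x + ξ)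
def BB (m : (Fin d → ℤ) → ℂ) (r C : ℝ) : Prop := ∀ (c : Trm d → ℂ) (_ : Lc c) (P : Pack d) (x : Eucl (d + 1)) (S : ℝ),
  (∀ ξ : Eucl (d + 1), lastC ξ = 0 → ‖ξ‖ ≤ r → |va c P (x + ξ)| ≤ S) → |va c (Pack.mult m P) x| ≤ C * S

lemma last_add (x y : Eucl (d + 1)) : lastC (x + y) = lastC x + lastC y := rfl
lemma EE.comp {m m' : (Fin d → ℤ) → ℂ} {r r' : ℝ} (h : EE m r) (h' : EE m' r') : EE (m * m') (r + r') := fun c hc P x => by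
  obtain ⟨ξ, a1, a2, a3⟩ := h c hc (Pack.mult m' P) x
  obtain ⟨ζ, b1, b2, b3⟩ := h' c hc P (x + ξ)
  exact ⟨ξ + ζ, by rw [last_add, a1, b1, add_zero], (norm_add_le _ _).trans (add_le_add a2 b2), by rw [← va_mm hc, a3, b3, add_assoc]⟩
lemma EE.one : EE (1 : (Fin d → ℤ) → ℂ) 0 := fun c hc P x => ⟨0, rfl, by simp, by
  rw [add_zero]
  induction P with
  | nil => rfl
  | cons τ l ih => rw [va_mc hc, ih, va_cons]; simp⟩
lemma EE.bb {m : (Fin d → ℤ) → ℂ} {r : ℝ} (h : EE m r) : BB m r 1 := fun c hc P x S hS => by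
  obtain ⟨ξ, a1, a2, a3⟩ := h c hc P x
  rw [a3, one_mul]; exact hS ξ a1 a2
lemma BB.comp {m m' : (Fin d → ℤ) → ℂ} {r r' C C' : ℝ} (h : BB m r C) (h' : BB m' r' C') : BB (m * m') (r + r') (C * C') := fun c hc P x S hS => by
  rw [← va_mm hc, mul_assoc]
  refine h c hc _ x _ fun ξ a1 a2 => h' c hc _ _ _ fun ζ b1 b2 => ?_
  rw [add_assoc]; exact hS _ (by rw [last_add, a1, b1, add_zero]) ((norm_add_le _ _).trans (add_le_add a2 b2))
lemma last_cs (i : Fin d) (s : ℝ) : lastC (cs i s) = 0 := by simp [lastC, cs, Fin.castSucc_ne_last]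
lemma EE_av (i : Fin d) {δ : ℝ} (hδ : 0 < δ) : EE (av i δ) δ := fun c hc P x => by
  obtain ⟨s, hs, h⟩ := va_avg hc i hδ P x
  exact ⟨cs i s, last_cs i s, by simp [cs, abs_of_pos hs.1, hs.2.le], h⟩
lemma BB_dif (i : Fin d) {δ : ℝ} (hδ : 0 < δ) : BB (fun k => I * k i * av i δ k) δ (2 / δ) := fun c hc P x S hS => by
  rw [va_dif hc i δ, abs_div, abs_of_pos hδ, div_mul_eq_mul_div]
  gcongr
  have h1 := hS (cs i δ) (last_cs i δ) (by simp [cs, abs_of_pos hδ])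
  have h2 := hS 0 rfl (by simp [hδ.le])
  rw [add_zero] at h2
  exact (abs_sub _ _).trans (by linarith)

def ma (δ : ℝ) (s : Finset (Fin d)) : (Fin d → ℤ) → ℂ := ∏ i ∈ s, av i δ
lemma EE_ma {δ : ℝ} (hδ : 0 < δ) (s : Finset (Fin d)) : EE (ma δ s) (s.card * δ) := by
  induction s using Finset.induction_on with
  | empty => simpa [ma] using EE.one
  | insert i s hi ih =>
    rw [ma, Finset.prod_insert hi, Finset.card_insert_of_notMem hi]
    convert (EE_av i hδ).comp ih using 1
    · rfl
    · push_cast; ring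
def Ik (i : Fin d) : (Fin d → ℤ) → ℂ := fun k => I * k i
lemma BB_ma {δ : ℝ} (hδ : 0 < δ) (i : Fin d) : BB (Ik i * ma δ Finset.univ) (d * δ) (2 / δ) := by
  have := (BB_dif i hδ).comp (EE_ma hδ (Finset.univ.erase i)).bb
  rw [mul_one] at this
  convert this using 1
  · rw [ma, ma, ← Finset.mul_prod_erase _ _ (Finset.mem_univ i), ← mul_assoc]; rfl
  · have : 0 < d := i.pos
    rw [Finset.card_erase_of_mem (Finset.mem_univ i), Finset.card_univ, Fintype.card_fin, Nat.cast_sub this]; push_cast; ring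

def dP : List (Fin d) → Pack d → Pack d
  | [], P => P
  | i :: l, P => Pack.mult (Ik i) (dP l P)
lemma va_dP {c : Trm d → ℂ} (hc : Lc c) (l : List (Fin d)) (m) (P : Pack d) : va c (dP l (Pack.mult m P)) = va c (Pack.mult ((l.map Ik).prod * m) P) := by
  have : ∀ n x, va c (Pack.mult n (dP l (Pack.mult m P))) x = va c (Pack.mult (n * ((l.map Ik).prod * m)) P) x := by
    induction l with
    | nil => intro n x; simp [dP, va_mm hc]
    | cons i l ih => intro n x; rw [dP, va_mm hc, ih]; simp [mul_assoc]
  funext x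
  cases l with
  | nil => simp [dP]
  | cons i l => 
    have h2 := this 1 x
    rw [one_mul, dP, va_mm hc, one_mul] at h2
    exact h2
lemma BB_l {δ : ℝ} (hδ : 0 < δ) (l : List (Fin d)) : BB ((l.map Ik).prod * ma δ Finset.univ ^ l.length) (l.length * (d * δ)) ((2 / δ) ^ l.length) := by
  induction l with
  | nil => simpa using EE.one.bb
  | cons i l ih =>
    convert (BB_ma hδ i).comp ih using 1
    · simp [pow_succ]; ring
    · simp; ring
    · simp [pow_succ]; ring
lemma EE_pow {δ : ℝ} (hδ : 0 < δ) (n : ℕ) : EE (ma δ (Finset.univ : Finset (Fin d)) ^ n) (n * (d * δ)) := by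
  induction n with
  | zero => simpa using EE.one
  | succ n ih =>
    convert ih.comp (EE_ma hδ Finset.univ) using 1
    · rfl
    · simp; ring

lemma Lc0 (y t : ℝ) : Lc (Trm.c0 (d := d) y t) := fun m τ => Trm.c0_mul m y t τ
lemma Lc1 (lam Q y t) : Lc (Trm.c1 (d := d) lam Q y t) := fun m τ => Trm.c1_mul m _ _ _ _ τ
lemma Lc2 (v t) : Lc (Trm.c2 (d := d) v t) := fun m τ => Trm.c2_mul m _ _ τ

def Rs (ε : ℝ) (V : Reg (d + 1)) (S : Set (SpaceTime (d + 1))) : Prop := ∀ p ∈ S, |W.lam * V.ut p - V.L (W.Q p.2) p| ≤ ε ∧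
      (lastC p.1 = 0 → |V.ut p - ⟪W.v p.2, V.g p⟫| ≤ ε)

lemma IG_sh {p : SpaceTime (d + 1)} (hp : p ∈ IG d (1 / 4) (1 / 2)) {ξ} (h1 : lastC ξ = 0) (h2 : ‖ξ‖ ≤ 1 / 4) : (p.1 + ξ, p.2) ∈ IG d (1 / 2) (1 / 2) :=
  ⟨(norm_add_le _ _).trans (by linarith [hp.1]), by rw [last_add, h1, add_zero]; exact hp.2.1, hp.2.2⟩

lemma approx3 {η : SpaceTime (d + 1) → ℝ} (h1 : ObliqueSub d W.lam W.Q W.v η) (h2 : ObliqueSub d W.lam W.Q W.v (fun p => - η p)) (hb : ∀ p ∈ KcP d 1, |η p| ≤ 1) {ε : ℝ} (hε : 0 < ε) :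
    ∃ P : Pack d, (∀ p ∈ IG d (1 / 4) (1 / 2), |η p - (Pack.reg P).u p| ≤ ε) ∧ ∀ l : List (Fin d), l.length ≤ 3 → Rs W ε (Pack.reg (dP l P)) (IG d (1 / 4) (1 / 2)) := by
  have uc : UniformContinuousOn η (GS d) := GS_compact.uniformContinuousOn_of_continuous (h1.1.mono fun p hp => GS_sub hp)
  obtain ⟨δ0, hδ0, huc⟩ := Metric.uniformContinuousOn_iff.1 uc (ε / 2) (by positivity)
  let δ : ℝ := min 1 (min (1 / 4) (δ0 / 2)) / (3 * d + 1)
  have hd : (0:ℝ) < 3 * d + 1 := by positivity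
  have hm : 0 < min 1 (min (1 / 4) (δ0 / 2)) := lt_min one_pos (lt_min (by norm_num) (by positivity))
  have hδ : 0 < δ := div_pos hm hd
  have hδd : 3 * (d * δ) + δ = min 1 (min (1 / 4) (δ0 / 2)) := by simp only [δ]; field_simp
  have hdδ : 0 ≤ d * δ := by positivity
  have hδ1 : δ ≤ 1 := by linarith [min_le_left 1 (min (1 / 4) (δ0 / 2))]
  have hδ4 : 3 * (d * δ) ≤ 1 / 4 := by linarith [(min_le_right 1 (min (1 / 4) (δ0 / 2))).trans (min_le_left _ _)]
  have hδ0' : 3 * (d * δ) < δ0 := by linarith [(min_le_right 1 (min (1 / 4) (δ0 / 2))).trans (min_le_right _ _)]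
  obtain ⟨P, hP⟩ := approx W h1 h2 hb (show 0 < ε / 2 by positivity) (show 0 < ε * (δ / 2) ^ 3 by positivity)
  have sub : ∀ {q}, q ∈ IG d (1 / 2) (1 / 2) → q ∈ GS d := fun hq => ⟨by linarith [hq.1], hq.2.1, by linarith [hq.2.2.1], hq.2.2.2⟩
  refine ⟨Pack.mult (ma δ Finset.univ ^ 3) P, fun p hp => ?_, fun l hl p hp => ?_⟩
  · obtain ⟨ξ, x1, x2, x3⟩ := EE_pow hδ 3 _ (Lc0 (lastC p.1) p.2) P p.1
    have x2 : ‖ξ‖ ≤ 3 * (d * δ) := by exact_mod_cast x2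
    have hq := IG_sh hp x1 (x2.trans hδ4)
    have e : (Pack.reg (Pack.mult (ma δ Finset.univ ^ 3) P)).u p = (Pack.reg P).u (p.1 + ξ, p.2) := by
      rw [Pack.reg_u, Pack.reg_u, last_add, x1, add_zero]; exact x3
    have a := (hP _ hq).1
    have b := huc p ⟨by linarith [hp.1], hp.2.1, by linarith [hp.2.2.1], hp.2.2.2⟩ _ (sub hq) (by
      have : dist p (p.1 + ξ, p.2) = ‖ξ‖ := by
        rw [Prod.dist_eq]; simp
      rw [this]; linarith)
    rw [Real.dist_eq] at b
    rw [e]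
    calc _ = |(η p - η (p.1 + ξ, p.2)) + (η (p.1 + ξ, p.2) - (Pack.reg P).u (p.1 + ξ, p.2))| := by ring_nf
      _ ≤ _ := (abs_add_le _ _).trans (by linarith)
  · have B : BB ((l.map Ik).prod * ma δ Finset.univ ^ 3) (3 * (d * δ)) ((2 / δ) ^ l.length) := by
      have h := (BB_l hδ l).comp (EE_pow hδ (3 - l.length)).bb
      rw [mul_assoc, ← pow_add, Nat.add_sub_cancel' hl, mul_one, ← add_mul, ← Nat.cast_add, Nat.add_sub_cancel' hl] at h
      exact_mod_cast h
    have hC : (2 / δ) ^ l.length * (ε * (δ / 2) ^ 3) ≤ ε := by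
      have : (1:ℝ) ≤ 2 / δ := by rw [le_div_iff₀ hδ]; linarith
      calc (2 / δ) ^ l.length * (ε * (δ / 2) ^ 3) ≤ (2 / δ) ^ 3 * (ε * (δ / 2) ^ 3) := by gcongr
        _ = ε := by field_simp
    refine ⟨?_, fun h0 => ?_⟩
    · rw [Pack.reg_1 _ (W.sym _)]
      change |va (Trm.c1 W.lam (W.Q p.2) (lastC p.1) p.2) (dP l _) p.1| ≤ _
      rw [va_dP (Lc1 _ _ _ _)]
      refine (B _ (Lc1 _ _ _ _) P p.1 _ fun ξ x1 x2 => ?_).trans hC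
      have := (hP _ (IG_sh hp x1 (x2.trans hδ4))).2.1
      rw [Pack.reg_1 _ (W.sym _), last_add, x1, add_zero] at this
      exact this
    · rw [Pack.reg_2 _ _ _ h0]
      change |va (Trm.c2 (W.v p.2) p.2) (dP l _) p.1| ≤ _
      rw [va_dP (Lc2 _ _)]
      refine (B _ (Lc2 _ _) P p.1 _ fun ξ x1 x2 => ?_).trans hC
      have h0' : lastC (p.1 + ξ) = 0 := by rw [last_add, h0, x1, add_zero]
      have := (hP _ (IG_sh hp x1 (x2.trans hδ4))).2.2 h0'
      rw [Pack.reg_2 _ _ _ h0'] at this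
      exact this
end
end OB
end


noncomputable section
namespace OB
open Filter Topology Complex

section
variable {d : ℕ} (W : Co d)

def JJ : ℝ := 1 + (2 + 2 * d * W.K) / W.c
lemma JJ1 : 1 ≤ JJ W := by
  have := W.hc; have := W.hK; unfold JJ; have : 0 ≤ (2 + 2 * d * W.K) / W.c := by positivity
  linarith
lemma cJ : 2 + 2 * d * W.K ≤ W.c * JJ W := by
  have := W.hc; unfold JJ; rw [mul_add, mul_div_cancel₀ _ this.ne']; linarith
def zt (θ : ℝ) : Reg (d + 1) :=
  (Reg.quad (fun i => if i = Fin.last d then -(100 * JJ W ^ 2) else -1) (fun i => if i = Fin.last d then JJ W else 0)).add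
    (Reg.ofTime _ (fun t => θ + t) (fun _ => 1) (fun t => (hasDerivAt_id t).const_add θ) continuous_const)
lemma zt_u (θ p) : (zt W θ).u p = θ + p.2 - ∑ j : Fin d, p.1 j.castSucc ^ 2 - 100 * (JJ W * lastC p.1) ^ 2 + JJ W * lastC p.1 := by
  simp only [zt, Reg.add, Reg.quad, Reg.ofTime, Fin.sum_univ_castSucc, lastC]; simp [Fin.castSucc_ne_last]; ring
lemma zt_ut (θ p) : (zt W θ).ut p = 1 := by simp [zt, Reg.add, Reg.quad, Reg.ofTime]
lemma zt_gc (θ p) (i : Fin d) : (zt W θ).g p i.castSucc = -2 * p.1 i.castSucc := by simp [zt, Reg.add, Reg.quad, Reg.ofTime, Fin.castSucc_ne_last]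
lemma zt_gl (θ p) : (zt W θ).g p (Fin.last d) = -200 * JJ W ^ 2 * lastC p.1 + JJ W := by simp only [zt, Reg.add, Reg.quad, Reg.ofTime, lastC]; simp; ring_nf; simp
lemma zt_L (θ p Q) : (zt W θ).L Q p = ∑ i, Q i i * (2 * (if i = Fin.last d then -(100 * JJ W ^ 2) else -1)) := by
  rw [zt, Reg.L_add, Reg.L_ofTime, Reg.L_quad, add_zero]

def SZ (θ : ℝ) : Set (SpaceTime (d + 1)) := {p | 0 ≤ (zt W θ).u p ∧ 0 ≤ lastC p.1 ∧ p.2 ≤ 0}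
lemma nsq' (x : Eucl (d + 1)) : ‖x‖ ^ 2 = ∑ j : Fin d, x j.castSucc ^ 2 + lastC x ^ 2 := by rw [← nsq, Fin.sum_univ_castSucc]; rfl
lemma SZ_b {θ : ℝ} (hθ : θ ≤ 1 / 100) {p} (hp : p ∈ SZ W θ) : (∑ j : Fin d, p.1 j.castSucc ^ 2 + 50 * (JJ W * lastC p.1) ^ 2 ≤ 3 / 200 + p.2) ∧ ‖p.1‖ ≤ 1 / 4 ∧ (zt W θ).u p ≤ 1 ∧ JJ W * lastC p.1 ≤ 1 / 50 := by
  obtain ⟨h1, h2, h3⟩ := hp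
  have e := zt_u W θ p
  have S0 : 0 ≤ ∑ j : Fin d, p.1 j.castSucc ^ 2 := Finset.sum_nonneg fun i _ => sq_nonneg _
  have J1 := JJ1 W
  have hs : lastC p.1 ≤ JJ W * lastC p.1 := le_mul_of_one_le_left h2 J1
  generalize JJ W * lastC p.1 = s at *
  have h4 : ∑ j : Fin d, p.1 j.castSucc ^ 2 + 50 * s ^ 2 ≤ 3 / 200 + p.2 := by nlinarith [sq_nonneg (s - 1 / 100)]
  refine ⟨h4, ?_, ?_, ?_⟩
  · refine abs_le_of_sq_le_sq' (b := 1/4) ?_ (by norm_num) |>.2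
    rw [nsq']; nlinarith
  · rw [e]; nlinarith [sq_nonneg (s - 1 / 100)]
  · nlinarith
lemma SZ_IG {θ : ℝ} (hθ : θ ≤ 1 / 100) : SZ W θ ⊆ IG d (1 / 4) (1 / 2) := fun p hp => by
  obtain ⟨h1, h2, _⟩ := SZ_b W hθ hp
  have S0 : 0 ≤ ∑ j : Fin d, p.1 j.castSucc ^ 2 := Finset.sum_nonneg fun i _ => sq_nonneg _
  exact ⟨h2, hp.2.1, by nlinarith [sq_nonneg (JJ W * lastC p.1)], hp.2.2⟩
lemma SZ_compact {θ : ℝ} (hθ : θ ≤ 1 / 100) : IsCompact (SZ W θ) := by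
  have hc : IsClosed (SZ W θ) :=
    (isClosed_le continuous_const (zt W θ).cu).inter ((isClosed_le continuous_const (cont_last.comp continuous_fst)).inter (isClosed_le continuous_snd continuous_const))
  refine IsCompact.of_isClosed_subset ((isCompact_closedBall (0 : Eucl (d + 1)) (1/4)).prod (isCompact_Icc (a := -(1/2:ℝ)) (b := 0))) hc fun p hp => ?_
  obtain ⟨h1, _, h3, h4⟩ := SZ_IG W hθ hp
  exact ⟨by simpa using h1, h3, h4⟩

def C1 : ℝ := 1 + 300 * (d + 1) ^ 2 * W.K * JJ W ^ 2
lemma zt_bd {θ : ℝ} (hθ : θ ≤ 1 / 100) {p} (hp : p ∈ SZ W θ) :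
    W.lam * (zt W θ).ut p - (zt W θ).L (W.Q p.2) p ≤ C1 W ∧ bq (W.Q p.2) ((zt W θ).g p) ((zt W θ).g p) ≤ C1 W ∧
    (lastC p.1 = 0 → (zt W θ).ut p - ⟪W.v p.2, (zt W θ).g p⟫ ≤ -1) := by
  obtain ⟨h1, h2, h3, h4⟩ := SZ_b W hθ hp
  have J1 := JJ1 W
  have hK := W.hK
  have hd : (1:ℝ) ≤ d + 1 := by linarith [Nat.cast_nonneg (α := ℝ) d]
  have JJ2 : 1 ≤ JJ W ^ 2 := one_le_pow₀ J1
  have hy := hp.2.1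
  refine ⟨?_, ?_, fun h0 => ?_⟩
  · rw [zt_ut, zt_L]
    have : -∑ i, W.Q p.2 i i * (2 * (if i = Fin.last d then -(100 * JJ W ^ 2) else -1)) ≤ ∑ i : Fin (d + 1), W.K * (200 * JJ W ^ 2) := by
      rw [← Finset.sum_neg_distrib]
      refine Finset.sum_le_sum fun i _ => ?_
      have h := (abs_le.1 (W.Qb p.2 i i)).2
      split_ifs
      · nlinarith
      · nlinarith
    rw [Finset.sum_const, Finset.card_univ, Fintype.card_fin, nsmul_eq_mul] at this
    push_cast at this
    have : ((d:ℝ) + 1) * (W.K * (200 * JJ W ^ 2)) ≤ (d + 1) ^ 2 * (W.K * (300 * JJ W ^ 2)) := by gcongr <;> nlinarith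
    have := W.hlam1
    unfold C1; nlinarith
  · have hg : ‖(zt W θ).g p‖ ^ 2 ≤ 26 * JJ W ^ 2 := by
      rw [nsq']
      simp only [lastC, zt_gc, zt_gl, mul_pow, ← Finset.mul_sum]
      have e : -200 * JJ W ^ 2 * lastC p.1 + JJ W = JJ W * (1 - 200 * (JJ W * lastC p.1)) := by ring
      have e2 := nsq' p.1
      change _ + (-200 * JJ W ^ 2 * lastC p.1 + JJ W) ^ 2 ≤ _
      rw [e, mul_pow]
      have s0 : 0 ≤ JJ W * lastC p.1 := by positivity
      have : (1 - 200 * (JJ W * lastC p.1)) ^ 2 ≤ 25 := by nlinarith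
      have : ‖p.1‖ ^ 2 ≤ 1 / 16 := by nlinarith [norm_nonneg p.1]
      nlinarith [sq_nonneg (lastC p.1)]
    refine (le_abs_self _).trans ((bq_bd (W.Qb p.2) _ _).trans ?_)
    rw [← sq]
    have : (d + 1) ^ 2 * W.K * ‖(zt W θ).g p‖ ^ 2 ≤ (d + 1) ^ 2 * W.K * (26 * JJ W ^ 2) := by gcongr
    have : 0 ≤ ((d:ℝ) + 1) ^ 2 * W.K * JJ W ^ 2 := by positivity
    unfold C1; nlinarith
  · rw [zt_ut, PiLp.inner_apply, Fin.sum_univ_castSucc]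
    simp only [RCLike.inner_apply, conj_trivial, zt_gc, zt_gl, h0]
    have : -∑ j : Fin d, -2 * p.1 j.castSucc * W.v p.2 j.castSucc ≤ ∑ j : Fin d, 2 * W.K := by
      rw [← Finset.sum_neg_distrib]
      refine Finset.sum_le_sum fun j _ => ?_
      have h5 := abs_le.1 (W.vb p.2 j.castSucc)
      have h6 := abs_le.1 ((coord_le p.1 j.castSucc).trans h2)
      nlinarith
    rw [Finset.sum_const, Finset.card_univ, Fintype.card_fin, nsmul_eq_mul] at this
    have h7 := cJ W
    have h8 : W.c * JJ W ≤ W.v p.2 (Fin.last d) * JJ W := mul_le_mul_of_nonneg_right (W.vn p.2) (by linarith)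
    linarith

lemma bern_alg {b11 b12 b22 z p Tz Tp C A V TV c bV A0 : ℝ} (hz : 0 ≤ z) (hz1 : z ≤ 1) (hC : 0 ≤ C) (hA : 0 < A)
    (hpos : 0 ≤ 4 * p ^ 2 * b11 + 4 * p * z * b12 + z ^ 2 * b22) (h11 : b11 ≤ C) (hTz : Tz ≤ C) (hTp : |Tp| ≤ 1)
    (hV : |V| ≤ A0) (hTV : |TV| ≤ 1) (hbV : c * p ^ 2 ≤ bV) (hAc : 2 * A * c = 2 + 8 * C)
    (h : 0 ≤ 2 * (z * p) * (z * Tp + p * Tz - 2 * b12) - 2 * (z ^ 2 * b22 + 2 * z * p * b12 + p ^ 2 * b11) + A * (2 * V * TV - 2 * bV)) :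
    p ^ 2 ≤ 1 + 2 * A * A0 := by
  have e1 : 2 * (z ^ 2 * (p * Tp)) ≤ 1 + p ^ 2 := by
    have : p * Tp ≤ (1 + p ^ 2) / 2 := by
      have : |p * Tp| ≤ |p| * 1 := by rw [abs_mul]; gcongr
      have := le_abs_self (p * Tp)
      nlinarith [sq_abs p, sq_nonneg (|p| - 1)]
    have z2 : z ^ 2 ≤ 1 := by nlinarith
    have : z ^ 2 * (p * Tp) ≤ z ^ 2 * ((1 + p ^ 2) / 2) := by gcongr
    have : z ^ 2 * ((1 + p ^ 2) / 2) ≤ 1 * ((1 + p ^ 2) / 2) := by gcongr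
    linarith
  have e2 : z * p ^ 2 * Tz ≤ p ^ 2 * C := by
    calc z * p ^ 2 * Tz ≤ z * p ^ 2 * C := by gcongr
      _ ≤ 1 * p ^ 2 * C := by gcongr
      _ = _ := by ring
  have e3 : p ^ 2 * b11 ≤ p ^ 2 * C := by gcongr
  have e4 : V * TV ≤ A0 := by
    refine (le_abs_self _).trans ?_
    rw [abs_mul]
    calc |V| * |TV| ≤ |V| * 1 := by gcongr
      _ ≤ A0 := by linarith
  have e5 : A * (V * TV) ≤ A * A0 := by gcongr
  have e6 : A * (c * p ^ 2) ≤ A * bV := by gcongr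
  have e7 : 2 * A * c * p ^ 2 = (2 + 8 * C) * p ^ 2 := by rw [hAc]
  nlinarith

lemma bern_alg2 {z p Nz Np A V NV A0 : ℝ} (hz : 0 ≤ z) (hz1 : z ≤ 1) (hA : 0 < A) (hNz : Nz ≤ -1) (hNp : |Np| ≤ 1)
    (hV : |V| ≤ A0) (hTV : |NV| ≤ 1) (h : 0 ≤ 2 * (z * p) * (z * Np + p * Nz) + A * (2 * V * NV)) :
    (z * p) ^ 2 ≤ 1 + 2 * A * A0 := by
  have e4 : V * NV ≤ A0 := by
    refine (le_abs_self _).trans ?_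
    rw [abs_mul]
    calc |V| * |NV| ≤ |V| * 1 := by gcongr
      _ ≤ A0 := by linarith
  have e5 : A * (V * NV) ≤ A * A0 := by gcongr
  have e1 : z * (z * p) * Np ≤ (1 + (z * p) ^ 2) / 2 := by
    have h1 : |z * (z * p) * Np| ≤ 1 * |z * p| * 1 := by
      rw [abs_mul, abs_mul z (z * p), abs_of_nonneg hz]; gcongr
    nlinarith [le_abs_self (z * (z * p) * Np), sq_abs (z * p), sq_nonneg (|z * p| - 1)]
  have e2 : z * p ^ 2 * Nz ≤ z * p ^ 2 * (-1) := by gcongr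
  have e3 : (z * p) ^ 2 ≤ z * p ^ 2 := by
    have : z * (z * p ^ 2) ≤ 1 * (z * p ^ 2) := by gcongr
    nlinarith
  nlinarith

lemma bq_quad {Q : Matrix (Fin (d + 1)) (Fin (d + 1)) ℝ} (hQ : Q.IsSymm) (a b : ℝ) (x y : Eucl (d + 1)) :
    bq Q (a • x + b • y) (a • x + b • y) = a ^ 2 * bq Q x x + 2 * a * b * bq Q x y + b ^ 2 * bq Q y y := by
  have e : 2 * a * b * bq Q x y = a * b * bq Q x y + a * b * bq Q y x := by rw [bq_comm hQ y x]; ring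
  rw [e]
  simp only [bq, Finset.mul_sum, ← Finset.sum_add_distrib]
  refine Finset.sum_congr rfl fun i _ => Finset.sum_congr rfl fun j _ => ?_
  simp only [PiLp.add_apply, PiLp.smul_apply, smul_eq_mul]; ring

def Ell : Prop := ∀ t (x : Eucl (d + 1)), W.c * ‖x‖ ^ 2 ≤ bq (W.Q t) x x

def bC (c C A0 : ℝ) : ℝ := 1 + 2 * ((1 + 4 * C) / c) * A0 + (1 + 4 * C) / c * A0 ^ 2

lemma bern (he : Ell W) {θ A0 : ℝ} (hθ0 : 0 < θ) (hθ : θ ≤ 1 / 100) (V p : Reg (d + 1)) (i : Fin d) (hp : ∀ q, p.u q = V.g q i.castSucc)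
    (hV : ∀ q ∈ SZ W θ, |V.u q| ≤ A0) (r1 : Rs W 1 V (SZ W θ)) (r2 : Rs W 1 p (SZ W θ)) :
    ∀ q ∈ SZ W (θ / 2), |p.u q| ≤ bC W.c (C1 W) A0 / (θ / 2) := by
  have hc := W.hc
  have hC1 : 1 ≤ C1 W := by unfold C1; have := W.hK; have : 0 ≤ 300 * ((d:ℝ) + 1) ^ 2 * W.K * JJ W ^ 2 := by positivity
                            linarith
  set A : ℝ := (1 + 4 * C1 W) / W.c with hA
  have A0p : 0 < A := by positivity
  have hAc : 2 * A * W.c = 2 + 8 * C1 W := by rw [hA]; field_simp; ring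
  set z := zt W θ with hzd
  set Y := z.mul p with hY
  set R := (Y.mul Y).add (Reg.smul A (V.mul V)) with hR
  have Ru : ∀ q, R.u q = (z.u q * p.u q) ^ 2 + A * V.u q ^ 2 := fun q => by simp [hR, hY, Reg.add, Reg.mul, Reg.smul]; ring
  have hsub : SZ W (θ / 2) ⊆ SZ W θ := fun q hq => ⟨by have := hq.1; rw [zt_u] at this ⊢; linarith, hq.2⟩
  intro q hq
  have hne : (SZ W θ).Nonempty := ⟨q, hsub hq⟩
  obtain ⟨m, hm, hmax⟩ := (SZ_compact W hθ).exists_isMaxOn hne R.cu.continuousOn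
  have hA0 : 0 ≤ A0 := (abs_nonneg _).trans (hV m hm)
  have key : R.u m ≤ bC W.c (C1 W) A0 := by
    have hVm := hV m hm
    have hAV : A * V.u m ^ 2 ≤ A * A0 ^ 2 := by
      have : V.u m ^ 2 ≤ A0 ^ 2 := by rw [← sq_abs]; gcongr
      gcongr
    rw [Ru]
    suffices h : (z.u m * p.u m) ^ 2 ≤ 1 + 2 * A * A0 by unfold bC; rw [← hA]; linarith
    rcases hm.1.eq_or_lt with h0 | h0
    · rw [← hzd] at h0; rw [← h0]; simp; positivity
    rw [← hzd] at h0
    have hmm : (m.1, m.2) = m := rfl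
    have hz1 : z.u m ≤ 1 := (SZ_b W hθ hm).2.2.1
    have hloc : ∀ᶠ q in 𝓝 (m.1, m.2), 0 ≤ lastC q.1 → q.2 ≤ m.2 → R.u q ≤ R.u (m.1, m.2) := by
      filter_upwards [z.cu.continuousAt.eventually (lt_mem_nhds h0)] with q h1 h2 h3
      exact hmax ⟨le_of_lt h1, h2, h3.trans hm.2.2⟩
    obtain ⟨m1, m2, m3⟩ := R.max_pt m.1 m.2 hm.2.1 hloc
    rw [hmm] at m1 m2 m3
    obtain ⟨z1, z2, z3⟩ := zt_bd W hθ hm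
    rw [← hzd] at z1 z2 z3
    have Rut : R.ut m = 2 * (z.u m * p.u m) * (z.u m * p.ut m + p.u m * z.ut m) + A * (2 * V.u m * V.ut m) := by
      simp [hR, hY, Reg.add, Reg.mul, Reg.smul]; ring
    have Yg : Y.g m = z.u m • p.g m + p.u m • z.g m := rfl
    rcases hm.2.1.eq_or_lt with hy | hy
    · have m3 := m3 (W.v m.2) (W.hc.le.trans (W.vn m.2))
      have Rg : ⟪W.v m.2, R.g m⟫ = 2 * (z.u m * p.u m) * (z.u m * ⟪W.v m.2, p.g m⟫ + p.u m * ⟪W.v m.2, z.g m⟫) + A * (2 * V.u m * ⟪W.v m.2, V.g m⟫) := by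
        have : R.g m = (z.u m * p.u m) • Y.g m + (z.u m * p.u m) • Y.g m + A • (V.u m • V.g m + V.u m • V.g m) := rfl
        rw [this, Yg]; simp only [inner_add_right, inner_smul_right]; ring
      refine bern_alg2 (Nz := z.ut m - ⟪W.v m.2, z.g m⟫) (Np := p.ut m - ⟪W.v m.2, p.g m⟫) (V := V.u m) (NV := V.ut m - ⟪W.v m.2, V.g m⟫) h0.le hz1 A0p (z3 hy.symm) ((r2 m hm).2 hy.symm) hVm ((r1 m hm).2 hy.symm) ?_
      rw [Rg] at m3; rw [Rut] at m1; nlinarith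
    · have m2 := m2 hy (W.Q m.2) (W.psd m.2)
      have hs := W.sym m.2
      have RL : R.L (W.Q m.2) m = 2 * (z.u m * p.u m) * (z.u m * p.L (W.Q m.2) m + p.u m * z.L (W.Q m.2) m + 2 * bq (W.Q m.2) (z.g m) (p.g m)) + 2 * bq (W.Q m.2) (Y.g m) (Y.g m) + A * (2 * V.u m * V.L (W.Q m.2) m + 2 * bq (W.Q m.2) (V.g m) (V.g m)) := by
        have : Y.u m = z.u m * p.u m := rfl
        rw [hR, Reg.L_add, Reg.L_smul, Reg.L_mul _ _ hs, Reg.L_mul _ _ hs, this, Reg.L_mul _ _ hs]; ring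
      rw [Yg, bq_quad hs, bq_comm hs (p.g m) (z.g m)] at RL
      have hp2 : W.c * p.u m ^ 2 ≤ bq (W.Q m.2) (V.g m) (V.g m) := by
        refine le_trans ?_ (he m.2 (V.g m))
        have : p.u m ^ 2 ≤ ‖V.g m‖ ^ 2 := by rw [← sq_abs, hp]; gcongr; exact coord_le _ _
        gcongr
      have hpos := bq_nonneg (W.psd m.2) ((2 * p.u m) • z.g m + z.u m • p.g m)
      rw [bq_quad hs] at hpos
      have := bern_alg (b11 := bq (W.Q m.2) (z.g m) (z.g m)) (b12 := bq (W.Q m.2) (z.g m) (p.g m)) (b22 := bq (W.Q m.2) (p.g m) (p.g m)) (Tz := W.lam * z.ut m - z.L (W.Q m.2) m) (Tp := W.lam * p.ut m - p.L (W.Q m.2) m)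
        (V := V.u m) (TV := W.lam * V.ut m - V.L (W.Q m.2) m) h0.le hz1 (by linarith) A0p (by nlinarith) z2 z1 (r2 m hm).1 hVm (r1 m hm).1 hp2 hAc (by
          have h5 : 0 ≤ W.lam * R.ut m - R.L (W.Q m.2) m := by have := mul_nonneg W.hlam.le m1; linarith
          rw [Rut, RL] at h5; refine h5.trans (le_of_eq ?_); ring)
      refine le_trans ?_ this
      rw [mul_pow]
      exact mul_le_of_le_one_left (sq_nonneg _) (pow_le_one₀ h0.le hz1)
  have hq2 := (hmax (hsub hq)).trans key
  change R.u q ≤ _ at hq2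
  rw [Ru] at hq2
  have hzq : θ / 2 ≤ z.u q := by have := hq.1; rw [zt_u] at this; rw [hzd, zt_u]; linarith
  have b1 : 1 ≤ bC W.c (C1 W) A0 := by
    unfold bC; rw [← hA]; have : 0 ≤ 2 * A * A0 + A * A0 ^ 2 := by positivity
    linarith
  have h1 : |z.u q * p.u q| ≤ bC W.c (C1 W) A0 := by
    refine abs_le_of_sq_le_sq ?_ (by linarith)
    have : 0 ≤ A * V.u q ^ 2 := by positivity
    nlinarith
  rw [le_div_iff₀ (by positivity)]
  rw [abs_mul, abs_of_nonneg ((by positivity : 0 ≤ θ / 2).trans hzq)] at h1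
  refine le_trans ?_ h1
  rw [mul_comm]; gcongr

def Bk : ℕ → ℝ
  | 0 => 2
  | k + 1 => bC W.c (C1 W) (Bk k) / (1 / 100 / 2 ^ (k + 1))

lemma bern3 (he : Ell W) {ε : ℝ} (h1 : ε ≤ 1) (P : Pack d) (hb : ∀ p ∈ IG d (1/4) (1/2), |(Pack.reg P).u p| ≤ 2)
    (hr : ∀ l : List (Fin d), l.length ≤ 3 → Rs W ε (Pack.reg (dP l P)) (IG d (1/4) (1/2))) :
    ∀ l : List (Fin d), l.length ≤ 3 → ∀ q ∈ SZ W (1 / 100 / 2 ^ l.length), |(Pack.reg (dP l P)).u q| ≤ Bk W l.length := by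
  have hl : ∀ k : ℕ, (1:ℝ) / 100 / 2 ^ k ≤ 1 / 100 := fun k => div_le_self (by norm_num) (one_le_pow₀ (by norm_num))
  intro l
  induction l with
  | nil => intro _ q hq; exact hb q (SZ_IG W (by simp) hq)
  | cons i l ih =>
    intro h
    simp only [List.length_cons] at h ⊢
    have hh : ∀ l : List (Fin d), l.length ≤ 3 → ∀ k, Rs W 1 (Pack.reg (dP l P)) (SZ W (1 / 100 / 2 ^ k)) := fun l hl' k q hq =>
      ⟨((hr l hl' q (SZ_IG W (hl k) hq)).1).trans h1, fun hy => ((hr l hl' q (SZ_IG W (hl k) hq)).2 hy).trans h1⟩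
    have := bern W he (by positivity) (hl l.length) (Pack.reg (dP l P)) (Pack.reg (dP (i :: l) P)) i (fun q => (Pack.reg_g (dP l P) q i).symm) (ih (by omega)) (hh _ (by omega) _) (hh (i :: l) (by simpa using h) _)
    rwa [div_div _ _ (2:ℝ), ← pow_succ] at this
lemma IG_SZ {k : ℕ} (hk : k ≤ 3) {r : ℝ} (hr : r ≤ 1 / (10000 * JJ W ^ 2)) : IG d r r ⊆ SZ W (1 / 100 / 2 ^ k) := fun p ⟨h1, h2, h3, h4⟩ => by
  refine ⟨?_, h2, h4⟩
  have J1 := JJ1 W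
  have JJ2 : 1 ≤ JJ W ^ 2 := one_le_pow₀ J1
  rw [le_div_iff₀ (by positivity)] at hr
  have r0 : 0 ≤ r := (norm_nonneg _).trans h1
  have hn := nsq' p.1
  have h5 : ‖p.1‖ ^ 2 ≤ r ^ 2 := by gcongr
  have hk' : (1:ℝ) / 800 ≤ 1 / 100 / 2 ^ k := by
    have : (2:ℝ) ^ k ≤ 2 ^ 3 := pow_le_pow_right₀ (by norm_num) hk
    rw [le_div_iff₀ (by positivity)]; linarith
  have h6 : r ≤ 1 / 10000 := by nlinarith
  have S0 : 0 ≤ ∑ j : Fin d, p.1 j.castSucc ^ 2 := Finset.sum_nonneg fun i _ => sq_nonneg _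
  have h7 : 100 * (JJ W * lastC p.1) ^ 2 ≤ r := by
    rw [mul_pow]
    have : JJ W ^ 2 * lastC p.1 ^ 2 ≤ JJ W ^ 2 * r ^ 2 := by gcongr; nlinarith
    nlinarith
  have h8 : 0 ≤ JJ W * lastC p.1 := by positivity
  rw [zt_u]
  nlinarith [sq_nonneg (lastC p.1)]

/-- tangential derivative bounds -/
lemma tang (d : ℕ) (c K : ℝ) : ∃ C r : ℝ, 1 ≤ C ∧ 0 < r ∧ r ≤ 1 / 4 ∧ ∀ W : Co d, W.c = c → W.K = K → Ell W → ∀ ε ≤ 1, ∀ P : Pack d,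
    (∀ p ∈ IG d (1/4) (1/2), |(Pack.reg P).u p| ≤ 2) → (∀ l : List (Fin d), l.length ≤ 3 → Rs W ε (Pack.reg (dP l P)) (IG d (1/4) (1/2))) →
    ∀ l : List (Fin d), l.length ≤ 3 → ∀ q ∈ IG d r r, |(Pack.reg (dP l P)).u q| ≤ C := by
  by_cases h : ∃ W0 : Co d, W0.c = c ∧ W0.K = K
  · obtain ⟨W0, e1, e2⟩ := h
    have J1 := one_le_pow₀ (n := 2) (JJ1 W0)
    refine ⟨1 + ∑ k ∈ Finset.range 4, |Bk W0 k|, 1 / (10000 * JJ W0 ^ 2), ?_, by positivity, ?_, fun W f1 f2 he ε h1 P hb hr l hl q hq => ?_⟩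
    · have : 0 ≤ ∑ k ∈ Finset.range 4, |Bk W0 k| := Finset.sum_nonneg fun i _ => abs_nonneg _
      linarith
    · exact (div_le_div_iff_of_pos_left one_pos (by positivity) (by norm_num)).2 (by linarith)
    · have eJ : JJ W = JJ W0 := by simp [JJ, e1, e2, f1, f2]
      have eB : ∀ k, Bk W k = Bk W0 k := fun k => by
        induction k with
        | zero => rfl
        | succ k ih => simp [Bk, ih, C1, eJ, e1, e2, f1, f2]
      refine (bern3 W he h1 P hb hr l hl q (IG_SZ W hl (by rw [eJ]) hq)).trans ?_
      rw [eB]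
      have := Finset.single_le_sum (f := fun k => |Bk W0 k|) (fun i _ => abs_nonneg _) (Finset.mem_range.2 (Nat.lt_succ_of_le hl))
      have := le_abs_self (Bk W0 l.length)
      beta_reduce at *
      linarith
  · exact ⟨1, 1/4, le_rfl, by norm_num, le_rfl, fun W f1 f2 => absurd ⟨W, f1, f2⟩ h⟩
end
end OB
end


noncomputable section
namespace OB
open Filter Topology Complex

section
lemma max3 {F : ℝ → ℝ → ℝ → ℝ} {a b t Ft Faa Fbb : ℝ} {Fa Fb : ℝ → ℝ} (hb : 0 ≤ b)
    (hm : ∀ᶠ p in 𝓝 (a, b, t), 0 ≤ p.2.1 → p.2.2 ≤ t → F p.1 p.2.1 p.2.2 ≤ F a b t)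
    (ht : HasDerivWithinAt (fun t => F a b t) Ft (Iic t) t) (ha : ∀ x, HasDerivAt (fun a => F a b t) (Fa x) x) (haa : HasDerivAt Fa Faa a)
    (hb1 : ∀ x, HasDerivAt (fun b => F a b t) (Fb x) x) (hbb : HasDerivAt Fb Fbb b) :
    0 ≤ Ft ∧ Faa ≤ 0 ∧ (0 < b → Fbb ≤ 0) ∧ (b = 0 → Fb b ≤ 0) := by
  have c1 : Tendsto (fun x : ℝ => (a, b, x)) (𝓝 t) (𝓝 (a, b, t)) := Continuous.tendsto (by fun_prop) t
  have c2 : Tendsto (fun x : ℝ => (x, b, t)) (𝓝 a) (𝓝 (a, b, t)) := Continuous.tendsto (f := fun x : ℝ => (x, b, t)) (by fun_prop) a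
  have c3 : Tendsto (fun x : ℝ => (a, x, t)) (𝓝 b) (𝓝 (a, b, t)) := Continuous.tendsto (f := fun x : ℝ => (a, x, t)) (by fun_prop) b
  have sh : ∀ x : ℝ, Tendsto (fun y => x + y) (𝓝 0) (𝓝 x) := fun x => by simpa using (continuous_const.add continuous_id).tendsto (f := fun y : ℝ => x + y) 0
  refine ⟨deriv_left_max ht ?_, ?_, fun h0 => ?_, fun h0 => deriv_right_max (hb1 b).hasDerivWithinAt ?_⟩
  · filter_upwards [(c1.mono_left nhdsWithin_le_nhds).eventually hm, self_mem_nhdsWithin] with s h1 h2 using h1 hb h2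
  · refine sdt (f := fun y => F (a + y) b t) (f1 := fun y => Fa (a + y)) (fun y => (ha (a + y)).comp_const_add a y) (HasDerivAt.comp_const_add a 0 (by simpa using haa)) ?_
    filter_upwards [(sh a).eventually (c2.eventually hm)] with s h1; simpa using h1 hb le_rfl
  · refine sdt (f := fun y => F a (b + y) t) (f1 := fun y => Fb (b + y)) (fun y => (hb1 (b + y)).comp_const_add b y) (HasDerivAt.comp_const_add b 0 (by simpa using hbb)) ?_
    filter_upwards [(sh b).eventually (c3.eventually hm), (sh b).eventually (lt_mem_nhds h0)] with s h1 h2; simpa using h1 h2.le le_rfl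
  · filter_upwards [(c3.mono_left nhdsWithin_le_nhds).eventually hm, self_mem_nhdsWithin] with s h1 h2
    exact h1 (h0 ▸ h2) le_rfl

structure Z1 (r c K C lam : ℝ) (z zy zyy zt : ℝ → ℝ → ℝ) (q w : ℝ → ℝ) : Prop where
  hr : 0 < r
  hr1 : r ≤ 1
  hc : 0 < c
  hC : 0 < C
  hl : 0 < lam
  hl1 : lam ≤ 1
  qc : ∀ t, c ≤ q t
  w0 : ∀ t, 0 ≤ w t
  wK : ∀ t, w t ≤ K
  hz : ∀ y t, HasDerivAt (fun y => z y t) (zy y t) y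
  hzy : ∀ y t, HasDerivAt (fun y => zy y t) (zyy y t) y
  ht : ∀ y, ∀ t ∈ Ioc (-r) 0, HasDerivWithinAt (fun t => z y t) (zt y t) (Iic t) t
  cont : Continuous fun p : ℝ × ℝ => z p.1 p.2
  bd : ∀ y ∈ Icc 0 r, ∀ t ∈ Icc (-r) 0, |z y t| ≤ C
  pde : ∀ y ∈ Icc 0 r, ∀ t ∈ Icc (-r) 0, |lam * zt y t - q t * zyy y t| ≤ C
  bc : ∀ t ∈ Icc (-r) 0, |zt 0 t - w t * zy 0 t| ≤ C

variable {r c K C lam : ℝ} {z zy zyy zt : ℝ → ℝ → ℝ} {q w : ℝ → ℝ}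
lemma Z1.neg (h : Z1 r c K C lam z zy zyy zt q w) : Z1 r c K C lam (fun y t => -z y t) (fun y t => -zy y t) (fun y t => -zyy y t) (fun y t => -zt y t) q w :=
  { h with
    hz := fun y t => (h.hz y t).neg
    hzy := fun y t => (h.hzy y t).neg
    ht := fun y t ht => (h.ht y t ht).neg
    cont := h.cont.neg
    bd := fun y hy t ht => by rw [abs_neg]; exact h.bd y hy t ht
    pde := fun y hy t ht => by rw [← abs_neg]; convert h.pde y hy t ht using 2; ring
    bc := fun t ht => by rw [← abs_neg]; convert h.bc t ht using 2; ring }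

lemma mp3 {r k : ℝ} {F : ℝ → ℝ → ℝ → ℝ} (hF : Continuous fun p : ℝ × ℝ × ℝ => F p.1 p.2.1 p.2.2)
    (h : ∀ a b t, 0 ≤ b → b ≤ a → t ≤ 0 → a ≤ t + r → k * (a - b) ≤ t + r → 0 < F a b t →
      (b < a → a < t + r → k * (a - b) < t + r → ∀ᶠ p in 𝓝 (a, b, t), 0 ≤ p.2.1 → p.2.2 ≤ t → F p.1 p.2.1 p.2.2 ≤ F a b t) → False)
    {a b t : ℝ} (h1 : 0 ≤ b) (h2 : b ≤ a) (h3 : t ≤ 0) (h4 : a ≤ t + r) (h5 : k * (a - b) ≤ t + r) : F a b t ≤ 0 := by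
  set S : Set (ℝ × ℝ × ℝ) := {p | 0 ≤ p.2.1 ∧ p.2.1 ≤ p.1 ∧ p.2.2 ≤ 0 ∧ p.1 ≤ p.2.2 + r ∧ k * (p.1 - p.2.1) ≤ p.2.2 + r} with hS
  have hcl {f g : ℝ × ℝ × ℝ → ℝ} (hf : Continuous f) (hg : Continuous g) : IsClosed {p | f p ≤ g p} := isClosed_le hf hg
  have hSc : IsCompact S := by
    refine IsCompact.of_isClosed_subset ((isCompact_Icc (a := (0:ℝ)) (b := r)).prod ((isCompact_Icc (a := (0:ℝ)) (b := r)).prod (isCompact_Icc (a := -r) (b := 0))))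
      ((hcl (f := fun _ => 0) (g := fun p => p.2.1) (by fun_prop) (by fun_prop)).inter ((hcl (f := fun p => p.2.1) (g := fun p => p.1) (by fun_prop) (by fun_prop)).inter ((hcl (f := fun p => p.2.2) (g := fun _ => 0) (by fun_prop) (by fun_prop)).inter
      ((hcl (f := fun p => p.1) (g := fun p => p.2.2 + r) (by fun_prop) (by fun_prop)).inter (hcl (f := fun p => k * (p.1 - p.2.1)) (g := fun p => p.2.2 + r) (by fun_prop) (by fun_prop)))))) fun p hp => ?_
    obtain ⟨h1, h2, h3, h4, h5⟩ := hp
    exact ⟨⟨by linarith, by linarith⟩, ⟨h1, by linarith⟩, by linarith, h3⟩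
  obtain ⟨⟨a', b', t'⟩, hm, hmax⟩ := hSc.exists_isMaxOn ⟨(a, b, t), h1, h2, h3, h4, h5⟩ hF.continuousOn
  by_contra hc
  push Not at hc
  obtain ⟨g1, g2, g3, g4, g5⟩ := hm
  refine h a' b' t' g1 g2 g3 g4 g5 (hc.trans_le (hmax (a := (a, b, t)) ⟨h1, h2, h3, h4, h5⟩)) fun l3 l1 l2 => ?_
  have hop {f g : ℝ × ℝ × ℝ → ℝ} (hf : Continuous f) (hg : Continuous g) (h : f (a', b', t') < g (a', b', t')) : ∀ᶠ p in 𝓝 (a', b', t'), f p < g p := (isOpen_lt hf hg).mem_nhds h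
  filter_upwards [hop (f := fun p => p.1) (g := fun p => p.2.2 + r) (by fun_prop) (by fun_prop) l1, hop (f := fun p => k * (p.1 - p.2.1)) (g := fun p => p.2.2 + r) (by fun_prop) (by fun_prop) l2,
    hop (f := fun p => p.2.1) (g := fun p => p.1) (by fun_prop) (by fun_prop) l3] with p e1 e2 e3 e4 e5
  exact hmax (a := p) ⟨e4, e3.le, e5.trans g3, e1.le, e2.le⟩

lemma G1_alg {s D Y a C : ℝ} (hC : 0 < C) (hs : 0 ≤ s) (hD : D ≤ 2 * C) (hY : 0 ≤ Y) (hYs : Y ≤ s) (h : 0 < s ^ 2 * D - 4 * C * (Y * s - Y ^ 2 / 2 + a ^ 2)) (h0 : Y = 0 → D = 0) :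
    a ≠ s ∧ Y ≠ s ∧ Y ≠ 0 := by
  have h1 : s ^ 2 * D ≤ s ^ 2 * (2 * C) := by gcongr
  have h2 : 0 ≤ C * (Y * s - Y ^ 2 / 2) := mul_nonneg hC.le (by nlinarith)
  have h3 : 0 ≤ C * a ^ 2 := by positivity
  refine ⟨fun e => ?_, fun e => ?_, fun e => ?_⟩
  · subst e; nlinarith
  · subst e; nlinarith
  · rw [h0 e, e] at h; nlinarith

lemma G1_alg2 {c k C l s q D ta tb za Y : ℝ} (hc : 0 < c) (hk : c * (k ^ 2 - 2) = 2) (hC : 0 < C) (hl : 0 < l) (hl1 : l ≤ 1) (hs : 0 < s) (hs1 : s ≤ 1) (hq : c ≤ q) (hD : D ≤ 2 * C)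
    (m1 : 0 ≤ 2 * s * D + s ^ 2 * (ta - tb) - 4 * C * Y) (m2 : s ^ 2 * za - 4 * C * (2 - k ^ 2) ≤ 0) (pa : l * ta - q * za ≤ C) (hY : 0 ≤ Y) (hb : -C ≤ l * tb) : False := by
  have s2 : s ^ 2 ≤ 1 := by nlinarith
  have k2 : 0 < k ^ 2 - 2 := by by_contra hh; push Not at hh; nlinarith
  have A1 : s ^ 2 * (q * za) ≤ -(8 * C) := by
    have h1 : q * (s ^ 2 * za) ≤ q * (-(4 * C * (k ^ 2 - 2))) := by
      have := hc.trans_le hq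
      gcongr; linarith
    have h2 : c * (4 * C * (k ^ 2 - 2)) ≤ q * (4 * C * (k ^ 2 - 2)) := by gcongr
    have h3 : c * (4 * C * (k ^ 2 - 2)) = 4 * C * 2 := by linear_combination 4 * C * hk
    linarith
  have A2 : s ^ 2 * (l * ta - q * za) ≤ C := by
    have : s ^ 2 * (l * ta - q * za) ≤ s ^ 2 * C := by gcongr
    nlinarith
  have A4 : l * (s * D) ≤ 2 * C := by
    have : l * (s * D) ≤ l * (s * (2 * C)) := by gcongr
    have : l * s * (2 * C) ≤ 1 * 1 * (2 * C) := by gcongr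
    linarith
  have A3 : s ^ 2 * (-C) ≤ s ^ 2 * (l * tb) := by gcongr
  have A6 : s ^ 2 * C ≤ 1 * C := by gcongr
  have A5 : 0 ≤ l * (4 * C * Y) := by positivity
  have := mul_nonneg hl.le m1
  linarith

lemma G1 (h : Z1 r c K C lam z zy zyy zt q w) {k : ℝ} (hk0 : 0 < k) (hk : c * (k ^ 2 - 2) = 2) {a b t : ℝ} (hb : 0 ≤ b) (hab : b ≤ a) (ht : t ≤ 0) (has : a ≤ t + r) (hkk : k * (a - b) ≤ t + r) :
    (t + r) ^ 2 * (z a t - z b t) ≤ 4 * C * (k * (a - b) * (t + r) - k ^ 2 * (a - b) ^ 2 / 2 + a ^ 2) := by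
  have hC := h.hC; have hr := h.hr; have hr1 := h.hr1; have hl := h.hl; have hl1 := h.hl1
  set F : ℝ → ℝ → ℝ → ℝ := fun a b t => (t + r) ^ 2 * (z a t - z b t) - 4 * C * (k * (a - b) * (t + r) - k ^ 2 * (a - b) ^ 2 / 2 + a ^ 2) with hF
  have e1 : Continuous fun p : ℝ × ℝ × ℝ => z p.1 p.2.2 := h.cont.comp (by fun_prop : Continuous fun p : ℝ × ℝ × ℝ => (p.1, p.2.2))
  have e2 : Continuous fun p : ℝ × ℝ × ℝ => z p.2.1 p.2.2 := h.cont.comp (by fun_prop : Continuous fun p : ℝ × ℝ × ℝ => (p.2.1, p.2.2))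
  have e3 : Continuous fun p : ℝ × ℝ × ℝ => 4 * C * (k * (p.1 - p.2.1) * (p.2.2 + r) - k ^ 2 * (p.1 - p.2.1) ^ 2 / 2 + p.1 ^ 2) := by fun_prop
  refine sub_nonpos.1 (mp3 (F := F) (((by fun_prop : Continuous fun p : ℝ × ℝ × ℝ => (p.2.2 + r) ^ 2).mul (e1.sub e2)).sub e3) ?_ hb hab ht has hkk)
  clear hb hab ht has hkk a b t
  intro a b t hb hab ht has hkk hpos hmax
  have ha0 : a ∈ Icc 0 r := ⟨hb.trans hab, by linarith⟩
  have hb0 : b ∈ Icc 0 r := ⟨hb, by linarith⟩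
  have ht0 : t ∈ Icc (-r) 0 := ⟨by linarith, ht⟩
  have hD : z a t - z b t ≤ 2 * C := by
    have := (abs_le.1 (h.bd a ha0 t ht0)).2; have := (abs_le.1 (h.bd b hb0 t ht0)).1; linarith
  have hs0 : 0 ≤ t + r := hb.trans (hab.trans has)
  have hP : F a b t = (t + r) ^ 2 * (z a t - z b t) - 4 * C * ((k * (a - b)) * (t + r) - (k * (a - b)) ^ 2 / 2 + a ^ 2) := by simp only [hF]; ring
  have hy : 0 ≤ k * (a - b) := mul_nonneg hk0.le (by linarith)
  rw [hP] at hpos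
  obtain ⟨n1, n2, n3⟩ := G1_alg hC hs0 hD hy hkk hpos fun e => by rw [show a = b by rcases mul_eq_zero.1 e with h | h <;> linarith]; simp
  have l1 : a < t + r := lt_of_le_of_ne has n1
  have l2 : k * (a - b) < t + r := lt_of_le_of_ne hkk n2
  have l3 : b < a := lt_of_le_of_ne hab fun e => n3 (by rw [e]; simp)
  have hs : 0 < t + r := lt_of_le_of_lt ha0.1 l1
  have tt : t ∈ Ioc (-r) 0 := ⟨by linarith, ht⟩
  have dt : HasDerivWithinAt (fun t => F a b t) (2 * (t + r) * (z a t - z b t) + (t + r) ^ 2 * (zt a t - zt b t) - 4 * C * (k * (a - b))) (Iic t) t := by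
    have e1 : HasDerivWithinAt (fun t : ℝ => t + r) 1 (Iic t) t := ((hasDerivAt_id t).add_const r).hasDerivWithinAt
    refine (((e1.pow 2).mul ((h.ht a t tt).sub (h.ht b t tt))).sub ((((e1.const_mul (k * (a - b))).sub_const (k ^ 2 * (a - b) ^ 2 / 2)).add_const (a ^ 2)).const_mul (4 * C))).congr_deriv ?_
    simp only [Nat.reduceSub, pow_one, Nat.cast_ofNat, Pi.sub_apply, Pi.pow_apply]; ring
  have da : ∀ x, HasDerivAt (fun a => F a b t) ((t + r) ^ 2 * zy x t - 4 * C * (k * (t + r) - k ^ 2 * (x - b) + 2 * x)) x := fun x => by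
    have e1 : HasDerivAt (fun x : ℝ => x - b) 1 x := (hasDerivAt_id x).sub_const b
    refine ((((h.hz x t).sub_const (z b t)).const_mul ((t + r) ^ 2)).sub (((((e1.const_mul k).mul_const (t + r)).sub (((e1.pow 2).const_mul (k ^ 2)).div_const 2)).add ((hasDerivAt_id x).pow 2)).const_mul (4 * C))).congr_deriv ?_
    simp only [Nat.reduceSub, pow_one, Nat.cast_ofNat, id_eq]; ring
  have daa : HasDerivAt (fun x => (t + r) ^ 2 * zy x t - 4 * C * (k * (t + r) - k ^ 2 * (x - b) + 2 * x)) ((t + r) ^ 2 * zyy a t - 4 * C * (2 - k ^ 2)) a := by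
    have e1 : HasDerivAt (fun x : ℝ => x - b) 1 a := (hasDerivAt_id a).sub_const b
    refine (((h.hzy a t).const_mul ((t + r) ^ 2)).sub (((((e1.const_mul (k ^ 2)).const_sub (k * (t + r)))).add ((hasDerivAt_id a).const_mul 2)).const_mul (4 * C))).congr_deriv ?_
    ring
  have db : ∀ x, HasDerivAt (fun b => F a b t) (-((t + r) ^ 2 * zy x t) - 4 * C * (-(k * (t + r)) + k ^ 2 * (a - x))) x := fun x => by
    have e1 : HasDerivAt (fun x : ℝ => a - x) (-1) x := (hasDerivAt_id x).const_sub a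
    refine ((((h.hz x t).const_sub (z a t)).const_mul ((t + r) ^ 2)).sub (((((e1.const_mul k).mul_const (t + r)).sub (((e1.pow 2).const_mul (k ^ 2)).div_const 2)).add_const (a ^ 2)).const_mul (4 * C))).congr_deriv ?_
    simp only [Nat.reduceSub, pow_one, Nat.cast_ofNat, id_eq]; ring
  have dbb : HasDerivAt (fun x => -((t + r) ^ 2 * zy x t) - 4 * C * (-(k * (t + r)) + k ^ 2 * (a - x))) (-((t + r) ^ 2 * zyy b t) + 4 * C * k ^ 2) b := by
    have e1 : HasDerivAt (fun x : ℝ => a - x) (-1) b := (hasDerivAt_id b).const_sub a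
    refine (((h.hzy b t).const_mul ((t + r) ^ 2)).neg.sub ((((e1.const_mul (k ^ 2)).const_add (-(k * (t + r))))).const_mul (4 * C))).congr_deriv ?_
    ring
  obtain ⟨m1, m2, m3, m4⟩ := max3 hb (hmax l3 l1 l2) dt da daa db dbb
  have pa := abs_le.1 (h.pde a ha0 t ht0)
  have pb := abs_le.1 (h.pde b hb0 t ht0)
  have qc := h.qc t
  have s1 : t + r ≤ 1 := by linarith
  refine G1_alg2 h.hc hk hC hl hl1 hs s1 qc hD m1 m2 pa.2 hy ?_
  rcases hb.eq_or_lt with hb' | hb'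
  · have m4 := m4 hb'.symm
    subst hb'
    have : 0 ≤ (t + r) ^ 2 * zy 0 t := by
      have : 0 ≤ C * (k * ((t + r) - k * (a - 0))) := mul_nonneg hC.le (mul_nonneg hk0.le (by linarith))
      linarith
    have z0 : 0 ≤ zy 0 t := nonneg_of_mul_nonneg_right this (by positivity)
    have := (abs_le.1 (h.bc t ht0)).1
    have := mul_nonneg (h.w0 t) z0
    have : -C ≤ zt 0 t := by linarith
    have : lam * (-C) ≤ lam * zt 0 t := by gcongr
    nlinarith
  · have m3 := m3 hb'
    have : 0 ≤ (t + r) ^ 2 * zyy b t := by have : 0 ≤ 4 * C * k ^ 2 := by positivity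
                                           linarith
    have := mul_nonneg (h.hc.le.trans qc) (nonneg_of_mul_nonneg_right this (by positivity))
    linarith

lemma G2a (h : Z1 r c K C lam z zy zyy zt q w) {k : ℝ} (hk0 : 0 < k) (hk : c * (k ^ 2 - 2) = 2) {y t : ℝ} (hy : y ∈ Icc 0 (r / 2)) (ht : t ∈ Icc (-(r / 2)) 0) :
    z y t - z 0 t ≤ 8 * C * (k + 1) / r * y := by
  obtain ⟨y0, y1⟩ := hy
  obtain ⟨t0, t1⟩ := ht
  have hr := h.hr; have hC := h.hC
  have hs : r / 2 ≤ t + r := by linarith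
  have key : (t + r) * (z y t - z 0 t) ≤ 4 * C * (k + 1) * y := by
    by_cases hc : k * y ≤ t + r
    · have := G1 h hk0 hk le_rfl y0 t1 (y1.trans hs) (by simpa using hc)
      have h1 : (t + r) * ((t + r) * (z y t - z 0 t)) ≤ (t + r) * (4 * C * (k + 1) * y) := by
        have e1 : 0 ≤ C * (k ^ 2 * (y - 0) ^ 2) := by positivity
        have e2 : C * y * y ≤ C * y * (t + r) := by gcongr; linarith
        nlinarith
      exact le_of_mul_le_mul_left h1 (by linarith)
    · have a1 := (abs_le.1 (h.bd y ⟨y0, by linarith⟩ t ⟨by linarith, t1⟩)).2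
      have a2 := (abs_le.1 (h.bd 0 ⟨le_rfl, by linarith⟩ t ⟨by linarith, t1⟩)).1
      have e1 : (t + r) * (z y t - z 0 t) ≤ (t + r) * (2 * C) := mul_le_mul_of_nonneg_left (by linarith) (by linarith)
      have e2 : (t + r) * (2 * C) ≤ (k * y) * (2 * C) := mul_le_mul_of_nonneg_right (by linarith) (by linarith)
      have : 0 ≤ C * (k * y) := by positivity
      have : 0 ≤ C * y := by positivity
      nlinarith
  have : 0 ≤ 4 * C * (k + 1) * y := by positivity
  rw [div_mul_eq_mul_div, le_div_iff₀ hr]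
  by_cases h0 : 0 ≤ z y t - z 0 t
  · nlinarith
  · nlinarith

lemma G2 (r c K C : ℝ) (hc : 0 < c) : ∃ G : ℝ, 0 ≤ G ∧ ∀ {lam z zy zyy zt q w}, Z1 r c K C lam z zy zyy zt q w → ∀ t ∈ Icc (-(r / 2)) 0,
    (∀ y ∈ Icc 0 (r / 2), |z y t - z 0 t| ≤ G * y) ∧ |zy 0 t| ≤ G ∧ |zt 0 t| ≤ G := by
  have hk0 : 0 < 2 + 2 / c := by positivity
  set k := √(2 + 2 / c) with hkd
  have hk : c * (k ^ 2 - 2) = 2 := by rw [hkd, Real.sq_sqrt hk0.le]; field_simp; ring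
  have kp : 0 < k := Real.sqrt_pos.2 hk0
  set G0 := |8 * C * (k + 1) / r| with hG0
  have G0p : 0 ≤ G0 := abs_nonneg _
  refine ⟨G0 + (|C| + |K| * G0), by positivity, fun {lam z zy zyy zt q w} h t ht => ?_⟩
  have hr := h.hr; have hC := h.hC
  have e0 : 8 * C * (k + 1) / r = G0 := by rw [hG0, abs_of_nonneg]; positivity
  have h1 : ∀ y ∈ Icc 0 (r / 2), |z y t - z 0 t| ≤ G0 * y := fun y hy => by
    have a1 := G2a h kp hk hy ht
    have a2 := G2a h.neg kp hk hy ht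
    rw [e0] at a1 a2; rw [abs_le]; constructor <;> linarith
  have der : ∀ {z zy zyy zt}, Z1 r c K C lam z zy zyy zt q w → (∀ y ∈ Icc 0 (r / 2), z y t - z 0 t ≤ G0 * y) → zy 0 t ≤ G0 := fun {z zy zyy zt} h h1 => by
    have := deriv_right_max (f := fun y => z y t - G0 * y) (t := 0) (((h.hz 0 t).sub ((hasDerivAt_id (0:ℝ)).const_mul G0)).hasDerivWithinAt) (by
      filter_upwards [Icc_mem_nhdsGE (show (0:ℝ) < r / 2 by linarith)] with y hy
      have := h1 y hy; simp; linarith)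
    linarith
  have h2 : |zy 0 t| ≤ G0 := by
    have a1 := der h fun y hy => (abs_le.1 (h1 y hy)).2
    have a2 := der h.neg fun y hy => by have := (abs_le.1 (h1 y hy)).1; linarith
    rw [abs_le]; constructor <;> linarith
  have gp : 0 ≤ |C| + |K| * G0 := by positivity
  refine ⟨fun y hy => (h1 y hy).trans (by have := hy.1; gcongr; linarith), h2.trans (by linarith), ?_⟩
  have h3 := h.bc t ⟨by linarith [ht.1], ht.2⟩
  have h4 : |w t * zy 0 t| ≤ |K| * G0 := by
    rw [abs_mul]; exact mul_le_mul (abs_le_abs_of_nonneg (h.w0 t) (h.wK t)) h2 (abs_nonneg _) (abs_nonneg _)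
  have : |zt 0 t| ≤ |zt 0 t - w t * zy 0 t| + |w t * zy 0 t| := by simpa using abs_add_le (zt 0 t - w t * zy 0 t) (w t * zy 0 t)
  have := le_abs_self C
  linarith

lemma S_alg {a b s G N : ℝ} {D : ℝ} (hb : 0 ≤ b) (hab : b ≤ a) (has : a ≤ s) (hN : 2 * G ≤ N) (hN0 : 0 ≤ N) (hD : |D| ≤ 2 * G * (a * b)) (hD0 : a = b → D = 0)
    (h : 0 < s * D - N * (3 * a ^ 2 * b - b ^ 3 - a * b ^ 2 / 2)) : 0 < b ∧ b < a ∧ a < s := by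
  have hP : a ^ 2 * b ≤ 3 * a ^ 2 * b - b ^ 3 - a * b ^ 2 / 2 := by
    have e1 : b * b ^ 2 ≤ b * a ^ 2 := by gcongr
    have e2 : b * (a * b) ≤ b * (a * a) := by gcongr; linarith
    nlinarith [mul_nonneg hb (sq_nonneg a)]
  have hNP := mul_le_mul_of_nonneg_left hP hN0
  have h0 : 0 ≤ N * (a ^ 2 * b) := by positivity
  have hD' := (abs_le.1 hD).2
  refine ⟨lt_of_le_of_ne hb fun e => ?_, lt_of_le_of_ne hab fun e => ?_, lt_of_le_of_ne has fun e => ?_⟩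
  · rw [← e] at hD'; nlinarith
  · rw [hD0 e.symm] at h; linarith
  · subst e
    have h1 : a * D ≤ a * (2 * G * (a * b)) := mul_le_mul_of_nonneg_left hD' (hb.trans hab)
    have h2 : 2 * G * (a * a * b) ≤ N * (a * a * b) := by have := hb.trans hab; gcongr
    linarith

lemma S_alg2 {a b s G N C c q l D ya yb ta tb : ℝ} (hb : 0 < b) (hab : b < a) (hs : 0 ≤ s) (hs1 : s ≤ 1) (hG : 0 ≤ G) (hC : 0 ≤ C) (hl : 0 ≤ l) (hl1 : l ≤ 1) (hc : 0 < c) (hq : c ≤ q)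
    (hN : 4 * G + 2 * C + 1 ≤ c * N) (ha1 : b ≤ 1) (hD : |D| ≤ 2 * G * (a * b))
    (m1 : 0 ≤ D + s * (b * ta - a * tb)) (m2 : s * b * ya - N * (6 * b) ≤ 0) (m3 : -(s * a * yb) + N * (6 * b + a) ≤ 0)
    (pa : l * ta - q * ya ≤ C + G) (pb : -(C + G) ≤ l * tb - q * yb) : False := by
  have ha : 0 < a := hb.trans hab
  have e1 : l * D ≤ 2 * G * a := by
    have h1 : l * D ≤ l * (2 * G * (a * b)) := mul_le_mul_of_nonneg_left (abs_le.1 hD).2 hl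
    have h2 : l * (2 * G * (a * b)) ≤ 1 * (2 * G * (a * 1)) := by gcongr
    linarith
  have e2 : s * b * (l * ta - q * ya) ≤ s * b * (C + G) := by gcongr
  have e3 : s * a * (-(C + G)) ≤ s * a * (l * tb - q * yb) := by gcongr
  have e4 : s * b * (C + G) ≤ 1 * a * (C + G) := by gcongr
  have e5 : s * a * (C + G) ≤ 1 * a * (C + G) := by gcongr
  have N0 : 0 ≤ N := by by_contra hh; push Not at hh; nlinarith
  have e6 : q * (s * b * ya - s * a * yb) ≤ q * (-(N * a)) := mul_le_mul_of_nonneg_left (by linarith) (hc.le.trans hq)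
  have e7 : c * (N * a) ≤ q * (N * a) := by gcongr
  have e8 : (4 * G + 2 * C + 1) * a ≤ c * N * a := mul_le_mul_of_nonneg_right hN ha.le
  have := mul_nonneg hl m1
  nlinarith

lemma S1 (h : Z1 r c K C lam z zy zyy zt q w) {G N : ℝ} (hG0 : 0 ≤ G) (hG : ∀ t ∈ Icc (-(r / 2)) 0, (∀ y ∈ Icc 0 (r / 2), |z y t - z 0 t| ≤ G * y) ∧ |zt 0 t| ≤ G)
    (hN : 4 * G + 2 * C + 1 ≤ c * N) (hN2 : 2 * G ≤ N) {a b t : ℝ} (hb : 0 ≤ b) (hab : b ≤ a) (ht : t ≤ 0) (has : a ≤ t + r / 2) :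
    (t + r / 2) * (b * z a t - a * z b t + (a - b) * z 0 t) ≤ N * (3 * a ^ 2 * b - b ^ 3 - a * b ^ 2 / 2) := by
  have hr := h.hr; have hr1 := h.hr1
  set F : ℝ → ℝ → ℝ → ℝ := fun a b t => (t + r / 2) * (b * z a t - a * z b t + (a - b) * z 0 t) - N * (3 * a ^ 2 * b - b ^ 3 - a * b ^ 2 / 2) with hF
  have e1 : Continuous fun p : ℝ × ℝ × ℝ => z p.1 p.2.2 := h.cont.comp (by fun_prop : Continuous fun p : ℝ × ℝ × ℝ => (p.1, p.2.2))
  have e2 : Continuous fun p : ℝ × ℝ × ℝ => z p.2.1 p.2.2 := h.cont.comp (by fun_prop : Continuous fun p : ℝ × ℝ × ℝ => (p.2.1, p.2.2))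
  have e3 : Continuous fun p : ℝ × ℝ × ℝ => z 0 p.2.2 := h.cont.comp (by fun_prop : Continuous fun p : ℝ × ℝ × ℝ => ((0:ℝ), p.2.2))
  have e4 : Continuous fun p : ℝ × ℝ × ℝ => N * (3 * p.1 ^ 2 * p.2.1 - p.2.1 ^ 3 - p.1 * p.2.1 ^ 2 / 2) := by fun_prop
  have e5 : Continuous fun p : ℝ × ℝ × ℝ => p.2.1 := by fun_prop
  have e6 : Continuous fun p : ℝ × ℝ × ℝ => p.1 := by fun_prop
  refine sub_nonpos.1 (mp3 (F := F) (k := 0) (((by fun_prop : Continuous fun p : ℝ × ℝ × ℝ => (p.2.2 + r / 2)).mul (((e5.mul e1).sub (e6.mul e2)).add ((e6.sub e5).mul e3))).sub e4) ?_ hb hab ht has (by linarith))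
  clear hb hab ht has a b t
  intro a b t hb hab ht has _ hpos hmax
  have ta : t ∈ Icc (-(r / 2)) 0 := ⟨by linarith, ht⟩
  obtain ⟨g1, g2⟩ := hG t ta
  have ha := g1 a ⟨hb.trans hab, by linarith⟩
  have hb' := g1 b ⟨hb, by linarith⟩
  have hD : |b * z a t - a * z b t + (a - b) * z 0 t| ≤ 2 * G * (a * b) := by
    have : b * z a t - a * z b t + (a - b) * z 0 t = b * (z a t - z 0 t) - a * (z b t - z 0 t) := by ring
    rw [this]
    refine (abs_sub _ _).trans ?_
    rw [abs_mul, abs_mul, abs_of_nonneg hb, abs_of_nonneg (hb.trans hab)]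
    have h1 : b * |z a t - z 0 t| ≤ b * (G * a) := by gcongr
    have h2 : a * |z b t - z 0 t| ≤ a * (G * b) := by have := hb.trans hab; gcongr
    linarith
  have N0 : 0 ≤ N := by linarith
  obtain ⟨l1, l2, l3⟩ := S_alg hb hab has hN2 N0 hD (fun e => by rw [e]; ring) hpos
  have tt : t ∈ Ioc (-r) 0 := ⟨by linarith, ht⟩
  have dt : HasDerivWithinAt (fun t => F a b t) ((b * z a t - a * z b t + (a - b) * z 0 t) + (t + r / 2) * (b * (zt a t - zt 0 t) - a * (zt b t - zt 0 t))) (Iic t) t := by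
    have e1 : HasDerivWithinAt (fun t : ℝ => t + r / 2) 1 (Iic t) t := ((hasDerivAt_id t).add_const (r / 2)).hasDerivWithinAt
    refine ((e1.mul ((((h.ht a t tt).const_mul b).sub ((h.ht b t tt).const_mul a)).add ((h.ht 0 t tt).const_mul (a - b)))).sub_const (N * (3 * a ^ 2 * b - b ^ 3 - a * b ^ 2 / 2))).congr_deriv ?_
    simp only [Pi.sub_apply, Pi.add_apply]; ring
  have da : ∀ x, HasDerivAt (fun a => F a b t) ((t + r / 2) * (b * zy x t - z b t + z 0 t) - N * (6 * b * x - b ^ 2 / 2)) x := fun x => by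
    have i := hasDerivAt_id x
    refine (((((h.hz x t).const_mul b).sub (i.mul_const (z b t))).add ((i.sub_const b).mul_const (z 0 t))).const_mul (t + r / 2) |>.sub (((((i.pow 2).const_mul 3).mul_const b).sub_const (b ^ 3) |>.sub ((i.mul_const (b ^ 2)).div_const 2)).const_mul N)).congr_deriv ?_
    simp only [Nat.reduceSub, pow_one, Nat.cast_ofNat, id_eq]; ring
  have daa : HasDerivAt (fun x => (t + r / 2) * (b * zy x t - z b t + z 0 t) - N * (6 * b * x - b ^ 2 / 2)) ((t + r / 2) * b * zyy a t - N * (6 * b)) a := by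
    refine (((((h.hzy a t).const_mul b).sub_const (z b t)).add_const (z 0 t)).const_mul (t + r / 2) |>.sub (((hasDerivAt_id a).const_mul (6 * b)).sub_const (b ^ 2 / 2) |>.const_mul N)).congr_deriv ?_
    ring
  have db : ∀ x, HasDerivAt (fun b => F a b t) ((t + r / 2) * (z a t - a * zy x t - z 0 t) - N * (3 * a ^ 2 - 3 * x ^ 2 - a * x)) x := fun x => by
    have i := hasDerivAt_id x
    refine ((((i.mul_const (z a t)).sub ((h.hz x t).const_mul a)).add ((i.const_sub a).mul_const (z 0 t))).const_mul (t + r / 2) |>.sub (((i.const_mul (3 * a ^ 2)).sub (i.pow 3) |>.sub (((i.pow 2).const_mul a).div_const 2)).const_mul N)).congr_deriv ?_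
    simp only [Nat.reduceSub, pow_one, Nat.cast_ofNat, id_eq]; ring
  have dbb : HasDerivAt (fun x => (t + r / 2) * (z a t - a * zy x t - z 0 t) - N * (3 * a ^ 2 - 3 * x ^ 2 - a * x)) (-((t + r / 2) * a * zyy b t) + N * (6 * b + a)) b := by
    have i := hasDerivAt_id b
    refine (((((h.hzy b t).const_mul a).const_sub (z a t)).sub_const (z 0 t)).const_mul (t + r / 2) |>.sub ((((i.pow 2).const_mul 3).const_sub (3 * a ^ 2) |>.sub (i.const_mul a)).const_mul N)).congr_deriv ?_
    simp only [Nat.reduceSub, pow_one, Nat.cast_ofNat, id_eq]; ring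
  obtain ⟨m1, m2, m3, _⟩ := max3 hb (hmax l2 l3 (by linarith)) dt da daa db dbb
  have pa := (abs_le.1 (h.pde a ⟨by linarith, by linarith⟩ t ⟨by linarith, ht⟩)).2
  have pb := (abs_le.1 (h.pde b ⟨by linarith, by linarith⟩ t ⟨by linarith, ht⟩)).1
  have hl : |lam * zt 0 t| ≤ G := by
    rw [abs_mul, abs_of_pos h.hl]
    calc lam * |zt 0 t| ≤ 1 * G := mul_le_mul h.hl1 g2 (abs_nonneg _) zero_le_one
      _ = G := one_mul _
  have hl' := abs_le.1 hl
  exact S_alg2 l1 l2 (by linarith) (by linarith) hG0 h.hC.le h.hl.le h.hl1 h.hc (h.qc t) hN (by linarith) hD m1 m2 (m3 l1) (by linarith) (by linarith)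

lemma GS2 (r c K C : ℝ) (hr : 0 < r) (hc : 0 < c) (hC : 0 < C) : ∃ G : ℝ, 0 ≤ G ∧ ∀ {lam z zy zyy zt q w}, Z1 r c K C lam z zy zyy zt q w → ∀ t ∈ Icc (-(r / 4)) 0,
    (∀ y ∈ Icc 0 (r / 4), |z y t - z 0 t| ≤ G * y) ∧ |zy 0 t| ≤ G ∧ |zt 0 t| ≤ G ∧ (∀ y ∈ Icc 0 (r / 4), |z y t - z 0 t - y * zy 0 t| ≤ G * y ^ 2) := by
  obtain ⟨G, hG0, hG⟩ := G2 r c K C hc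
  set N := 2 * G + (4 * G + 2 * C + 1) / c with hNd
  have N0 : 0 ≤ N := by positivity
  have hN2 : 2 * G ≤ N := by have : 0 ≤ (4 * G + 2 * C + 1) / c := by positivity
                             linarith
  have hN : 4 * G + 2 * C + 1 ≤ c * N := by
    have : c * N = c * (2 * G) + (4 * G + 2 * C + 1) := by rw [hNd]; field_simp
    rw [this]; have : 0 ≤ c * (2 * G) := by positivity
    linarith
  refine ⟨G + 12 * N / r, by positivity, fun {lam z zy zyy zt q w} h t ht => ?_⟩
  have t2 : t ∈ Icc (-(r / 2)) 0 := ⟨by linarith [ht.1], ht.2⟩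
  obtain ⟨g1, g2, g3⟩ := hG h t t2
  have gN : 0 ≤ 12 * N / r := by positivity
  have key : ∀ {z zy zyy zt}, Z1 r c K C lam z zy zyy zt q w → (∀ t ∈ Icc (-(r / 2)) 0, (∀ y ∈ Icc 0 (r / 2), |z y t - z 0 t| ≤ G * y) ∧ |zt 0 t| ≤ G) → ∀ a ∈ Icc 0 (r / 4), z a t - z 0 t - a * zy 0 t ≤ 12 * N / r * a ^ 2 := fun {z zy zyy zt} h hh a ha => by
    rcases ha.1.eq_or_lt with e | a0
    · rw [← e]; simp
    have := deriv_right_max (f := fun b => b * (z a t - z 0 t) - a * (z b t - z 0 t) - 12 * N / r * a ^ 2 * b) (t := 0) ((((hasDerivAt_id (0:ℝ)).mul_const (z a t - z 0 t)).sub (((h.hz 0 t).sub_const (z 0 t)).const_mul a) |>.sub ((hasDerivAt_id (0:ℝ)).const_mul (12 * N / r * a ^ 2))).hasDerivWithinAt) (by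
      filter_upwards [Icc_mem_nhdsGE a0] with b hb
      have h1 := S1 h hG0 hh hN hN2 hb.1 hb.2 ht.2 (by linarith [ht.1, ha.2] : a ≤ t + r / 2)
      set D := b * z a t - a * z b t + (a - b) * z 0 t with hD
      have h2 : N * (3 * a ^ 2 * b - b ^ 3 - a * b ^ 2 / 2) ≤ N * (3 * a ^ 2 * b) := by
        have e1 : 0 ≤ b ^ 3 := pow_nonneg hb.1 3
        have e2 : 0 ≤ a * b ^ 2 := by positivity
        gcongr; linarith
      have b0 := hb.1
      have h3 : D ≤ 12 * N / r * a ^ 2 * b := by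
        rcases le_total D 0 with d0 | d0
        · exact d0.trans (by positivity)
        have h4 : r / 4 * D ≤ (t + r / 2) * D := mul_le_mul_of_nonneg_right (by linarith [ht.1]) d0
        have : 12 * N / r * a ^ 2 * b = (N * (3 * a ^ 2 * b)) / (r / 4) := by field_simp; ring
        rw [this, le_div_iff₀ (by positivity)]; linarith
      simp only [zero_mul, sub_self, mul_zero]; linarith)
    linarith
  refine ⟨fun y hy => (g1 y ⟨hy.1, by linarith [hy.2]⟩).trans (by have := hy.1; gcongr; linarith), by linarith, by linarith, fun y hy => ?_⟩
  have k1 := key h (fun t ht => ⟨(hG h t ht).1, (hG h t ht).2.2⟩) y hy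
  have k2 := key h.neg (fun t ht => ⟨(hG h.neg t ht).1, (hG h.neg t ht).2.2⟩) y hy
  have : 0 ≤ G * y ^ 2 := by positivity
  rw [abs_le]; constructor <;> linarith
end
end OB
end


noncomputable section
namespace OB
open Filter Topology Complex

section
variable {d : ℕ}
lemma sb {n : ℕ} {f : Fin n → ℝ} {B : ℝ} (h : ∀ i, |f i| ≤ B) : |∑ i, f i| ≤ n * B :=
  (Finset.abs_sum_le_sum_abs _ _).trans ((Finset.sum_le_sum fun i _ => h i).trans (by simp))
lemma nle {x : Eucl (d + 1)} {B : ℝ} (h : ∀ i, |x i| ≤ B) : ‖x‖ ≤ (d + 1) * B := by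
  have h1 := (le_abs_self _).trans (inner_bd h x)
  rw [real_inner_self_eq_norm_sq] at h1
  rcases (norm_nonneg x).eq_or_lt with e | e
  · rw [← e]; have := (abs_nonneg _).trans (h 0); positivity
  · exact le_of_mul_le_mul_right (by linarith [sq ‖x‖]) e
lemma lcs {p : Fin (d + 1) → Prop} (h : ∀ i : Fin d, p i.castSucc) (h' : p (Fin.last d)) (i) : p i := Fin.lastCases h' h i
lemma inn (x y : Eucl (d + 1)) : ⟪x, y⟫ = ∑ i, x i * y i := by simp [PiLp.inner_apply, mul_comm]

lemma regH (V : Reg (d + 1)) (i : Fin d) {V' : Reg (d + 1)} (h : ∀ p, V.g p i.castSucc = V'.u p) (p j) : V.H p i.castSucc j = V'.g p j := by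
  have h1 : HasFDerivAt (fun x => V'.u (x, p.2)) ((EuclideanSpace.proj i.castSucc : Eucl (d + 1) →L[ℝ] ℝ).comp (mL (V.H (p.1, p.2)))) p.1 := by
    have := (EuclideanSpace.proj i.castSucc : Eucl (d + 1) →L[ℝ] ℝ).hasFDerivAt.comp p.1 (V.hg p.1 p.2)
    exact this.congr_of_eventuallyEq (Eventually.of_forall fun x => (h (x, p.2)).symm)
  have h2 := congrArg (fun f : Eucl (d + 1) →L[ℝ] ℝ => f (EuclideanSpace.single j 1)) (h1.unique (V'.hx p.1 p.2))
  simpa [mL_apply, inn] using h2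

/-- conormal direction -/
def eT (W : Co d) (t : ℝ) : Eucl (d + 1) := WithLp.toLp 2 fun i => W.Q t i (Fin.last d) / W.Q t (Fin.last d) (Fin.last d)
def LD (W : Co d) (D : ℝ) (E : ℝ → Eucl (d + 1)) : Prop := ∀ t ∈ Ioc (-1) 0, HasDerivWithinAt (eT W) (E t) (Iic t) t ∧ E t (Fin.last d) = 0 ∧ ∀ i, W.lam * |E t i| ≤ D
variable (W : Co d)
lemma qpos (t) : 0 < W.Q t (Fin.last d) (Fin.last d) := W.hc.trans_le (W.Qn t)
lemma eT_last (t) : eT W t (Fin.last d) = 1 := div_self (qpos W t).ne'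
lemma eT_bd (t i) : |eT W t i| ≤ W.K / W.c := by
  have := W.hK
  show |_ / _| ≤ _
  rw [abs_div, abs_of_pos (qpos W t)]
  exact div_le_div₀ W.hK (W.Qb _ _ _) W.hc (W.Qn t)
lemma eT_cont : Continuous (eT W) := (PiLp.continuous_toLp 2 _).comp (continuous_pi fun i => (W.cQ i _).div (W.cQ _ _) fun t => (qpos W t).ne')
lemma KC1 : 1 ≤ W.K / W.c := by
  rw [le_div_iff₀ W.hc, one_mul]
  exact (W.Qn 0).trans ((le_abs_self _).trans (W.Qb _ _ _))

structure Vb (W : Co d) (V : Reg (d + 1)) (r C : ℝ) : Prop where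
  u : ∀ p ∈ IG d r r, |V.u p| ≤ C
  g : ∀ p ∈ IG d r r, ∀ j : Fin d, |V.g p j.castSucc| ≤ C
  H : ∀ p ∈ IG d r r, ∀ i j : Fin d, |V.H p i.castSucc j.castSucc| ≤ C
  res : Rs W 1 V (IG d r r)

lemma shA (t) (V : Reg (d + 1)) (p) {C : ℝ} (hC : 0 ≤ C) (h : ∀ i j : Fin d, |V.H p i.castSucc j.castSucc| ≤ C) :
    |V.L (W.Q t) p - W.Q t (Fin.last d) (Fin.last d) * bq (V.H p) (eT W t) (eT W t)| ≤ (d + 1) * ((d + 1) * ((W.K + W.K * (W.K / W.c)) * C)) := by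
  have h0 : V.L (W.Q t) p - W.Q t (Fin.last d) (Fin.last d) * bq (V.H p) (eT W t) (eT W t) = ∑ i, ∑ j, (W.Q t i j - W.Q t i (Fin.last d) * eT W t j) * V.H p i j := by
    simp only [Reg.L, bq, Finset.mul_sum, ← Finset.sum_sub_distrib]
    refine Finset.sum_congr rfl fun i _ => Finset.sum_congr rfl fun j _ => ?_
    have : W.Q t (Fin.last d) (Fin.last d) * eT W t i = W.Q t i (Fin.last d) := by
      show _ * (_ / _) = _
      field_simp [(qpos W t).ne']
    rw [← this]; ring
  rw [h0]
  have B0 : 0 ≤ (W.K + W.K * (W.K / W.c)) * C := by have := W.hK; have := W.hc; positivity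
  have key : ∀ i j, |(W.Q t i j - W.Q t i (Fin.last d) * eT W t j) * V.H p i j| ≤ (W.K + W.K * (W.K / W.c)) * C := by
    refine lcs (fun i => lcs (fun j => ?_) ?_) fun j => ?_
    · rw [abs_mul]
      refine mul_le_mul ((abs_sub _ _).trans (add_le_add (W.Qb _ _ _) ?_)) (h i j) (abs_nonneg _) (by have := W.hK; have := W.hc; positivity)
      rw [abs_mul]; exact mul_le_mul (W.Qb _ _ _) (eT_bd W t _) (abs_nonneg _) W.hK
    · rw [eT_last]; simpa using B0
    · have : W.Q t (Fin.last d) (Fin.last d) * eT W t j = W.Q t (Fin.last d) j := by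
        show _ * (_ / _) = _
        rw [mul_div_cancel₀ _ (qpos W t).ne', (W.sym t).apply]
      rw [this]; simpa using B0
  simpa using sb fun i => sb fun j => key i j

variable {W}
lemma shZ {V : Reg (d + 1)} {r r1 C D : ℝ} {E : ℝ → Eucl (d + 1)} (hE : LD W D E) (hV : Vb W V r C) (hC : 1 ≤ C) (hD : 0 ≤ D) (hr : 0 < r1) (hr1 : r1 ≤ r) (hr2 : r ≤ 1 / 4) (hre : r1 * ((d + 1) * (W.K / W.c)) ≤ r) :
    Z1 r1 W.c W.K (1 + C + (d + 1) * ((d + 1) * ((W.K + W.K * (W.K / W.c)) * C)) + (d + 1) * (C * D)) W.lam (fun y t => V.u (y • eT W t, t)) (fun y t => ⟪V.g (y • eT W t, t), eT W t⟫)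
      (fun y t => bq (V.H (y • eT W t, t)) (eT W t) (eT W t)) (fun y t => V.ut (y • eT W t, t) + ⟪V.g (y • eT W t, t), y • E t⟫) (fun t => W.Q t (Fin.last d) (Fin.last d)) (fun t => W.v t (Fin.last d)) := by
  have hK := W.hK; have hc := W.hc
  have P1 : 0 ≤ (W.K + W.K * (W.K / W.c)) * C := by positivity
  have P2 : 0 ≤ (d + 1) * ((d + 1) * ((W.K + W.K * (W.K / W.c)) * C)) := by positivity
  have P3 : 0 ≤ (d + 1) * (C * D) := by positivity
  have mem : ∀ y ∈ Icc 0 r1, ∀ t ∈ Icc (-r1) 0, (y • eT W t, t) ∈ IG d r r := fun y hy t ht => by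
    refine ⟨?_, ?_, by show -r ≤ t; linarith [ht.1], ht.2⟩
    · show ‖y • eT W t‖ ≤ r
      rw [norm_smul, Real.norm_of_nonneg hy.1]
      exact (mul_le_mul hy.2 (nle (eT_bd W t)) (norm_nonneg _) hr.le).trans hre
    · show 0 ≤ y * eT W t (Fin.last d)
      rw [eT_last, mul_one]; exact hy.1
  refine ⟨hr, by linarith, W.hc, by positivity, W.hlam, W.hlam1, W.Qn, fun t => W.hc.le.trans (W.vn t), fun t => (le_abs_self _).trans (W.vb t _),
    fun y t => by simpa using V.line1 0 (eT W t) t y, fun y t => by simpa using V.line2 0 (eT W t) (eT W t) t y, fun y t ht => ?_, ?_, fun y hy t ht => (hV.u _ (mem y hy t ht)).trans (by linarith), fun y hy t ht => ?_, fun t ht => ?_⟩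
  · obtain ⟨e1, -, -⟩ := hE t ⟨by linarith [ht.1], ht.2⟩
    have := HasFDerivAt.comp_hasDerivWithinAt (f := fun s => (y • eT W s, s)) t (V.hu (y • eT W t, t)) ((e1.const_smul y).prodMk (hasDerivWithinAt_id t (Iic t)))
    refine this.congr_deriv ?_
    rw [dL_apply, inn]; simp; ring
  · exact V.cu.comp ((continuous_fst.smul ((eT_cont W).comp continuous_snd)).prodMk continuous_snd)
  · obtain ⟨-, e2, e3⟩ := hE t ⟨by linarith [ht.1], ht.2⟩
    have m := mem y hy t ht
    set p := (y • eT W t, t) with hp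
    have a1 := (hV.res p m).1
    have a2 := shA W t V p (by linarith) (hV.H p m)
    have a3 : |W.lam * ⟪V.g p, y • E t⟫| ≤ (d + 1) * (C * D) := by
      have : W.lam * ⟪V.g p, y • E t⟫ = ∑ i, V.g p i * (W.lam * (y * E t i)) := by rw [inn, Finset.mul_sum]; exact Finset.sum_congr rfl fun i _ => by simp; ring
      rw [this]
      refine (sb (B := C * D) (lcs (fun i => ?_) ?_)).trans (by simp)
      · rw [abs_mul, abs_mul, abs_mul, abs_of_pos W.hlam, abs_of_nonneg hy.1]
        refine mul_le_mul (hV.g p m i) ?_ (by have := W.hlam; have := hy.1; positivity) (by linarith)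
        have h5 := e3 i.castSucc
        have h6 : y * (W.lam * |E t i.castSucc|) ≤ 1 * (W.lam * |E t i.castSucc|) := mul_le_mul_of_nonneg_right (by linarith [hy.2]) (by have := W.hlam; positivity)
        linarith
      · rw [e2]; simp; positivity
    have : W.lam * (V.ut p + ⟪V.g p, y • E t⟫) - W.Q t (Fin.last d) (Fin.last d) * bq (V.H p) (eT W t) (eT W t) = (W.lam * V.ut p - V.L (W.Q p.2) p) + (V.L (W.Q t) p - W.Q t (Fin.last d) (Fin.last d) * bq (V.H p) (eT W t) (eT W t)) + W.lam * ⟪V.g p, y • E t⟫ := by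
      show _ = (_ - V.L (W.Q t) p) + _ + _; ring
    rw [this]
    refine (abs_add_three _ _ _).trans ?_
    linarith
  · have m := mem 0 ⟨le_rfl, hr.le⟩ t ht
    simp only [zero_smul, inner_zero_right, add_zero] at m ⊢
    have a1 := (hV.res _ m).2 rfl
    have a2 : |⟪W.v t, V.g (0, t)⟫ - W.v t (Fin.last d) * ⟪V.g (0, t), eT W t⟫| ≤ (d + 1) * ((W.K + W.K * (W.K / W.c)) * C) := by
      have : ⟪W.v t, V.g (0, t)⟫ - W.v t (Fin.last d) * ⟪V.g (0, t), eT W t⟫ = ∑ i, (W.v t i - W.v t (Fin.last d) * eT W t i) * V.g (0, t) i := by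
        rw [inn, inn, Finset.mul_sum, ← Finset.sum_sub_distrib]; exact Finset.sum_congr rfl fun i _ => by ring
      rw [this]
      refine (sb (B := (W.K + W.K * (W.K / W.c)) * C) (lcs (fun i => ?_) ?_)).trans (by simp)
      · rw [abs_mul]
        refine mul_le_mul ((abs_sub _ _).trans (add_le_add (W.vb _ _) ?_)) (hV.g _ m i) (abs_nonneg _) (by positivity)
        rw [abs_mul]; exact mul_le_mul (W.vb _ _) (eT_bd W t _) (abs_nonneg _) hK
      · rw [eT_last]; simpa using P1
    have a3 : (d + 1) * ((W.K + W.K * (W.K / W.c)) * C) ≤ (d + 1) * ((d + 1) * ((W.K + W.K * (W.K / W.c)) * C)) := by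
      have d0 : (0:ℝ) ≤ d := d.cast_nonneg
      exact mul_le_mul_of_nonneg_left (le_mul_of_one_le_left P1 (by linarith)) (by linarith)
    have := abs_add_le (V.ut (0, t) - ⟪W.v t, V.g (0, t)⟫) (⟪W.v t, V.g (0, t)⟫ - W.v t (Fin.last d) * ⟪V.g (0, t), eT W t⟫)
    rw [sub_add_sub_cancel] at this
    have a1 : |V.ut (0, t) - ⟪W.v t, V.g (0, t)⟫| ≤ 1 := a1
    linarith

lemma tay2 {f f1 f2 : ℝ → ℝ} {B : ℝ} (h : ∀ s, HasDerivAt f (f1 s) s) (h1 : ∀ s, HasDerivAt f1 (f2 s) s) (hB : ∀ s ∈ Icc (0:ℝ) 1, |f2 s| ≤ B) : |f 1 - f 0 - f1 0| ≤ B := by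
  have a1 : ∀ s ∈ Icc (0:ℝ) 1, |f1 s - f1 0| ≤ B := fun s hs => by
    have B0 : 0 ≤ B := (abs_nonneg _).trans (hB s hs)
    have := (convex_Icc (0:ℝ) 1).norm_image_sub_le_of_norm_hasDerivWithin_le (fun x _ => (h1 x).hasDerivWithinAt) (fun x hx => hB x hx) ⟨le_rfl, zero_le_one⟩ hs
    rw [Real.norm_eq_abs, Real.norm_eq_abs, sub_zero, abs_of_nonneg hs.1] at this
    exact this.trans (mul_le_of_le_one_right B0 hs.2)
  have := (convex_Icc (0:ℝ) 1).norm_image_sub_le_of_norm_hasDerivWithin_le (f := fun s => f s - s * f1 0) (f' := fun s => f1 s - f1 0) (C := B) (fun x _ => by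
    exact ((h x).sub ((hasDerivAt_id x).mul_const (f1 0))).hasDerivWithinAt.congr_deriv (by simp)) (fun x hx => a1 x hx) ⟨le_rfl, zero_le_one⟩ ⟨zero_le_one, le_rfl⟩
  simpa [sub_right_comm] using this

structure St (V : Reg (d + 1)) (r C : ℝ) : Prop where
  tay : ∀ t ∈ Icc (-r) 0, ∀ x, ‖x‖ ≤ r → 0 ≤ lastC x → |V.u (x, t) - V.u (0, t) - ⟪V.g (0, t), x⟫| ≤ C * ‖x‖ ^ 2
  g0 : ∀ t ∈ Icc (-r) 0, ‖V.g (0, t)‖ ≤ C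
  ut0 : ∀ t ∈ Icc (-r) 0, |V.ut (0, t)| ≤ C
  gt : ∀ t ∈ Icc (-r) 0, ∀ j : Fin d, |V.g (0, t) j.castSucc - V.g (0, 0) j.castSucc| ≤ C * |t|

lemma tayA {V : Reg (d + 1)} {r r1 C G κ : ℝ} (hV : Vb W V r C) (hk : κ = (d + 1) * (W.K / W.c)) (hre : r1 * (2 * κ + 1) ≤ r) (hr2 : r1 ≤ r) (hG : 0 ≤ G) (hC : 0 ≤ C) {t : ℝ} (ht : t ∈ Icc (-r1) 0)
    (h1 : ∀ y ∈ Icc 0 r1, |V.u (y • eT W t, t) - V.u (0, t) - y * ⟪V.g (0, t), eT W t⟫| ≤ G * y ^ 2)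
    (h2 : ∀ y ∈ Icc 0 r1, ∀ j : Fin d, |V.g (y • eT W t, t) j.castSucc - V.g (0, t) j.castSucc| ≤ G * y) {x : Eucl (d + 1)} (hx : ‖x‖ ≤ r1) (hx0 : 0 ≤ lastC x) :
    |V.u (x, t) - V.u (0, t) - ⟪V.g (0, t), x⟫| ≤ (G + (d + 1) * (G * (1 + κ)) + (d + 1) * ((d + 1) * (C * (1 + κ) ^ 2))) * ‖x‖ ^ 2 := by
  set e := eT W t with he
  set y := lastC x with hy
  set ξ := x - y • e with hξ
  have k0 : 0 ≤ κ := by rw [hk]; have := W.hK; have := W.hc; positivity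
  have ne : ‖e‖ ≤ κ := hk ▸ nle (eT_bd W t)
  have yx : y ≤ ‖x‖ := (le_abs_self _).trans (coord_le x _)
  have nye : ‖y • e‖ ≤ ‖x‖ * κ := by
    rw [norm_smul, Real.norm_of_nonneg hx0]; exact mul_le_mul yx ne (norm_nonneg _) (norm_nonneg _)
  have nξ : ‖ξ‖ ≤ (1 + κ) * ‖x‖ := (norm_sub_le _ _).trans (by linarith)
  have lξ : ξ (Fin.last d) = 0 := by
    show x (Fin.last d) - y * e (Fin.last d) = 0
    rw [he, eT_last]; simp [hy, lastC]
  have yI : y ∈ Icc 0 r1 := ⟨hx0, yx.trans hx⟩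
  have m : ∀ s ∈ Icc (0:ℝ) 1, (y • e + s • ξ, t) ∈ IG d r r := fun s hs => by
    refine ⟨?_, ?_, by show -r ≤ t; linarith [ht.1], ht.2⟩
    · show ‖y • e + s • ξ‖ ≤ r
      refine (norm_add_le _ _).trans ?_
      have h3 : ‖s • ξ‖ ≤ ‖ξ‖ := by rw [norm_smul, Real.norm_of_nonneg hs.1]; exact mul_le_of_le_one_left (norm_nonneg _) hs.2
      have : ‖x‖ * (2 * κ + 1) ≤ r1 * (2 * κ + 1) := by gcongr
      linarith
    · show 0 ≤ y * e (Fin.last d) + s * ξ (Fin.last d)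
      rw [he, eT_last, lξ]; simpa using hx0
  have T := tay2 (B := (d + 1) * ((d + 1) * (C * ‖ξ‖ ^ 2))) (fun s => V.line1 (y • e) ξ t s) (fun s => V.line2 (y • e) ξ ξ t s) (fun s hs => by
    unfold bq
    have key : ∀ i j, |V.H (y • e + s • ξ, t) i j * (ξ i * ξ j)| ≤ C * ‖ξ‖ ^ 2 := by
      refine lcs (fun i => lcs (fun j => ?_) ?_) fun j => ?_
      · rw [abs_mul, abs_mul, sq]
        exact mul_le_mul (hV.H _ (m s hs) i j) (mul_le_mul (coord_le _ _) (coord_le _ _) (abs_nonneg _) (norm_nonneg _)) (by positivity) hC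
      · rw [lξ]; simp; positivity
      · rw [lξ]; simp; positivity
    simpa using sb fun i => sb fun j => key i j)
  simp only [one_smul, zero_smul, add_zero] at T
  have e1 : y • e + ξ = x := by rw [hξ]; abel
  rw [e1] at T
  have T2 : |⟪V.g (y • e, t), ξ⟫ - ⟪V.g (0, t), ξ⟫| ≤ (d + 1) * (G * y * ‖ξ‖) := by
    rw [inn, inn, ← Finset.sum_sub_distrib]
    refine (sb (B := G * y * ‖ξ‖) (lcs (fun i => ?_) ?_)).trans (by simp)
    · rw [← sub_mul, abs_mul]
      exact mul_le_mul (h2 y yI i) (coord_le _ _) (abs_nonneg _) (by positivity)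
    · rw [lξ]; simp; positivity
  have T1 := h1 y yI
  have e2 : ⟪V.g (0, t), x⟫ = y * ⟪V.g (0, t), e⟫ + ⟪V.g (0, t), ξ⟫ := by rw [← e1, inner_add_right, inner_smul_right]
  have b1 : G * y ^ 2 ≤ G * ‖x‖ ^ 2 := by gcongr
  have b2 : (d + 1) * (G * y * ‖ξ‖) ≤ (d + 1) * (G * ‖x‖ * ((1 + κ) * ‖x‖)) := by gcongr
  have b3 : (d + 1) * ((d + 1) * (C * ‖ξ‖ ^ 2)) ≤ (d + 1) * ((d + 1) * (C * ((1 + κ) * ‖x‖) ^ 2)) := by gcongr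
  have : V.u (x, t) - V.u (0, t) - ⟪V.g (0, t), x⟫ = (V.u (x, t) - V.u (y • e, t) - ⟪V.g (y • e, t), ξ⟫) + (V.u (y • e, t) - V.u (0, t) - y * ⟪V.g (0, t), e⟫) + (⟪V.g (y • e, t), ξ⟫ - ⟪V.g (0, t), ξ⟫) := by rw [e2]; ring
  rw [this]
  refine (abs_add_three _ _ _).trans ?_
  linarith

lemma st (d : ℕ) (c K D : ℝ) (hc : 0 < c) (hK : 0 ≤ K) (hD : 0 ≤ D) : ∃ C r : ℝ, 1 ≤ C ∧ 0 < r ∧ r ≤ 1 / 4 ∧ ∀ W : Co d, W.c = c → W.K = K → Ell W → ∀ E, LD W D E → ∀ ε ≤ 1, ∀ P, (∀ p ∈ IG d (1 / 4) (1 / 2), |(Pack.reg P).u p| ≤ 2) →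
    (∀ l, l.length ≤ 3 → Rs W ε (Pack.reg (dP l P)) (IG d (1 / 4) (1 / 2))) → St (Pack.reg P) r C ∧ Vb W (Pack.reg P) r C := by
  obtain ⟨C, r, hC, hr, hr4, ht⟩ := tang d c K
  set κ : ℝ := (d + 1) * (K / c) with hκ
  have k0 : 0 ≤ κ := by positivity
  set r1 := r / (2 * κ + 1) with hr1
  have r10 : 0 < r1 := by positivity
  have hre : r1 * (2 * κ + 1) = r := by rw [hr1]; field_simp
  have r1r : r1 ≤ r := by nlinarith
  have rk : r1 * κ ≤ r := by nlinarith
  set C' := 1 + C + (d + 1) * ((d + 1) * ((K + K * (K / c)) * C)) + (d + 1) * (C * D) with hC'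
  have C'0 : 0 < C' := by positivity
  obtain ⟨G, hG0, hG⟩ := GS2 r1 c K C' r10 hc C'0
  set A := G + (d + 1) * (G * (1 + κ)) + (d + 1) * ((d + 1) * (C * (1 + κ) ^ 2)) with hA
  have A0 : 0 ≤ A := by positivity
  have B0 : 0 ≤ (d + 1) * (C + (G + (d + 1) * (C * (K / c)))) := by positivity
  refine ⟨C + A + (d + 1) * (C + (G + (d + 1) * (C * (K / c)))) + G, r1 / 4, by linarith, by positivity, by linarith, ?_⟩
  rintro W rfl rfl hE E hL ε hε P hb hR
  have T := ht W rfl rfl hE ε hε P hb hR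
  have vb : ∀ l, l.length ≤ 1 → Vb W (Pack.reg (dP l P)) r C := fun l hl => by
    refine ⟨fun p hp => T l (by omega) p hp, fun p hp j => ?_, fun p hp i j => ?_, fun p hp => ?_⟩
    · rw [Pack.reg_g]; exact T (j :: l) (by simp; omega) p hp
    · rw [regH _ i (V' := Pack.reg (dP (i :: l) P)) (fun p => Pack.reg_g (dP l P) p i), Pack.reg_g]
      exact T (j :: i :: l) (by simp; omega) p hp
    · have := hR l (by omega) p ⟨hp.1.trans hr4, hp.2.1, by linarith [hp.2.2.1], hp.2.2.2⟩
      exact ⟨this.1.trans hε, fun h => (this.2 h).trans hε⟩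
  have z := fun (l : List (Fin d)) (hl : l.length ≤ 1) => hG (shZ hL (vb l hl) hC hD r10 r1r hr4 rk)
  have z0 := z [] (by simp)
  have zj := fun j : Fin d => z [j] (by simp)
  simp only [zero_smul, inner_zero_right, add_zero] at z0 zj
  have v0 : Vb W (Pack.reg P) r C := vb [] (by simp)
  have dg : ∀ (j : Fin d) p, (Pack.reg P).g p j.castSucc = (Pack.reg (dP [j] P)).u p := fun j p => Pack.reg_g P p j
  have hz : ∀ t ∈ Icc (-(r1 / 4)) 0, ((0 : Eucl (d + 1)), t) ∈ IG d r r := fun t ht => ⟨by simpa using hr.le, le_rfl, by show -r ≤ t; linarith [ht.1], ht.2⟩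
  refine ⟨⟨fun t ht x hx hx0 => ?_, fun t ht => ?_, fun t ht => (z0 t ht).2.2.1.trans (by linarith), fun t ht j => ?_⟩, ?_⟩
  · refine (tayA v0 hκ (by nlinarith : r1 / 4 * (2 * κ + 1) ≤ r) (by linarith) hG0 (by linarith) ht (z0 t ht).2.2.2 (fun y hy j => ?_) hx hx0).trans (mul_le_mul_of_nonneg_right (by linarith) (sq_nonneg _))
    rw [dg, dg]; exact (zj j t ht).1 y hy
  · refine (nle (B := C + (G + (d + 1) * (C * (W.K / W.c)))) (lcs (fun i => (v0.g _ (hz t ht) i).trans ?_) ?_)).trans (by linarith)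
    · have : 0 ≤ (d + 1) * (C * (W.K / W.c)) := by positivity
      linarith
    · have h1 : (Pack.reg P).g (0, t) (Fin.last d) = ⟪(Pack.reg P).g (0, t), eT W t⟫ - ∑ i : Fin d, (Pack.reg P).g (0, t) i.castSucc * eT W t i.castSucc := by
        rw [inn, Fin.sum_univ_castSucc, eT_last]; ring
      have h2 : |∑ i : Fin d, (Pack.reg P).g (0, t) i.castSucc * eT W t i.castSucc| ≤ d * (C * (W.K / W.c)) := sb fun i => by
        rw [abs_mul]; exact mul_le_mul (v0.g _ (hz t ht) i) (eT_bd W t _) (abs_nonneg _) (by linarith)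
      have h3 : |⟪(Pack.reg P).g (0, t), eT W t⟫| ≤ G := (z0 t ht).2.1
      have h4 : 0 ≤ C * (W.K / W.c) := by positivity
      rw [h1]; refine (abs_sub _ _).trans ?_
      linarith
  · rw [dg, dg]
    have := (convex_Icc (-(r1 / 4)) 0).norm_image_sub_le_of_norm_hasDerivWithin_le (f := fun s => (Pack.reg (dP [j] P)).u (0, s)) (fun x _ => ((Pack.reg (dP [j] P)).htime 0 x).hasDerivWithinAt) (fun x hx => (zj j x hx).2.2.1) ⟨by linarith, le_rfl⟩ ht
    rw [sub_zero] at this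
    exact this.trans (mul_le_mul_of_nonneg_right (by linarith) (norm_nonneg _))
  · have m : ∀ p ∈ IG d (r1 / 4) (r1 / 4), p ∈ IG d r r := fun p hp => ⟨hp.1.trans (by linarith), hp.2.1, by linarith [hp.2.2.1], hp.2.2.2⟩
    have le : C ≤ C + A + (d + 1) * (C + (G + (d + 1) * (C * (W.K / W.c)))) + G := by linarith
    exact ⟨fun p hp => (v0.u p (m p hp)).trans le, fun p hp j => (v0.g p (m p hp) j).trans le, fun p hp i j => (v0.H p (m p hp) i j).trans le, fun p hp => v0.res p (m p hp)⟩

lemma mkLD {lam Λ M C₀ : ℝ} {Q Q' : ℝ → Matrix (Fin (d + 1)) (Fin (d + 1)) ℝ} {v v' : ℝ → Eucl (d + 1)} (h : ObliqueData d lam Λ M C₀ Q Q' v v') :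
    ∃ E, LD (mkCo h) (2 * (C₀ * (Λ * M ^ 2)) * ((Λ * M ^ 2) * (Λ * M ^ 2))) E := by
  have hl := h.lam_pos; have hΛ := h.Lam_ge_one; have hM := h.M_ge_one; have hC := h.C0_pos
  refine ⟨fun t => WithLp.toLp 2 fun i => (Q' t i (Fin.last d) * Q t (Fin.last d) (Fin.last d) - Q t i (Fin.last d) * Q' t (Fin.last d) (Fin.last d)) / Q t (Fin.last d) (Fin.last d) ^ 2, fun t ht => ?_⟩
  have tI : t ∈ Icc (-1) 0 := ⟨ht.1.le, ht.2⟩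
  have ct : cl t = t := cl_id tI
  have qp := qpos (mkCo h) t
  have qn := (mkCo h).Qn t
  have qb := fun i j => (mkCo h).Qb t i j
  simp only [mkCo, ct] at qp qn qb
  refine ⟨?_, ?_, fun i => ?_⟩
  · refine ((PiLp.continuousLinearEquiv 2 ℝ fun _ : Fin (d + 1) => ℝ).symm.hasFDerivAt.comp_hasDerivWithinAt t (f := fun s i => (mkCo h).Q s i (Fin.last d) / (mkCo h).Q s (Fin.last d) (Fin.last d)) (hasDerivWithinAt_pi.2 fun i => ?_) :)
    have dq : ∀ i j, HasDerivWithinAt (fun s => (mkCo h).Q s i j) (Q' t i j) (Iic t) t := fun i j => by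
      have h1 : HasDerivWithinAt (fun s => (mkCo h).Q s i j) (Q' t i j) (Icc (-1) 0) t := (h.Qderiv t tI i j).congr (fun s hs => by simp [mkCo, cl_id hs]) (by simp [mkCo, ct])
      refine h1.mono_of_mem_nhdsWithin ?_
      exact mem_of_superset (Icc_mem_nhdsLE ht.1) (Icc_subset_Icc_right ht.2)
    refine ((dq i (Fin.last d)).div (dq (Fin.last d) (Fin.last d)) (qpos _ t).ne').congr_deriv ?_
    simp [mkCo, ct]
  · simp; left; ring
  · have q' : ∀ i j, |Q' t i j| ≤ C₀ / lam := fun i j => (op_entry _ i j).trans (h.Qderiv_bound t tI)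
    set k := Λ * M ^ 2 with hk
    have k0 : 0 < k := by positivity
    show lam * |_ / _| ≤ _
    rw [abs_div, abs_of_pos (pow_pos qp 2)]
    have n1 : |Q' t i (Fin.last d) * Q t (Fin.last d) (Fin.last d) - Q t i (Fin.last d) * Q' t (Fin.last d) (Fin.last d)| ≤ C₀ / lam * k + k * (C₀ / lam) := by
      refine (abs_sub _ _).trans (add_le_add ?_ ?_) <;> rw [abs_mul]
      · exact mul_le_mul (q' _ _) (qb _ _) (abs_nonneg _) (by positivity)
      · exact mul_le_mul (qb _ _) (q' _ _) (abs_nonneg _) (by positivity)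
    have n2 : k⁻¹ ^ 2 ≤ Q t (Fin.last d) (Fin.last d) ^ 2 := by gcongr
    calc lam * (_ / _) ≤ lam * ((C₀ / lam * k + k * (C₀ / lam)) / k⁻¹ ^ 2) := by gcongr
      _ = _ := by field_simp; ring
end
end OB
end


noncomputable section
namespace OB
open Filter Topology Complex

section
variable {d : ℕ}
def ps (R y : ℝ) : ℝ := 60 / R ^ 6 * (y ^ 2 * (R - y) ^ 2)
def ps1 (R y : ℝ) : ℝ := 60 / R ^ 6 * (2 * R ^ 2 * y - 6 * R * y ^ 2 + 4 * y ^ 3)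
def ps2 (R y : ℝ) : ℝ := 60 / R ^ 6 * (2 * R ^ 2 - 12 * R * y + 12 * y ^ 2)
lemma ps_d (R y : ℝ) : HasDerivAt (ps R) (ps1 R y) y := by
  have i := hasDerivAt_id y
  refine (((i.pow 2).mul ((i.const_sub R).pow 2)).const_mul (60 / R ^ 6)).congr_deriv ?_
  simp only [ps1, Nat.reduceSub, pow_one, Nat.cast_ofNat, id_eq, Pi.pow_apply]; ring
lemma ps1_d (R y : ℝ) : HasDerivAt (ps1 R) (ps2 R y) y := by
  have i := hasDerivAt_id y
  refine ((((i.const_mul (2 * R ^ 2)).sub ((i.pow 2).const_mul (6 * R))).add ((i.pow 3).const_mul 4)).const_mul (60 / R ^ 6)).congr_deriv ?_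
  simp only [ps2, Nat.reduceSub, pow_one, Nat.cast_ofNat, id_eq]; ring
lemma ps_c (R : ℝ) : Continuous (ps R) := by unfold ps; fun_prop
lemma ps1_c (R : ℝ) : Continuous (ps1 R) := by unfold ps1; fun_prop
lemma ps2_c (R : ℝ) : Continuous (ps2 R) := by unfold ps2; fun_prop
lemma ps_b {R y : ℝ} (hR : 0 < R) (hy : y ∈ Icc 0 R) : |ps R y| ≤ 60 / R ^ 2 ∧ |ps1 R y| ≤ 720 / R ^ 3 ∧ |ps2 R y| ≤ 1560 / R ^ 4 := by
  obtain ⟨h0, h1⟩ := hy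
  have e1 : y ^ 2 ≤ R ^ 2 := by gcongr
  have e2 : y ^ 3 ≤ R ^ 3 := by gcongr
  have e3 : (R - y) ^ 2 ≤ R ^ 2 := by gcongr <;> linarith
  have e4 : R * y ^ 2 ≤ R * R ^ 2 := by gcongr
  have e5 : R ^ 2 * y ≤ R ^ 2 * R := by gcongr
  have e6 : R * y ≤ R * R := by gcongr
  have p1 : 0 ≤ R * y ^ 2 := by positivity
  have p2 : 0 ≤ R ^ 2 * y := by positivity
  have p3 : 0 ≤ y ^ 3 := by positivity
  have p4 : 0 ≤ R * y := by positivity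
  have g : ∀ (n : ℕ) (x B : ℝ), |x| ≤ B * R ^ n → ∀ m : ℕ, n + m = 6 → |60 / R ^ 6 * x| ≤ 60 * B / R ^ m := fun n x B hx m hm => by
    rw [abs_mul, abs_of_nonneg (by positivity : 0 ≤ 60 / R ^ 6), le_div_iff₀ (by positivity)]
    calc 60 / R ^ 6 * |x| * R ^ m ≤ 60 / R ^ 6 * (B * R ^ n) * R ^ m := by gcongr
      _ = 60 * B * (R ^ (n + m) / R ^ 6) := by rw [pow_add]; ring
      _ = 60 * B := by rw [hm, div_self (by positivity), mul_one]
  refine ⟨?_, ?_, ?_⟩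
  · have := g 4 (y ^ 2 * (R - y) ^ 2) 1 (by
      rw [abs_of_nonneg (by positivity)]
      calc _ ≤ R ^ 2 * R ^ 2 := mul_le_mul e1 e3 (by positivity) (by positivity)
        _ = _ := by ring) 2 rfl
    simpa [ps] using this
  · have := g 3 (2 * R ^ 2 * y - 6 * R * y ^ 2 + 4 * y ^ 3) 12 (by
      rw [abs_le]; constructor <;> nlinarith) 3 rfl
    unfold ps1; norm_num at this ⊢; exact this
  · have := g 2 (2 * R ^ 2 - 12 * R * y + 12 * y ^ 2) 26 (by
      rw [abs_le]; constructor <;> nlinarith [sq_nonneg R, sq_nonneg y]) 4 rfl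
    unfold ps2; norm_num at this ⊢; exact this
lemma ps_int {R : ℝ} (hR : 0 < R) : ∫ y in (0:ℝ)..R, ps R y * y = 1 := by
  have : ∀ y ∈ uIcc 0 R, HasDerivAt (fun y => 60 / R ^ 6 * (R ^ 2 * y ^ 4 / 4 - 2 * R * y ^ 5 / 5 + y ^ 6 / 6)) (ps R y * y) y := fun y _ => by
    have i := hasDerivAt_id y
    refine ((((((i.pow 4).const_mul (R ^ 2)).div_const 4).sub (((i.pow 5).const_mul (2 * R)).div_const 5)).add ((i.pow 6).div_const 6)).const_mul (60 / R ^ 6)).congr_deriv ?_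
    simp only [ps, Nat.reduceSub, pow_one, Nat.cast_ofNat, id_eq]; ring
  rw [intervalIntegral.integral_eq_sub_of_hasDerivAt this (((ps_c R).mul continuous_id).intervalIntegrable _ _)]
  field_simp; ring

def en : Eucl (d + 1) := EuclideanSpace.single (Fin.last d) 1
lemma en_last (y : ℝ) : lastC (y • (en : Eucl (d + 1))) = y := by simp [lastC, en]
lemma en_norm {y : ℝ} (hy : 0 ≤ y) : ‖y • (en : Eucl (d + 1))‖ = y := by simp [norm_smul, en, abs_of_nonneg hy]
lemma en_inn (x : Eucl (d + 1)) : ⟪x, en⟫ = x (Fin.last d) := by simp [inn, en]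

def an (V : Reg (d + 1)) (R t : ℝ) : ℝ := ∫ y in (0:ℝ)..R, ps R y * (V.u (y • en, t) - V.u (0, t))
def an' (V : Reg (d + 1)) (R t : ℝ) : ℝ := ∫ y in (0:ℝ)..R, ps R y * (V.ut (y • en, t) - V.ut (0, t))

lemma cc (f : SpaceTime (d + 1) → ℝ) (hf : Continuous f) (R : ℝ) : Continuous fun p : ℝ × ℝ => ps R p.1 * (f (p.1 • en, p.2) - f (0, p.2)) :=
  ((ps_c R).comp continuous_fst).mul ((hf.comp ((continuous_fst.smul continuous_const).prodMk continuous_snd)).sub (hf.comp (continuous_const.prodMk continuous_snd)))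

lemma an_d (V : Reg (d + 1)) (R t : ℝ) : HasDerivAt (an V R) (an' V R t) t := by
  obtain ⟨B, hB⟩ := (((isCompact_uIcc (a := (0:ℝ)) (b := R)).prod (isCompact_Icc (a := t - 1) (b := t + 1))).bddAbove_image (cc V.ut V.cut R).norm.continuousOn)
  have c1 := cc V.u V.cu R; have c2 := cc V.ut V.cut R
  have hc : ∀ {F : ℝ × ℝ → ℝ} (s : ℝ), Continuous F → Continuous fun y => F (y, s) := fun s h => h.comp (continuous_id.prodMk continuous_const)
  refine (intervalIntegral.hasDerivAt_integral_of_dominated_loc_of_deriv_le (bound := fun _ => B) (F := fun t y => ps R y * (V.u (y • en, t) - V.u (0, t)))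
    (F' := fun t y => ps R y * (V.ut (y • en, t) - V.ut (0, t))) (s := Ioo (t - 1) (t + 1)) (Ioo_mem_nhds (by linarith) (by linarith)) (Eventually.of_forall fun s => (hc s c1).aestronglyMeasurable) ((hc t c1).intervalIntegrable _ _) (hc t c2).aestronglyMeasurable
    (Eventually.of_forall fun y hy s hs => hB ⟨(y, s), ⟨uIoc_subset_uIcc hy, Ioo_subset_Icc_self hs⟩, rfl⟩) intervalIntegrable_const (Eventually.of_forall fun y _ s _ => ((V.htime _ s).sub (V.htime _ s)).const_mul _)).2

lemma en_mem {r R y t : ℝ} (hR : R ≤ r) (hy : y ∈ Icc 0 R) (ht : t ∈ Icc (-r) 0) : (y • (en : Eucl (d + 1)), t) ∈ IG d r r :=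
  ⟨(en_norm hy.1).le.trans (hy.2.trans hR), (en_last y).symm ▸ hy.1, ht.1, ht.2⟩

lemma an_g {V : Reg (d + 1)} {r C R t : ℝ} (h : St V r C) (hR0 : 0 < R) (hR : R ≤ r) (ht : t ∈ Icc (-r) 0) : |an V R t - V.g (0, t) (Fin.last d)| ≤ 60 * C * R := by
  have C0 : 0 ≤ C := (norm_nonneg _).trans (h.g0 t ht)
  have e : an V R t - V.g (0, t) (Fin.last d) = ∫ y in (0:ℝ)..R, ps R y * (V.u (y • en, t) - V.u (0, t) - ⟪V.g (0, t), y • en⟫) := by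
    have c1 : Continuous fun y => ps R y * (V.u (y • en, t) - V.u (0, t)) := (cc V.u V.cu R).comp (continuous_id.prodMk continuous_const)
    have c2 : Continuous fun y => V.g (0, t) (Fin.last d) * (ps R y * y) := continuous_const.mul ((ps_c R).mul continuous_id)
    rw [an, ← mul_one (V.g (0, t) (Fin.last d)), ← ps_int hR0, ← intervalIntegral.integral_const_mul, ← intervalIntegral.integral_sub (c1.intervalIntegrable _ _) (c2.intervalIntegrable _ _)]
    congr 1; ext y; rw [inner_smul_right, en_inn]; ring
  rw [e]
  have := intervalIntegral.norm_integral_le_of_norm_le_const (a := 0) (b := R) (C := 60 * C) (f := fun y => ps R y * (V.u (y • en, t) - V.u (0, t) - ⟪V.g (0, t), y • en⟫)) fun y hy => by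
    rw [uIoc_of_le hR0.le] at hy
    have hy' : y ∈ Icc 0 R := ⟨hy.1.le, hy.2⟩
    have h1 := h.tay t ht (y • en) ((en_norm hy.1.le).le.trans (hy.2.trans hR)) ((en_last y).symm ▸ hy.1.le)
    rw [en_norm hy.1.le] at h1
    have h2 : C * y ^ 2 ≤ C * R ^ 2 := by have := hy.1; have := hy.2; gcongr
    rw [Real.norm_eq_abs, abs_mul]
    calc _ ≤ 60 / R ^ 2 * (C * R ^ 2) := mul_le_mul (ps_b hR0 hy').1 (h1.trans h2) (abs_nonneg _) (by positivity)
      _ = 60 * C := by field_simp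
  rwa [sub_zero, abs_of_pos hR0, Real.norm_eq_abs] at this

lemma LT {Q : Matrix (Fin (d + 1)) (Fin (d + 1)) ℝ} (hQ : Q.IsSymm) (V : Reg (d + 1)) (p) : V.L Q p = 2 * bq (V.H p) (WithLp.toLp 2 fun i => Q i (Fin.last d)) en - Q (Fin.last d) (Fin.last d) * bq (V.H p) en en +
    ∑ i : Fin d, ∑ j : Fin d, Q i.castSucc j.castSucc * V.H p i.castSucc j.castSucc := by
  have e1 : ∀ f : Eucl (d + 1), bq (V.H p) f en = ∑ i, V.H p i (Fin.last d) * f i := fun f => Finset.sum_congr rfl fun i _ => by simp [en]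
  have e2 : ∀ j : Fin d, Q (Fin.last d) j.castSucc * V.H p (Fin.last d) j.castSucc = V.H p j.castSucc (Fin.last d) * Q j.castSucc (Fin.last d) := fun j => by rw [hQ.apply, V.sym]; ring
  rw [e1, e1]
  simp only [Reg.L, Fin.sum_univ_castSucc, Finset.sum_add_distrib, e2, mul_comm (Q (Fin.castSucc _) (Fin.last d))]
  simp [en, Fin.castSucc_ne_last]; ring

lemma R_alg {A B D R K C l : ℝ} {p p1 p2 a t u g q w : ℝ} (hR : 0 < R) (hR1 : R ≤ 1) (hC : 0 ≤ C) (hp : |p| ≤ 60 / R ^ 2) (hp1 : |p1| ≤ 720 / R ^ 3) (hp2 : |p2| ≤ 1560 / R ^ 4)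
    (ha : |a| ≤ 1) (ht : |t| ≤ A) (hu : |u| ≤ C) (hl : |l| ≤ 1) (hg : |g| ≤ B) (hq : |q| ≤ K) (hw : |w| ≤ D * R) :
    |p * (a + t - l * u) - 2 * p1 * g + q * p2 * w| ≤ (60 * (1 + A + C) + 1440 * B + 1560 * K * D) / R ^ 3 := by
  have h1 : |p * (a + t - l * u)| ≤ 60 / R ^ 3 * (1 + A + C) := by
    rw [abs_mul]
    have : 60 / R ^ 2 ≤ 60 / R ^ 3 := div_le_div_of_nonneg_left (by norm_num) (by positivity) (pow_le_pow_of_le_one hR.le hR1 (by norm_num))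
    refine mul_le_mul (hp.trans this) ?_ (abs_nonneg _) (by positivity)
    have : |l * u| ≤ 1 * C := by rw [abs_mul]; exact mul_le_mul hl hu (abs_nonneg _) zero_le_one
    have := abs_sub (a + t) (l * u); have := abs_add_le a t; linarith
  have h2 : |2 * p1 * g| ≤ 2 * (720 / R ^ 3) * B := by
    rw [abs_mul, abs_mul, abs_two]; exact mul_le_mul (by linarith) hg (abs_nonneg _) (by positivity)
  have h3 : |q * p2 * w| ≤ K * (1560 / R ^ 4) * (D * R) := by
    rw [abs_mul, abs_mul]
    have := (abs_nonneg _).trans hq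
    exact mul_le_mul (mul_le_mul hq hp2 (abs_nonneg _) this) hw (abs_nonneg _) (by positivity)
  have := abs_add_le (p * (a + t - l * u) - 2 * p1 * g) (q * p2 * w); have := abs_sub (p * (a + t - l * u)) (2 * p1 * g)
  have e : (60 * (1 + A + C) + 1440 * B + 1560 * K * D) / R ^ 3 = 60 / R ^ 3 * (1 + A + C) + 2 * (720 / R ^ 3) * B + K * (1560 / R ^ 4) * (D * R) := by field_simp; ring
  linarith

lemma an_b {W : Co d} {V : Reg (d + 1)} {r C R t : ℝ} (h : St V r C) (hV : Vb W V r C) (hR0 : 0 < R) (hR : R ≤ r) (hr : r ≤ 1 / 4) (ht : t ∈ Icc (-r) 0) :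
    W.lam * |an' V R t| ≤ (60 * (1 + d * (d * (W.K * C)) + C) + 1440 * (d * (W.K * C)) + 1560 * W.K * (2 * C)) / R ^ 2 := by
  have C0 : 0 ≤ C := (norm_nonneg _).trans (h.g0 t ht)
  set X := 60 * (1 + d * (d * (W.K * C)) + C) + 1440 * (d * (W.K * C)) + 1560 * W.K * (2 * C) with hX
  set b : Eucl (d + 1) := WithLp.toLp 2 fun i => W.Q t i (Fin.last d) with hb
  set q := W.Q t (Fin.last d) (Fin.last d) with hq
  set Θ : ℝ → ℝ := fun y => ps R y * (2 * ⟪V.g (y • en, t), b⟫ - q * ⟪V.g (y • en, t), en⟫) - q * (ps1 R y * (V.u (y • en, t) - V.u (0, t))) with hΘ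
  set Θ' : ℝ → ℝ := fun y => (ps1 R y * (2 * ⟪V.g (y • en, t), b⟫ - q * ⟪V.g (y • en, t), en⟫) + ps R y * (2 * bq (V.H (y • en, t)) b en - q * bq (V.H (y • en, t)) en en)) - q * (ps2 R y * (V.u (y • en, t) - V.u (0, t)) + ps1 R y * ⟪V.g (y • en, t), en⟫) with hΘ'
  have dΘ : ∀ y, HasDerivAt Θ (Θ' y) y := fun y => by
    have l1 : HasDerivAt (fun y : ℝ => V.u (y • en, t)) ⟪V.g (y • en, t), en⟫ y := by simpa using V.line1 0 en t y
    have l2 : ∀ f, HasDerivAt (fun y : ℝ => ⟪V.g (y • en, t), f⟫) (bq (V.H (y • en, t)) f en) y := fun f => by simpa using V.line2 0 en f t y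
    exact ((ps_d R y).mul (((l2 b).const_mul 2).sub ((l2 en).const_mul q))).sub (((ps1_d R y).mul (l1.sub_const (V.u (0, t)))).const_mul q)
  have cy : Continuous fun y : ℝ => (y • (en : Eucl (d + 1)), t) := (continuous_id.smul continuous_const).prodMk continuous_const
  have cΘ : Continuous Θ' := by
    have c1 := V.cu.comp cy
    have c2 : ∀ f, Continuous fun y : ℝ => ⟪V.g (y • en, t), f⟫ := fun f => (V.cg.comp cy).inner continuous_const
    have c3 : ∀ f, Continuous fun y : ℝ => bq (V.H (y • en, t)) f en := fun f => continuous_finsetSum _ fun i _ => continuous_finsetSum _ fun j _ => ((V.cHi i j).comp cy).mul continuous_const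
    exact (((ps1_c R).mul (((c2 b).const_mul 2).sub ((c2 en).const_mul q))).add ((ps_c R).mul (((c3 b).const_mul 2).sub ((c3 en).const_mul q)))).sub ((((ps2_c R).mul (c1.sub continuous_const)).add ((ps1_c R).mul (c2 en))).const_mul q)
  have cf : Continuous fun y => W.lam * (ps R y * (V.ut (y • en, t) - V.ut (0, t))) := ((cc V.ut V.cut R).comp (continuous_id.prodMk continuous_const)).const_mul W.lam
  have i0 : ∫ y in (0:ℝ)..R, Θ' y = 0 := by
    rw [intervalIntegral.integral_eq_sub_of_hasDerivAt (fun y _ => dΘ y) (cΘ.intervalIntegrable _ _)]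
    have z1 : ps R R = 0 ∧ ps1 R R = 0 ∧ ps R 0 = 0 ∧ ps1 R 0 = 0 := by refine ⟨?_, ?_, ?_, ?_⟩ <;> simp only [ps, ps1] <;> ring
    simp only [hΘ, z1]; ring
  have e : W.lam * an' V R t = ∫ y in (0:ℝ)..R, (W.lam * (ps R y * (V.ut (y • en, t) - V.ut (0, t))) - Θ' y) := by
    rw [intervalIntegral.integral_sub (cf.intervalIntegrable _ _) (cΘ.intervalIntegrable _ _), i0, sub_zero, intervalIntegral.integral_const_mul]; rfl
  rw [← abs_of_pos W.hlam, ← abs_mul, e]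
  have := intervalIntegral.norm_integral_le_of_norm_le_const (a := 0) (b := R) (C := X / R ^ 3) (f := fun y => W.lam * (ps R y * (V.ut (y • en, t) - V.ut (0, t))) - Θ' y) fun y hy => by
    rw [uIoc_of_le hR0.le] at hy
    have hy' : y ∈ Icc 0 R := ⟨hy.1.le, hy.2⟩
    have m := en_mem (d := d) hR hy' ht
    obtain ⟨b1, b2, b3⟩ := ps_b hR0 hy'
    set p := (y • (en : Eucl (d + 1)), t) with hp
    have hw : |V.u p - V.u (0, t)| ≤ 2 * C * R := by
      have h1 := h.tay t ht (y • en) ((en_norm hy.1.le).le.trans (hy.2.trans hR)) ((en_last y).symm ▸ hy.1.le)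
      have h2 := (abs_real_inner_le_norm (V.g (0, t)) (y • en)).trans (mul_le_mul_of_nonneg_right (h.g0 t ht) (norm_nonneg _))
      rw [en_norm hy.1.le] at h1 h2
      have h3 := abs_add_le (V.u p - V.u (0, t) - ⟪V.g (0, t), y • en⟫) ⟪V.g (0, t), y • en⟫
      rw [sub_add_cancel] at h3
      have h4 : C * y ≤ C * R := by have := hy.2; gcongr
      have h5 : C * y ^ 2 ≤ C * y := by have := hy.1; gcongr; nlinarith [hy.2]
      linarith
    have hg : |∑ i : Fin d, W.Q t i.castSucc (Fin.last d) * V.g p i.castSucc| ≤ d * (W.K * C) := sb fun i => by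
      rw [abs_mul]; exact mul_le_mul (W.Qb _ _ _) (hV.g p m i) (abs_nonneg _) W.hK
    have hT : |∑ i : Fin d, ∑ j : Fin d, W.Q t i.castSucc j.castSucc * V.H p i.castSucc j.castSucc| ≤ d * (d * (W.K * C)) := sb fun i => sb fun j => by
      rw [abs_mul]; exact mul_le_mul (W.Qb _ _ _) (hV.H p m i j) (abs_nonneg _) W.hK
    have := R_alg hR0 (by linarith) C0 b1 b2 b3 (hV.res p m).1 hT (h.ut0 t ht) (by rw [abs_of_pos W.hlam]; exact W.hlam1) hg (W.Qb t (Fin.last d) (Fin.last d)) hw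
    rw [Real.norm_eq_abs]
    refine le_trans (le_of_eq (congrArg _ ?_)) this
    have eb : ⟪V.g p, b⟫ = ∑ i : Fin d, W.Q t i.castSucc (Fin.last d) * V.g p i.castSucc + q * ⟪V.g p, en⟫ := by
      rw [inn, Fin.sum_univ_castSucc, en_inn]; simp [hb, hq, mul_comm]
    have eL : V.L (W.Q p.2) p = _ := LT (W.sym t) V p
    simp only [hΘ', ← hp]
    rw [eL, eb]; ring
  rw [sub_zero, abs_of_pos hR0, Real.norm_eq_abs] at this
  refine this.trans (le_of_eq ?_)
  field_simp

/-- approximate slope -/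
def ab (V : Reg (d + 1)) (R t : ℝ) : Eucl (d + 1) := WithLp.toLp 2 (Fin.lastCases (an V R t) fun j => V.g (0, 0) j.castSucc)
lemma ab_last (V : Reg (d + 1)) (R t : ℝ) : ab V R t (Fin.last d) = an V R t := by simp [ab]
lemma ab_cast (V : Reg (d + 1)) (R t : ℝ) (j : Fin d) : ab V R t j.castSucc = V.g (0, 0) j.castSucc := by simp [ab]
lemma ab_cont (V : Reg (d + 1)) (R : ℝ) : Continuous (ab V R) := by
  refine (PiLp.continuous_toLp 2 _).comp (continuous_pi (lcs (fun j => ?_) ?_))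
  · simp only [Fin.lastCases_castSucc]; exact continuous_const
  · simp only [Fin.lastCases_last]; exact continuous_iff_continuousAt.2 fun t => (an_d V R t).continuousAt

lemma asm {W : Co d} {V : Reg (d + 1)} {η : SpaceTime (d + 1) → ℝ} {r C R ε : ℝ} (h : St V r C) (hV : Vb W V r C) (hC : 1 ≤ C) (hR0 : 0 < R) (hR : R ≤ r) (hr : r ≤ 1 / 4) (hε : ε ≤ R ^ 6)
    (hη : ∀ p ∈ IG d (1 / 4) (1 / 2), |η p - V.u p| ≤ ε) (hRs : Rs W ε V (IG d (1 / 4) (1 / 2))) :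
    (∀ t ∈ Icc (-r) 0, ‖ab V R t‖ ≤ (d + 1) * (61 * C)) ∧ ∃ bb : ℝ → ℝ, (∀ t, HasDerivAt bb ⟪W.v t, ab V R t⟫ t) ∧
      ∀ p ∈ Kc d (R ^ 3), |η p - ⟪ab V R p.2, p.1⟫ - bb p.2| ≤ (2 + C + (d + 1) * (60 * C) + (d + 1) * W.K * ((d + 1) * (60 * C))) * R ^ 4 := by
  set B : ℝ := (d + 1) * (60 * C) with hB
  have B0 : 0 ≤ B := by positivity
  have hK := W.hK
  have R1 : R ≤ 1 := by linarith
  have R3 : R ^ 3 ≤ R := pow_le_of_le_one hR0.le R1 (by norm_num)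
  have gd : ∀ t ∈ Icc (-r) 0, |t| ≤ R → ‖V.g (0, t) - ab V R t‖ ≤ B * R := fun t ht htR => by
    refine (nle (B := 60 * C * R) (lcs (fun j => ?_) ?_)).trans (le_of_eq (by rw [hB]; ring))
    · rw [PiLp.sub_apply, ab_cast]
      refine (h.gt t ht j).trans ?_
      have : C * |t| ≤ C * R := by gcongr
      have : 0 ≤ C * R := by positivity
      linarith
    · rw [PiLp.sub_apply, ab_last, abs_sub_comm]; exact an_g h hR0 hR ht
  have cW : Continuous W.v := by
    refine (PiLp.continuous_toLp 2 _).comp (continuous_pi fun i => W.cv i)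
  have ci : Continuous fun s => ⟪W.v s, ab V R s⟫ := cW.inner (ab_cont V R)
  refine ⟨fun t ht => ?_, fun t => V.u (0, 0) + ∫ s in (0:ℝ)..t, ⟪W.v s, ab V R s⟫, fun t => ((ci.integral_hasStrictDerivAt 0 t).hasDerivAt.const_add _), fun p hp => ?_⟩
  · have g0 := fun t ht i => (coord_le (V.g (0, t)) i).trans (h.g0 t ht)
    refine nle (lcs (fun j => ?_) ?_)
    · rw [ab_cast]
      have := g0 0 ⟨by linarith, le_rfl⟩ j.castSucc
      linarith
    · rw [ab_last]
      have a1 := an_g h hR0 hR ht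
      have a2 := g0 t ht (Fin.last d)
      have a3 : 60 * C * R ≤ 60 * C * 1 := by gcongr
      have := abs_sub_abs_le_abs_sub (an V R t) (V.g (0, t) (Fin.last d))
      linarith
  set bb : ℝ → ℝ := fun t => V.u (0, 0) + ∫ s in (0:ℝ)..t, ⟪W.v s, ab V R s⟫ with hbb
  have db : ∀ t, HasDerivAt bb ⟪W.v t, ab V R t⟫ t := fun t => ((ci.integral_hasStrictDerivAt 0 t).hasDerivAt.const_add _)
  obtain ⟨x, t⟩ := p
  obtain ⟨hx, hx0, ht⟩ := hp
  simp only [mem_ball, dist_zero_right] at hx hx0 ht ⊢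
  have ex := hη (x, t) ⟨by show ‖x‖ ≤ _; linarith, hx0.le, by show _ ≤ t; linarith [ht.1], ht.2⟩
  have tr : t ∈ Icc (-(R ^ 3)) 0 := ⟨ht.1.le, ht.2⟩
  have sub : ∀ s ∈ Icc (-(R ^ 3)) 0, s ∈ Icc (-r) 0 ∧ |s| ≤ R := fun s hs => ⟨⟨by linarith [hs.1], hs.2⟩, by rw [abs_of_nonpos hs.2]; linarith [hs.1]⟩
  have T := h.tay t (sub t tr).1 x (by linarith) hx0.le
  have eg : |⟪V.g (0, t) - ab V R t, x⟫| ≤ B * R * R ^ 3 := (abs_real_inner_le_norm _ _).trans (mul_le_mul (gd t (sub t tr).1 (sub t tr).2) hx.le (norm_nonneg _) (by positivity))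
  have ed : |V.u (0, t) - bb t| ≤ (R ^ 6 + (d + 1) * W.K * (B * R)) * R ^ 3 := by
    have := (convex_Icc (-(R ^ 3)) 0).norm_image_sub_le_of_norm_hasDerivWithin_le (f := fun s => V.u (0, s) - bb s) (f' := fun s => V.ut (0, s) - ⟪W.v s, ab V R s⟫) (C := R ^ 6 + (d + 1) * W.K * (B * R)) (fun s _ => ((V.htime 0 s).sub (db s)).hasDerivWithinAt) (fun s hs => by
      have a1 : |V.ut (0, s) - ⟪W.v s, V.g (0, s)⟫| ≤ ε := (hRs (0, s) ⟨by simp, le_rfl, by show _ ≤ s; linarith [hs.1], hs.2⟩).2 rfl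
      have a2 := (inner_bd (W.vb s) (V.g (0, s) - ab V R s)).trans (mul_le_mul_of_nonneg_left (gd s (sub s hs).1 (sub s hs).2) (by positivity))
      rw [inner_sub_right] at a2
      have := abs_add_le (V.ut (0, s) - ⟪W.v s, V.g (0, s)⟫) (⟪W.v s, V.g (0, s)⟫ - ⟪W.v s, ab V R s⟫)
      rw [sub_add_sub_cancel] at this
      rw [Real.norm_eq_abs]; linarith) ⟨by have := pow_pos hR0 3; linarith, le_rfl⟩ tr
    simp only [hbb, intervalIntegral.integral_same, add_zero, sub_self, sub_zero, Real.norm_eq_abs] at this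
    refine this.trans (mul_le_mul_of_nonneg_left ?_ (by positivity))
    rw [abs_of_nonpos ht.2]; linarith [ht.1]
  have q1 : C * ‖x‖ ^ 2 ≤ C * (R ^ 3) ^ 2 := by gcongr
  have q2 : R ^ 6 ≤ R ^ 4 := pow_le_pow_of_le_one hR0.le R1 (by norm_num)
  have q3 : C * R ^ 6 ≤ C * R ^ 4 := by gcongr
  have q4 : R ^ 9 ≤ R ^ 4 := pow_le_pow_of_le_one hR0.le R1 (by norm_num)
  have : η (x, t) - ⟪ab V R t, x⟫ - bb t = ((η (x, t) - V.u (x, t)) + (V.u (x, t) - V.u (0, t) - ⟪V.g (0, t), x⟫) + ⟪V.g (0, t) - ab V R t, x⟫) + (V.u (0, t) - bb t) := by rw [inner_sub_left]; ring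
  rw [this]
  refine (abs_add_le _ _).trans ((add_le_add_left (abs_add_three _ _ _) _).trans ?_)
  linarith
end
end OB
end

noncomputable section
namespace OB
open Filter Topology Complex
section
lemma fin (d : ℕ) (Λ M C₀ : ℝ) (hΛ : 1 ≤ Λ) (hM : 1 ≤ M) (hC₀ : 0 < C₀) :
    ∃ C : ℝ, 0 < C ∧
      ∀ (lam : ℝ) (Q Q' : ℝ → Matrix (Fin (d + 1)) (Fin (d + 1)) ℝ)
        (v v' : ℝ → Eucl (d + 1)) (η : SpaceTime (d + 1) → ℝ),
        ObliqueData d lam Λ M C₀ Q Q' v v' →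
        ObliqueSolution d lam Q v η →
        (∀ p ∈ KcP d 1, |η p| ≤ 1) →
        ∀ ρ : ℝ, 0 < ρ → ρ ≤ 1 / 2 →
          ∃ (abar : ℝ → Eucl (d + 1)) (abar' : ℝ → ℝ) (bbar : ℝ → ℝ),
            (∀ i : Fin d, ∀ t s : ℝ, abar t i.castSucc = abar s i.castSucc) ∧
            (∀ t ∈ Icc (-ρ) 0,
              HasDerivWithinAt (fun s => lastC (abar s)) (abar' t) (Icc (-ρ) 0) t) ∧
            (∀ t ∈ Icc (-ρ) 0, ‖abar t‖ ≤ C ∧ |abar' t| ≤ C * ρ ^ ((1 / 3 : ℝ) - 1) * lam⁻¹) ∧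
            (∀ t ∈ Icc (-ρ) 0, HasDerivWithinAt bbar (⟪v t, abar t⟫) (Icc (-ρ) 0) t) ∧
            ∀ p ∈ Kc d ρ, |η p - ⟪abar p.2, p.1⟫ - bbar p.2| ≤ C * ρ ^ (1 + (1 / 3 : ℝ)) := by
  have hK : 0 < Λ * M ^ 2 := by positivity
  obtain ⟨C, r, hC, hr0, hr, key⟩ := st d (Λ * M ^ 2)⁻¹ (Λ * M ^ 2) (2 * (C₀ * (Λ * M ^ 2)) * ((Λ * M ^ 2) * (Λ * M ^ 2))) (by positivity) hK.le (by positivity)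
  set K := Λ * M ^ 2 with hKd
  set X1 : ℝ := 60 * (1 + d * (d * (K * C)) + C) + 1440 * (d * (K * C)) + 1560 * K * (2 * C) with hX1
  set X2 : ℝ := 2 + C + (d + 1) * (60 * C) + (d + 1) * K * ((d + 1) * (60 * C)) with hX2
  have p1 : 0 ≤ X1 := by positivity
  have p2 : 0 ≤ X2 := by positivity
  have p3 : 0 ≤ (d + 1) * (61 * C) := by positivity
  have p4 : 0 < (r ^ 4)⁻¹ := by positivity
  refine ⟨X1 + X2 + (d + 1) * (61 * C) + (r ^ 4)⁻¹, by linarith, fun lam Q Q' v v' η h hs hb ρ h0 h1 => ?_⟩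
  set F := X1 + X2 + (d + 1) * (61 * C) + (r ^ 4)⁻¹ with hF
  obtain ⟨R, hR0, rfl⟩ : ∃ R : ℝ, 0 < R ∧ ρ = R ^ 3 := ⟨ρ ^ (1 / 3 : ℝ), by positivity, by
    rw [← Real.rpow_natCast, ← Real.rpow_mul h0.le]; norm_num⟩
  have e1 : (R ^ 3) ^ (1 + (1 / 3 : ℝ)) = R ^ 4 := by
    rw [← Real.rpow_natCast, ← Real.rpow_mul hR0.le, ← Real.rpow_natCast]; norm_num
  have e2 : (R ^ 3) ^ ((1 / 3 : ℝ) - 1) = (R ^ 2)⁻¹ := by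
    rw [← Real.rpow_natCast, ← Real.rpow_mul hR0.le, ← Real.rpow_natCast, ← Real.rpow_neg hR0.le]; norm_num
  rw [e1, e2]
  have hl := h.lam_pos
  rcases le_total r R with hR | hR
  · refine ⟨fun _ => 0, fun _ => 0, fun _ => 0, fun _ _ _ => rfl, fun t _ => hasDerivWithinAt_const _ _ _, fun t _ => ⟨by rw [norm_zero]; linarith, by rw [abs_zero]; exact mul_nonneg (mul_nonneg (by linarith) (by positivity)) (by positivity)⟩, fun t _ => by rw [inner_zero_right]; exact hasDerivWithinAt_const _ _ _, fun p hp => ?_⟩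
    rw [inner_zero_left, sub_zero, sub_zero]
    refine (hb p (Or.inl ⟨ball_subset_ball (by linarith) hp.1, hp.2.1, ?_, hp.2.2.2⟩)).trans ?_
    · have := hp.2.2.1
      linarith
    · calc (1:ℝ) = (r ^ 4)⁻¹ * r ^ 4 := by field_simp
        _ ≤ F * R ^ 4 := by
          have : (r ^ 4)⁻¹ ≤ F := by linarith
          gcongr
  · have R1 : R ≤ 1 := by linarith
    have hε : R ^ 6 ≤ 1 := pow_le_one₀ hR0.le R1
    have sub : R ^ 3 ≤ R := pow_le_of_le_one hR0.le R1 (by norm_num)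
    have hQ : ∀ t ∈ Icc (-1:ℝ) 0, (mkCo h).Q t = Q t := fun t ht => congrArg Q (cl_id ht)
    have hv : ∀ t ∈ Icc (-1:ℝ) 0, (mkCo h).v t = v t := fun t ht => congrArg v (cl_id ht)
    obtain ⟨P, a1, a2⟩ := approx3 (mkCo h) (sub_co hQ hv hs.1) (sub_co hQ hv (sup_neg hs.2)) hb (pow_pos hR0 6)
    obtain ⟨E, hE⟩ := mkLD h
    obtain ⟨s1, s2⟩ := key (mkCo h) rfl rfl (mkCo_ell h) E hE (R ^ 6) hε P (fun p hp => by
      have b1 := a1 p hp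
      have b2 : |η p| ≤ 1 := hb p (by
        obtain ⟨q1, q2, q3, q4⟩ := hp
        rcases q2.eq_or_lt with q | q
        · exact Or.inr ⟨by rw [mem_ball_zero_iff]; linarith, q.symm, by linarith, q4⟩
        · exact Or.inl ⟨by rw [mem_ball_zero_iff]; linarith, q, by linarith, q4⟩)
      have := abs_sub_abs_le_abs_sub ((Pack.reg P).u p) (η p)
      rw [abs_sub_comm] at this
      linarith) a2
    obtain ⟨m1, bb, m2, m3⟩ := asm s1 s2 hC hR0 hR hr le_rfl a1 (a2 [] (by simp))
    have ms : ∀ t ∈ Icc (-(R ^ 3)) 0, t ∈ Icc (-r) 0 := fun t ht => ⟨by linarith [ht.1], ht.2⟩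
    refine ⟨ab (Pack.reg P) R, an' (Pack.reg P) R, bb, fun i t s => by rw [ab_cast, ab_cast], fun t ht => ?_, fun t ht => ⟨(m1 t (ms t ht)).trans (by linarith), ?_⟩, fun t ht => ?_, fun p hp => (m3 p hp).trans ?_⟩
    · have : (fun s => lastC (ab (Pack.reg P) R s)) = an (Pack.reg P) R := funext fun s => ab_last _ _ _
      rw [this]; exact (an_d _ _ _).hasDerivWithinAt
    · have := an_b s1 s2 hR0 hR hr (ms t ht)
      change lam * _ ≤ X1 / R ^ 2 at this
      calc _ = lam * |an' (Pack.reg P) R t| * lam⁻¹ := by field_simp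
        _ ≤ (F * (R ^ 2)⁻¹) * lam⁻¹ := by
          refine mul_le_mul_of_nonneg_right (this.trans ?_) (by positivity)
          rw [div_eq_mul_inv]
          exact mul_le_mul_of_nonneg_right (by linarith) (by positivity)
    · rw [← hv t ⟨by linarith [ht.1], ht.2⟩]; exact (m2 t).hasDerivWithinAt
    · exact mul_le_mul_of_nonneg_right (show X2 ≤ F by linarith) (by positivity)
end
end OB
end

/-- **Linear approximation of solutions.** There are universal `α ∈ (0,1)` and `C > 0`,
depending only on `n, Λ, M, C₀`, such that if `η` is a viscosity solution of the
linearized oblique problem on `K₁⁺` with `|η| ≤ 1`, then for every `0 < ρ ≤ 1/2` there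
are `ā(t)` (first `n−1` components constant, `āₙ` differentiable with
`|āₙ'| ≤ Cρ^{α−1}λ⁻¹`, `|ā| ≤ C`) and `b̄` with `b̄' = v(t)·ā(t)` such that
`|η − ā(t)·x − b̄(t)| ≤ Cρ^{1+α}` in `K_ρ`. -/
theorem linear_approximation (d : ℕ) (hd : 1 ≤ d) (Λ M C₀ : ℝ)
    (hΛ : 1 ≤ Λ) (hM : 1 ≤ M) (hC₀ : 0 < C₀) :
    ∃ α C : ℝ, 0 < α ∧ α < 1 ∧ 0 < C ∧
      ∀ (lam : ℝ) (Q Q' : ℝ → Matrix (Fin (d + 1)) (Fin (d + 1)) ℝ)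
        (v v' : ℝ → Eucl (d + 1)) (η : SpaceTime (d + 1) → ℝ),
        ObliqueData d lam Λ M C₀ Q Q' v v' →
        ObliqueSolution d lam Q v η →
        (∀ p ∈ KcP d 1, |η p| ≤ 1) →
        ∀ ρ : ℝ, 0 < ρ → ρ ≤ 1 / 2 →
          ∃ (abar : ℝ → Eucl (d + 1)) (abar' : ℝ → ℝ) (bbar : ℝ → ℝ),
            (∀ i : Fin d, ∀ t s : ℝ, abar t i.castSucc = abar s i.castSucc) ∧
            (∀ t ∈ Icc (-ρ) 0,
              HasDerivWithinAt (fun s => lastC (abar s)) (abar' t) (Icc (-ρ) 0) t) ∧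
            (∀ t ∈ Icc (-ρ) 0, ‖abar t‖ ≤ C ∧ |abar' t| ≤ C * ρ ^ (α - 1) * lam⁻¹) ∧
            (∀ t ∈ Icc (-ρ) 0, HasDerivWithinAt bbar (⟪v t, abar t⟫) (Icc (-ρ) 0) t) ∧
            ∀ p ∈ Kc d ρ, |η p - ⟪abar p.2, p.1⟫ - bbar p.2| ≤ C * ρ ^ (1 + α) := by
  obtain ⟨C, hC, h⟩ := OB.fin d Λ M C₀ hΛ hM hC₀
  exact ⟨1 / 3, C, by norm_num, by norm_num, hC, h⟩
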